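/- Let ν_n = ⌊(n−2)/3⌋. Then: H̃_{ν_n}(M_n; ℤ) is a nontrivial elementary abelian 3-group for n ∈ {7,10,12,13} and for all n ≥ 15; the torsion subgroup of H̃_{ν_n}(M_n; ℤ) is a nontrivial elementary abelian 3-group for n ∈ {9,11} and is zero for n ∈ {1,2,3,4,5,6,8}; and H̃_{ν_14}(M_14; ℤ) = H̃_4(M_14; ℤ) is a finite group with nonvanishing 3-torsion. -/

import Mathlib

set_option synthInstance.maxHeartbeats 1000000
set_option maxHeartbeats 1000000

noncomputable section

namespace MatchPaper

attribute [local instance 10] Classical.propDecidable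

/-! ### Guarded constructions on additive groups -/

section AddGadgets

variable {A B : Type*} [AddCommGroup A] [AddCommGroup B]

/-- Lift a homomorphism to the quotient (it genuinely descends whenever it kills `S`). -/
def liftOrZero (S : AddSubgroup A) (f : A →+ B) : A ⧸ S →+ B :=
  if h : S ≤ f.ker then QuotientAddGroup.lift S f h else 0

/-- Descend a homomorphism to quotients (genuine whenever `f S ≤ T`). -/
def descend (S : AddSubgroup A) (T : AddSubgroup B) (f : A →+ B) : A ⧸ S →+ B ⧸ T :=
  if h : S ≤ T.comap f then QuotientAddGroup.map S T f h else 0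

/-- Restrict a homomorphism to subgroups (genuine whenever `f Z ≤ Z'`). -/
def restrictHom (f : A →+ B) (Z : AddSubgroup A) (Z' : AddSubgroup B) : Z →+ Z' :=
  if h : ∀ x : Z, f x ∈ Z' then (f.comp Z.subtype).codRestrict Z' (fun x => h x) else 0

/-- The subquotient `Z / (Bd ∩ Z)`. -/
abbrev subQuot (Z Bd : AddSubgroup A) : Type _ := Z ⧸ Bd.addSubgroupOf Z

/-- The map induced by `f` on subquotients. -/
def subQuotMap (f : A →+ B) (Z Bd : AddSubgroup A) (Z' Bd' : AddSubgroup B) :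
    subQuot Z Bd →+ subQuot Z' Bd' :=
  descend (Bd.addSubgroupOf Z) (Bd'.addSubgroupOf Z') (restrictHom f Z Z')

end AddGadgets

/-! ### Chain complexes of abelian groups, group actions, quotient and fixed-difference
subcomplexes, and homology -/

section Abstract

variable (X : ℤ → Type*) [∀ i, AddCommGroup (X i)]

/-- Transport along an equality of indices. -/
def castAE {i j : ℤ} (h : i = j) : X i ≃+ X j := by subst h; exact AddEquiv.refl _

variable (d : ∀ i : ℤ, X (i + 1) →+ X i)

/-- The boundary map leaving degree `i`. -/
def dfrom (i : ℤ) : X i →+ X (i - 1) :=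
  (d (i - 1)).comp (castAE X (show i = (i - 1) + 1 by ring)).toAddMonoidHom

/-- Cycles in degree `i`. -/
def cyc (i : ℤ) : AddSubgroup (X i) := (dfrom X d i).ker

/-- Boundaries in degree `i`. -/
def bdr (i : ℤ) : AddSubgroup (X i) := (d i).range

/-- Homology of the chain complex `(X, d)` in degree `i`. -/
abbrev Hgrp (i : ℤ) : Type _ := subQuot (cyc X d i) (bdr X d i)

variable {G : Type*} [Group G] (act : G → ∀ i : ℤ, X i ≃+ X i)

/-- The subgroup `C_i^G` generated by the elements `c - g c`. -/
def gsub (i : ℤ) : AddSubgroup (X i) :=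
  AddSubgroup.closure {x | ∃ (c : X i) (g : G), x = c - act g i c}

/-- The degree-`i` part of the quotient complex `C/G`. -/
abbrev QX (i : ℤ) : Type _ := X i ⧸ gsub X act i

/-- The boundary map of the quotient complex `C/G`. -/
def qd (i : ℤ) : QX X act (i + 1) →+ QX X act i :=
  descend (gsub X act (i + 1)) (gsub X act i) (d i)

/-- Homology of the quotient complex `C/G`. -/
abbrev HQgrp (i : ℤ) : Type _ := Hgrp (QX X act) (qd X d act) i

/-- The boundary map of the subcomplex `C^G`. -/
def sd (i : ℤ) : gsub X act (i + 1) →+ gsub X act i :=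
  restrictHom (d i) (gsub X act (i + 1)) (gsub X act i)

/-- Homology of the subcomplex `C^G`. -/
abbrev HSgrp (i : ℤ) : Type _ := Hgrp (fun j => gsub X act j) (sd X d act) i

/-- The projection chain map `C → C/G`. -/
def projX (i : ℤ) : X i →+ QX X act i := QuotientAddGroup.mk' _

/-- The map `π*` induced on homology by the projection `C → C/G`. -/
def piStar (i : ℤ) : Hgrp X d i →+ HQgrp X d act i :=
  subQuotMap (projX X act i) (cyc X d i) (bdr X d i)
    (cyc (QX X act) (qd X d act) i) (bdr (QX X act) (qd X d act) i)

/-- The chain map `φ : C/G → C`, `[c] ↦ ∑ g • c`. -/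
def phiX [Fintype G] (i : ℤ) : QX X act i →+ X i :=
  liftOrZero (gsub X act i) (∑ g : G, (act g i).toAddMonoidHom)

/-- The map `φ*` induced on homology by `φ`. -/
def phiStar [Fintype G] (i : ℤ) : HQgrp X d act i →+ Hgrp X d i :=
  subQuotMap (phiX X act i) (cyc (QX X act) (qd X d act) i) (bdr (QX X act) (qd X d act) i)
    (cyc X d i) (bdr X d i)

end Abstract

/-! ### Guarded constructions on modules -/

section LinGadgets

variable (R : Type*) [CommRing R] {M N : Type*} [AddCommGroup M] [Module R M]
  [AddCommGroup N] [Module R N]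

def liftOrZeroL (S : Submodule R M) (f : M →ₗ[R] N) : (M ⧸ S) →ₗ[R] N :=
  if h : S ≤ LinearMap.ker f then S.liftQ f h else 0

def descendL (S : Submodule R M) (T : Submodule R N) (f : M →ₗ[R] N) :
    (M ⧸ S) →ₗ[R] (N ⧸ T) :=
  if h : S ≤ T.comap f then S.mapQ T f h else 0

def restrictL (f : M →ₗ[R] N) (Z : Submodule R M) (Z' : Submodule R N) : Z →ₗ[R] Z' :=
  if h : ∀ x ∈ Z, f x ∈ Z' then f.restrict h else 0

/-- The subquotient `Z / (Bd ∩ Z)`. -/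
abbrev subQuotL (Z Bd : Submodule R M) : Type _ := Z ⧸ Bd.comap Z.subtype

def subQuotMapL (f : M →ₗ[R] N) (Z Bd : Submodule R M) (Z' Bd' : Submodule R N) :
    subQuotL R Z Bd →ₗ[R] subQuotL R Z' Bd' :=
  descendL R (Bd.comap Z.subtype) (Bd'.comap Z'.subtype) (restrictL R f Z Z')

end LinGadgets

/-! ### Reduced simplicial chains and homology of a family of finite sets

A family `K : Finset V → Prop` of finite subsets of a vertex type `V` (in our applications a
simplicial complex, in particular closed under taking subsets and containing `∅`) has reduced
simplicial chain groups over a ring `R`: the degree-`d` chain group is free on the faces of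
cardinality `d + 1`, i.e. we index chain groups by the cardinality `c = d + 1` of the faces,
with the empty face (cardinality `0`, degree `-1`) giving the augmentation.  Orientations are
induced by an injection `rank : V → ℕ` of the vertices into `ℕ`. -/

section Simplicial

variable (R : Type*) [CommRing R]

/-- Chains on the faces of cardinality `c` of the family `K`. -/
abbrev SChain {V : Type*} (K : Finset V → Prop) (c : ℕ) : Type _ :=
  {σ : Finset V // K σ ∧ σ.card = c} →₀ R

/-- The basis chain of a face, or zero for a non-face. -/
def basisOrZero {V : Type*} (K : Finset V → Prop) (c : ℕ) (τ : Finset V) : SChain R K c :=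
  if h : K τ ∧ τ.card = c then Finsupp.single ⟨τ, h⟩ (1 : R) else 0

/-- The simplicial boundary map, with signs determined by the ordering of the vertices via
`rank`. -/
def bdry {V : Type*} [DecidableEq V] (rank : V → ℕ) (K : Finset V → Prop) (c : ℕ) :
    SChain R K (c + 1) →ₗ[R] SChain R K c :=
  Finsupp.lsum R fun σ => LinearMap.toSpanSingleton R _
    (∑ v ∈ σ.1, ((-1 : ℤ) ^ ((σ.1.filter fun u => rank u < rank v).card) •
      basisOrZero R K c (σ.1.erase v)))

/-- The orientation sign of a map `f` on a face `σ`: the parity of the number of inversions. -/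
def mapSign {V W : Type*} (rank : V → ℕ) (rank' : W → ℕ) (f : V → W) (σ : Finset V) : ℤ :=
  (-1) ^ (((σ ×ˢ σ).filter fun p => rank p.1 < rank p.2 ∧ rank' (f p.2) < rank' (f p.1)).card)

/-- The chain map induced by a map `f` on vertices, taking orientations into account. -/
def chainMap {V W : Type*} [DecidableEq V] [DecidableEq W] (rank : V → ℕ) (rank' : W → ℕ)
    (f : V → W) (K : Finset V → Prop) (K' : Finset W → Prop) (c : ℕ) :
    SChain R K c →ₗ[R] SChain R K' c :=
  Finsupp.lsum R fun σ => LinearMap.toSpanSingleton R _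
    (mapSign rank rank' f σ.1 • basisOrZero R K' c (σ.1.image f))

/-- Cycles among the chains on faces of cardinality `c` (for `c = 0` everything is a cycle:
the boundary map leaving degree `-1` is zero). -/
def cycLow {V : Type*} [DecidableEq V] (rank : V → ℕ) (K : Finset V → Prop) :
    (c : ℕ) → Submodule R (SChain R K c)
  | 0 => ⊤
  | (m + 1) => LinearMap.ker (bdry R rank K m)

/-- Reduced simplicial homology at the faces of cardinality `c`, i.e. in degree `c - 1`. -/
abbrev RHc {V : Type*} [DecidableEq V] (rank : V → ℕ) (K : Finset V → Prop) (c : ℕ) : Type _ :=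
  subQuotL R (cycLow R rank K c) (LinearMap.range (bdry R rank K c))

/-- Reduced simplicial homology `H̃_dg(K; R)`. -/
abbrev RH {V : Type*} [DecidableEq V] (rank : V → ℕ) (K : Finset V → Prop) (dg : ℕ) : Type _ :=
  RHc R rank K (dg + 1)

end Simplicial

/-! ### The matching complex and the complexes of graphs of bounded degree -/

/-- The standard injection of pairs into `ℕ`, inducing the lexicographic order. -/
def rankP (m : ℕ) : Fin m × Fin m → ℕ := fun p => p.1.val * m + p.2.val

/-- A face of the matching complex `M_m`: a set of edges `(i, j)`, `i < j`, of the complete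
graph on `Fin m`, no two of which share an endpoint. -/
def IsMatching (m : ℕ) (σ : Finset (Fin m × Fin m)) : Prop :=
  (∀ p ∈ σ, p.1 < p.2) ∧
    ∀ p ∈ σ, ∀ q ∈ σ, p ≠ q → p.1 ≠ q.1 ∧ p.1 ≠ q.2 ∧ p.2 ≠ q.1 ∧ p.2 ≠ q.2

/-- `H̃_dg(M_m; R)`, the reduced homology of the matching complex on `m` vertices. -/
abbrev MH (R : Type*) [CommRing R] (m dg : ℕ) : Type _ := RH R (rankP m) (IsMatching m) dg

/-- The degree of the vertex `i` in the graph `σ` (a loop `(i, i)` counts twice). -/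
def degB {n : ℕ} (σ : Finset (Fin n × Fin n)) (i : Fin n) : ℕ :=
  ∑ p ∈ σ, ((if p.1 = i then 1 else 0) + (if p.2 = i then 1 else 0))

/-- A face of `BD_n^λ`: a graph on `Fin n` (loops allowed, encoded as pairs `(i, j)` with
`i ≤ j`) in which the vertex `i` has degree at most `λ i`. -/
def IsBDGraph {n : ℕ} (lam : Fin n → ℕ) (σ : Finset (Fin n × Fin n)) : Prop :=
  (∀ p ∈ σ, p.1 ≤ p.2) ∧ ∀ i, degB σ i ≤ lam i

/-- `H̃_dg(BD_n^λ; R)`. -/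
abbrev BDH (R : Type*) [CommRing R] {n : ℕ} (lam : Fin n → ℕ) (dg : ℕ) : Type _ :=
  RH R (rankP n) (IsBDGraph lam) dg

/-! ### The Young group action on the matching complex -/

/-- The action of a permutation of the vertices on the edges of the complete graph. -/
def emap {m : ℕ} (g : Equiv.Perm (Fin m)) : Fin m × Fin m → Fin m × Fin m :=
  fun p => (min (g p.1) (g p.2), max (g p.1) (g p.2))

/-- The quotient map on edges induced by a surjection `kap` on vertices (whose fibers are the
blocks `U_i` of the partition). -/
def kmap {N n : ℕ} (kap : Fin N → Fin n) : Fin N × Fin N → Fin n × Fin n :=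
  fun p => (min (kap p.1) (kap p.2), max (kap p.1) (kap p.2))

/-- Membership of a permutation in the Young group: it preserves each block of the partition
determined by `kap`. -/
def KeepsBlocks {N n : ℕ} (kap : Fin N → Fin n) (g : Equiv.Perm (Fin N)) : Prop :=
  ∀ x, kap (g x) = kap x

section YoungAction

variable (R : Type*) [CommRing R]

/-- The action of a permutation `g` of the `N` vertices on chains. -/
def actC (N : ℕ) (K : Finset (Fin N × Fin N) → Prop) (g : Equiv.Perm (Fin N)) (c : ℕ) :
    SChain R K c →ₗ[R] SChain R K c :=
  chainMap R (rankP N) (rankP N) (emap g) K K c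

/-- The submodule of chains generated by the elements `c - g c`, `g` in the Young group. -/
def ysub (N n : ℕ) (kap : Fin N → Fin n) (K : Finset (Fin N × Fin N) → Prop) (c : ℕ) :
    Submodule R (SChain R K c) :=
  Submodule.span R {x | ∃ (ch : SChain R K c) (g : Equiv.Perm (Fin N)),
    KeepsBlocks kap g ∧ x = ch - actC R N K g c ch}

/-- The chains of the quotient complex `C̃/S_λ`. -/
abbrev QC (N n : ℕ) (kap : Fin N → Fin n) (K : Finset (Fin N × Fin N) → Prop) (c : ℕ) :
    Type _ :=
  SChain R K c ⧸ ysub R N n kap K c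

/-- The boundary map of the quotient complex `C̃/S_λ`. -/
def qbdry (N n : ℕ) (kap : Fin N → Fin n) (K : Finset (Fin N × Fin N) → Prop) (c : ℕ) :
    QC R N n kap K (c + 1) →ₗ[R] QC R N n kap K c :=
  descendL R (ysub R N n kap K (c + 1)) (ysub R N n kap K c) (bdry R (rankP N) K c)

/-- Homology of the quotient complex `C̃(M_N)/S_λ` in degree `dg`. -/
abbrev QMH (N n : ℕ) (kap : Fin N → Fin n) (dg : ℕ) : Type _ :=
  subQuotL R (LinearMap.ker (qbdry R N n kap (IsMatching N) dg))
    (LinearMap.range (qbdry R N n kap (IsMatching N) (dg + 1)))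

/-- The chain map `φ : C̃/S_λ → C̃`, `[c] ↦ ∑_{g ∈ S_λ} g c`. -/
def phiC (N n : ℕ) (kap : Fin N → Fin n) (K : Finset (Fin N × Fin N) → Prop) (c : ℕ) :
    QC R N n kap K c →ₗ[R] SChain R K c :=
  liftOrZeroL R (ysub R N n kap K c)
    (∑ g ∈ Finset.univ.filter (fun g : Equiv.Perm (Fin N) => ∀ x, kap (g x) = kap x),
      actC R N K g c)

/-- The map `φ* : H_dg(C̃(M_N)/S_λ) → H̃_dg(M_N; R)` induced by `φ`. -/
def phiStarM (N n : ℕ) (kap : Fin N → Fin n) (dg : ℕ) :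
    QMH R N n kap dg →ₗ[R] MH R N dg :=
  subQuotMapL R (phiC R N n kap (IsMatching N) (dg + 1))
    (LinearMap.ker (qbdry R N n kap (IsMatching N) dg))
    (LinearMap.range (qbdry R N n kap (IsMatching N) (dg + 1)))
    (cycLow R (rankP N) (IsMatching N) (dg + 1))
    (LinearMap.range (bdry R (rankP N) (IsMatching N) (dg + 1)))

end YoungAction

/-! ### The subfamilies `Δ_λ` and `Γ_λ` of the matching complex -/

/-- `σ` contains two distinct edges `ab`, `cd` with `a, c` in the same block and `b, d` in the
same block. -/
def InDelta {N n : ℕ} (kap : Fin N → Fin n) (σ : Finset (Fin N × Fin N)) : Prop :=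
  ∃ p ∈ σ, ∃ q ∈ σ, p ≠ q ∧
    ((kap p.1 = kap q.1 ∧ kap p.2 = kap q.2) ∨ (kap p.1 = kap q.2 ∧ kap p.2 = kap q.1))

/-- A face of `Δ_λ`. -/
def IsDelta {N n : ℕ} (kap : Fin N → Fin n) (σ : Finset (Fin N × Fin N)) : Prop :=
  IsMatching N σ ∧ InDelta kap σ

/-- A face of `Γ_λ = M_N \ Δ_λ`. -/
def IsGamma {N n : ℕ} (kap : Fin N → Fin n) (σ : Finset (Fin N × Fin N)) : Prop :=
  IsMatching N σ ∧ ¬ InDelta kap σ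

section YoungMore

variable (R : Type*) [CommRing R]

/-- The map `κ̂ : C̃(Γ_λ)/S_λ → C̃(BD_n^λ)`, `[c] ↦ κ(c)`. -/
def khat (N n : ℕ) (kap : Fin N → Fin n) (lam : Fin n → ℕ) (c : ℕ) :
    QC R N n kap (IsGamma kap) c →ₗ[R] SChain R (IsBDGraph lam) c :=
  liftOrZeroL R (ysub R N n kap (IsGamma kap) c)
    (chainMap R (rankP N) (rankP n) (kmap kap) (IsGamma kap) (IsBDGraph lam) c)

/-- The boundary map of the subcomplex `C̃(M_N; R)^{S_λ}`. -/
def sbdry (N n : ℕ) (kap : Fin N → Fin n) (c : ℕ) :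
    ysub R N n kap (IsMatching N) (c + 1) →ₗ[R] ysub R N n kap (IsMatching N) c :=
  restrictL R (bdry R (rankP N) (IsMatching N) c)
    (ysub R N n kap (IsMatching N) (c + 1)) (ysub R N n kap (IsMatching N) c)

/-- Homology of the subcomplex `C̃(M_N; R)^{S_λ}` in degree `dg`: the cycles of the
subcomplex (elements of the subcomplex with vanishing boundary) modulo the boundaries of
elements of the subcomplex. -/
abbrev SubH (N n : ℕ) (kap : Fin N → Fin n) (dg : ℕ) : Type _ :=
  subQuotL R
    (ysub R N n kap (IsMatching N) (dg + 1) ⊓ cycLow R (rankP N) (IsMatching N) (dg + 1))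
    ((ysub R N n kap (IsMatching N) (dg + 1 + 1)).map (bdry R (rankP N) (IsMatching N) (dg + 1)))

/-! ### Inclusion maps between matching complexes -/

/-- The chain map induced by the inclusion `M_m ⊆ M_{m'}`. -/
def inclChain (m m' : ℕ) (h : m ≤ m') (c : ℕ) :
    SChain R (IsMatching m) c →ₗ[R] SChain R (IsMatching m') c :=
  chainMap R (rankP m) (rankP m') (fun p => (Fin.castLE h p.1, Fin.castLE h p.2))
    (IsMatching m) (IsMatching m') c

/-- The map `H̃_dg(M_m; R) → H̃_dg(M_{m'}; R)` induced by the inclusion. -/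
def inclStar (m m' : ℕ) (h : m ≤ m') (dg : ℕ) : MH R m dg →ₗ[R] MH R m' dg :=
  subQuotMapL R (inclChain R m m' h (dg + 1))
    (cycLow R (rankP m) (IsMatching m) (dg + 1))
    (LinearMap.range (bdry R (rankP m) (IsMatching m) (dg + 1)))
    (cycLow R (rankP m') (IsMatching m') (dg + 1))
    (LinearMap.range (bdry R (rankP m') (IsMatching m') (dg + 1)))

/-! ### The pair `(M_m, M_m \ e)`, where `e` is the last edge -/

/-- The edge `e` between the last two of the `m` vertices. -/
def eEdge (m : ℕ) (h : 2 ≤ m) : Fin m × Fin m := (⟨m - 2, by omega⟩, ⟨m - 1, by omega⟩)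

/-- A face of `M_m \ e`: a matching not containing the edge `e`. -/
def MnMinusE (m : ℕ) (h : 2 ≤ m) (σ : Finset (Fin m × Fin m)) : Prop :=
  IsMatching m σ ∧ eEdge m h ∉ σ

/-- Pass from a set of edges avoiding the last two vertices of `Fin m` to a set of edges on
`Fin (m - 2)`. -/
def shrink (m : ℕ) (σ : Finset (Fin m × Fin m)) : Finset (Fin (m - 2) × Fin (m - 2)) :=
  (σ.filter fun p => p.1.val < m - 2 ∧ p.2.val < m - 2).attach.image
    fun p => (⟨p.1.1.val, (Finset.mem_filter.mp p.2).2.1⟩,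
              ⟨p.1.2.val, (Finset.mem_filter.mp p.2).2.2⟩)

/-- The chain map realizing the composition
`C̃(M_m) → C̃(M_m, M_m \ e) ≅ C̃(M_{m - 2})[1]`: a face `σ` containing `e` is written as
`σ = ± e ∧ w` and sent to `± w`, viewed in the matching complex on the remaining `m - 2`
vertices; a face not containing `e` is sent to zero. -/
def theta (m : ℕ) (hm : 2 ≤ m) (c : ℕ) :
    SChain R (IsMatching m) (c + 1) →ₗ[R] SChain R (IsMatching (m - 2)) c :=
  Finsupp.lsum R fun σ => LinearMap.toSpanSingleton R _
    (if eEdge m hm ∈ σ.1 then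
      ((-1 : ℤ) ^ c) • basisOrZero R (IsMatching (m - 2)) c (shrink m (σ.1.erase (eEdge m hm)))
     else 0)

/-- The map `H̃_dg(M_m \ e; R) → H̃_dg(M_m; R)` induced by the inclusion. -/
def inclEStar (m : ℕ) (hm : 2 ≤ m) (dg : ℕ) :
    RH R (rankP m) (MnMinusE m hm) dg →ₗ[R] MH R m dg :=
  subQuotMapL R (chainMap R (rankP m) (rankP m) id (MnMinusE m hm) (IsMatching m) (dg + 1))
    (cycLow R (rankP m) (MnMinusE m hm) (dg + 1))
    (LinearMap.range (bdry R (rankP m) (MnMinusE m hm) (dg + 1)))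
    (cycLow R (rankP m) (IsMatching m) (dg + 1))
    (LinearMap.range (bdry R (rankP m) (IsMatching m) (dg + 1)))

/-- The composition `H̃_dg(M_m; R) → H_dg(M_m, M_m \ e; R) ≅ H̃_{dg - 1}(M_{m - 2}; R)` of the
map to relative homology with the canonical isomorphism. -/
def thetaStar (m : ℕ) (hm : 2 ≤ m) (dg : ℕ) :
    MH R m dg →ₗ[R] RHc R (rankP (m - 2)) (IsMatching (m - 2)) dg :=
  subQuotMapL R (theta R m hm dg)
    (cycLow R (rankP m) (IsMatching m) (dg + 1))
    (LinearMap.range (bdry R (rankP m) (IsMatching m) (dg + 1)))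
    (cycLow R (rankP (m - 2)) (IsMatching (m - 2)) dg)
    (LinearMap.range (bdry R (rankP (m - 2)) (IsMatching (m - 2)) dg))

end YoungMore

end MatchPaper

end
set_option synthInstance.maxHeartbeats 20000
set_option maxHeartbeats 400000
set_option linter.all false

namespace MC

/-! ## The exterior algebra on a set of generators -/

/-- The exterior algebra over the integers on the generators `E`. -/
def Lam (E : Type) : Type := ExteriorAlgebra ℤ (E →₀ ℤ)

noncomputable instance (E : Type) : Ring (Lam E) :=
  inferInstanceAs (Ring (ExteriorAlgebra ℤ (E →₀ ℤ)))

/-- The generator. -/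
noncomputable def gen {E : Type} (e : E) : Lam E :=
  ExteriorAlgebra.ι ℤ (Finsupp.single e (1 : ℤ))

/-- The functional with prescribed values. -/
noncomputable def fun1 {E : Type} (f : E → ℤ) : Module.Dual ℤ (E →₀ ℤ) :=
  Finsupp.lsum ℤ fun e => LinearMap.toSpanSingleton ℤ ℤ (f e)

/-- Contraction. -/
noncomputable def D {E : Type} (f : E → ℤ) : Lam E →ₗ[ℤ] Lam E :=
  AddMonoidHom.toIntLinearMap
    (CliffordAlgebra.contractLeft (Q := (0 : QuadraticForm ℤ (E →₀ ℤ))) (fun1 f)).toAddMonoidHom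

/-- Scalar part. -/
noncomputable def sc {E : Type} : Lam E →+* ℤ :=
  (ExteriorAlgebra.algebraMapInv (R := ℤ) (M := (E →₀ ℤ))).toRingHom

variable {E : Type}

theorem D_gen_mul (f : E → ℤ) (e : E) (z : Lam E) :
    D f (gen e * z) = f e • z - gen e * D f z := by
  have := CliffordAlgebra.contractLeft_ι_mul (Q := (0 : QuadraticForm ℤ (E →₀ ℤ))) (d := fun1 f)
    (Finsupp.single e (1 : ℤ)) z
  have h1 : fun1 f (Finsupp.single e (1 : ℤ)) = f e := by simp [fun1]
  rw [h1] at this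
  exact this

theorem D_one (f : E → ℤ) : D f (1 : Lam E) = 0 :=
  CliffordAlgebra.contractLeft_one (Q := (0 : QuadraticForm ℤ (E →₀ ℤ))) (d := fun1 f)

theorem D_gen (f : E → ℤ) (e : E) : D f (gen e) = f e • (1 : Lam E) := by
  have := D_gen_mul f e 1
  simpa [D_one] using this

theorem D_D (f : E → ℤ) (z : Lam E) : D f (D f z) = 0 :=
  CliffordAlgebra.contractLeft_contractLeft (Q := (0 : QuadraticForm ℤ (E →₀ ℤ))) (fun1 f) z

theorem D_comm (f g : E → ℤ) (z : Lam E) : D f (D g z) = - D g (D f z) :=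
  CliffordAlgebra.contractLeft_comm (Q := (0 : QuadraticForm ℤ (E →₀ ℤ))) (fun1 f) (fun1 g) z

theorem gen_sq (e : E) : gen e * gen e = 0 :=
  ExteriorAlgebra.ι_sq_zero (R := ℤ) (Finsupp.single e (1 : ℤ))

theorem gen_anti (e f : E) : gen e * gen f = - (gen f * gen e) := by
  have := ExteriorAlgebra.ι_add_mul_swap (R := ℤ) (Finsupp.single e (1 : ℤ)) (Finsupp.single f (1 : ℤ))
  exact eq_neg_of_add_eq_zero_left this

theorem gen_sq_mul (e : E) (z : Lam E) : gen e * (gen e * z) = 0 := by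
  rw [← mul_assoc, gen_sq, zero_mul]

theorem gen_anti_mul (e f : E) (z : Lam E) : gen e * (gen f * z) = - (gen f * (gen e * z)) := by
  rw [← mul_assoc, gen_anti, neg_mul, mul_assoc]

theorem sc_gen (e : E) : sc (gen e : Lam E) = 0 := by
  have : ExteriorAlgebra.algebraMapInv (R := ℤ) (ExteriorAlgebra.ι ℤ (Finsupp.single e (1 : ℤ))) = 0 := by
    simp [ExteriorAlgebra.algebraMapInv]
  exact this

theorem Lam_ind {P : Lam E → Prop} (h1 : P 1) (ha : ∀ u v, P u → P v → P (u + v))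
    (hn : ∀ u, P u → P (-u)) (hg : ∀ e z, P z → P (gen e * z)) (z : Lam E) : P z := by
  have h0 : P 0 := by simpa using ha _ _ h1 (hn _ h1)
  have hs : ∀ (n : ℕ) u, P u → P (n • u) := by
    intro n u hu
    induction n with
    | zero => simpa using h0
    | succ n ih => rw [succ_nsmul]; exact ha _ _ ih hu
  have hz : ∀ (n : ℤ) u, P u → P (n • u) := by
    intro n u hu
    obtain ⟨m, rfl | rfl⟩ := n.eq_nat_or_neg
    · simpa using hs m u hu
    · simpa using hn _ (hs m u hu)
  refine CliffordAlgebra.left_induction (Q := (0 : QuadraticForm ℤ (E →₀ ℤ))) (P := P) ?_ ?_ ?_ z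
  · intro r
    have : (algebraMap ℤ (CliffordAlgebra (0 : QuadraticForm ℤ (E →₀ ℤ))) r : Lam E) = r • (1 : Lam E) := by
      rw [zsmul_one]
      exact eq_intCast (algebraMap ℤ (CliffordAlgebra (0 : QuadraticForm ℤ (E →₀ ℤ)))) r
    rw [this]; exact hz r _ h1
  · exact ha
  · intro u m hu
    induction m using Finsupp.induction_linear with
    | zero =>
      have : CliffordAlgebra.ι (0 : QuadraticForm ℤ (E →₀ ℤ)) 0 * u = 0 := by simp
      rw [this]; exact h0
    | add f g hf hg' =>
      rw [map_add]
      have : (CliffordAlgebra.ι (0 : QuadraticForm ℤ (E →₀ ℤ)) f +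
        CliffordAlgebra.ι (0 : QuadraticForm ℤ (E →₀ ℤ)) g) * u = CliffordAlgebra.ι (0 : QuadraticForm ℤ (E →₀ ℤ)) f * u +
        CliffordAlgebra.ι (0 : QuadraticForm ℤ (E →₀ ℤ)) g * u := add_mul _ _ _
      rw [this]; exact ha _ _ hf hg'
    | single e r =>
      have h2 : (Finsupp.single e r : E →₀ ℤ) = r • Finsupp.single e 1 := by simp
      have : CliffordAlgebra.ι (0 : QuadraticForm ℤ (E →₀ ℤ)) (Finsupp.single e r) * u = (r • ((gen e : Lam E) * (show Lam E from u)) : Lam E) := by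
        rw [h2, map_smul]
        have h3 : r • CliffordAlgebra.ι (0 : QuadraticForm ℤ (E →₀ ℤ)) (Finsupp.single e 1) = r • (gen e : Lam E) :=
          (Int.cast_smul_eq_zsmul ℤ r _)
        rw [h3]
        exact smul_mul_assoc r (gen e : Lam E) (show Lam E from u)
      rw [this]; exact hz _ _ (hg _ _ hu)

/-- Algebra maps induced by linear maps on generators. -/
noncomputable def mapL {E' : Type} (φ : E → (E' →₀ ℤ)) : Lam E →+* Lam E' :=
  (ExteriorAlgebra.map (Finsupp.lsum ℤ fun e => LinearMap.toSpanSingleton ℤ (E' →₀ ℤ) (φ e))).toRingHom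

/-- Linear combinations of generators. -/
noncomputable def lin {E' : Type} (m : E' →₀ ℤ) : Lam E' := ExteriorAlgebra.ι ℤ m

theorem mapL_gen {E' : Type} (φ : E → (E' →₀ ℤ)) (e : E) : mapL φ (gen e) = lin (φ e) := by
  have := ExteriorAlgebra.map_apply_ι (R := ℤ)
    (Finsupp.lsum ℤ fun e => LinearMap.toSpanSingleton ℤ (E' →₀ ℤ) (φ e)) (Finsupp.single e (1 : ℤ))
  refine Eq.trans this ?_
  simp only [lin, Finsupp.lsum_single, LinearMap.toSpanSingleton_apply, one_smul]
  rfl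

theorem lin_add {E' : Type} (m n : E' →₀ ℤ) : lin (m + n) = lin m + lin n :=
  map_add (ExteriorAlgebra.ι ℤ) m n

theorem lin_single {E' : Type} (e : E') : lin (Finsupp.single e 1) = gen e := rfl

theorem lin_sum {E' ι : Type} (s : Finset ι) (m : ι → E' →₀ ℤ) :
    lin (∑ i ∈ s, m i) = ∑ i ∈ s, lin (m i) :=
  map_sum (ExteriorAlgebra.ι ℤ) m s

end MC

set_option synthInstance.maxHeartbeats 20000
set_option maxHeartbeats 400000
set_option linter.all false

namespace MC

/-! ## Chains of matchings inside the exterior algebra on edges -/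

/-- The exterior algebra on edges. -/
abbrev LE : Type := Lam (Sym2 ℕ)

/-- The edge `ab`. -/
noncomputable def x (a b : ℕ) : LE := gen s(a, b)

theorem x_symm (a b : ℕ) : x a b = x b a := by rw [x, x, Sym2.eq_swap]

/-- The boundary. -/
noncomputable def bd : LE →ₗ[ℤ] LE := D fun _ => 1

/-- The partial derivative. -/
noncomputable def dd (a b : ℕ) : LE →ₗ[ℤ] LE := D fun e => if e = s(a, b) then 1 else 0

theorem dd_symm (a b : ℕ) : dd a b = dd b a := by rw [dd, dd, Sym2.eq_swap]

theorem bd_x_mul (a b : ℕ) (z : LE) : bd (x a b * z) = z - x a b * bd z := by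
  rw [bd, x, D_gen_mul, one_smul]

theorem bd_one : bd 1 = 0 := D_one _

theorem bd_x (a b : ℕ) : bd (x a b) = 1 := by rw [bd, x, D_gen, one_smul]

theorem bd_bd (z : LE) : bd (bd z) = 0 := D_D _ z

theorem dd_bd (a b : ℕ) (z : LE) : dd a b (bd z) = - bd (dd a b z) := D_comm _ _ z

theorem bd_dd (a b : ℕ) (z : LE) : bd (dd a b z) = - dd a b (bd z) := D_comm _ _ z

theorem dd_dd (a b c d : ℕ) (z : LE) : dd a b (dd c d z) = - dd c d (dd a b z) := D_comm _ _ z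

theorem dd_one (a b : ℕ) : dd a b 1 = 0 := D_one _

theorem dd_x_same (a b : ℕ) (z : LE) : dd a b (x a b * z) = z - x a b * dd a b z := by
  rw [dd, x, D_gen_mul]; simp

theorem dd_x_ne {a b c d : ℕ} (h : s(c, d) ≠ s(a, b)) (z : LE) :
    dd a b (x c d * z) = - (x c d * dd a b z) := by
  rw [dd, x, D_gen_mul]; simp [h]

theorem x_sq (a b : ℕ) (z : LE) : x a b * (x a b * z) = 0 := gen_sq_mul _ _

theorem x_anti (a b c d : ℕ) (z : LE) : x a b * (x c d * z) = - (x c d * (x a b * z)) :=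
  gen_anti_mul _ _ _

/-- Chains of matchings with `c` edges on the vertex set `V`. -/
noncomputable def C : ℕ → Finset ℕ → Submodule ℤ LE
  | 0, _ => Submodule.span ℤ {1}
  | (c + 1), V => Submodule.span ℤ
      {w | ∃ a b z, a ∈ V ∧ b ∈ V ∧ a ≠ b ∧ z ∈ C c (V \ {a, b}) ∧ w = x a b * z}

theorem one_mem_C (V : Finset ℕ) : (1 : LE) ∈ C 0 V := by
  rw [C]; exact Submodule.mem_span_singleton_self _

theorem x_mul_mem_C {c : ℕ} {V : Finset ℕ} {a b : ℕ} {z : LE} (ha : a ∈ V) (hb : b ∈ V)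
    (hab : a ≠ b) (hz : z ∈ C c (V \ {a, b})) : x a b * z ∈ C (c + 1) V := by
  rw [C]; exact Submodule.subset_span ⟨a, b, z, ha, hb, hab, hz, rfl⟩

theorem C_succ_le {c : ℕ} {V : Finset ℕ} {S : Submodule ℤ LE}
    (h : ∀ a b z, a ∈ V → b ∈ V → a ≠ b → z ∈ C c (V \ {a, b}) → x a b * z ∈ S) :
    C (c + 1) V ≤ S := by
  rw [C, Submodule.span_le]
  rintro _ ⟨a, b, z, ha, hb, hab, hz, rfl⟩
  exact h a b z ha hb hab hz

theorem C_zero_le {V : Finset ℕ} {S : Submodule ℤ LE} (h : (1 : LE) ∈ S) : C 0 V ≤ S := by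
  rw [C, Submodule.span_le]; simpa using h

theorem C_mono {c : ℕ} {V W : Finset ℕ} (h : V ⊆ W) : C c V ≤ C c W := by
  induction c generalizing V W with
  | zero => exact C_zero_le (one_mem_C _)
  | succ c ih =>
    refine C_succ_le fun a b z ha hb hab hz => x_mul_mem_C (h ha) (h hb) hab (ih ?_ hz)
    exact Finset.sdiff_subset_sdiff h (le_refl _)

theorem x_mul_mem_C' {c : ℕ} {V W : Finset ℕ} {a b : ℕ} {z : LE} (ha : a ∈ V) (hb : b ∈ V)
    (hab : a ≠ b) (hz : z ∈ C c W) (hW : W ⊆ V) (haW : a ∉ W) (hbW : b ∉ W) :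
    x a b * z ∈ C (c + 1) V := by
  refine x_mul_mem_C ha hb hab (C_mono ?_ hz)
  intro t ht
  simp only [Finset.mem_sdiff, Finset.mem_insert, Finset.mem_singleton]
  refine ⟨hW ht, ?_⟩
  rintro (rfl | rfl)
  · exact haW ht
  · exact hbW ht

theorem D_mul (f : Sym2 ℕ → ℤ) {c : ℕ} {V : Finset ℕ} {u : LE} (hu : u ∈ C c V) (w : LE) :
    D f (u * w) = D f u * w + (-1 : ℤ) ^ c • (u * D f w) := by
  induction c generalizing V u with
  | zero =>
    have : C 0 V ≤ LinearMap.eqLocus ((D f).comp (LinearMap.mulRight ℤ w))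
      ((LinearMap.mulRight ℤ w).comp (D f) + (LinearMap.mulRight ℤ (D f w))) :=
      C_zero_le (by simp [LinearMap.mem_eqLocus, D_one])
    simpa [LinearMap.mem_eqLocus] using this hu
  | succ c ih =>
    have : C (c + 1) V ≤ LinearMap.eqLocus ((D f).comp (LinearMap.mulRight ℤ w))
      ((LinearMap.mulRight ℤ w).comp (D f) + (-1 : ℤ) ^ (c + 1) • (LinearMap.mulRight ℤ (D f w))) := by
      refine C_succ_le fun a b z ha hb hab hz => ?_
      simp only [LinearMap.mem_eqLocus, LinearMap.comp_apply, LinearMap.mulRight_apply,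
        LinearMap.add_apply, LinearMap.smul_apply]
      rw [x, mul_assoc, D_gen_mul, D_gen_mul, ih hz, pow_succ, mul_add, sub_mul, mul_assoc,
        mul_smul_comm, ← mul_assoc, ← mul_assoc, smul_mul_assoc]
      simp only [mul_neg, mul_one, neg_smul, mul_assoc]
      abel
    exact this hu

theorem bd_mul {c : ℕ} {V : Finset ℕ} {u : LE} (hu : u ∈ C c V) (w : LE) :
    bd (u * w) = bd u * w + (-1 : ℤ) ^ c • (u * bd w) := D_mul _ hu w

theorem dd_mul (a b : ℕ) {c : ℕ} {V : Finset ℕ} {u : LE} (hu : u ∈ C c V) (w : LE) :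
    dd a b (u * w) = dd a b u * w + (-1 : ℤ) ^ c • (u * dd a b w) := D_mul _ hu w

theorem x_comm {c : ℕ} {V : Finset ℕ} {u : LE} (hu : u ∈ C c V) (a b : ℕ) :
    x a b * u = (-1 : ℤ) ^ c • (u * x a b) := by
  induction c generalizing V u with
  | zero =>
    have : C 0 V ≤ LinearMap.eqLocus (LinearMap.mulLeft ℤ (x a b)) (LinearMap.mulRight ℤ (x a b)) :=
      C_zero_le (by simp [LinearMap.mem_eqLocus])
    simpa [LinearMap.mem_eqLocus] using this hu
  | succ c ih =>
    have : C (c + 1) V ≤ LinearMap.eqLocus (LinearMap.mulLeft ℤ (x a b))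
      ((-1 : ℤ) ^ (c + 1) • LinearMap.mulRight ℤ (x a b)) := by
      refine C_succ_le fun p q z ha hb hab hz => ?_
      simp only [LinearMap.mem_eqLocus, LinearMap.mulRight_apply, LinearMap.mulLeft_apply,
        LinearMap.smul_apply]
      rw [x_anti, ih hz, pow_succ, mul_smul_comm, mul_assoc]
      simp
    exact this hu

theorem dd_zero {c : ℕ} {V : Finset ℕ} {p : ℕ} (hp : p ∉ V) (a : ℕ) {z : LE} (hz : z ∈ C c V) :
    dd p a z = 0 := by
  induction c generalizing V z with
  | zero =>
    have : C 0 V ≤ LinearMap.ker (dd p a) := C_zero_le (by simp [dd_one])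
    exact this hz
  | succ c ih =>
    have : C (c + 1) V ≤ LinearMap.ker (dd p a) := by
      refine C_succ_le fun a' b z ha hb hab hz => ?_
      rw [LinearMap.mem_ker, dd_x_ne, ih (by simp [hp]) hz, mul_zero, neg_zero]
      intro h
      rw [Sym2.eq_iff] at h
      rcases h with ⟨rfl, _⟩ | ⟨_, rfl⟩ <;> contradiction
    exact this hz

theorem dd_zero' {c : ℕ} {V : Finset ℕ} {p : ℕ} (hp : p ∉ V) (a : ℕ) {z : LE} (hz : z ∈ C c V) :
    dd a p z = 0 := by rw [dd_symm]; exact dd_zero hp a hz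

theorem dd_self {c : ℕ} {V : Finset ℕ} (a : ℕ) {z : LE} (hz : z ∈ C c V) : dd a a z = 0 := by
  induction c generalizing V z with
  | zero =>
    have : C 0 V ≤ LinearMap.ker (dd a a) := C_zero_le (by simp [dd_one])
    exact this hz
  | succ c ih =>
    have : C (c + 1) V ≤ LinearMap.ker (dd a a) := by
      refine C_succ_le fun a' b z ha hb hab hz => ?_
      rw [LinearMap.mem_ker, dd_x_ne, ih hz, mul_zero, neg_zero]
      intro h
      rw [Sym2.eq_iff] at h
      rcases h with ⟨rfl, rfl⟩ | ⟨rfl, rfl⟩ <;> contradiction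
    exact this hz

theorem dd_C0 (a b : ℕ) {V : Finset ℕ} {z : LE} (hz : z ∈ C 0 V) : dd a b z = 0 := by
  have : C 0 V ≤ LinearMap.ker (dd a b) := C_zero_le (by simp [dd_one])
  exact this hz

theorem bd_C0 {V : Finset ℕ} {z : LE} (hz : z ∈ C 0 V) : bd z = 0 := by
  have : C 0 V ≤ LinearMap.ker bd := C_zero_le (by simp [bd_one])
  exact this hz

theorem dd_mem {c : ℕ} {V : Finset ℕ} (a b : ℕ) {z : LE} (hz : z ∈ C (c + 1) V) :
    dd a b z ∈ C c (V \ {a, b}) := by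
  induction c generalizing V z with
  | zero =>
    have : C (0 + 1) V ≤ (C 0 (V \ {a, b})).comap (dd a b) := by
      refine C_succ_le fun p q z hp hq hpq hz => ?_
      rw [Submodule.mem_comap]
      by_cases h : s(p, q) = s(a, b)
      · have : x p q = x a b := by rw [x, x, h]
        rw [this, dd_x_same, dd_C0 a b hz]; simpa using C_mono (by
          rw [Sym2.eq_iff] at h
          rcases h with ⟨rfl, rfl⟩ | ⟨rfl, rfl⟩
          · exact le_refl _
          · rw [Finset.pair_comm]) hz
      · rw [dd_x_ne h, dd_C0 a b hz]; simp
    exact this hz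
  | succ c ih =>
    have : C (c + 1 + 1) V ≤ (C (c + 1) (V \ {a, b})).comap (dd a b) := by
      refine C_succ_le fun p q z hp hq hpq hz => ?_
      rw [Submodule.mem_comap]
      by_cases h : s(p, q) = s(a, b)
      · have hx : x p q = x a b := by rw [x, x, h]
        have ha : a ∉ V \ {p, q} := by
          rw [Sym2.eq_iff] at h
          rcases h with ⟨rfl, rfl⟩ | ⟨rfl, rfl⟩ <;> simp
        rw [hx, dd_x_same, dd_zero ha b hz, mul_zero, sub_zero]
        refine C_mono ?_ hz
        rw [Sym2.eq_iff] at h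
        rcases h with ⟨rfl, rfl⟩ | ⟨rfl, rfl⟩
        · exact le_refl _
        · rw [Finset.pair_comm]
      · rw [dd_x_ne h]
        refine Submodule.neg_mem _ ?_
        by_cases h1 : a = p ∨ a = q
        · rw [dd_zero (p := a) (V := V \ {p, q}) (by simp [h1]) b hz]; simp
        by_cases h2 : b = p ∨ b = q
        · rw [dd_zero' (p := b) (V := V \ {p, q}) (by simp [h2]) a hz]; simp
        push Not at h1 h2
        refine x_mul_mem_C (by simp [hp, h1.1.symm, h2.1.symm]) (by simp [hq, h1.2.symm, h2.2.symm]) hpq ?_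
        have := ih hz
        rwa [sdiff_right_comm] at this
    exact this hz

theorem bd_mem {c : ℕ} {V : Finset ℕ} {z : LE} (hz : z ∈ C (c + 1) V) : bd z ∈ C c V := by
  induction c generalizing V z with
  | zero =>
    have : C (0 + 1) V ≤ (C 0 V).comap bd := by
      refine C_succ_le fun p q z hp hq hpq hz => ?_
      rw [Submodule.mem_comap, bd_x_mul, bd_C0 hz]; simpa using C_mono Finset.sdiff_subset hz
    exact this hz
  | succ c ih =>
    have : C (c + 1 + 1) V ≤ (C (c + 1) V).comap bd := by
      refine C_succ_le fun p q z hp hq hpq hz => ?_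
      rw [Submodule.mem_comap, bd_x_mul]
      exact Submodule.sub_mem _ (C_mono Finset.sdiff_subset hz) (x_mul_mem_C hp hq hpq (ih hz))
    exact this hz

theorem C_mul {c d : ℕ} {V W : Finset ℕ} (h : Disjoint V W) {u w : LE} (hu : u ∈ C c V)
    (hw : w ∈ C d W) : u * w ∈ C (c + d) (V ∪ W) := by
  induction c generalizing V u with
  | zero =>
    have : C 0 V ≤ (C (0 + d) (V ∪ W)).comap (LinearMap.mulRight ℤ w) :=
      C_zero_le (by
        simp only [Submodule.mem_comap, LinearMap.mulRight_apply, one_mul, zero_add]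
        exact C_mono Finset.subset_union_right hw)
    exact this hu
  | succ c ih =>
    have : C (c + 1) V ≤ (C (c + 1 + d) (V ∪ W)).comap (LinearMap.mulRight ℤ w) := by
      refine C_succ_le fun p q z hp hq hpq hz => ?_
      simp only [Submodule.mem_comap, LinearMap.mulRight_apply, mul_assoc]
      have e : c + 1 + d = c + d + 1 := by omega
      rw [e]
      refine x_mul_mem_C' (Finset.mem_union_left _ hp) (Finset.mem_union_left _ hq) hpq
        (ih (Finset.disjoint_of_subset_left Finset.sdiff_subset h) hz) ?_ ?_ ?_
      · exact Finset.union_subset_union_left Finset.sdiff_subset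
      · simp [Finset.disjoint_left.1 h hp]
      · simp [Finset.disjoint_left.1 h hq]
    exact this hu

/-- The part of a chain avoiding a vertex. -/
noncomputable def Nv (v : ℕ) (V : Finset ℕ) : LE →ₗ[ℤ] LE :=
  LinearMap.id - ∑ w ∈ V.erase v, (LinearMap.mulLeft ℤ (x v w)).comp (dd v w)

theorem Nv_apply (v : ℕ) (V : Finset ℕ) (z : LE) :
    Nv v V z = z - ∑ w ∈ V.erase v, x v w * dd v w z := by
  simp [Nv]

theorem Nv_mem {c : ℕ} {V : Finset ℕ} (v : ℕ) {z : LE} (hz : z ∈ C c V) :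
    Nv v V z ∈ C c (V.erase v) := by
  induction c generalizing V z with
  | zero =>
    have : C 0 V ≤ (C 0 (V.erase v)).comap (Nv v V) :=
      C_zero_le (by simp [Nv_apply, dd_one, one_mem_C])
    exact this hz
  | succ c ih =>
    have : C (c + 1) V ≤ (C (c + 1) (V.erase v)).comap (Nv v V) := by
      refine C_succ_le fun p q z hp hq hpq hz => ?_
      have key : ∀ p q z, p ∈ V → q ∈ V → p ≠ q → z ∈ C c (V \ {p, q}) → p = v →
          x p q * z ∈ (C (c + 1) (V.erase v)).comap (Nv v V) := by
        rintro p q z hp hq hpq hz rfl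
        rw [Submodule.mem_comap, Nv_apply]
        rw [Finset.sum_eq_single q]
        · rw [dd_x_same, dd_zero (V := V \ {p, q}) (by simp) _ hz]; simp
        · intro b hb hbq
          rw [dd_x_ne, dd_zero (V := V \ {p, q}) (by simp) _ hz]; simp
          simp [Ne.symm hbq]; intro h1 h2; exact absurd h2.symm hpq
        · intro h; exact absurd (Finset.mem_erase.2 ⟨hpq.symm, hq⟩) h
      by_cases h1 : p = v
      · exact key p q z hp hq hpq hz h1
      by_cases h2 : q = v
      · rw [x_symm]; exact key q p z hq hp hpq.symm (by rwa [Finset.pair_comm]) h2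
      rw [Submodule.mem_comap]
      have h3 : Nv v V (x p q * z) = x p q * Nv v (V \ {p, q}) z := by
        rw [Nv_apply, Nv_apply, mul_sub, Finset.mul_sum]
        congr 1
        have hs : ((V \ {p, q}).erase v) ⊆ V.erase v := Finset.erase_subset_erase _ Finset.sdiff_subset
        rw [← Finset.sum_subset hs]
        · refine Finset.sum_congr rfl fun w hw => ?_
          rw [dd_x_ne, x_anti p q]; simp
          intro h; rw [Sym2.eq_iff] at h
          rcases h with ⟨rfl, _⟩ | ⟨_, rfl⟩ <;> contradiction
        · intro w hw hw'
          have : w ∉ V \ {p, q} := by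
            intro h; exact hw' (Finset.mem_erase.2 ⟨(Finset.mem_erase.1 hw).1, h⟩)
          rw [dd_x_ne, dd_zero' this v hz]; simp
          intro h; rw [Sym2.eq_iff] at h
          rcases h with ⟨rfl, _⟩ | ⟨_, rfl⟩ <;> contradiction
      rw [h3]
      refine x_mul_mem_C' (Finset.mem_erase.2 ⟨h1, hp⟩) (Finset.mem_erase.2 ⟨h2, hq⟩) hpq (ih hz)
        (Finset.erase_subset_erase _ Finset.sdiff_subset) ?_ ?_ <;> simp
    exact this hz

theorem decomp (v : ℕ) (V : Finset ℕ) (z : LE) :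
    z = Nv v V z + ∑ w ∈ V.erase v, x v w * dd v w z := by
  rw [Nv_apply]; abel

/-- Cycles. -/
noncomputable def Z (c : ℕ) (V : Finset ℕ) : Submodule ℤ LE := C c V ⊓ LinearMap.ker bd

/-- Boundaries. -/
noncomputable def B (c : ℕ) (V : Finset ℕ) : Submodule ℤ LE := (C (c + 1) V).map bd

theorem mem_Z {c : ℕ} {V : Finset ℕ} {z : LE} : z ∈ Z c V ↔ z ∈ C c V ∧ bd z = 0 := by
  simp [Z]

theorem mem_B {c : ℕ} {V : Finset ℕ} {z : LE} : z ∈ B c V ↔ ∃ w ∈ C (c + 1) V, bd w = z := by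
  simp [B]

theorem bd_mem_B {c : ℕ} {V : Finset ℕ} {w : LE} (h : w ∈ C (c + 1) V) : bd w ∈ B c V :=
  mem_B.2 ⟨w, h, rfl⟩

theorem B_le_Z {c : ℕ} {V : Finset ℕ} : B c V ≤ Z c V := by
  intro z hz
  obtain ⟨w, hw, rfl⟩ := mem_B.1 hz
  exact mem_Z.2 ⟨bd_mem hw, bd_bd w⟩

theorem B_mono {c : ℕ} {V W : Finset ℕ} (h : V ⊆ W) : B c V ≤ B c W := Submodule.map_mono (C_mono h)

theorem Z_mono {c : ℕ} {V W : Finset ℕ} (h : V ⊆ W) : Z c V ≤ Z c W :=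
  inf_le_inf_right _ (C_mono h)

theorem dd_Z {c : ℕ} {V : Finset ℕ} (a b : ℕ) {z : LE} (hz : z ∈ Z (c + 1) V) :
    dd a b z ∈ Z c (V \ {a, b}) := by
  rw [mem_Z] at *
  exact ⟨dd_mem a b hz.1, by rw [bd_dd, hz.2, map_zero, neg_zero]⟩

theorem dd_B {c : ℕ} {V : Finset ℕ} (a b : ℕ) {z : LE} (hz : z ∈ B (c + 1) V) :
    dd a b z ∈ B c (V \ {a, b}) := by
  obtain ⟨w, hw, rfl⟩ := mem_B.1 hz
  rw [dd_bd]
  exact Submodule.neg_mem _ (bd_mem_B (dd_mem a b hw))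

theorem Z_mul {c d : ℕ} {V W : Finset ℕ} (h : Disjoint V W) {u w : LE} (hu : u ∈ Z c V)
    (hw : w ∈ Z d W) : u * w ∈ Z (c + d) (V ∪ W) := by
  rw [mem_Z] at *
  exact ⟨C_mul h hu.1 hw.1, by rw [bd_mul hu.1, hu.2, hw.2]; simp⟩

theorem Z_mul_B {c d : ℕ} {V W : Finset ℕ} (h : Disjoint V W) {u w : LE} (hu : u ∈ Z c V)
    (hw : w ∈ B d W) : u * w ∈ B (c + d) (V ∪ W) := by
  rw [mem_Z] at hu
  obtain ⟨y, hy, rfl⟩ := mem_B.1 hw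
  have : bd (u * y) = (-1 : ℤ) ^ c • (u * bd y) := by rw [bd_mul hu.1, hu.2]; simp
  have h2 : u * bd y = bd ((-1 : ℤ) ^ c • (u * y)) := by
    rw [map_smul, this, smul_smul, ← mul_pow]; simp
  rw [h2]
  exact bd_mem_B (Submodule.smul_mem _ _ (by rw [add_assoc]; exact C_mul h hu.1 hy))

theorem B_mul_Z {c d : ℕ} {V W : Finset ℕ} (h : Disjoint V W) {u w : LE} (hu : u ∈ B c V)
    (hw : w ∈ Z d W) : u * w ∈ B (c + d) (V ∪ W) := by
  rw [mem_Z] at hw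
  obtain ⟨y, hy, rfl⟩ := mem_B.1 hu
  have : bd y * w = bd (y * w) := by rw [bd_mul hy, hw.2]; simp
  rw [this]
  have e : c + d + 1 = c + 1 + d := by omega
  exact bd_mem_B (by rw [e]; exact C_mul h hy hw.1)

end MC

set_option synthInstance.maxHeartbeats 20000
set_option maxHeartbeats 400000
set_option linter.all false

namespace MC

/-! ## Vanishing and generators -/

theorem x_mem {a b : ℕ} {V : Finset ℕ} (ha : a ∈ V) (hb : b ∈ V) (h : a ≠ b) : x a b ∈ C 1 V := by
  have := x_mul_mem_C (c := 0) (V := V) (z := 1) ha hb h (one_mem_C _)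
  simpa using this

theorem x_mem_pair {a b : ℕ} (h : a ≠ b) : x a b ∈ C 1 {a, b} := x_mem (by simp) (by simp) h

/-- The basic 1-cycle on three letters. -/
noncomputable def br (a b c : ℕ) : LE := x a b - x b c

theorem br_mem {a b c : ℕ} {V : Finset ℕ} (ha : a ∈ V) (hb : b ∈ V) (hc : c ∈ V) (h1 : a ≠ b)
    (h3 : b ≠ c) : br a b c ∈ Z 1 V := by
  rw [mem_Z]
  refine ⟨Submodule.sub_mem _ (x_mem ha hb h1) (x_mem hb hc h3), ?_⟩
  simp [br, bd_x]

theorem bd_br_mul (a b c : ℕ) (z : LE) : bd (br a b c * z) = - (br a b c * bd z) := by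
  rw [br, sub_mul, map_sub, bd_x_mul, bd_x_mul, sub_mul]; abel

theorem B_congr {c c' : ℕ} {V V' : Finset ℕ} {z : LE} (hz : z ∈ B c V) (h : c = c') (h' : V ⊆ V') :
    z ∈ B c' V' := by subst h; exact B_mono h' hz

theorem Z_congr {c c' : ℕ} {V V' : Finset ℕ} {z : LE} (hz : z ∈ Z c V) (h : c = c') (h' : V ⊆ V') :
    z ∈ Z c' V' := by subst h; exact Z_mono h' hz

theorem C_congr {c c' : ℕ} {V V' : Finset ℕ} {z : LE} (hz : z ∈ C c V) (h : c = c') (h' : V ⊆ V') :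
    z ∈ C c' V' := by subst h; exact C_mono h' hz

theorem br_mul_B {a b d c : ℕ} {V W : Finset ℕ} {z : LE} (ha : a ∈ V) (hb : b ∈ V) (hd : d ∈ V)
    (h1 : a ≠ b) (h3 : b ≠ d) (hz : z ∈ B c W) (hW : W ⊆ V \ {a, b, d}) :
    br a b d * z ∈ B (c + 1) V := by
  have h := Z_mul_B (V := {a, b, d}) (W := W) (by
    rw [Finset.disjoint_left]; intro t ht ht'
    exact (Finset.mem_sdiff.1 (hW ht')).2 ht) (br_mem (by simp) (by simp) (by simp) h1 h3) hz
  refine B_congr h (by omega) ?_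
  refine Finset.union_subset ?_ (hW.trans Finset.sdiff_subset)
  intro t ht; simp at ht; rcases ht with rfl | rfl | rfl <;> assumption

theorem br_mul_C {a b d c : ℕ} {V W : Finset ℕ} {z : LE} (ha : a ∈ V) (hb : b ∈ V) (hd : d ∈ V)
    (h1 : a ≠ b) (h3 : b ≠ d) (hz : z ∈ C c W) (hW : W ⊆ V \ {a, b, d}) :
    br a b d * z ∈ C (c + 1) V := by
  have h := C_mul (V := {a, b, d}) (W := W) (by
    rw [Finset.disjoint_left]; intro t ht ht'
    exact (Finset.mem_sdiff.1 (hW ht')).2 ht)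
    (mem_Z.1 (br_mem (a := a) (b := b) (c := d) (by simp) (by simp) (by simp) h1 h3)).1 hz
  refine C_congr h (by omega) ?_
  refine Finset.union_subset ?_ (hW.trans Finset.sdiff_subset)
  intro t ht; simp at ht; rcases ht with rfl | rfl | rfl <;> assumption

theorem br_mul_Z {a b d c : ℕ} {V W : Finset ℕ} {z : LE} (ha : a ∈ V) (hb : b ∈ V) (hd : d ∈ V)
    (h1 : a ≠ b) (h3 : b ≠ d) (hz : z ∈ Z c W) (hW : W ⊆ V \ {a, b, d}) :
    br a b d * z ∈ Z (c + 1) V := by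
  rw [mem_Z] at *
  exact ⟨br_mul_C ha hb hd h1 h3 hz.1 hW, by rw [bd_br_mul, hz.2]; simp⟩

theorem stepA {c : ℕ} {V : Finset ℕ} {p q : ℕ} (hp : p ∈ V) (hq : q ∈ V) (hpq : p ≠ q)
    {S : Submodule ℤ LE} (hB : B (c + 1) V ≤ S)
    (h1 : ∀ s ∈ V \ {p, q}, ∀ u ∈ Z c (V \ {p, q, s}), br s p q * u ∈ S ∧ br s q p * u ∈ S)
    {a : LE} (ha : a ∈ Z (c + 1) V) (hz : ∀ s t, dd q t (dd p s a) = 0) : a ∈ S := by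
  rw [mem_Z] at ha
  -- the p-components
  have hps : ∀ s, dd p s a ∈ Z c (V \ {p, q, s}) := by
    intro s
    have h := dd_Z p s (mem_Z.2 ha)
    rw [mem_Z] at h ⊢
    refine ⟨?_, h.2⟩
    have h2 := Nv_mem q h.1
    have h3 : Nv q (V \ {p, s}) (dd p s a) = dd p s a := by
      rw [Nv_apply]; simp [hz]
    rw [h3] at h2
    refine C_mono ?_ h2
    intro t; simp; tauto
  have hqs : ∀ t, dd q t a ∈ Z c (V \ {p, q, t}) := by
    intro s
    have h := dd_Z q s (mem_Z.2 ha)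
    rw [mem_Z] at h ⊢
    refine ⟨?_, h.2⟩
    have h2 := Nv_mem p h.1
    have h3 : Nv p (V \ {q, s}) (dd q s a) = dd q s a := by
      rw [Nv_apply]
      have : ∀ w, dd p w (dd q s a) = 0 := by intro w; rw [dd_dd, hz]; simp
      simp [this]
    rw [h3] at h2
    refine C_mono ?_ h2
    intro t; simp; tauto
  set m := Nv p V a with hm
  have hmC : m ∈ C (c + 1) (V.erase p) := Nv_mem p ha.1
  set a0 := Nv q (V.erase p) m with ha0
  have ha0C : a0 ∈ C (c + 1) ((V.erase p).erase q) := Nv_mem q hmC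
  have hU : (V.erase p).erase q = V \ {p, q} := by ext t; simp; tauto
  rw [hU] at ha0C
  have e1 : a = m + (x p q * dd p q a + ∑ s ∈ V \ {p, q}, x p s * dd p s a) := by
    conv_lhs => rw [decomp p V a]
    rw [← hm]
    congr 1
    rw [← Finset.add_sum_erase (V.erase p) _ (Finset.mem_erase.2 ⟨hpq.symm, hq⟩), hU]
  have e2 : m = a0 + ∑ s ∈ V \ {p, q}, x q s * dd q s a := by
    conv_lhs => rw [decomp q (V.erase p) m]
    rw [← ha0, hU]
    congr 1
    refine Finset.sum_congr rfl fun t ht => ?_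
    congr 1
    have hm2 : m = a - x p q * dd p q a - ∑ s ∈ V \ {p, q}, x p s * dd p s a := by
      conv_rhs => rw [e1]
      have : dd p q (m + (x p q * dd p q a + ∑ s ∈ V \ {p, q}, x p s * dd p s a)) = dd p q a := by
        rw [← e1]
      rw [this]
      have : ∀ s, dd p s (m + (x p q * dd p q a + ∑ s ∈ V \ {p, q}, x p s * dd p s a)) = dd p s a := by
        intro s; rw [← e1]
      simp only [this]
      abel
    simp only [Finset.mem_sdiff, Finset.mem_insert, Finset.mem_singleton, not_or] at ht
    rw [hm2, map_sub, map_sub, map_sum, dd_x_ne, hz, Finset.sum_eq_zero]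
    · simp
    · intro s hs
      simp only [Finset.mem_sdiff, Finset.mem_insert, Finset.mem_singleton, not_or] at hs
      rw [dd_x_ne, hz]; simp
      rw [Ne, Sym2.eq_iff]; rintro (⟨h, _⟩ | ⟨h, _⟩)
      · exact hpq h
      · exact ht.2.1 h.symm
    · rw [Ne, Sym2.eq_iff]; rintro (⟨h, _⟩ | ⟨h, _⟩)
      · exact hpq h
      · exact ht.2.1 h.symm
  set b := dd p q a + ∑ s ∈ V \ {p, q}, dd p s a + ∑ s ∈ V \ {p, q}, dd q s a with hb
  have hbC : b ∈ C c (V \ {p, q}) := by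
    refine Submodule.add_mem _ (Submodule.add_mem _ (dd_mem p q ha.1) ?_) ?_
    · refine Submodule.sum_mem _ fun s _ => C_mono ?_ (mem_Z.1 (hps s)).1
      intro t; simp; tauto
    · refine Submodule.sum_mem _ fun s _ => C_mono ?_ (mem_Z.1 (hqs s)).1
      intro t; simp; tauto
  set T := ∑ s ∈ V \ {p, q}, br s p q * dd p s a + ∑ s ∈ V \ {p, q}, br s q p * dd q s a with hT
  have e3 : a = T + (x p q * b + a0) := by
    conv_lhs => rw [e1, e2]
    rw [hT, hb]
    have f1 : ∀ s, br s p q = x p s - x p q := by intro s; rw [br, x_symm s p]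
    have f2 : ∀ s, br s q p = x q s - x p q := by intro s; rw [br, x_symm s q, x_symm q p]
    simp only [f1, f2, sub_mul, Finset.sum_sub_distrib, mul_add, Finset.mul_sum]
    abel
  have hT0 : bd T = 0 := by
    rw [hT, map_add, map_sum, map_sum]
    simp only [bd_br_mul, (mem_Z.1 (hps _)).2, (mem_Z.1 (hqs _)).2]
    simp
  have e4 : b - x p q * bd b + bd a0 = 0 := by
    have := ha.2
    rw [e3, map_add, hT0, map_add, bd_x_mul, zero_add] at this
    exact this
  have hbb : bd b = 0 := by
    have h := congrArg (dd p q) e4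
    rw [map_add, map_sub, dd_x_same, dd_bd, dd_bd, dd_zero (V := V \ {p, q}) (by simp) _ hbC,
      dd_zero (V := V \ {p, q}) (by simp) _ ha0C] at h
    simpa using h
  have e5 : x p q * b + a0 = bd (x p q * a0) := by
    rw [bd_x_mul]
    rw [hbb, mul_zero, sub_zero] at e4
    rw [eq_neg_of_add_eq_zero_left e4]; noncomm_ring
  rw [e3, e5]
  refine Submodule.add_mem _ (Submodule.add_mem _ ?_ ?_) (hB (bd_mem_B (x_mul_mem_C hp hq hpq ha0C)))
  · exact Submodule.sum_mem _ fun s hs => (h1 s hs _ (hps s)).1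
  · exact Submodule.sum_mem _ fun s hs => (h1 s hs _ (hqs s)).2

/-- Elements `u` that are realised as a mixed derivative of an element of `S`. -/
def liftable (S : Submodule ℤ LE) (c : ℕ) (V : Finset ℕ) (p q s t : ℕ) : Submodule ℤ LE where
  carrier := {u | ∃ w ∈ S, w ∈ Z (c + 2) V ∧
    ∀ s' t', dd q t' (dd p s' w) = if s' = s ∧ t' = t then u else 0}
  add_mem' := by
    rintro u u' ⟨w, hw, hz, h⟩ ⟨w', hw', hz', h'⟩
    refine ⟨w + w', S.add_mem hw hw', Submodule.add_mem _ hz hz', fun s' t' => ?_⟩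
    rw [map_add, map_add, h, h']; split_ifs <;> simp
  zero_mem' := ⟨0, S.zero_mem, Submodule.zero_mem _, by intros; simp⟩
  smul_mem' := by
    rintro r u ⟨w, hw, hz, h⟩
    refine ⟨r • w, S.smul_mem r hw, Submodule.smul_mem _ r hz, fun s' t' => ?_⟩
    rw [map_smul, map_smul, h]; split_ifs <;> simp

theorem stepB {c : ℕ} {V : Finset ℕ} {p q : ℕ} (hpq : p ≠ q)
    {S : Submodule ℤ LE}
    (h1 : ∀ s ∈ V \ {p, q}, ∀ t ∈ V \ {p, q}, s ≠ t → Z c (V \ {p, q, s, t}) ≤ liftable S c V p q s t)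
    {a : LE} (ha : a ∈ Z (c + 2) V) :
    ∃ w ∈ S, w ∈ Z (c + 2) V ∧ ∀ s t, dd q t (dd p s (a - w)) = 0 := by
  have hz : ∀ s t, dd q t (dd p s a) ∈ Z c (V \ {p, q, s, t}) := by
    intro s t
    refine Z_mono ?_ (dd_Z q t (dd_Z p s ha))
    intro r; simp; tauto
  have h0 : ∀ s t, ¬ (s ∈ V \ {p, q} ∧ t ∈ V \ {p, q} ∧ s ≠ t) → dd q t (dd p s a) = 0 := by
    intro s t h
    rw [mem_Z] at ha
    by_cases hs : s ∈ V \ {p, q}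
    · by_cases ht : t ∈ V \ {p, q}
      · have : s = t := by tauto
        subst this
        exact dd_zero' (V := V \ {p, s}) (by simp) _ (dd_mem p s ha.1)
      · by_cases ht2 : t = q
        · subst ht2; exact dd_self _ (dd_mem p s ha.1)
        · refine dd_zero' (V := V \ {p, s}) ?_ _ (dd_mem p s ha.1)
          simp only [Finset.mem_sdiff, Finset.mem_insert, Finset.mem_singleton] at *
          tauto
    · by_cases hs1 : s = p
      · subst hs1; rw [dd_self _ ha.1, map_zero]
      by_cases hs2 : s = q
      · subst hs2; exact dd_zero (V := V \ {p, s}) (by simp) _ (dd_mem p s ha.1)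
      · rw [dd_zero' (V := V) _ _ ha.1, map_zero]
        simp only [Finset.mem_sdiff, Finset.mem_insert, Finset.mem_singleton] at *
        tauto
  have h2 : ∀ s t, ∃ w ∈ S, w ∈ Z (c + 2) V ∧
      ∀ s' t', dd q t' (dd p s' w) = if s' = s ∧ t' = t then dd q t (dd p s a) else 0 := by
    intro s t
    by_cases h : s ∈ V \ {p, q} ∧ t ∈ V \ {p, q} ∧ s ≠ t
    · exact h1 s h.1 t h.2.1 h.2.2 (hz s t)
    · exact ⟨0, S.zero_mem, Submodule.zero_mem _, by intros; simp [h0 s t h]⟩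
  choose w hw1 hw2 hw3 using h2
  refine ⟨∑ s ∈ V, ∑ t ∈ V, w s t, Submodule.sum_mem _ fun s _ => Submodule.sum_mem _ fun t _ => hw1 s t,
    Submodule.sum_mem _ fun s _ => Submodule.sum_mem _ fun t _ => hw2 s t, fun s t => ?_⟩
  simp only [map_sub, map_sum, hw3]
  have hV : dd q t (dd p s a) ≠ 0 → s ∈ V ∧ t ∈ V := by
    intro h
    by_contra h'
    refine h (h0 s t ?_)
    simp only [Finset.mem_sdiff]; tauto
  by_cases h : dd q t (dd p s a) = 0
  · rw [h, zero_sub, neg_eq_zero]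
    refine Finset.sum_eq_zero fun s' _ => Finset.sum_eq_zero fun t' _ => ?_
    split_ifs with hh
    · rw [← hh.1, ← hh.2, h]
    · rfl
  · obtain ⟨hs, ht⟩ := hV h
    rw [Finset.sum_eq_single s, Finset.sum_eq_single t]
    · simp
    · intro t' _ h'; exact if_neg (fun hh => h' hh.2.symm)
    · intro h'; exact absurd ht h'
    · intro s' _ h'; refine Finset.sum_eq_zero fun t' _ => ?_
      exact if_neg (fun hh => h' hh.1.symm)
    · intro h'; exact absurd hs h'

theorem card_sdiff_le (V : Finset ℕ) (W : Finset ℕ) (k n : ℕ) (hk : W.card ≤ k) (h : n + k ≤ V.card) :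
    n ≤ (V \ W).card := by
  have := Finset.le_card_sdiff W V
  omega

theorem stepAB {c : ℕ} {V : Finset ℕ} {p q : ℕ} (hp : p ∈ V) (hq : q ∈ V) (hpq : p ≠ q)
    {S : Submodule ℤ LE} (hB : B (c + 2) V ≤ S)
    (h2 : ∀ s ∈ V \ {p, q}, ∀ t ∈ V \ {p, q}, s ≠ t → Z c (V \ {p, q, s, t}) ≤ liftable S c V p q s t)
    (h1 : ∀ s ∈ V \ {p, q}, ∀ u ∈ Z (c + 1) (V \ {p, q, s}), br s p q * u ∈ S ∧ br s q p * u ∈ S) :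
    Z (c + 2) V ≤ S := by
  intro a ha
  obtain ⟨w, hw, hwZ, h⟩ := stepB hpq h2 ha
  have := stepA hp hq hpq hB h1 (Submodule.sub_mem _ ha hwZ) h
  simpa using S.add_mem this hw

theorem B_liftable {c : ℕ} {V : Finset ℕ} {p q s t : ℕ} (hp : p ∈ V) (hq : q ∈ V) (hpq : p ≠ q)
    (hs : s ∈ V \ {p, q}) (ht : t ∈ V \ {p, q}) (hst : s ≠ t)
    {S : Submodule ℤ LE} (hB : B (c + 2) V ≤ S) : B c (V \ {p, q, s, t}) ≤ liftable S c V p q s t := by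
  intro u hu
  obtain ⟨b, hb, rfl⟩ := mem_B.1 hu
  simp only [Finset.mem_sdiff, Finset.mem_insert, Finset.mem_singleton, not_or] at hs ht
  have hm : x p s * (x q t * b) ∈ C (c + 3) V := by
    refine x_mul_mem_C hp hs.1 (Ne.symm hs.2.1) (x_mul_mem_C ?_ ?_ (Ne.symm ht.2.2) (C_mono ?_ hb))
    · simp [hq, hpq.symm, Ne.symm hs.2.2]
    · simp [ht, hst.symm]
    · intro r; simp; tauto
  refine ⟨bd (x p s * (x q t * b)), hB (bd_mem_B hm), B_le_Z (bd_mem_B hm), fun s' t' => ?_⟩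
  rw [dd_bd, map_neg, dd_bd, neg_neg]
  have hb0 : ∀ r, dd p r b = 0 := fun r => dd_zero (V := V \ {p, q, s, t}) (by simp) _ hb
  have hb1 : ∀ r, dd q r b = 0 := fun r => dd_zero (V := V \ {p, q, s, t}) (by simp) _ hb
  by_cases h1 : s' = s
  · subst h1
    rw [dd_x_same, dd_x_ne, hb0]
    · by_cases h2 : t' = t
      · subst h2; simp [dd_x_same, hb1]
      · rw [mul_zero, neg_zero, mul_zero, sub_zero, dd_x_ne, hb1]
        · simp [h2]
        · rw [Ne, Sym2.eq_iff]; rintro (⟨_, h⟩ | ⟨h, h'⟩)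
          · exact h2 h.symm
          · exact ht.2.2 h'
    · rw [Ne, Sym2.eq_iff]; rintro (⟨h, _⟩ | ⟨h, h'⟩)
      · exact hpq h.symm
      · exact ht.2.1 h'
  · rw [dd_x_ne, dd_x_ne, hb0]
    · simp [h1]
    · rw [Ne, Sym2.eq_iff]; rintro (⟨h, _⟩ | ⟨h, h'⟩)
      · exact hpq h.symm
      · exact ht.2.1 h'
    · rw [Ne, Sym2.eq_iff]; rintro (⟨_, h⟩ | ⟨h, h'⟩)
      · exact h1 h.symm
      · exact hs.2.1 h'

theorem exists_two {V : Finset ℕ} (h : 2 ≤ V.card) : ∃ p ∈ V, ∃ q ∈ V, p ≠ q :=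
  Finset.one_lt_card.1 h

theorem vanishing (c : ℕ) : ∀ V : Finset ℕ, 3 * c + 2 ≤ V.card → Z c V ≤ B c V := by
  induction c using Nat.strong_induction_on with
  | _ c ih =>
    intro V hV
    obtain ⟨p, hp, q, hq, hpq⟩ := exists_two (V := V) (by omega)
    match c, ih, hV with
    | 0, ih, hV =>
      refine inf_le_left.trans (C_zero_le ?_)
      rw [← bd_x p q]
      exact bd_mem_B (x_mem hp hq hpq)
    | 1, ih, hV =>
      intro a ha
      refine stepA hp hq hpq (le_refl _) ?_ ha ?_
      · intro s hs u hu
        have hu' := ih 0 (by omega) _ (card_sdiff_le V _ 3 _ Finset.card_le_three (by omega)) hu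
        simp only [Finset.mem_sdiff, Finset.mem_insert, Finset.mem_singleton, not_or] at hs
        exact ⟨br_mul_B hs.1 hp hq hs.2.1 hpq hu' (by intro r; simp; tauto),
          br_mul_B hs.1 hq hp hs.2.2 hpq.symm hu' (by intro r; simp; tauto)⟩
      · intro s t
        exact dd_C0 _ _ (dd_mem p s (mem_Z.1 ha).1)
    | c + 2, ih, hV =>
      refine stepAB hp hq hpq (le_refl _) ?_ ?_
      · intro s hs t ht hst u hu
        exact B_liftable hp hq hpq hs ht hst (le_refl _) (ih c (by omega) _
          (card_sdiff_le V _ 4 _ Finset.card_le_four (by omega)) hu)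
      · intro s hs u hu
        have hu' := ih (c + 1) (by omega) _ (card_sdiff_le V _ 3 _ Finset.card_le_three (by omega)) hu
        simp only [Finset.mem_sdiff, Finset.mem_insert, Finset.mem_singleton, not_or] at hs
        exact ⟨br_mul_B hs.1 hp hq hs.2.1 hpq hu' (by intro r; simp; tauto),
          br_mul_B hs.1 hq hp hs.2.2 hpq.symm hu' (by intro r; simp; tauto)⟩

/-- Span of products of `c` brackets on disjoint triples of `V`. -/
noncomputable def Br : ℕ → Finset ℕ → Submodule ℤ LE
  | 0, _ => Submodule.span ℤ {1}
  | (c + 1), V => Submodule.span ℤ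
      {w | ∃ a b d z, a ∈ V ∧ b ∈ V ∧ d ∈ V ∧ a ≠ b ∧ a ≠ d ∧ b ≠ d ∧ z ∈ Br c (V \ {a, b, d}) ∧
        w = br a b d * z}

theorem one_mem_Br (V : Finset ℕ) : (1 : LE) ∈ Br 0 V := by
  rw [Br]; exact Submodule.mem_span_singleton_self _

theorem br_mul_mem_Br {c : ℕ} {V : Finset ℕ} {a b d : ℕ} {z : LE} (ha : a ∈ V) (hb : b ∈ V)
    (hd : d ∈ V) (hab : a ≠ b) (had : a ≠ d) (hbd : b ≠ d) (hz : z ∈ Br c (V \ {a, b, d})) :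
    br a b d * z ∈ Br (c + 1) V := by
  rw [Br]; exact Submodule.subset_span ⟨a, b, d, z, ha, hb, hd, hab, had, hbd, hz, rfl⟩

theorem Br_succ_le {c : ℕ} {V : Finset ℕ} {S : Submodule ℤ LE}
    (h : ∀ a b d z, a ∈ V → b ∈ V → d ∈ V → a ≠ b → a ≠ d → b ≠ d → z ∈ Br c (V \ {a, b, d}) →
      br a b d * z ∈ S) : Br (c + 1) V ≤ S := by
  rw [Br, Submodule.span_le]
  rintro _ ⟨a, b, d, z, ha, hb, hd, h1, h2, h3, hz, rfl⟩
  exact h a b d z ha hb hd h1 h2 h3 hz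

theorem Br_zero_le {V : Finset ℕ} {S : Submodule ℤ LE} (h : (1 : LE) ∈ S) : Br 0 V ≤ S := by
  rw [Br, Submodule.span_le]; simpa using h

theorem Br_mono {c : ℕ} {V W : Finset ℕ} (h : V ⊆ W) : Br c V ≤ Br c W := by
  induction c generalizing V W with
  | zero => exact Br_zero_le (one_mem_Br _)
  | succ c ih =>
    refine Br_succ_le fun a b d z ha hb hd h1 h2 h3 hz => br_mul_mem_Br (h ha) (h hb) (h hd) h1 h2 h3 (ih ?_ hz)
    exact Finset.sdiff_subset_sdiff h (le_refl _)

theorem Br_le_Z {c : ℕ} {V : Finset ℕ} : Br c V ≤ Z c V := by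
  induction c generalizing V with
  | zero => exact Br_zero_le (mem_Z.2 ⟨one_mem_C _, bd_one⟩)
  | succ c ih =>
    exact Br_succ_le fun a b d z ha hb hd h1 h2 h3 hz => br_mul_Z ha hb hd h1 h3 (ih hz) (le_refl _)

theorem Br_spare {c : ℕ} {V : Finset ℕ} (hV : 3 * c + 1 ≤ V.card) {S : Submodule ℤ LE}
    (h : ∀ r ∈ V, Br c (V.erase r) ≤ S) : Br c V ≤ S := by
  induction c generalizing V S with
  | zero =>
    obtain ⟨r, hr⟩ := Finset.card_pos.1 (show 0 < V.card by omega)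
    exact Br_zero_le (h r hr (one_mem_Br _))
  | succ c ih =>
    refine Br_succ_le fun a b d z ha hb hd h1 h2 h3 hz => ?_
    have hc := card_sdiff_le V {a, b, d} 3 (3 * c + 1) Finset.card_le_three (by omega)
    have := ih hc (S := S.comap (LinearMap.mulLeft ℤ (br a b d))) (fun r hr z hz => by
      simp only [Finset.mem_sdiff, Finset.mem_insert, Finset.mem_singleton, not_or] at hr
      refine h r hr.1 (br_mul_mem_Br (c := c) ?_ ?_ ?_ h1 h2 h3 (Br_mono ?_ hz))
      · simp [ha, Ne.symm hr.2.1]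
      · simp [hb, Ne.symm hr.2.2.1]
      · simp [hd, Ne.symm hr.2.2.2]
      · intro t; simp; tauto) hz
    exact this

theorem br_mul_sup {c : ℕ} {V : Finset ℕ} {a b d : ℕ} {z : LE} (ha : a ∈ V) (hb : b ∈ V)
    (hd : d ∈ V) (hab : a ≠ b) (had : a ≠ d) (hbd : b ≠ d)
    (hz : z ∈ Br c (V \ {a, b, d}) ⊔ B c (V \ {a, b, d})) :
    br a b d * z ∈ Br (c + 1) V ⊔ B (c + 1) V := by
  obtain ⟨u, hu, w, hw, rfl⟩ := Submodule.mem_sup.1 hz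
  rw [mul_add]
  exact Submodule.add_mem_sup (br_mul_mem_Br ha hb hd hab had hbd hu)
    (br_mul_B ha hb hd hab hbd hw (le_refl _))

theorem generation (c : ℕ) : ∀ V : Finset ℕ, 3 * c ≤ V.card → Z c V ≤ Br c V ⊔ B c V := by
  induction c with
  | zero =>
    intro V hV
    exact (inf_le_left.trans (C_zero_le (one_mem_Br V))).trans le_sup_left
  | succ c ih =>
    intro V hV
    obtain ⟨p, hp, q, hq, hpq⟩ := exists_two (V := V) (by omega)
    have h1 : ∀ s ∈ V \ {p, q}, ∀ u ∈ Z c (V \ {p, q, s}),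
        br s p q * u ∈ Br (c + 1) V ⊔ B (c + 1) V ∧ br s q p * u ∈ Br (c + 1) V ⊔ B (c + 1) V := by
      intro s hs u hu
      have hu' := ih _ (card_sdiff_le V _ 3 _ Finset.card_le_three (by omega)) hu
      simp only [Finset.mem_sdiff, Finset.mem_insert, Finset.mem_singleton, not_or] at hs
      have e1 : ({p, q, s} : Finset ℕ) = {s, p, q} := by ext; simp; tauto
      have e2 : ({p, q, s} : Finset ℕ) = {s, q, p} := by ext; simp; tauto
      refine ⟨br_mul_sup hs.1 hp hq hs.2.1 hs.2.2 hpq ?_, br_mul_sup hs.1 hq hp hs.2.2 hs.2.1 hpq.symm ?_⟩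
      · rwa [← e1]
      · rwa [← e2]
    match c, ih, hV, h1 with
    | 0, ih, hV, h1 =>
      intro a ha
      exact stepA hp hq hpq le_sup_right h1 ha fun s t => dd_C0 _ _ (dd_mem p s (mem_Z.1 ha).1)
    | c + 1, ih, hV, h1 =>
      refine stepAB hp hq hpq le_sup_right ?_ h1
      intro s hs t ht hst u hu
      exact B_liftable hp hq hpq hs ht hst le_sup_right (vanishing c _
          (card_sdiff_le V _ 4 _ Finset.card_le_four (by omega)) hu)

/-- The 2-cycle on five letters. -/
noncomputable def pent (p q s t r : ℕ) : LE :=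
  x p s * x q t + x q t * x s r + x s r * x p q + x p q * x t r + x t r * x p s

theorem xx_mem {a b c d : ℕ} {V : Finset ℕ} (ha : a ∈ V) (hb : b ∈ V) (hc : c ∈ V) (hd : d ∈ V)
    (h : [a, b, c, d].Nodup) : x a b * x c d ∈ C 2 V := by
  simp at h
  refine x_mul_mem_C (c := 1) ha hb h.1.1 (x_mem ?_ ?_ h.2.2)
  · simp [hc]; tauto
  · simp [hd]; tauto

theorem pent_mem {p q s t r : ℕ} {V : Finset ℕ} (hV : {p, q, s, t, r} ⊆ V)
    (h : [p, q, s, t, r].Nodup) : pent p q s t r ∈ Z 2 V := by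
  simp only [Finset.insert_subset_iff, Finset.singleton_subset_iff] at hV
  obtain ⟨hp, hq, hs, ht, hr⟩ := hV
  simp at h
  rw [mem_Z]
  constructor
  · unfold pent
    repeat' apply Submodule.add_mem
    all_goals apply xx_mem <;> first | assumption | (simp; tauto)
  · simp only [pent, map_add, bd_x_mul, bd_x, mul_one]; abel

theorem dd_x (a b c d : ℕ) : dd a b (x c d) = if s(c, d) = s(a, b) then 1 else 0 := by
  rw [dd, x, D_gen]; split_ifs <;> simp

theorem dd_xm (a b c d : ℕ) (z : LE) :
    dd a b (x c d * z) = (if s(c, d) = s(a, b) then z else 0) - x c d * dd a b z := by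
  rw [dd, x, D_gen_mul]; split_ifs <;> simp

theorem dd_pent {p q s t r : ℕ} (h : [p, q, s, t, r].Nodup) (s' t' : ℕ) :
    dd q t' (dd p s' (pent p q s t r)) = if s' = s ∧ t' = t then 1 else 0 := by
  simp at h
  obtain ⟨⟨h1, h2, h3, h4⟩, ⟨h5, h6, h7⟩, ⟨h8, h9⟩, h10⟩ := h
  simp only [pent, map_add, dd_xm, dd_x]
  by_cases hq : s' = q
  · subst hq
    simp [*, dd_x, eq_comm, Ne.symm h5, Ne.symm h6, Ne.symm h7]
  by_cases hs : s = s'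
  · subst hs
    by_cases ht : t = t'
    · subst ht
      simp [*, dd_x, eq_comm]
    · simp [*, dd_x, eq_comm]
  · simp [*, Ne.symm hs, Ne.symm hq, eq_comm]

theorem dd_pent_mul {p q s t r c : ℕ} {W : Finset ℕ} (h : [p, q, s, t, r].Nodup) (s' t' : ℕ) {z : LE}
    (hz : z ∈ C c W) (hp : p ∉ W) (hq : q ∉ W) :
    dd q t' (dd p s' (pent p q s t r * z)) = if s' = s ∧ t' = t then z else 0 := by
  have h2 := (mem_Z.1 (pent_mem (V := {p, q, s, t, r}) (le_refl _) h)).1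
  rw [dd_mul _ _ h2, dd_zero hp _ hz, mul_zero, smul_zero, add_zero,
    dd_mul _ _ (dd_mem p s' h2), dd_zero hq _ hz, mul_zero, smul_zero, add_zero, dd_pent h]
  split_ifs <;> simp

/-- Span of products of a pentagon and brackets. -/
noncomputable def Pn (c : ℕ) (V : Finset ℕ) : Submodule ℤ LE := Submodule.span ℤ
  {w | ∃ p q s t r z, {p, q, s, t, r} ⊆ V ∧ [p, q, s, t, r].Nodup ∧ z ∈ Br c (V \ {p, q, s, t, r}) ∧
    w = pent p q s t r * z}

theorem pent_mul_Z {p q s t r c : ℕ} {V W : Finset ℕ} {z : LE} (h1 : {p, q, s, t, r} ⊆ V)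
    (h2 : [p, q, s, t, r].Nodup) (hz : z ∈ Z c W) (hW : W ⊆ V \ {p, q, s, t, r}) :
    pent p q s t r * z ∈ Z (c + 2) V := by
  refine Z_congr (Z_mul (V := {p, q, s, t, r}) (W := W) ?_ (pent_mem (le_refl _) h2) hz) (by omega) ?_
  · exact Finset.disjoint_of_subset_right hW Finset.disjoint_sdiff
  · exact Finset.union_subset h1 (hW.trans Finset.sdiff_subset)

theorem pent_mul_B {p q s t r c : ℕ} {V W : Finset ℕ} {z : LE} (h1 : {p, q, s, t, r} ⊆ V)
    (h2 : [p, q, s, t, r].Nodup) (hz : z ∈ B c W) (hW : W ⊆ V \ {p, q, s, t, r}) :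
    pent p q s t r * z ∈ B (c + 2) V := by
  refine B_congr (Z_mul_B (V := {p, q, s, t, r}) (W := W) ?_ (pent_mem (le_refl _) h2) hz) (by omega) ?_
  · exact Finset.disjoint_of_subset_right hW Finset.disjoint_sdiff
  · exact Finset.union_subset h1 (hW.trans Finset.sdiff_subset)

theorem br_mul_Pn {c : ℕ} {V : Finset ℕ} {a b d : ℕ} {z : LE} (ha : a ∈ V) (hb : b ∈ V)
    (hd : d ∈ V) (hab : a ≠ b) (had : a ≠ d) (hbd : b ≠ d)
    (hz : z ∈ Pn c (V \ {a, b, d}) ⊔ B (c + 2) (V \ {a, b, d})) :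
    br a b d * z ∈ Pn (c + 1) V ⊔ B (c + 3) V := by
  obtain ⟨u, hu, w, hw, rfl⟩ := Submodule.mem_sup.1 hz
  rw [mul_add]
  refine Submodule.add_mem_sup ?_ (br_mul_B ha hb hd hab hbd hw (le_refl _))
  have : Pn c (V \ {a, b, d}) ≤ (Pn (c + 1) V).comap (LinearMap.mulLeft ℤ (br a b d)) := by
    rw [Pn, Submodule.span_le]
    rintro _ ⟨p, q, s, t, r, z, h1, h2, hz, rfl⟩
    show br a b d * _ ∈ Pn (c + 1) V
    have hP := (mem_Z.1 (pent_mem (V := {p, q, s, t, r}) (le_refl _) h2)).1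
    have e : br a b d * (pent p q s t r * z) = pent p q s t r * (br a b d * z) := by
      rw [← mul_assoc, ← mul_assoc]
      congr 1
      rw [br, sub_mul, mul_sub, x_comm hP, x_comm hP]; simp
    rw [e]
    refine Submodule.subset_span ⟨p, q, s, t, r, _, h1.trans Finset.sdiff_subset, h2, ?_, rfl⟩
    have hd' : ∀ v ∈ ({a, b, d} : Finset ℕ), v ∉ ({p, q, s, t, r} : Finset ℕ) := by
      intro v hv hv'; exact (Finset.mem_sdiff.1 (h1 hv')).2 hv
    refine br_mul_mem_Br (Finset.mem_sdiff.2 ⟨ha, hd' a (by simp)⟩) (Finset.mem_sdiff.2 ⟨hb, hd' b (by simp)⟩)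
      (Finset.mem_sdiff.2 ⟨hd, hd' d (by simp)⟩) hab had hbd (Br_mono ?_ hz)
    intro v; simp; tauto
  exact this hu

theorem Z1_pair {V : Finset ℕ} (hV : V.card ≤ 2) {z : LE} (hz : z ∈ Z 1 V) : z = 0 := by
  rw [mem_Z] at hz
  obtain ⟨z0, z1⟩ := hz
  have : ∃ a b, C 1 V ≤ Submodule.span ℤ {x a b} := by
    by_cases h : V.card = 2
    · obtain ⟨a, b, hab, rfl⟩ := Finset.card_eq_two.1 h
      refine ⟨a, b, C_succ_le fun p q z hp hq hpq hz => ?_⟩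
      have hx : x p q = x a b := by
        simp only [Finset.mem_insert, Finset.mem_singleton] at hp hq
        rcases hp with rfl | rfl <;> rcases hq with rfl | rfl
        · exact absurd rfl hpq
        · rfl
        · exact x_symm _ _
        · exact absurd rfl hpq
      rw [hx]
      have : C 0 ({a, b} \ {p, q}) ≤ (Submodule.span ℤ {x a b}).comap (LinearMap.mulLeft ℤ (x a b)) :=
        C_zero_le (by
          simp only [Submodule.mem_comap, LinearMap.mulLeft_apply, mul_one]
          exact Submodule.mem_span_singleton_self _)
      exact this hz
    · refine ⟨0, 0, C_succ_le fun p q z hp hq hpq hz => ?_⟩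
      have := Finset.one_lt_card.2 ⟨p, hp, q, hq, hpq⟩
      omega
  obtain ⟨a, b, h⟩ := this
  obtain ⟨k, rfl⟩ := Submodule.mem_span_singleton.1 (h z0)
  rw [map_smul, bd_x] at z1
  have := congrArg sc z1
  simp at this
  simp [this]

theorem lift_aux (c : ℕ) (V : Finset ℕ) (hV : V.card = 3 * c + 5) {p q : ℕ} (hp : p ∈ V) (hq : q ∈ V)
    (hpq : p ≠ q) : ∀ s ∈ V \ {p, q}, ∀ t ∈ V \ {p, q}, s ≠ t →
      Z c (V \ {p, q, s, t}) ≤ liftable (Pn c V ⊔ B (c + 2) V) c V p q s t := by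
  intro s hs t ht hst
  have hc := card_sdiff_le V {p, q, s, t} 4 (3 * c + 1) Finset.card_le_four (by omega)
  refine (generation c _ (by omega)).trans (sup_le ?_ (B_liftable hp hq hpq hs ht hst le_sup_right))
  refine Br_spare hc fun r hr z hz => ?_
  simp only [Finset.mem_sdiff, Finset.mem_insert, Finset.mem_singleton, not_or] at hs ht hr
  have h1 : {p, q, s, t, r} ⊆ V := by simp [Finset.insert_subset_iff, *]
  have h2 : [p, q, s, t, r].Nodup := by simp; tauto
  have hz' : z ∈ Br c (V \ {p, q, s, t, r}) := by
    refine Br_mono ?_ hz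
    intro v; simp; tauto
  refine ⟨pent p q s t r * z, Submodule.mem_sup_left (Submodule.subset_span ⟨p, q, s, t, r, z, h1, h2, hz', rfl⟩),
    pent_mul_Z h1 h2 (Br_le_Z hz') (le_refl _), fun s' t' => ?_⟩
  exact dd_pent_mul h2 s' t' (mem_Z.1 (Br_le_Z hz')).1 (by simp) (by simp)

theorem generation_pent (c : ℕ) : ∀ V : Finset ℕ, V.card = 3 * c + 5 →
    Z (c + 2) V ≤ Pn c V ⊔ B (c + 2) V := by
  induction c with
  | zero =>
    intro V hV
    obtain ⟨p, hp, q, hq, hpq⟩ := exists_two (V := V) (by omega)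
    refine stepAB hp hq hpq le_sup_right ?_ ?_
    · exact lift_aux 0 V hV hp hq hpq
    · intro s hs u hu
      rw [Z1_pair ?_ hu]; simp
      rw [Finset.card_sdiff_of_subset]
      · have : ({p, q, s} : Finset ℕ).card = 3 := Finset.card_eq_three.2 (by
          simp at hs; exact ⟨p, q, s, hpq, Ne.symm hs.2.1, Ne.symm hs.2.2, rfl⟩)
        omega
      · simp at hs; simp [Finset.insert_subset_iff, hp, hq, hs]
  | succ c ih =>
    intro V hV
    obtain ⟨p, hp, q, hq, hpq⟩ := exists_two (V := V) (by omega)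
    refine stepAB hp hq hpq le_sup_right ?_ ?_
    · exact lift_aux (c + 1) V hV hp hq hpq
    · intro s hs u hu
      have hc : (V \ {p, q, s}).card = 3 * c + 5 := by
        rw [Finset.card_sdiff_of_subset]
        · have : ({p, q, s} : Finset ℕ).card = 3 := Finset.card_eq_three.2 (by
            simp at hs; exact ⟨p, q, s, hpq, Ne.symm hs.2.1, Ne.symm hs.2.2, rfl⟩)
          omega
        · simp at hs; simp [Finset.insert_subset_iff, hp, hq, hs]
      have hu' := ih _ hc hu
      simp only [Finset.mem_sdiff, Finset.mem_insert, Finset.mem_singleton, not_or] at hs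
      have e1 : ({p, q, s} : Finset ℕ) = {s, p, q} := by ext; simp; tauto
      have e2 : ({p, q, s} : Finset ℕ) = {s, q, p} := by ext; simp; tauto
      refine ⟨br_mul_Pn hs.1 hp hq hs.2.1 hs.2.2 hpq ?_, br_mul_Pn hs.1 hq hp hs.2.2 hs.2.1 hpq.symm ?_⟩
      · rwa [← e1]
      · rwa [← e2]

end MC

set_option synthInstance.maxHeartbeats 20000
set_option maxHeartbeats 400000
set_option linter.all false

namespace MC

/-! ## Seven letters: the sign rule, and exponent three -/

def mvR : Equiv.Perm (Fin 7) where
  toFun := ![1, 2, 6, 3, 4, 5, 0]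
  invFun := ![6, 0, 1, 3, 4, 5, 2]
  left_inv := by decide
  right_inv := by decide

def mvF : Equiv.Perm (Fin 7) where
  toFun := ![2, 1, 0, 3, 4, 5, 6]
  invFun := ![2, 1, 0, 3, 4, 5, 6]
  left_inv := by decide
  right_inv := by decide

def mvB : Equiv.Perm (Fin 7) where
  toFun := ![3, 4, 5, 0, 1, 2, 6]
  invFun := ![3, 4, 5, 0, 1, 2, 6]
  left_inv := by decide
  right_inv := by decide

theorem word_sign {A : Type} [AddCommGroup A] (Q : Equiv.Perm (Fin 7) → A)
    (hR : ∀ g, Q (g * mvR) = - Q g) (hF : ∀ g, Q (g * mvF) = - Q g) (hB : ∀ g, Q (g * mvB) = - Q g)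
    (l : List (Equiv.Perm (Fin 7))) (hl : ∀ w ∈ l, w = mvR ∨ w = mvF ∨ w = mvB) :
    ∀ g, Q (g * l.prod) = (-1 : ℤ) ^ l.length • Q g := by
  induction l with
  | nil => intro g; simp
  | cons w l ih =>
    intro g
    rw [List.prod_cons, ← mul_assoc, ih (fun w' h => hl w' (List.mem_cons_of_mem _ h)), List.length_cons, pow_succ]
    have : Q (g * w) = - Q g := by
      rcases hl w (List.mem_cons_self) with rfl | rfl | rfl
      · exact hR g
      · exact hF g
      · exact hB g
    rw [this]; simp

set_option maxRecDepth 10000 in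
theorem swap_word (i : Fin 6) : ∃ l : List (Equiv.Perm (Fin 7)),
    (∀ w ∈ l, w = mvR ∨ w = mvF ∨ w = mvB) ∧ l.prod = Equiv.swap i.castSucc i.succ ∧ Odd l.length := by
  fin_cases i
  · refine ⟨[mvR, mvR, mvR, mvB, mvR, mvR, mvF, mvB, mvR, mvF, mvB, mvR, mvR, mvB, mvR, mvB, mvR, mvR, mvB], ?_, ?_, ?_⟩
    · simp
    · decide
    · decide
  · refine ⟨[mvR, mvF, mvB, mvR, mvR, mvF, mvB, mvR, mvF, mvB, mvR, mvR, mvB, mvR, mvF, mvB, mvR, mvR, mvB], ?_, ?_, ?_⟩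
    · simp
    · decide
    · decide
  · refine ⟨[mvR, mvB, mvR, mvF, mvB, mvR, mvR, mvB, mvR, mvF, mvB, mvR, mvF], ?_, ?_, ?_⟩
    · simp
    · decide
    · decide
  · refine ⟨[mvR, mvR, mvF, mvB, mvR, mvR, mvR, mvB, mvR, mvR, mvB, mvR, mvF, mvB, mvR, mvR, mvB, mvR, mvB], ?_, ?_, ?_⟩
    · simp
    · decide
    · decide
  · refine ⟨[mvR, mvR, mvF, mvB, mvR, mvF, mvB, mvR, mvR, mvB, mvR, mvF, mvB, mvR, mvR, mvB, mvR, mvF, mvB], ?_, ?_, ?_⟩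
    · simp
    · decide
    · decide
  · refine ⟨[mvR, mvR, mvF, mvB, mvR, mvR, mvR, mvB, mvR, mvR, mvB, mvR, mvB, mvR, mvR], ?_, ?_, ?_⟩
    · simp
    · decide
    · decide

theorem swap_sign {A : Type} [AddCommGroup A] (Q : Equiv.Perm (Fin 7) → A)
    (hR : ∀ g, Q (g * mvR) = - Q g) (hF : ∀ g, Q (g * mvF) = - Q g) (hB : ∀ g, Q (g * mvB) = - Q g)
    (i : Fin 6) (g : Equiv.Perm (Fin 7)) : Q (g * Equiv.swap i.castSucc i.succ) = - Q g := by
  obtain ⟨l, h1, h2, h3⟩ := swap_word i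
  rw [← h2, word_sign Q hR hF hB l h1, h3.neg_one_pow]; simp

/-- Two brackets. -/
noncomputable def PP (t : Fin 7 → ℕ) (y : LE) : LE :=
  br (t 0) (t 1) (t 2) * (br (t 3) (t 4) (t 5) * y)

theorem br_anti (a b c d e f : ℕ) (y : LE) :
    br a b c * (br d e f * y) = - (br d e f * (br a b c * y)) := by
  simp only [br, sub_mul, mul_sub]
  rw [x_anti a b d e, x_anti a b e f, x_anti b c d e, x_anti b c e f]; abel

theorem br_rev (a b c : ℕ) : br c b a = - br a b c := by
  rw [br, br, x_symm c b, x_symm b a]; abel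

theorem PP_swap {m : ℕ} {V W : Finset ℕ} {y : LE} (hy : y ∈ Z m W) (hW : W ⊆ V) {t : Fin 7 → ℕ}
    (ht : Function.Injective t) (htV : ∀ i, t i ∈ V) (htW : ∀ i, t i ∉ W) (i : Fin 6) :
    PP (t ∘ Equiv.swap i.castSucc i.succ) y + PP t y ∈ B (m + 2) V := by
  let Q : Equiv.Perm (Fin 7) → LE ⧸ B (m + 2) V := fun g => Submodule.Quotient.mk (PP (t ∘ g) y)
  have key : ∀ g h : Equiv.Perm (Fin 7), PP (t ∘ ⇑(g * h : Equiv.Perm (Fin 7))) y + PP (t ∘ g) y ∈ B (m + 2) V →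
      Q (g * h) = - Q g := by
    intro g h hh
    rw [eq_neg_iff_add_eq_zero, ← Submodule.Quotient.mk_add]
    exact (Submodule.Quotient.mk_eq_zero _).2 hh
  have hQ := swap_sign Q ?_ ?_ ?_ i 1
  · rw [eq_neg_iff_add_eq_zero, ← Submodule.Quotient.mk_add, one_mul] at hQ
    exact (Submodule.Quotient.mk_eq_zero _).1 hQ
  · intro g
    refine key g _ ?_
    have hne : ∀ i j : Fin 7, i ≠ j → t (g i) ≠ t (g j) := fun i j h h' => h (g.injective (ht h'))
    have hw : br (t (g 3)) (t (g 4)) (t (g 5)) * y ∈ Z (m + 1) (V \ {t (g 0), t (g 1), t (g 2), t (g 6)}) := by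
      refine br_mul_Z ?_ ?_ ?_ (hne _ _ (by decide)) (hne _ _ (by decide)) hy ?_
      · simp [htV]; refine ⟨hne _ _ (by decide), hne _ _ (by decide), hne _ _ (by decide), hne _ _ (by decide)⟩
      · simp [htV]; refine ⟨hne _ _ (by decide), hne _ _ (by decide), hne _ _ (by decide), hne _ _ (by decide)⟩
      · simp [htV]; refine ⟨hne _ _ (by decide), hne _ _ (by decide), hne _ _ (by decide), hne _ _ (by decide)⟩
      · intro v hv
        have : ∀ i, v ≠ t i := fun i h => htW i (h ▸ hv)
        simp [hW hv, this]
    set w := br (t (g 3)) (t (g 4)) (t (g 5)) * y with hwdef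
    have e : PP (t ∘ ⇑(g * mvR : Equiv.Perm (Fin 7))) y + PP (t ∘ g) y = - bd (x (t (g 0)) (t (g 1)) * (x (t (g 2)) (t (g 6)) * w)) := by
      rw [bd_x_mul, bd_x_mul, (mem_Z.1 hw).2]
      have : PP (t ∘ ⇑(g * mvR : Equiv.Perm (Fin 7))) y = br (t (g 1)) (t (g 2)) (t (g 6)) * w := rfl
      rw [this]
      have : PP (t ∘ g) y = br (t (g 0)) (t (g 1)) (t (g 2)) * w := rfl
      rw [this, br, br]
      noncomm_ring
    rw [e]
    refine Submodule.neg_mem _ (bd_mem_B ?_)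
    refine x_mul_mem_C (htV _) (htV _) (hne _ _ (by decide)) (x_mul_mem_C ?_ ?_ (hne _ _ (by decide)) (C_mono ?_ (mem_Z.1 hw).1))
    · simp [htV]; refine ⟨hne _ _ (by decide), hne _ _ (by decide)⟩
    · simp [htV]; refine ⟨hne _ _ (by decide), hne _ _ (by decide)⟩
    · intro v; simp; tauto
  · intro g
    refine key g _ ?_
    have : PP (t ∘ ⇑(g * mvF : Equiv.Perm (Fin 7))) y = - PP (t ∘ g) y := by
      show br (t (g 2)) (t (g 1)) (t (g 0)) * _ = - (br (t (g 0)) (t (g 1)) (t (g 2)) * _)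
      rw [br_rev, neg_mul]; rfl
    rw [this]; simp
  · intro g
    refine key g _ ?_
    have : PP (t ∘ ⇑(g * mvB : Equiv.Perm (Fin 7))) y = - PP (t ∘ g) y := by
      show br (t (g 3)) (t (g 4)) (t (g 5)) * (br (t (g 0)) (t (g 1)) (t (g 2)) * _) =
        - (br (t (g 0)) (t (g 1)) (t (g 2)) * (br (t (g 3)) (t (g 4)) (t (g 5)) * _))
      rw [br_anti]
    rw [this]; simp

theorem PP_three {m : ℕ} {V W : Finset ℕ} {y : LE} (hy : y ∈ Z m W) (hW : W ⊆ V) {t : Fin 7 → ℕ}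
    (ht : Function.Injective t) (htV : ∀ i, t i ∈ V) (htW : ∀ i, t i ∉ W) :
    (3 : ℤ) • PP t y ∈ B (m + 2) V := by
  have cyc : ∀ t : Fin 7 → ℕ, Function.Injective t → (∀ i, t i ∈ V) → (∀ i, t i ∉ W) →
      PP (t ∘ Equiv.swap 0 1 ∘ Equiv.swap 1 2) y - PP t y ∈ B (m + 2) V := by
    intro t ht htV htW
    have h1 := PP_swap hy hW ht htV htW 0
    have h2 := PP_swap hy hW (ht.comp (Equiv.swap (0 : Fin 7) 1).injective) (fun i => htV _) (fun i => htW _) 1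
    have := Submodule.sub_mem _ h2 h1
    convert this using 1
    have : PP (t ∘ Equiv.swap 0 1 ∘ Equiv.swap 1 2) y = PP ((t ∘ ⇑(Equiv.swap 0 1)) ∘ ⇑(Equiv.swap (Fin.castSucc (1 : Fin 6)) (Fin.succ 1))) y := rfl
    rw [this]
    have : PP (t ∘ ⇑(Equiv.swap (Fin.castSucc (0 : Fin 6)) (Fin.succ 0))) y = PP (t ∘ ⇑(Equiv.swap 0 1)) y := rfl
    rw [this]
    abel
  have c1 := cyc t ht htV htW
  have c2 := cyc (t ∘ Equiv.swap 0 1 ∘ Equiv.swap 1 2)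
    (ht.comp ((Equiv.swap (0 : Fin 7) 1).injective.comp (Equiv.swap (1 : Fin 7) 2).injective)) (fun i => htV _) (fun i => htW _)
  have e0 : PP t y + PP (t ∘ Equiv.swap 0 1 ∘ Equiv.swap 1 2) y +
      PP ((t ∘ Equiv.swap 0 1 ∘ Equiv.swap 1 2) ∘ Equiv.swap 0 1 ∘ Equiv.swap 1 2) y = 0 := by
    have f1 : PP (t ∘ Equiv.swap 0 1 ∘ Equiv.swap 1 2) y = br (t 1) (t 2) (t 0) * (br (t 3) (t 4) (t 5) * y) := rfl
    have f2 : PP ((t ∘ Equiv.swap 0 1 ∘ Equiv.swap 1 2) ∘ Equiv.swap 0 1 ∘ Equiv.swap 1 2) y =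
      br (t 2) (t 0) (t 1) * (br (t 3) (t 4) (t 5) * y) := rfl
    rw [f1, f2, PP]
    simp only [br]
    noncomm_ring
  have e1 : (3 : ℤ) • PP t y = - ((PP (t ∘ Equiv.swap 0 1 ∘ Equiv.swap 1 2) y - PP t y) + (PP (t ∘ Equiv.swap 0 1 ∘ Equiv.swap 1 2) y - PP t y) +
      (PP ((t ∘ Equiv.swap 0 1 ∘ Equiv.swap 1 2) ∘ Equiv.swap 0 1 ∘ Equiv.swap 1 2) y - PP (t ∘ Equiv.swap 0 1 ∘ Equiv.swap 1 2) y)) := by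
    rw [add_assoc, add_comm] at e0
    rw [← sub_eq_zero, ← sub_eq_zero.2 e0]
    module
  rw [e1]
  exact Submodule.neg_mem _ (Submodule.add_mem _ (Submodule.add_mem _ c1 c1) c2)

theorem Br_three {k : ℕ} {X V : Finset ℕ} {r : ℕ} (hr : r ∉ X) (hrV : r ∈ V) (hX : X ⊆ V) {z : LE}
    (hz : z ∈ Br (k + 2) X) : (3 : ℤ) • z ∈ B (k + 2) V := by
  have : Br (k + 2) X ≤ (B (k + 2) V).comap ((3 : ℤ) • LinearMap.id) := by
    refine Br_succ_le fun a b d z ha hb hd h1 h2 h3 hz => ?_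
    have h' : Br (k + 1) (X \ {a, b, d}) ≤ ((B (k + 2) V).comap ((3 : ℤ) • LinearMap.id)).comap
        (LinearMap.mulLeft ℤ (br a b d)) := by
      refine Br_succ_le fun a' b' d' z ha' hb' hd' h1' h2' h3' hz => ?_
      simp only [Finset.mem_sdiff, Finset.mem_insert, Finset.mem_singleton, not_or] at ha' hb' hd'
      have hrne : ∀ v ∈ X, r ≠ v := fun v hv h => hr (h ▸ hv)
      have hn : [a, b, d, a', b', d', r].Nodup := by
        simp [h1, h2, h3, h1', h2', h3', Ne.symm ha'.2.1, Ne.symm ha'.2.2.1, Ne.symm ha'.2.2.2,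
          Ne.symm hb'.2.1, Ne.symm hb'.2.2.1, Ne.symm hb'.2.2.2, Ne.symm hd'.2.1, Ne.symm hd'.2.2.1,
          Ne.symm hd'.2.2.2, Ne.symm (hrne _ ha), Ne.symm (hrne _ hb), Ne.symm (hrne _ hd),
          Ne.symm (hrne _ ha'.1), Ne.symm (hrne _ hb'.1), Ne.symm (hrne _ hd'.1)]
      have ht : Function.Injective ![a, b, d, a', b', d', r] := by
        rw [← List.nodup_ofFn]; simpa using hn
      have hm : ∀ i, ![a, b, d, a', b', d', r] i ∈ V := by
        intro i; fin_cases i <;> simp [hX ha, hX hb, hX hd, hX ha'.1, hX hb'.1, hX hd'.1, hrV]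
      have hm' : ∀ i, ![a, b, d, a', b', d', r] i ∉ (X \ {a, b, d}) \ {a', b', d'} := by
        intro i; fin_cases i <;> simp [hr]
      exact PP_three (Br_le_Z hz) (Finset.sdiff_subset.trans (Finset.sdiff_subset.trans hX)) ht hm hm'
    exact h' hz
  exact this hz

theorem Br_three' {k : ℕ} {V : Finset ℕ} (hV : 3 * k + 7 ≤ V.card) {z : LE}
    (hz : z ∈ Br (k + 2) V) : (3 : ℤ) • z ∈ B (k + 2) V := by
  have : Br (k + 2) V ≤ (B (k + 2) V).comap ((3 : ℤ) • LinearMap.id) := by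
    refine Br_spare (by omega) fun r hr z hz => ?_
    exact Br_three (by simp) hr (Finset.erase_subset _ _) hz
  exact this hz

/-- Exponent three for `|V| = 3c+1`. -/
theorem exp_one {k : ℕ} {V : Finset ℕ} (hV : 3 * k + 7 ≤ V.card) {z : LE}
    (hz : z ∈ Z (k + 2) V) : (3 : ℤ) • z ∈ B (k + 2) V := by
  obtain ⟨u, hu, w, hw, rfl⟩ := Submodule.mem_sup.1 (generation (k + 2) V (by omega) hz)
  rw [smul_add]
  exact Submodule.add_mem _ (Br_three' hV hu) (Submodule.smul_mem _ _ hw)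

/-! ## The operator adding two vertices -/

/-- Replace the vertex `a` by `q`. -/
noncomputable def Rv (q a : ℕ) (V : Finset ℕ) : LE →ₗ[ℤ] LE :=
  Nv a V + ∑ b ∈ V.erase a, (LinearMap.mulLeft ℤ (x q b)).comp (dd a b)

/-- The suspension type operator. -/
noncomputable def Sv (p q : ℕ) (V : Finset ℕ) : LE →ₗ[ℤ] LE :=
  ∑ a ∈ V, ((LinearMap.mulLeft ℤ (x p a)).comp (Rv q a V) - (LinearMap.mulLeft ℤ (x q a)).comp (Nv a V))

theorem Rv_apply (q a : ℕ) (V : Finset ℕ) (z : LE) :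
    Rv q a V z = Nv a V z + ∑ b ∈ V.erase a, x q b * dd a b z := by
  simp [Rv]

theorem Sv_apply (p q : ℕ) (V : Finset ℕ) (z : LE) :
    Sv p q V z = ∑ a ∈ V, (x p a * Rv q a V z - x q a * Nv a V z) := by
  simp [Sv]

theorem bd_Nv (a : ℕ) (V : Finset ℕ) (z : LE) :
    bd (Nv a V z) = Nv a V (bd z) - ∑ b ∈ V.erase a, dd a b z := by
  simp only [Nv_apply, map_sub, map_sum, bd_x_mul, bd_dd, Finset.sum_sub_distrib, mul_neg,
    Finset.sum_neg_distrib]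
  abel

theorem bd_Rv (q a : ℕ) (V : Finset ℕ) (z : LE) : bd (Rv q a V z) = Rv q a V (bd z) := by
  simp only [Rv_apply, map_add, map_sum, bd_Nv, bd_x_mul, bd_dd, Finset.sum_sub_distrib, mul_neg,
    Finset.sum_neg_distrib]
  abel

theorem bd_Sv (p q : ℕ) (V : Finset ℕ) (z : LE) : bd (Sv p q V z) = - Sv p q V (bd z) := by
  have h : ∑ a ∈ V, ∑ b ∈ V.erase a, x q b * dd a b z = ∑ a ∈ V, ∑ b ∈ V.erase a, x q a * dd a b z := by
    rw [Finset.sum_sigma', Finset.sum_sigma']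
    refine Finset.sum_bij' (fun s _ => ⟨s.2, s.1⟩) (fun s _ => ⟨s.2, s.1⟩) ?_ ?_ ?_ ?_ ?_
    · intro s hs; simp at hs ⊢; tauto
    · intro s hs; simp at hs ⊢; tauto
    · intro s hs; rfl
    · intro s hs; rfl
    · intro s hs; rw [dd_symm]
  simp only [Sv_apply, map_sum, map_sub, bd_x_mul, bd_Rv, bd_Nv, mul_sub, Finset.sum_sub_distrib,
    Finset.mul_sum]
  simp only [Rv_apply, mul_add, Finset.sum_add_distrib] at *
  rw [h]
  abel

theorem Rv_mem {c q a : ℕ} {V : Finset ℕ} (hq : q ∉ V) {z : LE} (hz : z ∈ C c V) :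
    Rv q a V z ∈ C c (insert q (V.erase a)) := by
  rw [Rv_apply]
  refine Submodule.add_mem _ (C_mono (Finset.subset_insert _ _) (Nv_mem a hz)) ?_
  refine Submodule.sum_mem _ fun b hb => ?_
  match c, hz with
  | 0, hz => rw [dd_C0 _ _ hz]; simp
  | c + 1, hz =>
    refine x_mul_mem_C' (W := V \ {a, b}) (Finset.mem_insert_self _ _) (Finset.mem_insert_of_mem hb)
      ?_ (dd_mem a b hz) ?_ ?_ ?_
    · rintro rfl; exact hq (Finset.mem_of_mem_erase hb)
    · intro v; simp; tauto
    · simp [hq]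
    · simp

theorem Sv_mem {c p q : ℕ} {V : Finset ℕ} (hp : p ∉ V) (hq : q ∉ V) (hpq : p ≠ q) {z : LE}
    (hz : z ∈ C c V) : Sv p q V z ∈ C (c + 1) (insert p (insert q V)) := by
  rw [Sv_apply]
  refine Submodule.sum_mem _ fun a ha => Submodule.sub_mem _ ?_ ?_
  · refine x_mul_mem_C' (by simp) (by simp [ha]) (fun h => hp (h ▸ ha)) (Rv_mem hq hz) ?_ ?_ ?_
    · intro v; simp; tauto
    · simp [hp, hpq]
    · simp; rintro rfl; exact hq ha
  · refine x_mul_mem_C' (by simp) (by simp [ha]) (fun h => hq (h ▸ ha)) (Nv_mem a hz) ?_ ?_ ?_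
    · intro v; simp; tauto
    · simp [hq]
    · simp

theorem dd_Sv {c p q r : ℕ} {V : Finset ℕ} (hp : p ∉ V) (hq : q ∉ V) (hpq : p ≠ q) (hr : r ∈ V) {z : LE}
    (hz : z ∈ C c V) : dd p r (Sv p q V z) = Rv q r V z := by
  rw [Sv_apply, map_sum, Finset.sum_eq_single r]
  · rw [map_sub, dd_x_same, dd_zero (V := insert q (V.erase r)) _ _ (Rv_mem hq hz), dd_x_ne,
      dd_zero (V := V.erase r) _ _ (Nv_mem r hz)]
    · simp
    · simp [hp]
    · rw [Ne, Sym2.eq_iff]; rintro (⟨h, _⟩ | ⟨_, h⟩)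
      · exact hpq h.symm
      · exact hp (h ▸ hr)
    · simp [hp, hpq]
  · intro a ha har
    rw [map_sub, dd_x_ne, dd_x_ne, dd_zero (V := insert q (V.erase a)) _ _ (Rv_mem hq hz),
      dd_zero (V := V.erase a) _ _ (Nv_mem a hz)]
    · simp
    · simp [hp]
    · simp [hp, hpq]
    · rw [Ne, Sym2.eq_iff]; rintro (⟨h, _⟩ | ⟨_, h⟩)
      · exact hpq h.symm
      · exact hp (h ▸ ha)
    · rw [Ne, Sym2.eq_iff]; rintro (⟨_, h⟩ | ⟨_, h⟩)
      · exact har h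
      · exact hp (h ▸ ha)
  · intro h; exact absurd hr h

theorem Rv_spare {c q r : ℕ} {U : Finset ℕ} (hr : r ∉ U) {V : Finset ℕ} {z : LE} (hz : z ∈ C c U) :
    Rv q r V z = z ∧ Nv r V z = z := by
  have : ∀ b, dd r b z = 0 := fun b => dd_zero hr b hz
  simp [Rv_apply, Nv_apply, this]

theorem Sv_spare {c p q r : ℕ} {U : Finset ℕ} (hr : r ∉ U) {z : LE} (hz : z ∈ C c U) :
    Sv p q (insert r U) z = br p r q * z + Sv p q U z := by
  rw [Sv_apply, Finset.sum_insert hr, (Rv_spare (q := q) hr hz).1, (Rv_spare (q := q) hr hz).2, Sv_apply, br, sub_mul,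
    x_symm r q]
  congr 1
  have hN : ∀ a ∈ U, Nv a (insert r U) z = Nv a U z := by
    intro a ha
    have : a ≠ r := fun h => hr (h ▸ ha)
    rw [Nv_apply, Nv_apply, Finset.erase_insert_of_ne this.symm, Finset.sum_insert (by simp [hr]),
      dd_zero' hr _ hz]; simp
  have hR : ∀ a ∈ U, Rv q a (insert r U) z = Rv q a U z := by
    intro a ha
    have : a ≠ r := fun h => hr (h ▸ ha)
    rw [Rv_apply, Rv_apply, hN a ha, Finset.erase_insert_of_ne this.symm, Finset.sum_insert (by simp [hr]),
      dd_zero' hr _ hz]; simp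
  exact Finset.sum_congr rfl fun a ha => by rw [hN a ha, hR a ha]

theorem Sv_Z {c p q : ℕ} {V : Finset ℕ} (hp : p ∉ V) (hq : q ∉ V) (hpq : p ≠ q) {z : LE}
    (hz : z ∈ Z c V) : Sv p q V z ∈ Z (c + 1) (insert p (insert q V)) := by
  rw [mem_Z] at *
  exact ⟨Sv_mem hp hq hpq hz.1, by rw [bd_Sv, hz.2]; simp⟩

theorem Sv_B {c p q : ℕ} {V : Finset ℕ} (hp : p ∉ V) (hq : q ∉ V) (hpq : p ≠ q) {z : LE}
    (hz : z ∈ B c V) : Sv p q V z ∈ B (c + 1) (insert p (insert q V)) := by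
  obtain ⟨w, hw, rfl⟩ := mem_B.1 hz
  have : Sv p q V (bd w) = bd (- Sv p q V w) := by rw [map_neg, bd_Sv]; simp
  rw [this]
  exact bd_mem_B (Submodule.neg_mem _ (Sv_mem hp hq hpq hw))

end MC

set_option synthInstance.maxHeartbeats 20000
set_option maxHeartbeats 400000
set_option linter.all false

namespace MC

theorem Br_one_mul {m : ℕ} {X W : Finset ℕ} (h : Disjoint X W) {z y : LE} (hz : z ∈ Br 1 X)
    (hy : y ∈ Br m W) : z * y ∈ Br (m + 1) (X ∪ W) := by
  have : Br 1 X ≤ (Br (m + 1) (X ∪ W)).comap (LinearMap.mulRight ℤ y) := by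
    refine Br_succ_le fun a b d z ha hb hd h1 h2 h3 hz => ?_
    have h' : Br 0 (X \ {a, b, d}) ≤ ((Br (m + 1) (X ∪ W)).comap (LinearMap.mulRight ℤ y)).comap
        (LinearMap.mulLeft ℤ (br a b d)) := by
      refine Br_zero_le ?_
      simp only [Submodule.mem_comap, LinearMap.mulLeft_apply, LinearMap.mulRight_apply, mul_one]
      refine br_mul_mem_Br (Finset.mem_union_left _ ha) (Finset.mem_union_left _ hb)
        (Finset.mem_union_left _ hd) h1 h2 h3 (Br_mono ?_ hy)
      intro v hv
      have hvX : v ∉ X := fun h' => (Finset.disjoint_left.1 h) h' hv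
      simp [hv]
      exact ⟨fun h => hvX (h ▸ ha), fun h => hvX (h ▸ hb), fun h => hvX (h ▸ hd)⟩
    exact h' hz
  exact this hz

/-- The key relation: three times a product of many brackets bounds, with no spare vertex. -/
theorem three_Br {k : ℕ} {V : Finset ℕ} : Br (k + 4) V ≤ (B (k + 4) V).comap ((3 : ℤ) • LinearMap.id) := by
  refine Br_succ_le fun p r q z hp hr hq hpr hpq hrq hz => ?_
  have h1 : Br (k + 3) (V \ {p, r, q}) ≤ ((B (k + 4) V).comap ((3 : ℤ) • LinearMap.id)).comap
      (LinearMap.mulLeft ℤ (br p r q)) := by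
    refine Br_succ_le fun a b d z ha hb hd hab had hbd hz => ?_
    have h2 : Br (k + 2) ((V \ {p, r, q}) \ {a, b, d}) ≤ (((B (k + 4) V).comap ((3 : ℤ) • LinearMap.id)).comap
      (LinearMap.mulLeft ℤ (br p r q))).comap (LinearMap.mulLeft ℤ (br a b d)) := by
      refine Br_succ_le fun e f g y he hf hg hef heg hfg hy => ?_
      simp only [Finset.mem_sdiff, Finset.mem_insert, Finset.mem_singleton, not_or] at ha hb hd he hf hg
      obtain ⟨ha, ha1, ha2, ha3⟩ := ha
      obtain ⟨hb, hb1, hb2, hb3⟩ := hb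
      obtain ⟨hd, hd1, hd2, hd3⟩ := hd
      obtain ⟨⟨he, he1, he2, he3⟩, he4, he5, he6⟩ := he
      obtain ⟨⟨hf, hf1, hf2, hf3⟩, hf4, hf5, hf6⟩ := hf
      obtain ⟨⟨hg, hg1, hg2, hg3⟩, hg4, hg5, hg6⟩ := hg
      set W := ((V \ {p, r, q}) \ {a, b, d}) \ {e, f, g} with hW
      set U : Finset ℕ := {a, b, d, e, f, g} with hU
      set α := br a b d * br e f g with hα
      have hαB : α ∈ Br 2 U := by
        refine br_mul_mem_Br (by simp [U]) (by simp [U]) (by simp [U]) hab had hbd ?_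
        rw [← mul_one (br e f g)]
        refine br_mul_mem_Br ?_ ?_ ?_ hef heg hfg (one_mem_Br _)
        · simp [U, he4, he5, he6]
        · simp [U, hf4, hf5, hf6]
        · simp [U, hg4, hg5, hg6]
      have hpU : p ∉ U := by simp [U, Ne.symm ha1, Ne.symm hb1, Ne.symm hd1, Ne.symm he1, Ne.symm hf1, Ne.symm hg1]
      have hrU : r ∉ U := by simp [U, Ne.symm ha2, Ne.symm hb2, Ne.symm hd2, Ne.symm he2, Ne.symm hf2, Ne.symm hg2]
      have hqU : q ∉ U := by simp [U, Ne.symm ha3, Ne.symm hb3, Ne.symm hd3, Ne.symm he3, Ne.symm hf3, Ne.symm hg3]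
      have hUV : U ⊆ V := by simp [U, Finset.insert_subset_iff, ha, hb, hd, he, hf, hg]
      have hUc : U.card = 6 := by
        simp [U, Finset.card_insert_of_notMem, *, Ne.symm he4, Ne.symm he5, Ne.symm he6, Ne.symm hf4, Ne.symm hf5, Ne.symm hf6, Ne.symm hg4, Ne.symm hg5, Ne.symm hg6]
      have hWU : ∀ v ∈ W, v ∈ V ∧ v ∉ U ∧ v ≠ p ∧ v ≠ q ∧ v ≠ r := by
        intro v hv
        simp [W] at hv
        simp [U, hv]
      have hyZ : y ∈ Z (k + 1) W := Br_le_Z hy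
      have s1 : (3 : ℤ) • α ∈ B 2 (insert r U) :=
        Br_three hrU (Finset.mem_insert_self _ _) (Finset.subset_insert _ _) hαB
      have s2 := Sv_B (p := p) (q := q) (by simp [hpU, hpr]) (by simp [hqU, Ne.symm hrq]) hpq s1
      rw [map_smul, Sv_spare hrU (mem_Z.1 (Br_le_Z hαB)).1] at s2
      have hdis : Disjoint (insert p (insert q (insert r U))) W := by
        rw [Finset.disjoint_right]
        intro v hv
        have := hWU v hv
        simp [this]
      have s3 := B_mul_Z hdis s2 hyZ
      have s4 : Sv p q U α ∈ Z 3 (insert p (insert q U)) := Sv_Z hpU hqU hpq (Br_le_Z hαB)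
      have s5 := generation_pent 1 _ (by rw [Finset.card_insert_of_notMem (by simp [hpU, hpq]), Finset.card_insert_of_notMem hqU, hUc]) s4
      have s6 : (3 : ℤ) • (Sv p q U α * y) ∈ B (k + 4) V := by
        have t1 : B 3 (insert p (insert q U)) ≤ ((B (k + 4) V).comap ((3 : ℤ) • LinearMap.id)).comap (LinearMap.mulRight ℤ y) := by
          intro u hu
          simp only [Submodule.mem_comap, LinearMap.mulRight_apply, LinearMap.smul_apply, LinearMap.id_apply]
          refine Submodule.smul_mem _ _ (B_congr (B_mul_Z ?_ hu hyZ) (by omega) ?_)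
          · refine Finset.disjoint_of_subset_left ?_ hdis
            intro v; simp; rintro (h | h | h) <;> simp [h]
          · refine Finset.union_subset ?_ (fun v hv => (hWU v hv).1)
            simp [Finset.insert_subset_iff, hp, hq, hUV]
        have t2 : Pn 1 (insert p (insert q U)) ≤ ((B (k + 4) V).comap ((3 : ℤ) • LinearMap.id)).comap (LinearMap.mulRight ℤ y) := by
          rw [Pn, Submodule.span_le]
          rintro _ ⟨p', q', s', t', r', z, hs1, hs2, hz, rfl⟩
          show (3 : ℤ) • (pent p' q' s' t' r' * z * y) ∈ B (k + 4) V
          rw [mul_assoc, ← mul_smul_comm]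
          have hsV : insert p (insert q U) ⊆ V := by simp [Finset.insert_subset_iff, hp, hq, hUV]
          have hd1 : Disjoint (insert p (insert q U) \ {p', q', s', t', r'}) W := by
            refine Finset.disjoint_of_subset_left ?_ hdis
            intro v hv
            rw [Finset.mem_sdiff] at hv
            have := hv.1
            simp at this ⊢; rcases this with h | h | h <;> simp [h]
          have hzy := Br_one_mul hd1 hz hy
          refine pent_mul_B (hs1.trans hsV) hs2 (W := insert r ((insert p (insert q U) \ {p', q', s', t', r'}) ∪ W))
            (Br_three (r := r) (k := k) ?_ (Finset.mem_insert_self _ _) (Finset.subset_insert _ _) hzy) ?_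
          · intro hmem
            rcases Finset.mem_union.1 hmem with h | h
            · have := (Finset.mem_sdiff.1 h).1
              simp [hrU, Ne.symm hpr, hrq] at this
            · exact (hWU r h).2.2.2.2 rfl
          · intro v hv
            have hno : ∀ v, v ∉ insert p (insert q U) → v ∉ ({p', q', s', t', r'} : Finset ℕ) := fun v hv h => hv (hs1 h)
            rw [Finset.mem_insert, Finset.mem_union] at hv
            rw [Finset.mem_sdiff]
            rcases hv with rfl | hv | hv
            · exact ⟨hr, hno _ (by simp [hrU, Ne.symm hpr, hrq])⟩
            · rw [Finset.mem_sdiff] at hv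
              exact ⟨hsV hv.1, hv.2⟩
            · have := hWU v hv
              exact ⟨this.1, hno _ (by simp [this])⟩
        exact (sup_le t2 t1) s5
      have s7 : (3 : ℤ) • ((br p r q * α + Sv p q U α) * y) ∈ B (k + 4) V := by
        rw [smul_mul_assoc] at s3
        refine B_congr s3 (by omega) ?_
        refine Finset.union_subset ?_ (fun v hv => (hWU v hv).1)
        simp [Finset.insert_subset_iff, hp, hq, hr, hUV]
      have s8 := Submodule.sub_mem _ s7 s6
      show (3 : ℤ) • (br p r q * (br a b d * (br e f g * y))) ∈ B (k + 4) V
      convert s8 using 1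
      rw [hα, ← smul_sub, add_mul, add_sub_cancel_right, mul_assoc, mul_assoc]
    exact h2 hz
  exact h1 hz

/-- Exponent three for `|V| ≥ 3c`, `c ≥ 4`. -/
theorem exp_zero {k : ℕ} {V : Finset ℕ} (hV : 3 * (k + 4) ≤ V.card) {z : LE}
    (hz : z ∈ Z (k + 4) V) : (3 : ℤ) • z ∈ B (k + 4) V := by
  obtain ⟨u, hu, w, hw, rfl⟩ := Submodule.mem_sup.1 (generation (k + 4) V hV hz)
  rw [smul_add]
  exact Submodule.add_mem _ (three_Br hu) (Submodule.smul_mem _ _ hw)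

/-- Exponent three for `|V| = 3c-1`, `c ≥ 6`. -/
theorem exp_two {k : ℕ} {V : Finset ℕ} (hV : V.card = 3 * (k + 4) + 5) {z : LE}
    (hz : z ∈ Z (k + 6) V) : (3 : ℤ) • z ∈ B (k + 6) V := by
  have t : Pn (k + 4) V ≤ (B (k + 6) V).comap ((3 : ℤ) • LinearMap.id) := by
    rw [Pn, Submodule.span_le]
    rintro _ ⟨p, q, s, t, r, z, h1, h2, hz, rfl⟩
    show (3 : ℤ) • (pent p q s t r * z) ∈ B (k + 6) V
    rw [← mul_smul_comm]
    exact pent_mul_B h1 h2 (three_Br hz) (le_refl _)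
  have t' : B (k + 6) V ≤ (B (k + 6) V).comap ((3 : ℤ) • LinearMap.id) :=
    fun u hu => Submodule.smul_mem _ _ hu
  exact (sup_le t t') (generation_pent (k + 4) V hV hz)

end MC

set_option synthInstance.maxHeartbeats 20000
set_option maxHeartbeats 400000
set_option linter.all false

namespace MC

/-! ## Nontriviality -/

noncomputable def Ebr : List ℕ → LE
  | a :: b :: c :: l => br a b c * Ebr l
  | _ => 1

noncomputable def mon (l : List ℕ) : Lam ℕ := (l.map gen).prod

theorem mon_cons (a : ℕ) (l : List ℕ) : mon (a :: l) = gen a * mon l := by simp [mon]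
theorem mon_append (l l' : List ℕ) : mon (l ++ l') = mon l * mon l' := by simp [mon]
theorem mon_nil : mon [] = 1 := rfl

theorem D_mon_zero (a : ℕ) (l : List ℕ) (h : a ∉ l) : D (fun e => if e = a then 1 else 0) (mon l) = 0 := by
  induction l with
  | nil => rw [mon_nil, D_one]
  | cons b l ih =>
    rw [List.mem_cons, not_or] at h
    rw [mon_cons, D_gen_mul, ih h.2]; simp [Ne.symm h.1]

theorem mon_not_three (l : List ℕ) (hl : l.Nodup) (w : Lam ℕ) : mon l ≠ (3 : ℤ) • w := by
  induction l generalizing w with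
  | nil =>
    intro h
    have := congrArg sc h
    rw [mon_nil, map_one, map_zsmul, smul_eq_mul] at this
    omega
  | cons a l ih =>
    intro h
    rw [List.nodup_cons] at hl
    have := congrArg (D (fun e => if e = a then 1 else 0)) h
    rw [mon_cons, D_gen_mul, D_mon_zero a l hl.1, map_smul] at this
    refine ih hl.2 _ (Eq.trans ?_ this)
    simp

theorem mon_swap (p l : List ℕ) (a b : ℕ) : mon (p ++ a :: b :: l) = - mon (p ++ b :: a :: l) := by
  rw [mon_append, mon_append, mon_cons, mon_cons, mon_cons, mon_cons, gen_anti_mul, mul_neg]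

theorem Ebr_append (k : ℕ) : ∀ (l : List ℕ) (v : ℕ), l.length = 3 * k → Ebr (l ++ [v]) = Ebr l := by
  induction k with
  | zero => intro l v h; rw [show l = [] from List.length_eq_zero_iff.1 (by omega)]; rfl
  | succ k ih =>
    intro l v h
    match l, h with
    | a :: b :: c :: l, h =>
      show br a b c * Ebr (l ++ [v]) = br a b c * Ebr l
      rw [ih l v (by simp at h; omega)]

theorem Ebr_Br (k : ℕ) : ∀ (l : List ℕ) (U : Finset ℕ), l.length = 3 * k → l.Nodup → (∀ a ∈ l, a ∈ U) →
    Ebr l ∈ Br k U := by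
  induction k with
  | zero =>
    intro l U h _ _; rw [show l = [] from List.length_eq_zero_iff.1 (by omega)]
    exact one_mem_Br _
  | succ k ih =>
    intro l U h hn hm
    match l, h, hn, hm with
    | a :: b :: c :: l, h, hn, hm =>
      simp only [List.nodup_cons, List.mem_cons, not_or] at hn
      obtain ⟨⟨h1, h2, h3⟩, ⟨h4, h5⟩, h6, h7⟩ := hn
      refine br_mul_mem_Br (hm _ (by simp)) (hm _ (by simp)) (hm _ (by simp)) h1 h2 h4
        (ih l _ (by simp at h; omega) h7 fun v hv => ?_)
      simp only [Finset.mem_sdiff, Finset.mem_insert, Finset.mem_singleton, not_or]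
      exact ⟨hm _ (by simp [hv]), fun h => h3 (h ▸ hv), fun h => h5 (h ▸ hv), fun h => h6 (h ▸ hv)⟩

noncomputable def Gs (n : ℕ) (U : Finset ℕ) : Submodule ℤ (LE × Lam ℕ) :=
  Submodule.span ℤ {w | ∃ l : List ℕ, l.Nodup ∧ l.length = n ∧ (∀ a ∈ l, a ∈ U) ∧ w = (Ebr l, mon l)}

theorem mem_Gs {n : ℕ} {U : Finset ℕ} {l : List ℕ} (h1 : l.Nodup) (h2 : l.length = n) (h3 : ∀ a ∈ l, a ∈ U) :
    (Ebr l, mon l) ∈ Gs n U := Submodule.subset_span ⟨l, h1, h2, h3, rfl⟩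

theorem Gs_append {k : ℕ} {W U : Finset ℕ} {v : ℕ} (hv : v ∉ W) (hvU : v ∈ U) (hW : W ⊆ U) {a : LE} {n : Lam ℕ}
    (h : (a, n) ∈ Gs (3 * k) W) : (a, n * gen v) ∈ Gs (3 * k + 1) U := by
  have : Gs (3 * k) W ≤ (Gs (3 * k + 1) U).comap (LinearMap.prodMap LinearMap.id (LinearMap.mulRight ℤ (gen v))) := by
    rw [Gs, Submodule.span_le]
    rintro _ ⟨l, h1, h2, h3, rfl⟩
    have : (Ebr (l ++ [v]), mon (l ++ [v])) ∈ Gs (3 * k + 1) U := by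
      refine mem_Gs ?_ (by simp [h2]) ?_
      · rw [List.nodup_append]
        refine ⟨h1, by simp, ?_⟩
        intro x hx y hy
        simp at hy; subst hy
        rintro rfl; exact hv (h3 _ hx)
      · intro x hx
        simp at hx
        rcases hx with hx | rfl
        · exact hW (h3 x hx)
        · exact hvU
    rw [Ebr_append k l v h2, mon_append] at this
    simpa [mon] using this
  exact this h

theorem Br_Gs (k : ℕ) : ∀ (W : Finset ℕ), Br k W ≤ (Gs (3 * k) W).map (LinearMap.fst ℤ _ _) := by
  induction k with
  | zero =>
    intro W
    refine Br_zero_le ⟨(Ebr [], mon []), mem_Gs (by simp) (by simp) (by simp), rfl⟩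
  | succ k ih =>
    intro W
    refine Br_succ_le fun a b d z ha hb hd h1 h2 h3 hz => ?_
    obtain ⟨⟨z', m⟩, hzm, hzz⟩ := ih _ hz
    have hzz : z' = z := hzz
    subst hzz
    have : Gs (3 * k) (W \ {a, b, d}) ≤ (Gs (3 * (k + 1)) W).comap (LinearMap.prodMap
        (LinearMap.mulLeft ℤ (br a b d)) (LinearMap.mulLeft ℤ (gen a * (gen b * gen d)))) := by
      rw [Gs, Submodule.span_le]
      rintro _ ⟨l, g1, g2, g3, rfl⟩
      have hl : ∀ v ∈ l, v ∈ W ∧ v ≠ a ∧ v ≠ b ∧ v ≠ d := by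
        intro v hv; simpa using g3 v hv
      have : (Ebr (a :: b :: d :: l), mon (a :: b :: d :: l)) ∈ Gs (3 * (k + 1)) W := by
        refine mem_Gs ?_ (by simp [g2]; omega) ?_
        · simp only [List.nodup_cons, List.mem_cons, not_or]
          exact ⟨⟨h1, h2, fun h => (hl _ h).2.1 rfl⟩, ⟨h3, fun h => (hl _ h).2.2.1 rfl⟩,
            fun h => (hl _ h).2.2.2 rfl, g1⟩
        · intro v hv
          simp at hv
          rcases hv with rfl | rfl | rfl | hv
          · exact ha
          · exact hb
          · exact hd
          · exact (hl v hv).1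
      rw [mon_cons, mon_cons, mon_cons, ← mul_assoc, ← mul_assoc] at this
      simp only [Submodule.comap_coe, Set.mem_preimage, LinearMap.prodMap_apply, LinearMap.mulLeft_apply, ← mul_assoc]
      exact this
    exact ⟨_, this hzm, rfl⟩

theorem prod_mk_sum {A A' : Type} [AddCommMonoid A] [AddCommMonoid A'] (s : Finset ℕ) (f : ℕ → A) (g : ℕ → A') :
    (∑ i ∈ s, f i, ∑ i ∈ s, g i) = ∑ i ∈ s, (f i, g i) := by
  refine Prod.ext ?_ ?_
  · rw [Prod.fst_sum]
  · rw [Prod.snd_sum]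

def Well (c : ℕ) (U : Finset ℕ) : Prop :=
  ∀ a m, (a, m) ∈ Gs (3 * c + 1) U → a ∈ B c U → ∃ w, m = (3 : ℤ) • w

theorem sum_erase_swap {A : Type} [AddCommMonoid A] (V : Finset ℕ) (F : ℕ → ℕ → A) :
    ∑ a ∈ V, ∑ b ∈ V.erase a, F a b = ∑ b ∈ V, ∑ a ∈ V.erase b, F a b := by
  rw [Finset.sum_sigma', Finset.sum_sigma']
  refine Finset.sum_bij' (fun s _ => ⟨s.2, s.1⟩) (fun s _ => ⟨s.2, s.1⟩) ?_ ?_ ?_ ?_ ?_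
  · intro s hs; simp at hs ⊢; exact ⟨hs.2.2, Ne.symm hs.2.1, hs.1⟩
  · intro s hs; simp at hs ⊢; exact ⟨hs.2.2, Ne.symm hs.2.1, hs.1⟩
  · intro s hs; rfl
  · intro s hs; rfl
  · intro s hs; rfl

theorem sum_dd_mem {c : ℕ} {V T : Finset ℕ} {a : ℕ} (hT : V.erase a = T) {y : LE} (hy : y ∈ C (c + 1) V) (e : LE)
    (he : bd y = e) (hN : Nv a V e = e) :
    ∑ b ∈ T, dd a b y - e ∈ B c T := by
  have h1 := bd_Nv a V y
  rw [he, hN, hT] at h1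
  have : ∑ b ∈ T, dd a b y - e = bd (- Nv a V y) := by
    rw [map_neg, h1]; abel
  rw [this]
  exact bd_mem_B (Submodule.neg_mem _ (hT ▸ Nv_mem a hy))

theorem nonbd {c : ℕ} (hW : ∀ U : Finset ℕ, U.card = 3 * c + 1 → Well c U) {V : Finset ℕ} (hV : V.card = 3 * c + 4)
    {α β γ ρ : ℕ} {l : List ℕ} (hn : (α :: β :: γ :: ρ :: l).Nodup) (hm : ∀ v ∈ (α :: β :: γ :: ρ :: l), v ∈ V)
    (hl : l.length = 3 * c) : br α β γ * Ebr l ∉ B (c + 1) V := by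
  intro hB
  obtain ⟨y, hy, hby⟩ := mem_B.1 hB
  have hα := hm α (by simp)
  have hβ := hm β (by simp)
  have hγ := hm γ (by simp)
  have hρ := hm ρ (by simp)
  have hlV : ∀ v ∈ l, v ∈ V := fun v hv => hm v (by simp [hv])
  simp only [List.nodup_cons, List.mem_cons, not_or] at hn
  obtain ⟨⟨hαβ, hαγ, hαρ, hαl⟩, ⟨hβγ, hβρ, hβl⟩, ⟨hγρ, hγl⟩, hρl, hln⟩ := hn
  have hE : Ebr l ∈ C c l.toFinset :=
    (mem_Z.1 (Br_le_Z (Ebr_Br c l l.toFinset hl hln (by simp)))).1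
  set S := V \ {α, β} with hS
  have memS : ∀ v, v ∈ S ↔ v ∈ V ∧ v ≠ α ∧ v ≠ β := by intro v; simp [S]
  have hcyc : ∀ u ∈ S, dd α u (bd y) = 0 := by
    intro u hu
    have hu := (memS u).1 hu
    rw [hby, br, sub_mul, map_sub, dd_xm, dd_xm, dd_zero (V := l.toFinset) (by simpa using hαl) _ hE]
    rw [if_neg, if_neg]
    · simp
    · rw [Sym2.eq_iff]; rintro (⟨h, _⟩ | ⟨_, h⟩)
      · exact hαβ h.symm
      · exact hαγ h.symm
    · rw [Sym2.eq_iff]; rintro (⟨_, h⟩ | ⟨_, h⟩)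
      · exact hu.2.2 h.symm
      · exact hαβ h.symm
  have hcyc2 : ∀ u ∈ S, dd β u (bd y) = if u = γ then - Ebr l else 0 := by
    intro u hu
    have hu := (memS u).1 hu
    rw [hby, br, sub_mul, map_sub, dd_xm, dd_xm, dd_zero (V := l.toFinset) (by simpa using hβl) _ hE]
    rw [if_neg]
    · simp only [mul_zero, sub_zero, zero_sub]
      have : s(β, γ) = s(β, u) ↔ u = γ := by
        rw [Sym2.eq_iff]
        constructor
        · rintro (⟨_, h⟩ | ⟨h, _⟩)
          · exact h.symm
          · exact absurd h.symm hu.2.2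
        · rintro rfl; simp
      simp only [this]
      split_ifs <;> simp
    · rw [Sym2.eq_iff]; rintro (⟨h, _⟩ | ⟨h, _⟩)
      · exact hαβ h
      · exact hu.2.1 h.symm
  have hch : ∀ u z, ∃ a n, u ∈ S → z ∈ S → u ≠ z → (a, n) ∈ Gs (3 * c) (V \ {α, β, u, z}) ∧
      dd β z (dd α u y) - a ∈ B c (V \ {α, β, u, z}) := by
    intro u z
    by_cases h : u ∈ S ∧ z ∈ S ∧ u ≠ z
    · obtain ⟨hu, hz, huz⟩ := h
      have e1 : dd β z (dd α u y) ∈ Z c (V \ {α, β, u, z}) := by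
        rw [mem_Z]
        constructor
        · exact C_mono (by intro v; simp; tauto) (dd_mem β z (dd_mem α u hy))
        · rw [bd_dd, bd_dd, hcyc u hu]; simp
      have e2 : (V \ {α, β, u, z}).card = 3 * c := by
        have hu' := (memS u).1 hu
        have hz' := (memS z).1 hz
        rw [Finset.card_sdiff_of_subset (by simp [Finset.insert_subset_iff, hα, hβ, hu'.1, hz'.1]), hV]
        have : ({α, β, u, z} : Finset ℕ).card = 4 := by
          simp [Finset.card_insert_of_notMem, hαβ, Ne.symm hu'.2.1, Ne.symm hu'.2.2, Ne.symm hz'.2.1, Ne.symm hz'.2.2, huz]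
        omega
      obtain ⟨a, ha, w, hw, haw⟩ := Submodule.mem_sup.1 (generation c _ e2.ge e1)
      obtain ⟨⟨a', n⟩, han, haa⟩ := Br_Gs c _ ha
      have haa : a' = a := haa
      subst haa
      exact ⟨a', n, fun _ _ _ => ⟨han, by rw [← haw]; simpa using hw⟩⟩
    · exact ⟨0, 0, fun h1 h2 h3 => absurd ⟨h1, h2, h3⟩ h⟩
  choose a n han using hch
  have cardS : ∀ u ∈ S, (S.erase u).card = 3 * c + 1 := by
    intro u hu
    rw [Finset.card_erase_of_mem hu, Finset.card_sdiff_of_subset (by simp [Finset.insert_subset_iff, hα, hβ]), hV]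
    rw [Finset.card_pair hαβ]; omega
  have f1 : ∀ u ∈ S, ∃ w, ∑ z ∈ S.erase u, n u z * gen z = (3 : ℤ) • w := by
    intro u hu
    have hu' := (memS u).1 hu
    refine hW _ (cardS u hu) (∑ z ∈ S.erase u, a u z) _ ?_ ?_
    · have : (∑ z ∈ S.erase u, a u z, ∑ z ∈ S.erase u, n u z * gen z) = ∑ z ∈ S.erase u, (a u z, n u z * gen z) := by
        rw [prod_mk_sum]
      rw [this]
      refine Submodule.sum_mem _ fun z hz => ?_
      rw [Finset.mem_erase] at hz
      refine Gs_append (W := V \ {α, β, u, z}) (by simp) ?_ ?_ (han u z hu hz.2 hz.1.symm).1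
      · simp [hz]
      · intro v; simp [S]; tauto
    · have e : ∑ z ∈ S.erase u, a u z = (∑ z ∈ S.erase u, dd β z (dd α u y) - 0) - ∑ z ∈ S.erase u, (dd β z (dd α u y) - a u z) := by
        rw [Finset.sum_sub_distrib]; abel
      rw [e]
      refine Submodule.sub_mem _ (sum_dd_mem (V := V \ {α, u}) ?_ (dd_mem α u hy) 0 ?_ (map_zero _)) (Submodule.sum_mem _ fun z hz => ?_)
      · ext v; simp [S]; tauto
      · rw [bd_dd, hcyc u hu, neg_zero]
      · rw [Finset.mem_erase] at hz
        refine B_mono ?_ (han u z hu hz.2 hz.1.symm).2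
        intro v; simp [S]; tauto
  have f2 : ∀ z ∈ S, ∃ w, ∑ u ∈ S.erase z, n u z * gen u + (if z = γ then mon l * gen ρ else 0) = (3 : ℤ) • w := by
    intro z hz
    have hz' := (memS z).1 hz
    refine hW _ (cardS z hz) (∑ u ∈ S.erase z, a u z + (if z = γ then Ebr l else 0)) _ ?_ ?_
    · have : (∑ u ∈ S.erase z, a u z + (if z = γ then Ebr l else 0), ∑ u ∈ S.erase z, n u z * gen u + (if z = γ then mon l * gen ρ else 0))
        = ∑ u ∈ S.erase z, (a u z, n u z * gen u) + (if z = γ then (Ebr l, mon l * gen ρ) else 0) := by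
        split_ifs
        · rw [← Prod.mk_add_mk, prod_mk_sum]
        · rw [add_zero, add_zero, add_zero, prod_mk_sum]
      rw [this]
      refine Submodule.add_mem _ (Submodule.sum_mem _ fun u hu => ?_) ?_
      · rw [Finset.mem_erase] at hu
        refine Gs_append (W := V \ {α, β, u, z}) (by simp) ?_ ?_ (han u z hu.2 hz hu.1).1
        · simp [hu]
        · intro v; simp [S]; tauto
      · split_ifs with h
        · subst h
          refine Gs_append (W := l.toFinset) (by simpa using hρl) ?_ ?_ (mem_Gs hln hl (by simp))
          · simp [S, hρ, Ne.symm hγρ, Ne.symm hαρ, Ne.symm hβρ]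
          · intro v hv
            simp at hv
            simp only [Finset.mem_erase, memS]
            exact ⟨fun h => hγl (h ▸ hv), hlV v hv, fun h => hαl (h ▸ hv), fun h => hβl (h ▸ hv)⟩
        · exact Submodule.zero_mem _
    · have e : ∑ u ∈ S.erase z, a u z + (if z = γ then Ebr l else 0) =
          -(∑ u ∈ S.erase z, dd α u (dd β z y) - (if z = γ then Ebr l else 0)) - ∑ u ∈ S.erase z, (dd β z (dd α u y) - a u z) := by
        have : ∑ u ∈ S.erase z, dd α u (dd β z y) = - ∑ u ∈ S.erase z, dd β z (dd α u y) := by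
          rw [← Finset.sum_neg_distrib]
          exact Finset.sum_congr rfl fun u _ => dd_dd _ _ _ _ _
        rw [Finset.sum_sub_distrib, this]; abel
      rw [e]
      refine Submodule.sub_mem _ (Submodule.neg_mem _ (sum_dd_mem (V := V \ {β, z}) ?_ (dd_mem β z hy) _ ?_ ?_)) (Submodule.sum_mem _ fun u hu => ?_)
      · ext v; simp [S]; tauto
      · rw [bd_dd, hcyc2 z hz]; split_ifs <;> simp
      · split_ifs
        · exact (Rv_spare (q := 0) (by simpa using hαl) hE).2
        · simp
      · rw [Finset.mem_erase] at hu
        refine B_mono ?_ (han u z hu.2 hz hu.1).2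
        intro v; simp [S]; tauto
  have hγS : γ ∈ S := (memS γ).2 ⟨hγ, Ne.symm hαγ, Ne.symm hβγ⟩
  have f1' : ∃ w, ∑ u ∈ S, (∑ z ∈ S.erase u, n u z * gen z) * gen u = (3 : ℤ) • w := by
    choose! w hw using f1
    refine ⟨∑ u ∈ S, w u * gen u, ?_⟩
    rw [Finset.smul_sum]
    exact Finset.sum_congr rfl fun u hu => by rw [hw u hu, smul_mul_assoc]
  have f2' : ∃ w, ∑ z ∈ S, (∑ u ∈ S.erase z, n u z * gen u + (if z = γ then mon l * gen ρ else 0)) * gen z = (3 : ℤ) • w := by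
    choose! w hw using f2
    refine ⟨∑ u ∈ S, w u * gen u, ?_⟩
    rw [Finset.smul_sum]
    exact Finset.sum_congr rfl fun u hu => by rw [hw u hu, smul_mul_assoc]
  obtain ⟨w1, h1⟩ := f1'
  obtain ⟨w2, h2⟩ := f2'
  have e : ∑ u ∈ S, (∑ z ∈ S.erase u, n u z * gen z) * gen u + ∑ z ∈ S, (∑ u ∈ S.erase z, n u z * gen u + (if z = γ then mon l * gen ρ else 0)) * gen z
      = mon (l ++ [ρ, γ]) := by
    simp only [add_mul, Finset.sum_add_distrib, Finset.sum_mul, ite_mul, zero_mul]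
    rw [Finset.sum_ite_eq' S γ, if_pos hγS, sum_erase_swap S (fun u z => n u z * gen z * gen u), ← add_assoc,
      ← Finset.sum_add_distrib]
    have : ∑ i ∈ S, (∑ a ∈ S.erase i, n a i * gen i * gen a + ∑ i_1 ∈ S.erase i, n i_1 i * gen i_1 * gen i) = 0 := by
      refine Finset.sum_eq_zero fun i _ => ?_
      rw [← Finset.sum_add_distrib]
      refine Finset.sum_eq_zero fun j _ => ?_
      rw [mul_assoc, mul_assoc, ← mul_add, gen_anti i j]; simp
    rw [this, zero_add, mon_append, mon_cons, mon_cons, mon_nil, mul_one, mul_assoc]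
  refine mon_not_three (l ++ [ρ, γ]) ?_ (w1 + w2) ?_
  · rw [List.nodup_append]
    refine ⟨hln, by simp [Ne.symm hγρ], ?_⟩
    intro u hu v hv
    simp at hv
    rcases hv with rfl | rfl
    · rintro rfl; exact hρl hu
    · rintro rfl; exact hγl hu
  · rw [← e, h1, h2, smul_add]

end MC

set_option synthInstance.maxHeartbeats 20000
set_option maxHeartbeats 400000
set_option linter.all false

namespace MC

/-- The abstract criterion. -/
theorem well_of {c : ℕ} {U : Finset ℕ} (hU : U.card = 3 * c + 1) (K : Submodule ℤ LE) (hBK : B c U ≤ K)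
    (hsw : ∀ p l : List ℕ, ∀ a b : ℕ, (p ++ a :: b :: l).Nodup → (∀ v ∈ p ++ a :: b :: l, v ∈ U) →
      (p ++ a :: b :: l).length = 3 * c + 1 → Ebr (p ++ a :: b :: l) + Ebr (p ++ b :: a :: l) ∈ K)
    (h3 : ∀ l : List ℕ, l.Nodup → (∀ v ∈ l, v ∈ U) → l.length = 3 * c + 1 → (3 : ℤ) • Ebr l ∈ K)
    (hK : ∃ l : List ℕ, l.Nodup ∧ (∀ v ∈ l, v ∈ U) ∧ l.length = 3 * c + 1 ∧ Ebr l ∉ K) : Well c U := by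
  obtain ⟨l0, hn0, hm0, hl0, hK0⟩ := hK
  have perm : ∀ l1 l2 : List ℕ, l1.Perm l2 → ∀ p : List ℕ, (p ++ l1).Nodup → (∀ v ∈ p ++ l1, v ∈ U) →
      (p ++ l1).length = 3 * c + 1 → ∃ k : ℤ, Ebr (p ++ l1) - k • Ebr (p ++ l2) ∈ K ∧ mon (p ++ l1) = k • mon (p ++ l2) := by
    intro l1 l2 h
    induction h with
    | nil => intro p _ _ _; exact ⟨1, by simp, by simp⟩
    | @cons a l1 l2 h ih =>
      intro p h1 h2 h3
      have e : ∀ l : List ℕ, p ++ a :: l = (p ++ [a]) ++ l := by intro l; simp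
      rw [e l1] at h1 h2 h3 ⊢
      rw [e l2]
      exact ih _ h1 h2 h3
    | swap a b l =>
      intro p h1 h2 h3
      refine ⟨-1, ?_, ?_⟩
      · simpa using hsw p l b a h1 h2 h3
      · rw [mon_swap]; simp
    | @trans l1 l2 l3 h h' ih ih' =>
      intro p h1 h2 h3
      have hp : (p ++ l1).Perm (p ++ l2) := h.append_left p
      obtain ⟨k, hk, hk'⟩ := ih p h1 h2 h3
      obtain ⟨m, hm, hm'⟩ := ih' p (hp.nodup_iff.1 h1) (fun v hv => h2 v (hp.mem_iff.2 hv)) (hp.length_eq ▸ h3)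
      refine ⟨k * m, ?_, ?_⟩
      · have := Submodule.add_mem _ hk (Submodule.smul_mem _ k hm)
        convert this using 1
        rw [smul_sub, mul_smul]; abel
      · rw [hk', hm', mul_smul]
  have huniv : ∀ l : List ℕ, l.Nodup → (∀ v ∈ l, v ∈ U) → l.length = 3 * c + 1 → l.toFinset = U := by
    intro l h1 h2 h3
    refine Finset.eq_of_subset_of_card_le (fun v hv => h2 v (by simpa using hv)) ?_
    rw [List.toFinset_card_of_nodup h1, h3, hU]
  have key : ∀ w ∈ Gs (3 * c + 1) U, ∃ k : ℤ, w.1 - k • Ebr l0 ∈ K ∧ w.2 = k • mon l0 := by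
    intro w hw
    rw [Gs] at hw
    induction hw using Submodule.span_induction with
    | mem w hw =>
      obtain ⟨l, h1, h2, h3, rfl⟩ := hw
      have hp : l.Perm l0 := by
        refine List.perm_of_nodup_nodup_toFinset_eq h1 hn0 ?_
        rw [huniv l h1 h3 h2, huniv l0 hn0 hm0 hl0]
      exact perm l l0 hp [] h1 h3 h2
    | zero => exact ⟨0, by simp, by simp⟩
    | add u v _ _ hu hv =>
      obtain ⟨k, hk, hk'⟩ := hu
      obtain ⟨m, hm, hm'⟩ := hv
      refine ⟨k + m, ?_, ?_⟩
      · have := Submodule.add_mem _ hk hm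
        convert this using 1
        rw [add_smul, Prod.fst_add]; abel
      · rw [Prod.snd_add, hk', hm', add_smul]
    | smul t u _ hu =>
      obtain ⟨k, hk, hk'⟩ := hu
      refine ⟨t * k, ?_, ?_⟩
      · have := Submodule.smul_mem _ t hk
        convert this using 1
        rw [mul_smul, Prod.smul_fst, smul_sub]
      · rw [Prod.smul_snd, hk', mul_smul]
  intro a m ham ha
  obtain ⟨k, hk, hk'⟩ := key _ ham
  have hk' : m = _ := hk'
  have hk1 : k • Ebr l0 ∈ K := by
    have := Submodule.sub_mem _ (hBK ha) hk
    simpa using this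
  have h30 := h3 l0 hn0 hm0 hl0
  have hd : (3 : ℤ) ∣ k := by
    by_contra hd
    have hcop : IsCoprime (3 : ℤ) k := (Int.prime_three.coprime_iff_not_dvd).2 hd
    obtain ⟨s, t, hst⟩ := hcop
    refine hK0 ?_
    have := Submodule.add_mem _ (Submodule.smul_mem _ s h30) (Submodule.smul_mem _ t hk1)
    rw [← mul_smul, ← mul_smul, ← add_smul, hst, one_smul] at this
    exact this
  obtain ⟨j, rfl⟩ := hd
  exact ⟨j • mon l0, by rw [hk', mul_smul]⟩

/-! Swapping letters. -/

theorem swap_win {k : ℕ} {U : Finset ℕ} (t : Fin 7 → ℕ) (m : List ℕ) (hm : m.length = 3 * k)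
    (hn : (t 0 :: t 1 :: t 2 :: t 3 :: t 4 :: t 5 :: t 6 :: m).Nodup)
    (hU : ∀ v ∈ (t 0 :: t 1 :: t 2 :: t 3 :: t 4 :: t 5 :: t 6 :: m), v ∈ U) (i : Fin 6) :
    PP (t ∘ Equiv.swap i.castSucc i.succ) (Ebr m) + PP t (Ebr m) ∈ B (k + 2) U := by
  have e : (t 0 :: t 1 :: t 2 :: t 3 :: t 4 :: t 5 :: t 6 :: m) = List.ofFn t ++ m := by simp [List.ofFn_succ]
  rw [e] at hn hU
  rw [List.nodup_append] at hn
  have ht : ∀ i, t i ∈ List.ofFn t := fun i => by rw [List.mem_ofFn]; exact ⟨i, rfl⟩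
  refine PP_swap (W := m.toFinset) (Br_le_Z (Ebr_Br k m _ hm hn.2.1 (by simp))) ?_ (List.nodup_ofFn.1 hn.1) ?_ ?_ i
  · intro v hv; exact hU v (List.mem_append_right _ (by simpa using hv))
  · intro i; exact hU _ (List.mem_append_left _ (ht i))
  · intro i hi; exact hn.2.2 _ (ht i) _ (by simpa using hi) rfl

theorem Ebr_swap (c : ℕ) : ∀ (U : Finset ℕ) (p l : List ℕ) (a b : ℕ), (p ++ a :: b :: l).Nodup →
    (∀ v ∈ p ++ a :: b :: l, v ∈ U) → (p ++ a :: b :: l).length = 3 * (c + 2) + 1 →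
    Ebr (p ++ a :: b :: l) + Ebr (p ++ b :: a :: l) ∈ B (c + 2) U := by
  have small : ∀ (c : ℕ) (U : Finset ℕ) (m : List ℕ) (t0 t1 t2 t3 t4 t5 t6 : ℕ), m.length = 3 * c →
      (t0 :: t1 :: t2 :: t3 :: t4 :: t5 :: (m ++ [t6])).Nodup →
      (∀ v ∈ (t0 :: t1 :: t2 :: t3 :: t4 :: t5 :: (m ++ [t6])), v ∈ U) → ∀ i : Fin 6,
      PP (![t0, t1, t2, t3, t4, t5, t6] ∘ Equiv.swap i.castSucc i.succ) (Ebr m) +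
       PP ![t0, t1, t2, t3, t4, t5, t6] (Ebr m) ∈ B (c + 2) U := by
    intro c U m t0 t1 t2 t3 t4 t5 t6 hm hn hU i
    have hp : (t0 :: t1 :: t2 :: t3 :: t4 :: t5 :: (m ++ [t6])).Perm (t0 :: t1 :: t2 :: t3 :: t4 :: t5 :: t6 :: m) := by
      refine .cons _ (.cons _ (.cons _ (.cons _ (.cons _ (.cons _ ?_)))))
      exact List.perm_append_singleton _ _
    exact swap_win ![t0, t1, t2, t3, t4, t5, t6] m hm (hp.nodup_iff.1 hn) (fun v hv => hU v (hp.mem_iff.2 hv)) i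
  have last : ∀ l : List ℕ, l ≠ [] → ∃ m r, l = m ++ [r] := fun l hl =>
    ⟨l.dropLast, l.getLast hl, (List.dropLast_append_getLast hl).symm⟩
  induction c with
  | zero =>
    intro U p l a b hn hU hl
    have h7 : ∀ t0 t1 t2 t3 t4 t5 t6 : ℕ, [t0, t1, t2, t3, t4, t5, t6].Nodup → (∀ v ∈ [t0, t1, t2, t3, t4, t5, t6], v ∈ U) → ∀ i : Fin 6,
        PP (![t0, t1, t2, t3, t4, t5, t6] ∘ Equiv.swap i.castSucc i.succ) 1 + PP ![t0, t1, t2, t3, t4, t5, t6] 1 ∈ B 2 U :=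
      fun t0 t1 t2 t3 t4 t5 t6 h1 h2 i => small 0 U [] t0 t1 t2 t3 t4 t5 t6 rfl h1 h2 i
    rw [add_comm (Ebr _) (Ebr _)]
    match p, l, hn, hU, hl with
    | [], [t2, t3, t4, t5, t6], hn, hU, hl => exact h7 _ _ _ _ _ _ _ hn hU 0
    | [t0], [t3, t4, t5, t6], hn, hU, hl => exact h7 _ _ _ _ _ _ _ hn hU 1
    | [t0, t1], [t4, t5, t6], hn, hU, hl => exact h7 _ _ _ _ _ _ _ hn hU 2
    | [t0, t1, t2], [t5, t6], hn, hU, hl => exact h7 _ _ _ _ _ _ _ hn hU 3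
    | [t0, t1, t2, t3], [t6], hn, hU, hl => exact h7 _ _ _ _ _ _ _ hn hU 4
    | [t0, t1, t2, t3, t4], [], hn, hU, hl => exact h7 _ _ _ _ _ _ _ hn hU 5
    | _ :: _ :: _ :: _ :: _ :: _ :: _, l, hn, hU, hl => simp at hl; omega
  | succ c ih =>
    intro U p l a b hn hU hl
    match p, l, hn, hU, hl with
    | u :: v :: w :: p, l, hn, hU, hl =>
      show br u v w * Ebr (p ++ a :: b :: l) + br u v w * Ebr (p ++ b :: a :: l) ∈ _
      rw [← mul_add]
      have hn' : (u :: v :: w :: (p ++ a :: b :: l)).Nodup := hn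
      simp only [List.nodup_cons, List.mem_cons, not_or] at hn'
      obtain ⟨⟨h1, h2, h3⟩, ⟨h4, h5⟩, h6, h7⟩ := hn'
      refine br_mul_B (hU u (by simp)) (hU v (by simp)) (hU w (by simp)) h1 h4
        (ih (U \ {u, v, w}) p l a b h7 ?_ (by simp at hl ⊢; omega)) (le_refl _)
      intro y hy
      simp only [Finset.mem_sdiff, Finset.mem_insert, Finset.mem_singleton, not_or]
      exact ⟨hU y (List.mem_cons_of_mem _ (List.mem_cons_of_mem _ (List.mem_cons_of_mem _ hy))), fun h => h3 (h ▸ hy), fun h => h5 (h ▸ hy), fun h => h6 (h ▸ hy)⟩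
    | [], t2 :: t3 :: t4 :: t5 :: l, hn, hU, hl =>
      obtain ⟨m, r, rfl⟩ := last l (by rintro rfl; simp at hl; omega)
      have hm : m.length = 3 * (c + 1) := by simp at hl; omega
      have := small (c + 1) U m a b t2 t3 t4 t5 r hm hn hU 0
      rw [← Ebr_append _ m r hm] at this
      rw [add_comm (Ebr _) (Ebr _)]; exact this
    | [t0], t3 :: t4 :: t5 :: l, hn, hU, hl =>
      obtain ⟨m, r, rfl⟩ := last l (by rintro rfl; simp at hl; omega)
      have hm : m.length = 3 * (c + 1) := by simp at hl; omega
      have := small (c + 1) U m t0 a b t3 t4 t5 r hm hn hU 1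
      rw [← Ebr_append _ m r hm] at this
      rw [add_comm (Ebr _) (Ebr _)]; exact this
    | [t0, t1], t4 :: t5 :: l, hn, hU, hl =>
      obtain ⟨m, r, rfl⟩ := last l (by rintro rfl; simp at hl; omega)
      have hm : m.length = 3 * (c + 1) := by simp at hl; omega
      have := small (c + 1) U m t0 t1 a b t4 t5 r hm hn hU 2
      rw [← Ebr_append _ m r hm] at this
      rw [add_comm (Ebr _) (Ebr _)]; exact this
    | [], [t1], hn, hU, hl => simp at hl; omega

theorem split_last {n : ℕ} (l : List ℕ) (hl : l.length = n + 1) : ∃ m r, l = m ++ [r] ∧ m.length = n := by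
  have hne : l ≠ [] := by rintro rfl; simp at hl
  refine ⟨l.dropLast, l.getLast hne, (List.dropLast_append_getLast hne).symm, by simp [hl]⟩

/-- Existence of an enumerating list. -/
theorem enum (U : Finset ℕ) : ∃ l : List ℕ, l.Nodup ∧ l.length = U.card ∧ ∀ v ∈ l, v ∈ U :=
  ⟨U.toList, U.nodup_toList, U.length_toList, fun v hv => by simpa using hv⟩

theorem well_step {c : ℕ} (hW : ∀ U : Finset ℕ, U.card = 3 * (c + 1) + 1 → Well (c + 1) U) (U : Finset ℕ)
    (hU : U.card = 3 * (c + 2) + 1) : Well (c + 2) U := by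
  refine well_of hU (B (c + 2) U) le_rfl (fun p l a b h1 h2 h3 => Ebr_swap c U p l a b h1 h2 h3) ?_ ?_
  · intro l h1 h2 h3
    obtain ⟨m, r, rfl, hm⟩ := split_last l h3
    rw [Ebr_append _ m r hm]
    rw [List.nodup_append] at h1
    exact exp_one (by omega) (Br_le_Z (Ebr_Br _ m U hm h1.1 fun v hv => h2 v (by simp [hv])))
  · obtain ⟨l, h1, h2, h3⟩ := enum U
    refine ⟨l, h1, h3, by omega, ?_⟩
    match l, h1, h2, h3 with
    | a :: b :: d :: l, h1, h2, h3 =>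
      obtain ⟨m, r, rfl, hm⟩ := split_last (n := 3 * (c + 1)) l (by simp at h2; omega)
      show br a b d * Ebr (m ++ [r]) ∉ _
      rw [Ebr_append _ m r hm]
      have hp : (a :: b :: d :: (m ++ [r])).Perm (a :: b :: d :: r :: m) :=
        .cons _ (.cons _ (.cons _ (List.perm_append_singleton _ _)))
      exact nonbd (ρ := r) hW (by omega) (hp.nodup_iff.1 h1) (fun v hv => h3 v (hp.mem_iff.2 hv)) hm
    | [], h1, h2, h3 => simp at h2; omega
    | [_], h1, h2, h3 => simp at h2; omega
    | [_, _], h1, h2, h3 => simp at h2; omega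

/-! Base case. -/

def tab : Fin 4 → Fin 4 → ZMod 3 := ![![0, 0, 1, 2], ![0, 0, 2, 1], ![1, 2, 0, 0], ![2, 1, 0, 0]]

theorem tab_symm : ∀ i j, tab i j = tab j i := by decide
theorem tab_tri : ∀ i j k, i ≠ j → i ≠ k → j ≠ k → tab i j + tab j k + tab i k = 0 := by
  have h : ∀ i j k : Fin 4, i = j ∨ i = k ∨ j = k ∨ tab i j + tab j k + tab i k = 0 := by decide
  intro i j k h1 h2 h3; have := h i j k; simpa [h1, h2, h3] using this
theorem tab_star : ∀ i j k l, i ≠ j → i ≠ k → i ≠ l → j ≠ k → j ≠ l → k ≠ l → tab i j + tab i k + tab i l = 0 := by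
  have h : ∀ i j k l : Fin 4, i = j ∨ i = k ∨ i = l ∨ j = k ∨ j = l ∨ k = l ∨ tab i j + tab i k + tab i l = 0 := by decide
  intro i j k l h1 h2 h3 h4 h5 h6; have := h i j k l; simpa [h1, h2, h3, h4, h5, h6] using this
theorem tab_opp : ∀ i j k l, i ≠ j → i ≠ k → i ≠ l → j ≠ k → j ≠ l → k ≠ l → tab i j = tab k l := by
  have h : ∀ i j k l : Fin 4, i = j ∨ i = k ∨ i = l ∨ j = k ∨ j = l ∨ k = l ∨ tab i j = tab k l := by decide
  intro i j k l h1 h2 h3 h4 h5 h6; have := h i j k l; simpa [h1, h2, h3, h4, h5, h6] using this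

theorem well_one (U : Finset ℕ) (hU : U.card = 4) : Well 1 U := by
  obtain ⟨l, hl1, hl2, hl3⟩ := enum U
  rw [hU] at hl2
  obtain ⟨u0, u1, u2, u3, rfl⟩ : ∃ a b c d, l = [a, b, c, d] := by
    match l, hl2 with
    | [a, b, c, d], _ => exact ⟨a, b, c, d, rfl⟩
  have hUeq : ∀ v, v ∈ U ↔ v = u0 ∨ v = u1 ∨ v = u2 ∨ v = u3 := by
    have : [u0, u1, u2, u3].toFinset = U := Finset.eq_of_subset_of_card_le
      (fun v hv => hl3 v (by simpa using hv)) (by rw [List.toFinset_card_of_nodup hl1, hU]; simp)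
    intro v; rw [← this]; simp
  let idx : ℕ → Fin 4 := fun v => if v = u0 then 0 else if v = u1 then 1 else if v = u2 then 2 else 3
  simp only [List.nodup_cons, List.mem_cons, not_or, List.not_mem_nil, not_false_eq_true, and_true, List.nodup_nil] at hl1
  obtain ⟨⟨h01, h02, h03⟩, ⟨h12, h13⟩, h23⟩ := hl1
  have i0 : idx u0 = 0 := by simp [idx]
  have i1 : idx u1 = 1 := by simp [idx, Ne.symm h01]
  have i2 : idx u2 = 2 := by simp [idx, Ne.symm h02, Ne.symm h12]
  have i3 : idx u3 = 3 := by simp [idx, Ne.symm h03, Ne.symm h13, Ne.symm h23]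
  have inj : ∀ v ∈ U, ∀ w ∈ U, v ≠ w → idx v ≠ idx w := by
    intro v hv w hw hvw h
    rw [hUeq] at hv hw
    rcases hv with rfl | rfl | rfl | rfl <;> rcases hw with rfl | rfl | rfl | rfl <;>
      first
      | exact hvw rfl
      | (rw [i0, i1] at h; revert h; decide)
      | (rw [i0, i2] at h; revert h; decide)
      | (rw [i0, i3] at h; revert h; decide)
      | (rw [i1, i2] at h; revert h; decide)
      | (rw [i1, i3] at h; revert h; decide)
      | (rw [i2, i3] at h; revert h; decide)
      | (rw [i1, i0] at h; revert h; decide)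
      | (rw [i2, i0] at h; revert h; decide)
      | (rw [i3, i0] at h; revert h; decide)
      | (rw [i2, i1] at h; revert h; decide)
      | (rw [i3, i1] at h; revert h; decide)
      | (rw [i3, i2] at h; revert h; decide)
  let f : Sym2 ℕ → ℤ := Sym2.lift ⟨fun a b => ((tab (idx a) (idx b)).val : ℤ), fun a b => by show ((tab (idx a) (idx b)).val : ℤ) = ((tab (idx b) (idx a)).val : ℤ); rw [tab_symm]⟩
  have hf : ∀ a b, ((f s(a, b) : ℤ) : ZMod 3) = tab (idx a) (idx b) := by
    intro a b; simp [f]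
  let φ : LE →ₗ[ℤ] ZMod 3 :=
    (((Int.castRingHom (ZMod 3)).toAddMonoidHom.comp (sc : LE →+* ℤ).toAddMonoidHom).comp (D f).toAddMonoidHom).toIntLinearMap
  have hφ : ∀ a b, φ (x a b) = tab (idx a) (idx b) := by
    intro a b
    rw [← hf]
    show ((sc (D f (gen s(a, b))) : ℤ) : ZMod 3) = _
    rw [D_gen, map_zsmul, map_one]; simp
  have hφb : ∀ a b c, φ (br a b c) = tab (idx a) (idx b) - tab (idx b) (idx c) := by
    intro a b c; rw [br, map_sub, hφ, hφ]
  refine well_of hU (LinearMap.ker φ) ?_ ?_ ?_ ?_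
  · intro z hz
    obtain ⟨w, hw, rfl⟩ := mem_B.1 hz
    have : C 2 U ≤ (LinearMap.ker φ).comap bd := by
      refine C_succ_le fun a b z ha hb hab hz => ?_
      have : C 1 (U \ {a, b}) ≤ ((LinearMap.ker φ).comap bd).comap (LinearMap.mulLeft ℤ (x a b)) := by
        refine C_succ_le fun c d z hc hd hcd hz => ?_
        have : C 0 ((U \ {a, b}) \ {c, d}) ≤ (((LinearMap.ker φ).comap bd).comap (LinearMap.mulLeft ℤ (x a b))).comap (LinearMap.mulLeft ℤ (x c d)) := by
          refine C_zero_le ?_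
          simp only [Finset.mem_sdiff, Finset.mem_insert, Finset.mem_singleton, not_or] at hc hd
          show φ (bd (x a b * (x c d * 1))) = 0
          rw [mul_one, bd_x_mul, bd_x, mul_one, map_sub, hφ, hφ, sub_eq_zero]
          refine (tab_opp _ _ _ _ ?_ ?_ ?_ ?_ ?_ ?_).symm
          · exact inj a ha b hb hab
          · exact inj a ha c hc.1 (Ne.symm hc.2.1)
          · exact inj a ha d hd.1 (Ne.symm hd.2.1)
          · exact inj b hb c hc.1 (Ne.symm hc.2.2)
          · exact inj b hb d hd.1 (Ne.symm hd.2.2)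
          · exact inj c hc.1 d hd.1 hcd
        exact this hz
      exact this hz
    exact this hw
  · intro p l a b hn hm hl
    have three : ∀ s t u : ZMod 3, s + t + u = 0 → s - t + (s - u) = 0 := by decide
    match p, l, hn, hm, hl with
    | [], [c, d], hn, hm, hl =>
      show φ (br a b c * 1 + br b a c * 1) = 0
      simp at hn hm
      rw [mul_one, mul_one, map_add, hφb, hφb, tab_symm (idx b) (idx a)]
      exact three _ _ _ (tab_tri _ _ _ (inj a hm.1 b hm.2.1 hn.1.1) (inj a hm.1 c hm.2.2.1 hn.1.2.1) (inj b hm.2.1 c hm.2.2.1 hn.2.1.1))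
    | [c], [d], hn, hm, hl =>
      show φ (br c a b * 1 + br c b a * 1) = 0
      simp at hn hm
      have := tab_tri _ _ _ (inj c hm.1 a hm.2.1 hn.1.1) (inj c hm.1 b hm.2.2.1 hn.1.2.1) (inj a hm.2.1 b hm.2.2.1 hn.2.1.1)
      rw [mul_one, mul_one, map_add, hφb, hφb, tab_symm (idx b) (idx a)]
      have h3 : ∀ s t u : ZMod 3, s + t + u = 0 → s - t + (u - t) = 0 := by decide
      exact h3 _ _ _ this
    | [c, d], [], hn, hm, hl =>
      show φ (br c d a * 1 + br c d b * 1) = 0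
      simp at hn hm
      rw [mul_one, mul_one, map_add, hφb, hφb, tab_symm (idx c) (idx d)]
      refine three _ _ _ (tab_star _ _ _ _ ?_ ?_ ?_ ?_ ?_ ?_)
      · exact inj d hm.2.1 c hm.1 (Ne.symm hn.1.1)
      · exact inj d hm.2.1 a hm.2.2.1 hn.2.1.1
      · exact inj d hm.2.1 b hm.2.2.2 hn.2.1.2
      · exact inj c hm.1 a hm.2.2.1 hn.1.2.1
      · exact inj c hm.1 b hm.2.2.2 hn.1.2.2
      · exact inj a hm.2.2.1 b hm.2.2.2 hn.2.2
    | _ :: _ :: _ :: _, l, hn, hm, hl => simp at hl; omega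
  · intro l _ _ _
    rw [LinearMap.mem_ker, map_smul]
    have : ∀ s : ZMod 3, (3 : ℤ) • s = 0 := by decide
    exact this _
  · refine ⟨[u0, u1, u2, u3], ?_, hl3, rfl, ?_⟩
    · simp [*]
    · rw [LinearMap.mem_ker]
      show φ (br u0 u1 u2 * 1) ≠ 0
      rw [mul_one, hφb, i0, i1, i2]; decide

theorem well_all (c : ℕ) : ∀ U : Finset ℕ, U.card = 3 * (c + 1) + 1 → Well (c + 1) U := by
  induction c with
  | zero => intro U hU; exact well_one U hU
  | succ c ih => intro U hU; exact well_step ih U hU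

/-- The main nontriviality statement. -/
theorem nontriv (c : ℕ) {V : Finset ℕ} (hV : V.card = 3 * (c + 2) + 1) {r : ℕ} (hr : r ∈ V) {l : List ℕ}
    (hn : l.Nodup) (hl : l.length = 3 * (c + 2)) (hm : ∀ v ∈ l, v ∈ V.erase r) : Ebr l ∉ B (c + 2) V := by
  match l, hn, hl, hm with
  | a :: b :: d :: l, hn, hl, hm =>
    show br a b d * Ebr l ∉ _
    have hp : (a :: b :: d :: r :: l).Perm (r :: a :: b :: d :: l) := by
      refine .trans (.cons _ (.cons _ (.swap _ _ _))) (.trans (.cons _ (.swap _ _ _)) (.swap _ _ _))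
    refine nonbd (c := c + 1) (ρ := r) (well_all c) (by omega) ?_ ?_ (by simp at hl; omega)
    · rw [hp.nodup_iff, List.nodup_cons]
      exact ⟨fun h => by simpa using hm r h, hn⟩
    · intro v hv
      rw [hp.mem_iff, List.mem_cons] at hv
      rcases hv with rfl | hv
      · exact hr
      · exact Finset.mem_of_mem_erase (hm v hv)

end MC

set_option synthInstance.maxHeartbeats 20000
set_option maxHeartbeats 400000
set_option linter.all false

namespace MC

/-! ## The pairing on the exterior algebra -/

theorem D_add {E : Type} (f g : E → ℤ) : D (f + g) = D f + D g := by
  ext z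
  induction z using Lam_ind with
  | h1 => simp [D_one]
  | ha u v hu hv => rw [map_add, hu, hv, map_add]
  | hn u hu => rw [map_neg, hu, map_neg]
  | hg e z hz =>
    rw [D_gen_mul, hz, LinearMap.add_apply, LinearMap.add_apply, D_gen_mul, D_gen_mul, mul_add, Pi.add_apply, add_smul]
    abel

/-- Contraction by a general element. -/
noncomputable def kap {E : Type} : Lam E →+* (Module.End ℤ (Lam E))ᵐᵒᵖ :=
  (ExteriorAlgebra.lift ℤ (A := (Module.End ℤ (Lam E))ᵐᵒᵖ)
    ⟨AddMonoidHom.toIntLinearMap (AddMonoidHom.mk' (fun m : E →₀ ℤ => MulOpposite.op (D (E := E) m)) (by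
      intro a b
      rw [← MulOpposite.op_add, Finsupp.coe_add, D_add])), by
      intro m
      show MulOpposite.op (D (E := E) m) * MulOpposite.op (D (E := E) m) = 0
      rw [← MulOpposite.op_mul]
      have : D (E := E) m * D (E := E) m = 0 := by
        ext z; exact D_D _ z
      rw [this]; rfl⟩).toRingHom

theorem kap_gen {E : Type} (e : E) : kap (gen e) = MulOpposite.op (D (E := E) (Finsupp.single e (1 : ℤ))) := by
  have := ExteriorAlgebra.lift_ι_apply (R := ℤ) (A := (Module.End ℤ (Lam E))ᵐᵒᵖ)
    (AddMonoidHom.toIntLinearMap (AddMonoidHom.mk' (fun m : E →₀ ℤ => MulOpposite.op (D (E := E) m)) (by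
      intro a b
      rw [← MulOpposite.op_add, Finsupp.coe_add, D_add]))) (by
      intro m
      show MulOpposite.op (D (E := E) m) * MulOpposite.op (D (E := E) m) = 0
      rw [← MulOpposite.op_mul]
      have : D (E := E) m * D (E := E) m = 0 := by
        ext z; exact D_D _ z
      rw [this]; rfl) (Finsupp.single e (1 : ℤ))
  exact this

/-- The pairing. -/
noncomputable def pr : LE →+ LE →+ ℤ :=
  AddMonoidHom.mk' (fun z => ((sc : LE →+* ℤ).toAddMonoidHom).comp (LinearMap.toAddMonoidHom (MulOpposite.unop (kap z)))) (by
    intro a b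
    ext y
    show sc (MulOpposite.unop (kap (a + b)) y) = sc _ + sc _
    rw [map_add, MulOpposite.unop_add, LinearMap.add_apply, map_add]; rfl)

theorem pr_x_left (a b : ℕ) (z y : LE) : pr (x a b * z) y = pr z (dd a b y) := by
  show sc (MulOpposite.unop (kap (x a b * z)) y) = sc (MulOpposite.unop (kap z) (dd a b y))
  rw [map_mul, x, kap_gen]
  show sc (MulOpposite.unop (kap z) (D _ y)) = _
  have : (⇑(Finsupp.single s(a, b) (1 : ℤ))) = fun e => if e = s(a, b) then 1 else 0 := by
    ext e; rw [Finsupp.single_apply]; simp [eq_comm]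
  rw [this]; rfl

theorem pr_one (y : LE) : pr 1 y = sc y := by
  show sc (MulOpposite.unop (kap 1) y) = _
  rw [map_one]; rfl

theorem sc_x_mul (a b : ℕ) (z : LE) : sc (x a b * z) = 0 := by
  rw [map_mul, x, sc_gen, zero_mul]

theorem LE_ind {P : LE → Prop} (h1 : P 1) (ha : ∀ u v, P u → P v → P (u + v))
    (hn : ∀ u, P u → P (-u)) (hg : ∀ a b z, P z → P (x a b * z)) (z : LE) : P z :=
  Lam_ind h1 ha hn (fun e z hz => by induction e using Sym2.ind with | _ a b => exact hg a b z hz) z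

theorem pr_x_right (a b : ℕ) (z y : LE) : pr z (x a b * y) = pr (dd a b z) y := by
  induction z using LE_ind generalizing y with
  | h1 => rw [pr_one, sc_x_mul, dd_one]; simp
  | ha u v hu hv => rw [map_add, map_add, map_add, AddMonoidHom.add_apply, AddMonoidHom.add_apply, hu, hv]
  | hn u hu => rw [map_neg, map_neg, map_neg, AddMonoidHom.neg_apply, AddMonoidHom.neg_apply, hu]
  | hg c d z hz =>
    rw [pr_x_left, dd_xm, dd_xm, map_sub, map_sub, hz, AddMonoidHom.sub_apply, pr_x_left]
    congr 1
    by_cases h : s(a, b) = s(c, d)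
    · rw [if_pos h, if_pos h.symm]
    · rw [if_neg h, if_neg (Ne.symm h)]; simp

theorem pr_comm (z y : LE) : pr z y = pr y z := by
  induction z using LE_ind generalizing y with
  | h1 =>
    induction y using LE_ind with
    | h1 => rfl
    | ha u v hu hv => rw [map_add, map_add, AddMonoidHom.add_apply, hu, hv]
    | hn u hu => rw [map_neg, map_neg, AddMonoidHom.neg_apply, hu]
    | hg a b z hz => rw [pr_x_right, pr_x_left, dd_one]; simp
  | ha u v hu hv => rw [map_add, map_add, AddMonoidHom.add_apply, hu, hv]
  | hn u hu => rw [map_neg, map_neg, AddMonoidHom.neg_apply, hu]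
  | hg a b z hz => rw [pr_x_right, pr_x_left, hz]

theorem pr_sum_left {ι : Type} (s : Finset ι) (f : ι → LE) (y : LE) : pr (∑ i ∈ s, f i) y = ∑ i ∈ s, pr (f i) y := by
  rw [map_sum, AddMonoidHom.finset_sum_apply]

theorem pr_sum_right {ι : Type} (s : Finset ι) (f : ι → LE) (y : LE) : pr y (∑ i ∈ s, f i) = ∑ i ∈ s, pr y (f i) := map_sum _ _ _

theorem pr_smul_left (k : ℤ) (z y : LE) : pr (k • z) y = k * pr z y := by
  rw [map_zsmul, AddMonoidHom.zsmul_apply, smul_eq_mul]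
theorem pr_smul_right (k : ℤ) (z y : LE) : pr z (k • y) = k * pr z y := by
  rw [map_zsmul, smul_eq_mul]
theorem pr_sub_left (z z' y : LE) : pr (z - z') y = pr z y - pr z' y := by
  rw [map_sub, AddMonoidHom.sub_apply]
theorem pr_add_left (z z' y : LE) : pr (z + z') y = pr z y + pr z' y := by
  rw [map_add, AddMonoidHom.add_apply]
theorem pr_neg_left (z y : LE) : pr (-z) y = - pr z y := by
  rw [map_neg, AddMonoidHom.neg_apply]
theorem pr_zero_left (y : LE) : pr 0 y = 0 := by simp

theorem C_empty (c : ℕ) (z : LE) (hz : z ∈ C (c + 1) ∅) : z = 0 := by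
  have : C (c + 1) ∅ ≤ ⊥ := C_succ_le fun a b z ha => by simp at ha
  simpa using this hz

theorem C_small {c : ℕ} {V : Finset ℕ} (h : V.card < 2 * c) {z : LE} (hz : z ∈ C c V) : z = 0 := by
  induction c generalizing V z with
  | zero => omega
  | succ c ih =>
    have : C (c + 1) V ≤ ⊥ := by
      refine C_succ_le fun a b z ha hb hab hz => ?_
      have h2 : ({a, b} : Finset ℕ) ⊆ V := by
        intro v hv; simp at hv; rcases hv with rfl | rfl <;> assumption
      have := Finset.card_sdiff_of_subset h2
      rw [Finset.card_pair hab] at this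
      have h3 := Finset.card_le_card h2
      rw [Finset.card_pair hab] at h3
      rw [ih (V := V \ {a, b}) (by omega) hz, mul_zero]; exact Submodule.zero_mem _
    simpa using this hz

/-- Divisibility criterion: if all pairings are divisible by `m` then so is the chain. -/
theorem div_crit (m : ℤ) {c : ℕ} {V : Finset ℕ} {y : LE} (hy : y ∈ C c V)
    (h : ∀ z ∈ C c V, m ∣ pr z y) : ∃ y' ∈ C c V, y = m • y' := by
  induction c generalizing V y with
  | zero =>
    obtain ⟨k, rfl⟩ := Submodule.mem_span_singleton.1 hy
    have := h 1 (one_mem_C V)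
    rw [pr_one, map_zsmul, map_one] at this
    obtain ⟨j, hj⟩ := this
    refine ⟨j • 1, Submodule.smul_mem _ _ (one_mem_C V), ?_⟩
    rw [← mul_smul, ← hj]; simp
  | succ c ih =>
    induction V using Finset.strongInduction generalizing y with
    | _ V ihV =>
      rcases V.eq_empty_or_nonempty with rfl | ⟨v, hv⟩
      · refine ⟨0, Submodule.zero_mem _, ?_⟩
        rw [C_empty _ _ hy, smul_zero]
      · have h1 : ∀ w ∈ V.erase v, ∃ y' ∈ C c (V \ {v, w}), dd v w y = m • y' := by
          intro w hw
          refine ih (dd_mem v w hy) fun z hz => ?_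
          rw [← pr_x_left]
          exact h _ (x_mul_mem_C hv (Finset.mem_of_mem_erase hw) (Ne.symm (Finset.ne_of_mem_erase hw)) hz)
        choose! g hg1 hg2 using h1
        have hs : ∑ w ∈ V.erase v, x v w * dd v w y = m • ∑ w ∈ V.erase v, x v w * g w := by
          rw [Finset.smul_sum]
          refine Finset.sum_congr rfl fun w hw => ?_
          rw [hg2 w hw, mul_smul_comm]
        obtain ⟨y0, hy0, he⟩ := ihV (V.erase v) (Finset.erase_ssubset hv) (Nv_mem v hy) (fun z hz => by
          rw [Nv_apply, map_sub, hs, pr_smul_right]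
          exact Dvd.dvd.sub (h z (C_mono (Finset.erase_subset _ _) hz)) (Dvd.intro _ rfl))
        refine ⟨y0 + ∑ w ∈ V.erase v, x v w * g w, ?_, ?_⟩
        · refine Submodule.add_mem _ (C_mono (Finset.erase_subset _ _) hy0) (Submodule.sum_mem _ fun w hw => ?_)
          exact x_mul_mem_C hv (Finset.mem_of_mem_erase hw) (Ne.symm (Finset.ne_of_mem_erase hw)) (hg1 w hw)
        · rw [smul_add, ← he, ← hs]; exact decomp v V y

theorem nondeg {c : ℕ} {V : Finset ℕ} {y : LE} (hy : y ∈ C c V) (h : ∀ z ∈ C c V, pr z y = 0) : y = 0 := by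
  obtain ⟨y', _, rfl⟩ := div_crit 0 hy (fun z hz => by rw [h z hz])
  simp

theorem tf {c : ℕ} {V : Finset ℕ} {y : LE} (hy : y ∈ C c V) {m : ℤ} (hm : m ≠ 0) (h : m • y = 0) : y = 0 := by
  refine nondeg hy fun z _ => ?_
  have : pr z (m • y) = 0 := by rw [h]; simp
  rw [pr_smul_right] at this
  exact (mul_eq_zero.1 this).resolve_left hm

/-- Vanishing of the pairing. -/
theorem pr_x_avoid {c : ℕ} {V : Finset ℕ} {v : ℕ} (hv : v ∉ V) (w : ℕ) {z : LE} (hz : z ∈ C c V) (y : LE) :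
    pr z (x v w * y) = 0 := by
  rw [pr_x_right, dd_zero hv w hz, pr_zero_left]

/-- Representability of functionals. -/
theorem repr (c : ℕ) (V : Finset ℕ) (f : LE →+ ℤ) : ∃ y ∈ C c V, ∀ z ∈ C c V, pr z y = f z := by
  induction c generalizing V f with
  | zero =>
    refine ⟨f 1 • 1, Submodule.smul_mem _ _ (one_mem_C V), fun z hz => ?_⟩
    obtain ⟨k, rfl⟩ := Submodule.mem_span_singleton.1 hz
    rw [pr_smul_left, pr_smul_right, pr_one, map_one sc, map_zsmul, smul_eq_mul, mul_one]
  | succ c ih =>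
    induction V using Finset.strongInduction with
    | _ V ihV =>
      rcases V.eq_empty_or_nonempty with rfl | ⟨v, hv⟩
      · refine ⟨0, Submodule.zero_mem _, fun z hz => ?_⟩
        rw [C_empty _ _ hz]; simp
      · obtain ⟨y0, hy0, h0⟩ := ihV (V.erase v) (Finset.erase_ssubset hv)
        have h1 := fun w => ih (V \ {v, w}) (f.comp (AddMonoidHom.mulLeft (x v w)))
        choose g hg1 hg2 using h1
        refine ⟨y0 + ∑ w ∈ V.erase v, x v w * g w, ?_, fun z hz => ?_⟩
        · refine Submodule.add_mem _ (C_mono (Finset.erase_subset _ _) hy0) (Submodule.sum_mem _ fun w hw => ?_)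
          exact x_mul_mem_C hv (Finset.mem_of_mem_erase hw) (Ne.symm (Finset.ne_of_mem_erase hw)) (hg1 w)
        · have e1 : pr z y0 = f (Nv v V z) := by
            rw [← h0 _ (Nv_mem v hz), Nv_apply, pr_sub_left, pr_sum_left]
            rw [Finset.sum_eq_zero, sub_zero]
            intro w _
            rw [pr_x_left, dd_zero (Finset.notMem_erase v V) w hy0]; simp
          rw [map_add, e1, pr_sum_right]
          conv_rhs => rw [decomp v V z, map_add, map_sum]
          congr 1
          refine Finset.sum_congr rfl fun w hw => ?_
          rw [pr_x_right, hg2 w _ (dd_mem v w hz)]; rfl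

theorem sum_pair {V : Finset ℕ} {p q : ℕ} (hp : p ∈ V) (hq : q ∈ V) (hpq : p ≠ q) (w : LE) :
    ∑ a ∈ V, ∑ b ∈ V, (if s(p, q) = s(a, b) then w else 0) = (2 : ℤ) • w := by
  have : ∀ a b, (if s(p, q) = s(a, b) then w else 0) = (if a = p then (if b = q then w else 0) else 0) + (if a = q then (if b = p then w else 0) else 0) := by
    intro a b
    rw [← ite_and, ← ite_and]
    by_cases h1 : a = p ∧ b = q
    · obtain ⟨rfl, rfl⟩ := h1
      simp [hpq]
    · rw [if_neg h1]
      by_cases h2 : a = q ∧ b = p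
      · rw [if_pos h2, if_pos (by rw [h2.1, h2.2, Sym2.eq_swap]), zero_add]
      · rw [if_neg h2, if_neg, add_zero]
        intro h
        rcases Sym2.eq_iff.1 h with ⟨h3, h4⟩ | ⟨h3, h4⟩
        · exact h1 ⟨h3.symm, h4.symm⟩
        · exact h2 ⟨h4.symm, h3.symm⟩
  simp only [this, Finset.sum_add_distrib, Finset.sum_ite_eq', Finset.sum_ite_irrel, Finset.sum_const_zero, hp, hq, if_true]
  rw [two_smul]

/-- Euler's formula. -/
theorem sum_x_dd {c : ℕ} {V : Finset ℕ} {z : LE} (hz : z ∈ C c V) :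
    ∑ a ∈ V, ∑ b ∈ V, x a b * dd a b z = (2 * c : ℤ) • z := by
  induction c generalizing V z with
  | zero => simp [dd_C0 _ _ hz]
  | succ c ih =>
    let T : LE →ₗ[ℤ] LE := ∑ a ∈ V, ∑ b ∈ V, (LinearMap.mulLeft ℤ (x a b)).comp (dd a b)
    have hT : ∀ z, T z = ∑ a ∈ V, ∑ b ∈ V, x a b * dd a b z := by intro z; simp [T]
    have : C (c + 1) V ≤ LinearMap.ker (T - (2 * ((c + 1 : ℕ) : ℤ)) • LinearMap.id) := by
      refine C_succ_le fun p q z hp hq hpq hz => ?_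
      rw [LinearMap.mem_ker, LinearMap.sub_apply, sub_eq_zero, hT]
      have e : ∀ a b, x a b * dd a b (x p q * z) = (if s(p, q) = s(a, b) then x p q * z else 0) + x p q * (x a b * dd a b z) := by
        intro a b
        rw [dd_xm, mul_sub, x_anti a b p q, sub_neg_eq_add]
        split_ifs with h
        · have : x p q = x a b := by rw [x, x, h]
          rw [this]
        · simp
      simp only [e, Finset.sum_add_distrib]
      have e2 : ∑ a ∈ V, ∑ b ∈ V, x p q * (x a b * dd a b z) = (2 * c : ℤ) • (x p q * z) := by
        have := ih (V := V) (C_mono Finset.sdiff_subset hz)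
        rw [← mul_smul_comm, ← this, Finset.mul_sum]
        refine Finset.sum_congr rfl fun a _ => ?_
        rw [Finset.mul_sum]
      have e3 : ∑ a ∈ V, ∑ b ∈ V, (if s(p, q) = s(a, b) then x p q * z else 0) = (2 : ℤ) • (x p q * z) := by
        exact sum_pair hp hq hpq _
      rw [e2, e3, ← add_smul]
      simp only [LinearMap.smul_apply, LinearMap.id_apply]
      congr 1; push_cast; ring
    have h := this hz
    rw [LinearMap.mem_ker, LinearMap.sub_apply, sub_eq_zero, hT] at h
    rw [h]; rfl

theorem pr_self_nonneg {c : ℕ} {V : Finset ℕ} {z : LE} (hz : z ∈ C c V) : 0 ≤ pr z z := by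
  induction c generalizing V z with
  | zero =>
    obtain ⟨k, rfl⟩ := Submodule.mem_span_singleton.1 hz
    rw [pr_smul_left, pr_smul_right, pr_one, map_one, mul_one]; exact mul_self_nonneg k
  | succ c ih =>
    have h := congrArg (fun w => pr w z) (sum_x_dd hz)
    simp only [pr_sum_left, pr_smul_left, pr_x_left] at h
    have h2 : 0 ≤ ∑ a ∈ V, ∑ b ∈ V, pr (dd a b z) (dd a b z) :=
      Finset.sum_nonneg fun a _ => Finset.sum_nonneg fun b _ => ih (dd_mem a b hz)
    rw [h] at h2
    push_cast at h2
    by_contra h3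
    push Not at h3
    nlinarith

theorem sum_dd {c : ℕ} {V : Finset ℕ} {z : LE} (hz : z ∈ C c V) :
    ∑ a ∈ V, ∑ b ∈ V, dd a b z = (2 : ℤ) • bd z := by
  induction c generalizing V z with
  | zero => simp [dd_C0 _ _ hz, bd_C0 hz]
  | succ c ih =>
    let T : LE →ₗ[ℤ] LE := ∑ a ∈ V, ∑ b ∈ V, dd a b
    have hT : ∀ z, T z = ∑ a ∈ V, ∑ b ∈ V, dd a b z := by intro z; simp [T]
    have : C (c + 1) V ≤ LinearMap.ker (T - (2 : ℤ) • bd) := by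
      refine C_succ_le fun p q z hp hq hpq hz => ?_
      rw [LinearMap.mem_ker, LinearMap.sub_apply, sub_eq_zero, hT]
      simp only [dd_xm, Finset.sum_sub_distrib]
      rw [sum_pair hp hq hpq]
      simp only [← Finset.mul_sum]
      rw [ih (V := V) (C_mono Finset.sdiff_subset hz), LinearMap.smul_apply, bd_x_mul, smul_sub, mul_smul_comm]
    have h := this hz
    rw [LinearMap.mem_ker, LinearMap.sub_apply, sub_eq_zero, hT] at h
    rw [h]; rfl

theorem pr_self_zero {c : ℕ} {V : Finset ℕ} {z : LE} (hz : z ∈ C c V) (h : pr z z = 0) : z = 0 := by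
  induction c generalizing V z with
  | zero =>
    obtain ⟨k, rfl⟩ := Submodule.mem_span_singleton.1 hz
    rw [pr_smul_left, pr_smul_right, pr_one, map_one, mul_one] at h
    rw [mul_self_eq_zero.1 h, zero_smul]
  | succ c ih =>
    have h1 := congrArg (fun w => pr w z) (sum_x_dd hz)
    simp only [pr_sum_left, pr_smul_left, pr_x_left, h, mul_zero] at h1
    have hd : ∀ a ∈ V, ∀ b ∈ V, dd a b z = 0 := by
      intro a ha b hb
      refine ih (dd_mem a b hz) ?_
      have hn : ∀ a b, 0 ≤ pr (dd a b z) (dd a b z) := fun a b => pr_self_nonneg (dd_mem a b hz)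
      exact (Finset.sum_eq_zero_iff_of_nonneg (fun b _ => hn a b)).1
        ((Finset.sum_eq_zero_iff_of_nonneg (fun a _ => Finset.sum_nonneg fun b _ => hn a b)).1 h1 a ha) b hb
    have h2 := sum_x_dd hz
    rw [Finset.sum_eq_zero] at h2
    · exact tf hz (by positivity) h2.symm
    · intro a ha
      exact Finset.sum_eq_zero fun b hb => by rw [hd a ha b hb, mul_zero]

end MC

set_option synthInstance.maxHeartbeats 20000
set_option maxHeartbeats 400000
set_option linter.all false

namespace MC
open MatchPaper

/-! ## The bridge to simplicial chains -/

/-- The monomial of a set of codes. -/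
noncomputable def Pk (n : ℕ) (s : Finset ℕ) : LE := ((s.sort (· ≤ ·)).map fun k => x (k / n) (k % n)).prod

theorem Pk_empty (n : ℕ) : Pk n ∅ = 1 := by simp [Pk]

theorem Pk_min (n : ℕ) {a : ℕ} {s : Finset ℕ} (h : ∀ b ∈ s, a < b) : Pk n (insert a s) = x (a / n) (a % n) * Pk n s := by
  rw [Pk, Finset.sort_insert _ (fun b hb => (h b hb).le) (fun ha => lt_irrefl _ (h a ha))]
  simp [Pk]

theorem Pk_bd (n : ℕ) (s : Finset ℕ) :
    bd (Pk n s) = ∑ v ∈ s, ((-1 : ℤ) ^ ((s.filter fun u => u < v).card)) • Pk n (s.erase v) := by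
  induction s using Finset.induction_on_min with
  | empty => simp [Pk_empty, bd_one]
  | insert a s h ih =>
    have ha : a ∉ s := fun ha => lt_irrefl _ (h a ha)
    rw [Pk_min n h, bd_x_mul, ih, Finset.sum_insert ha, Finset.erase_insert ha]
    have e0 : (insert a s).filter (fun u => u < a) = ∅ := by
      ext u; simp only [Finset.mem_filter, Finset.mem_insert, Finset.notMem_empty, iff_false, not_and]
      rintro (rfl | hu)
      · exact lt_irrefl _
      · exact not_lt.2 (h u hu).le
    rw [e0, Finset.card_empty, pow_zero, one_smul, sub_eq_add_neg, Finset.mul_sum, ← Finset.sum_neg_distrib]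
    congr 1
    refine Finset.sum_congr rfl fun v hv => ?_
    have e1 : (insert a s).filter (fun u => u < v) = insert a (s.filter fun u => u < v) := by
      rw [Finset.filter_insert, if_pos (h v hv)]
    have e2 : (insert a s).erase v = insert a (s.erase v) :=
      Finset.erase_insert_of_ne (h v hv).ne
    rw [e1, e2, Finset.card_insert_of_notMem (by simp [ha]), Pk_min n (fun b hb => h b (Finset.mem_of_mem_erase hb)),
      pow_succ, mul_smul_comm, mul_smul, ← smul_neg]
    simp

theorem x_mul_Pk (n : ℕ) {k : ℕ} {s : Finset ℕ} (hk : k ∉ s) :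
    ∃ ε : ℤ, (ε = 1 ∨ ε = -1) ∧ Pk n (insert k s) = ε • (x (k / n) (k % n) * Pk n s) := by
  induction s using Finset.induction_on_min with
  | empty => exact ⟨1, Or.inl rfl, by rw [Pk_min n (by simp), one_smul]⟩
  | insert a s h ih =>
    simp only [Finset.mem_insert, not_or] at hk
    rcases lt_or_gt_of_ne hk.1 with h1 | h1
    · refine ⟨1, Or.inl rfl, ?_⟩
      rw [Pk_min n, one_smul]
      intro b hb
      rcases Finset.mem_insert.1 hb with rfl | hb
      · exact h1
      · exact h1.trans (h b hb)
    · obtain ⟨ε, hε, he⟩ := ih hk.2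
      refine ⟨-ε, by rcases hε with rfl | rfl <;> simp, ?_⟩
      rw [Finset.insert_comm, Pk_min n, he, Pk_min n h, x_anti]
      · rw [mul_smul_comm, smul_neg, neg_smul, neg_neg]
      · intro b hb
        rcases Finset.mem_insert.1 hb with rfl | hb
        · exact h1
        · exact h b hb

theorem rankP_div {n : ℕ} (p : Fin n × Fin n) : rankP n p / n = p.1.val := by
  have hn : 0 < n := p.1.pos
  rw [rankP, Nat.mul_comm, Nat.mul_add_div hn, Nat.div_eq_of_lt p.2.isLt, add_zero]

theorem rankP_mod {n : ℕ} (p : Fin n × Fin n) : rankP n p % n = p.2.val := by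
  rw [rankP, Nat.mul_comm, Nat.mul_add_mod, Nat.mod_eq_of_lt p.2.isLt]

theorem rankP_inj (n : ℕ) : Function.Injective (rankP n) := by
  intro p q h
  refine Prod.ext (Fin.ext ?_) (Fin.ext ?_)
  · rw [← rankP_div, h, rankP_div]
  · rw [← rankP_mod, h, rankP_mod]

/-- The monomial of a set of edges. -/
noncomputable def Mo (n : ℕ) (σ : Finset (Fin n × Fin n)) : LE := Pk n (σ.map ⟨rankP n, rankP_inj n⟩)

theorem Mo_insert (n : ℕ) {p : Fin n × Fin n} {σ : Finset (Fin n × Fin n)} (hp : p ∉ σ) :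
    ∃ ε : ℤ, (ε = 1 ∨ ε = -1) ∧ Mo n (insert p σ) = ε • (x p.1 p.2 * Mo n σ) := by
  have := x_mul_Pk n (k := rankP n p) (s := σ.map ⟨rankP n, rankP_inj n⟩) (by simpa [(rankP_inj n).eq_iff] using hp)
  rw [rankP_div, rankP_mod] at this
  rw [Mo, Finset.map_insert]; exact this

theorem Mo_bd (n : ℕ) (σ : Finset (Fin n × Fin n)) :
    bd (Mo n σ) = ∑ v ∈ σ, ((-1 : ℤ) ^ ((σ.filter fun u => rankP n u < rankP n v).card)) • Mo n (σ.erase v) := by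
  rw [Mo, Pk_bd, Finset.sum_map]
  refine Finset.sum_congr rfl fun v hv => ?_
  rw [Mo, Finset.map_erase, Finset.filter_map, Finset.card_map]; rfl

theorem Mo_empty (n : ℕ) : Mo n ∅ = 1 := by simp [Mo, Pk_empty]

/-- The covered vertices. -/
def vs {n : ℕ} (σ : Finset (Fin n × Fin n)) : Finset ℕ := σ.biUnion fun p => {p.1.val, p.2.val}

theorem mem_vs {n : ℕ} {σ : Finset (Fin n × Fin n)} {v : ℕ} : v ∈ vs σ ↔ ∃ p ∈ σ, v = p.1.val ∨ v = p.2.val := by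
  simp [vs]

theorem IsM_sub {n : ℕ} {σ τ : Finset (Fin n × Fin n)} (h : IsMatching n σ) (hτ : τ ⊆ σ) : IsMatching n τ :=
  ⟨fun p hp => h.1 p (hτ hp), fun p hp q hq => h.2 p (hτ hp) q (hτ hq)⟩

theorem Mo_mem {n : ℕ} {σ : Finset (Fin n × Fin n)} (h : IsMatching n σ) : Mo n σ ∈ C σ.card (vs σ) := by
  induction σ using Finset.induction_on with
  | empty => rw [Mo_empty]; exact one_mem_C _
  | insert p σ hp ih =>
    obtain ⟨ε, _, he⟩ := Mo_insert n hp
    rw [he, Finset.card_insert_of_notMem hp]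
    have hd : ∀ q ∈ σ, p ≠ q := fun q hq e => hp (e ▸ hq)
    refine Submodule.smul_mem _ _ (x_mul_mem_C' ?_ ?_ ?_ (ih (IsM_sub h (Finset.subset_insert _ _))) ?_ ?_ ?_)
    · rw [mem_vs]; exact ⟨p, Finset.mem_insert_self _ _, Or.inl rfl⟩
    · rw [mem_vs]; exact ⟨p, Finset.mem_insert_self _ _, Or.inr rfl⟩
    · have := h.1 p (Finset.mem_insert_self _ _)
      exact (Fin.val_ne_of_ne this.ne)
    · intro v; rw [mem_vs, mem_vs]
      rintro ⟨q, hq, h⟩; exact ⟨q, Finset.mem_insert_of_mem hq, h⟩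
    · rw [mem_vs]; rintro ⟨q, hq, h'⟩
      have := h.2 p (Finset.mem_insert_self _ _) q (Finset.mem_insert_of_mem hq) (hd q hq)
      rcases h' with h' | h'
      · exact this.1 (Fin.ext h')
      · exact this.2.1 (Fin.ext h')
    · rw [mem_vs]; rintro ⟨q, hq, h'⟩
      have := h.2 p (Finset.mem_insert_self _ _) q (Finset.mem_insert_of_mem hq) (hd q hq)
      rcases h' with h' | h'
      · exact this.2.2.1 (Fin.ext h')
      · exact this.2.2.2 (Fin.ext h')

theorem vs_range {n : ℕ} (σ : Finset (Fin n × Fin n)) : vs σ ⊆ Finset.range n := by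
  intro v; rw [mem_vs, Finset.mem_range]
  rintro ⟨p, _, rfl | rfl⟩
  · exact p.1.isLt
  · exact p.2.isLt

theorem C_span (n c : ℕ) : ∀ V : Finset ℕ, V ⊆ Finset.range n → C c V ≤
    Submodule.span ℤ {w | ∃ σ : Finset (Fin n × Fin n), IsMatching n σ ∧ σ.card = c ∧ vs σ ⊆ V ∧ w = Mo n σ} := by
  induction c with
  | zero =>
    intro V hV
    refine C_zero_le (Submodule.subset_span ⟨∅, ⟨by simp, by simp⟩, rfl, by simp [vs], (Mo_empty n).symm⟩)
  | succ c ih =>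
    intro V hV
    have key : ∀ a b z, a ∈ V → b ∈ V → a < b → z ∈ C c (V \ {a, b}) → x a b * z ∈
      Submodule.span ℤ {w | ∃ σ : Finset (Fin n × Fin n), IsMatching n σ ∧ σ.card = c + 1 ∧ vs σ ⊆ V ∧ w = Mo n σ} := by
      intro a b z ha hb hab hz
      have h1 := ih (V \ {a, b}) (Finset.sdiff_subset.trans hV) hz
      have h2 : Submodule.span ℤ {w | ∃ σ : Finset (Fin n × Fin n), IsMatching n σ ∧ σ.card = c ∧ vs σ ⊆ V \ {a, b} ∧ w = Mo n σ} ≤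
        (Submodule.span ℤ {w | ∃ σ : Finset (Fin n × Fin n), IsMatching n σ ∧ σ.card = c + 1 ∧ vs σ ⊆ V ∧ w = Mo n σ}).comap (LinearMap.mulLeft ℤ (x a b)) := by
        rw [Submodule.span_le]
        rintro w ⟨σ, h1, h2, h3, rfl⟩
        let p : Fin n × Fin n := (⟨a, Finset.mem_range.1 (hV ha)⟩, ⟨b, Finset.mem_range.1 (hV hb)⟩)
        have ha' : a ∉ vs σ := fun h => by simpa using h3 h
        have hb' : b ∉ vs σ := fun h => by simpa using h3 h
        have hp : p ∉ σ := fun h => ha' (mem_vs.2 ⟨p, h, Or.inl rfl⟩)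
        obtain ⟨ε, hε, he⟩ := Mo_insert n hp
        have he' : x a b * Mo n σ = ε • Mo n (insert p σ) := by
          rw [he, ← mul_smul]
          have : ε * ε = 1 := by rcases hε with rfl | rfl <;> rfl
          rw [this, one_smul]
        have hne : ∀ q ∈ σ, a ≠ q.1.val ∧ a ≠ q.2.val ∧ b ≠ q.1.val ∧ b ≠ q.2.val := fun q hq =>
          ⟨fun e => ha' (mem_vs.2 ⟨q, hq, Or.inl e⟩), fun e => ha' (mem_vs.2 ⟨q, hq, Or.inr e⟩),
            fun e => hb' (mem_vs.2 ⟨q, hq, Or.inl e⟩), fun e => hb' (mem_vs.2 ⟨q, hq, Or.inr e⟩)⟩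
        rw [SetLike.mem_coe, Submodule.mem_comap, LinearMap.mulLeft_apply]
        rw [he']
        refine Submodule.smul_mem _ _ (Submodule.subset_span ⟨_, ⟨?_, ?_⟩, ?_, ?_, rfl⟩)
        · intro q hq
          rcases Finset.mem_insert.1 hq with rfl | hq
          · exact hab
          · exact h1.1 q hq
        · intro q hq r hr hqr
          rcases Finset.mem_insert.1 hq with rfl | hq <;> rcases Finset.mem_insert.1 hr with rfl | hr
          · exact absurd rfl hqr
          · obtain ⟨e1, e2, e3, e4⟩ := hne r hr
            exact ⟨fun e => e1 (congrArg Fin.val e), fun e => e2 (congrArg Fin.val e), fun e => e3 (congrArg Fin.val e), fun e => e4 (congrArg Fin.val e)⟩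
          · obtain ⟨e1, e2, e3, e4⟩ := hne q hq
            exact ⟨fun e => e1 (congrArg Fin.val e).symm, fun e => e3 (congrArg Fin.val e).symm, fun e => e2 (congrArg Fin.val e).symm, fun e => e4 (congrArg Fin.val e).symm⟩
          · exact h1.2 q hq r hr hqr
        · rw [Finset.card_insert_of_notMem hp, h2]
        · intro v hv
          obtain ⟨q, hq, h⟩ := mem_vs.1 hv
          rcases Finset.mem_insert.1 hq with rfl | hq
          · rcases h with rfl | rfl
            · exact ha
            · exact hb
          · exact Finset.sdiff_subset (h3 (mem_vs.2 ⟨q, hq, h⟩))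
      exact h2 h1
    refine C_succ_le fun a b z ha hb hab hz => ?_
    rcases lt_or_gt_of_ne hab with h | h
    · exact key a b z ha hb h hz
    · rw [x_symm]; exact key b a z hb ha h (by rwa [Finset.pair_comm])

theorem dd_Mo {n : ℕ} {p : Fin n × Fin n} (hp : p.1 < p.2) {σ : Finset (Fin n × Fin n)} (h : ∀ q ∈ σ, q.1 < q.2)
    (hpσ : p ∉ σ) : dd p.1 p.2 (Mo n σ) = 0 := by
  induction σ using Finset.induction_on with
  | empty => rw [Mo_empty, dd_one]
  | insert q σ hq ih =>
    obtain ⟨ε, _, he⟩ := Mo_insert n hq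
    simp only [Finset.mem_insert, not_or] at hpσ
    rw [he, map_smul, dd_x_ne, ih (fun q hq => h q (Finset.mem_insert_of_mem hq)) hpσ.2]
    · simp
    · intro e
      have hq' := h q (Finset.mem_insert_self _ _)
      rcases Sym2.eq_iff.1 e with ⟨h1, h2⟩ | ⟨h1, h2⟩
      · exact hpσ.1 (Prod.ext (Fin.ext h1.symm) (Fin.ext h2.symm))
      · rw [Fin.lt_def] at hq' hp; omega

theorem pr_Mo_self {n : ℕ} {σ : Finset (Fin n × Fin n)} (h : ∀ q ∈ σ, q.1 < q.2) : pr (Mo n σ) (Mo n σ) = 1 := by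
  induction σ using Finset.induction_on with
  | empty => rw [Mo_empty, pr_one, map_one]
  | insert q σ hq ih =>
    obtain ⟨ε, hε, he⟩ := Mo_insert n hq
    rw [he, pr_smul_left, pr_smul_right, pr_x_left, dd_x_same, dd_Mo (h q (Finset.mem_insert_self _ _)) (fun q hq => h q (Finset.mem_insert_of_mem hq)) hq,
      mul_zero, sub_zero, ih (fun q hq => h q (Finset.mem_insert_of_mem hq))]
    rcases hε with rfl | rfl <;> rfl

theorem pr_Mo_ne {n : ℕ} {σ τ : Finset (Fin n × Fin n)} (hσ : ∀ q ∈ σ, q.1 < q.2) (hτ : ∀ q ∈ τ, q.1 < q.2)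
    (hc : σ.card = τ.card) (hne : σ ≠ τ) : pr (Mo n τ) (Mo n σ) = 0 := by
  obtain ⟨p, hp, hpσ⟩ : ∃ p ∈ τ, p ∉ σ := by
    by_contra hcon
    push Not at hcon
    exact hne (Finset.eq_of_subset_of_card_le hcon hc.le).symm
  obtain ⟨ε, hε, he⟩ := Mo_insert n (Finset.notMem_erase p τ)
  rw [Finset.insert_erase hp] at he
  rw [he, pr_smul_left, pr_x_left, dd_Mo (hτ p hp) hσ hpσ]; simp

/-- The comparison map. -/
noncomputable def Psi (n c : ℕ) : SChain ℤ (IsMatching n) c →ₗ[ℤ] LE :=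
  Finsupp.lsum ℤ fun σ => LinearMap.toSpanSingleton ℤ LE (Mo n σ.1)

theorem Psi_single (n c : ℕ) (σ : {σ : Finset (Fin n × Fin n) // IsMatching n σ ∧ σ.card = c}) (k : ℤ) :
    Psi n c (Finsupp.single σ k) = k • Mo n σ.1 := by
  simp [Psi]

theorem Psi_coord (n c : ℕ) (τ : {σ : Finset (Fin n × Fin n) // IsMatching n σ ∧ σ.card = c}) (u : SChain ℤ (IsMatching n) c) :
    pr (Mo n τ.1) (Psi n c u) = u τ := by
  induction u using Finsupp.induction_linear with
  | zero => simp
  | add u v hu hv => rw [map_add, map_add, hu, hv]; rfl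
  | single σ k =>
    rw [Psi_single, pr_smul_right, Finsupp.single_apply]
    by_cases h : σ = τ
    · subst h; rw [pr_Mo_self σ.2.1.1]; simp
    · rw [pr_Mo_ne σ.2.1.1 τ.2.1.1 (σ.2.2.trans τ.2.2.symm) (fun e => h (Subtype.ext e))]; simp [h]

theorem Psi_inj (n c : ℕ) : Function.Injective (Psi n c) := by
  intro u v h
  ext τ
  rw [← Psi_coord, h, Psi_coord]

theorem Psi_mem (n c : ℕ) (u : SChain ℤ (IsMatching n) c) : Psi n c u ∈ C c (Finset.range n) := by
  induction u using Finsupp.induction_linear with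
  | zero => simp
  | add u v hu hv => rw [map_add]; exact Submodule.add_mem _ hu hv
  | single σ k =>
    rw [Psi_single]
    refine Submodule.smul_mem _ _ (C_mono (vs_range σ.1) ?_)
    have := Mo_mem σ.2.1
    rwa [σ.2.2] at this

theorem Psi_surj (n c : ℕ) {z : LE} (hz : z ∈ C c (Finset.range n)) : ∃ u, Psi n c u = z := by
  have h : Submodule.span ℤ {w | ∃ σ : Finset (Fin n × Fin n), IsMatching n σ ∧ σ.card = c ∧ vs σ ⊆ Finset.range n ∧ w = Mo n σ} ≤ LinearMap.range (Psi n c) := by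
    rw [Submodule.span_le]
    rintro w ⟨σ, h1, h2, _, rfl⟩
    exact ⟨Finsupp.single ⟨σ, h1, h2⟩ 1, by rw [Psi_single, one_smul]⟩
  exact h (C_span n c _ subset_rfl hz)

theorem Psi_bd (n c : ℕ) (u : SChain ℤ (IsMatching n) (c + 1)) :
    Psi n c (bdry ℤ (rankP n) (IsMatching n) c u) = bd (Psi n (c + 1) u) := by
  induction u using Finsupp.induction_linear with
  | zero => simp
  | add u v hu hv => rw [map_add, map_add, map_add, map_add, hu, hv]
  | single σ k =>
    rw [Psi_single, map_smul, Mo_bd, bdry, Finsupp.lsum_single, LinearMap.toSpanSingleton_apply, map_smul, map_sum]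
    congr 1
    refine Finset.sum_congr rfl fun v hv => ?_
    have h : IsMatching n (σ.1.erase v) ∧ (σ.1.erase v).card = c :=
      ⟨IsM_sub σ.2.1 (Finset.erase_subset _ _), by rw [Finset.card_erase_of_mem hv, σ.2.2]; rfl⟩
    rw [basisOrZero, dif_pos h]
    have := Psi_single n c ⟨σ.1.erase v, h⟩ 1
    rw [one_smul] at this
    rw [← this, map_smul]

/-- The bridge. -/
theorem bridge (n dg : ℕ) : ∃ π : Z (dg + 1) (Finset.range n) →+ MH ℤ n dg, Function.Surjective π ∧
    ∀ z, π z = 0 ↔ z.1 ∈ B (dg + 1) (Finset.range n) := by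
  have hmem : ∀ u ∈ cycLow ℤ (rankP n) (IsMatching n) (dg + 1), Psi n (dg + 1) u ∈ Z (dg + 1) (Finset.range n) := by
    intro u hu
    refine mem_Z.2 ⟨Psi_mem n _ u, ?_⟩
    have hu' : bdry ℤ (rankP n) (IsMatching n) dg u = 0 := hu
    rw [← Psi_bd, hu', map_zero]
  let e0 : cycLow ℤ (rankP n) (IsMatching n) (dg + 1) →ₗ[ℤ] Z (dg + 1) (Finset.range n) := (Psi n (dg + 1)).restrict hmem
  have he0 : Function.Bijective e0 := by
    constructor
    · intro u v h
      exact Subtype.ext (Psi_inj n _ (congrArg Subtype.val h))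
    · rintro ⟨z, hz⟩
      obtain ⟨u, rfl⟩ := Psi_surj n _ (mem_Z.1 hz).1
      refine ⟨⟨u, ?_⟩, rfl⟩
      show bdry ℤ (rankP n) (IsMatching n) dg u = 0
      apply Psi_inj
      rw [Psi_bd, (mem_Z.1 hz).2, map_zero]
  let e := LinearEquiv.ofBijective e0 he0
  let q := Submodule.mkQ ((LinearMap.range (bdry ℤ (rankP n) (IsMatching n) (dg + 1))).comap (cycLow ℤ (rankP n) (IsMatching n) (dg + 1)).subtype)
  refine ⟨q.toAddMonoidHom.comp e.symm.toLinearMap.toAddMonoidHom, ?_, ?_⟩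
  · exact (Submodule.mkQ_surjective _).comp e.symm.surjective
  · intro z
    obtain ⟨u, rfl⟩ := e.surjective z
    show q (e.symm (e u)) = 0 ↔ _
    rw [LinearEquiv.symm_apply_apply, Submodule.mkQ_apply, Submodule.Quotient.mk_eq_zero, Submodule.mem_comap]
    show u.1 ∈ LinearMap.range _ ↔ Psi n (dg + 1) u.1 ∈ _
    rw [LinearMap.mem_range, mem_B]
    constructor
    · rintro ⟨w, hw⟩
      exact ⟨Psi n _ w, Psi_mem n _ w, by rw [← Psi_bd, hw]⟩
    · rintro ⟨w, hw, hw'⟩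
      obtain ⟨v, rfl⟩ := Psi_surj n _ hw
      refine ⟨v, Psi_inj n _ ?_⟩
      rw [Psi_bd, hw']

/-- Finite generation. -/
theorem C_fg (n c : ℕ) : (C c (Finset.range n)).FG := by
  have : C c (Finset.range n) = LinearMap.range (Psi n c) := by
    ext z
    constructor
    · intro hz; obtain ⟨u, rfl⟩ := Psi_surj n c hz; exact ⟨u, rfl⟩
    · rintro ⟨u, rfl⟩; exact Psi_mem n c u
  rw [this, LinearMap.range_eq_map]
  haveI : Finite {σ : Finset (Fin n × Fin n) // IsMatching n σ ∧ σ.card = c} := Subtype.finite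
  exact (Module.Finite.fg_top).map _

end MC

set_option synthInstance.maxHeartbeats 20000
set_option maxHeartbeats 400000
set_option linter.all false
namespace MC

theorem pr_add_right (z y y' : LE) : pr z (y + y') = pr z y + pr z y' := map_add _ _ _
theorem pr_sub_right (z y y' : LE) : pr z (y - y') = pr z y - pr z y' := map_sub _ _ _
theorem pr_neg_right (z y : LE) : pr z (- y) = - pr z y := map_neg _ _
theorem pr_zero_right (z : LE) : pr z 0 = 0 := map_zero _

/-- A perfect matching pairs to zero with chains avoiding one of its letters. -/
theorem pr_full {j : ℕ} {U U' : Finset ℕ} (hU : U.card = 2 * j) {p : ℕ} (hp : p ∈ U) (hp' : p ∉ U')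
    {c : ℕ} {z w : LE} (hz : z ∈ C j U) (hw : w ∈ C c U') : pr z w = 0 := by
  have h0 : Nv p U z = 0 := C_small (by
    rw [Finset.card_erase_of_mem hp]
    have := Finset.card_pos.2 ⟨p, hp⟩
    omega) (Nv_mem p hz)
  rw [decomp p U z, h0, zero_add, pr_sum_left]
  refine Finset.sum_eq_zero fun v hv => ?_
  rw [pr_x_left, dd_zero hp' v hw, pr_zero_right]

theorem even_top {k : ℕ} {V : Finset ℕ} (hV : V.card = 2 * (k + 1)) {m : ℤ} (hm : m ≠ 0) {u : LE}
    (hu : u ∈ C k V) (h : m • u ∈ B k V) : u ∈ B k V := by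
  obtain ⟨y, hy, hyu⟩ := mem_B.1 h
  have key : ∀ z ∈ C (k + 1) V, m ∣ pr z y := by
    let S : Submodule ℤ LE :=
      { carrier := {z | m ∣ pr z y}
        add_mem' := fun {a b} ha hb => by
          simp only [Set.mem_setOf_eq, pr_add_left] at *; exact dvd_add ha hb
        zero_mem' := by simp [pr_zero_left]
        smul_mem' := fun c z hz => by
          simp only [Set.mem_setOf_eq, pr_smul_left] at *; exact Dvd.dvd.mul_left hz c }
    have : C (k + 1) V ≤ S := by
      refine C_succ_le fun a b z ha hb hab hz => ?_
      show m ∣ pr (x a b * z) y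
      rw [pr_x_left]
      have hUc : (V \ {a, b}).card = 2 * k := by
        rw [Finset.card_sdiff_of_subset (by intro v; simp only [Finset.mem_insert, Finset.mem_singleton]; rintro (rfl | rfl) <;> assumption), Finset.card_pair hab]; omega
      have h2 := congrArg (pr z) (sum_dd hy)
      rw [pr_smul_right, hyu, pr_smul_right, pr_sum_right] at h2
      have h3 : ∀ a' ∈ V, ∀ b' ∈ V, pr z (dd a' b' y) = if s(a, b) = s(a', b') then pr z (dd a b y) else 0 := by
        intro a' ha' b' hb'
        split_ifs with hs
        · rcases Sym2.eq_iff.1 hs with ⟨rfl, rfl⟩ | ⟨rfl, rfl⟩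
          · rfl
          · rw [dd_symm]
        · by_cases e : a' = b'
          · subst e; rw [dd_self a' hy, pr_zero_right]
          by_cases h4 : a' ∈ V \ {a, b}
          · exact pr_full hUc h4 (by simp) hz (dd_mem a' b' hy)
          by_cases h5 : b' ∈ V \ {a, b}
          · exact pr_full hUc h5 (by simp) hz (dd_mem a' b' hy)
          exfalso
          simp only [Finset.mem_sdiff, ha', hb', true_and, not_not, Finset.mem_insert, Finset.mem_singleton] at h4 h5
          apply hs; rw [Sym2.eq_iff]; grind
      have h6 : ∑ a' ∈ V, pr z (∑ b' ∈ V, dd a' b' y) = 2 * pr z (dd a b y) := by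
        simp only [pr_sum_right]
        rw [Finset.sum_congr rfl fun a' ha' => Finset.sum_congr rfl fun b' hb' => h3 a' ha' b' hb']
        have h7 := congrArg sc (sum_pair ha hb hab (((pr z (dd a b y) : ℤ) : LE)))
        simp only [map_sum, apply_ite sc, map_zero, map_zsmul, map_intCast] at h7
        simpa using h7
      rw [h6] at h2
      exact ⟨pr z u, by linarith⟩
    exact fun z hz => this hz
  obtain ⟨y', hy', rfl⟩ := div_crit m hy key
  refine mem_B.2 ⟨y', hy', ?_⟩
  have h8 : m • (bd y' - u) = 0 := by rw [smul_sub, ← hyu, map_smul, sub_self]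
  exact sub_eq_zero.1 (tf (Submodule.sub_mem _ (bd_mem hy') hu) hm h8)

theorem tiny {k : ℕ} {V : Finset ℕ} (hV : V.card < 2 * (k + 1)) {m : ℤ} (hm : m ≠ 0) {u : LE}
    (hu : u ∈ C k V) (h : m • u ∈ B k V) : u ∈ B k V := by
  obtain ⟨y, hy, hyu⟩ := mem_B.1 h
  rw [C_small hV hy, map_zero] at hyu
  rw [tf hu hm hyu.symm]; exact Submodule.zero_mem _

/-! ### n = 14 -/

theorem pr_Nv {c : ℕ} {U V : Finset ℕ} {a : ℕ} (ha : a ∉ U) {z : LE} (hz : z ∈ C c U) (u : LE) :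
    pr z (Nv a V u) = pr z u := by
  rw [Nv_apply, pr_sub_right, pr_sum_right, Finset.sum_eq_zero, sub_zero]
  intro v hv; exact pr_x_avoid ha v hz _

theorem pr_Nv' {V : Finset ℕ} {a : ℕ} {z : LE} (hz : ∀ v, dd a v z = 0) (u : LE) :
    pr z (Nv a V u) = pr z u := by
  rw [Nv_apply, pr_sub_right, pr_sum_right, Finset.sum_eq_zero, sub_zero]
  intro v hv; rw [pr_x_right, hz, pr_zero_left]

theorem sum_erase {c : ℕ} {V : Finset ℕ} {u : LE} (hu : u ∈ C c V) :
    ∑ a ∈ V, ∑ b ∈ V.erase a, x a b * dd a b u = (2 * c : ℤ) • u := by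
  rw [← sum_x_dd hu]
  refine Finset.sum_congr rfl fun a ha => ?_
  rw [← Finset.add_sum_erase V _ ha, dd_self a hu, mul_zero, zero_add]

theorem sum_Nv {c : ℕ} {V : Finset ℕ} {u : LE} (hu : u ∈ C c V) :
    ∑ a ∈ V, Nv a V u = ((V.card : ℤ) - 2 * c) • u := by
  simp only [Nv_apply, Finset.sum_sub_distrib, Finset.sum_const]
  rw [sum_erase hu, sub_smul, natCast_zsmul]

theorem Nv_sub {c : ℕ} {U V : Finset ℕ} {a b : ℕ} (hU : U = V.erase a) {u : LE}
    (hu : u ∈ C c U) : Nv b V u = Nv b U u := by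
  rw [Nv_apply, Nv_apply]
  congr 1
  subst hU
  symm
  refine Finset.sum_subset (Finset.erase_subset_erase _ (Finset.erase_subset _ _)) ?_
  intro v hv hv'
  have : v = a := by simp only [Finset.mem_erase] at hv hv'; tauto
  subst this
  rw [dd_zero' (Finset.notMem_erase _ _) b hu, mul_zero]

noncomputable def del (V : Finset ℕ) : LE →ₗ[ℤ] LE :=
  ∑ a ∈ V, ∑ b ∈ V.erase a, (LinearMap.mulLeft ℤ (x a b)).comp ((Nv b V).comp (Nv a V))

theorem del_apply (V : Finset ℕ) (u : LE) :
    del V u = ∑ a ∈ V, ∑ b ∈ V.erase a, x a b * Nv b V (Nv a V u) := by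
  simp [del, LinearMap.sum_apply]

theorem NvNv_mem {c : ℕ} {V : Finset ℕ} {a b : ℕ} {u : LE} (hu : u ∈ C c V) :
    Nv b V (Nv a V u) ∈ C c (V \ {a, b}) := by
  rw [Nv_sub rfl (Nv_mem a hu)]
  have h := Nv_mem b (Nv_mem a hu)
  have e : (V.erase a).erase b = V \ {a, b} := by ext; simp; tauto
  rwa [e] at h

theorem del_mem {c : ℕ} {V : Finset ℕ} {u : LE} (hu : u ∈ C c V) : del V u ∈ C (c + 1) V := by
  rw [del_apply]
  refine Submodule.sum_mem _ fun a ha => Submodule.sum_mem _ fun b hb => ?_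
  exact x_mul_mem_C ha (Finset.mem_of_mem_erase hb) (Finset.ne_of_mem_erase hb).symm (NvNv_mem hu)

theorem lap_term {c : ℕ} {V : Finset ℕ} {u : LE} (hu : u ∈ Z (c + 1) V) {a b : ℕ} (ha : a ∈ V)
    (hb : b ∈ V.erase a) :
    pr (dd a b u) (bd (Nv b V (Nv a V u))) =
      pr (dd a b u) (dd a b u) - pr (dd a b u) (∑ w ∈ V.erase a, dd a w u)
        - pr (dd a b u) (∑ w ∈ V.erase b, dd b w u) := by
  obtain ⟨huC, hub⟩ := mem_Z.1 hu
  have hm : dd a b u ∈ C c (V \ {a, b}) := dd_mem a b huC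
  have hb' : b ∉ V \ {a, b} := by simp
  have ha' : a ∉ V \ {a, b} := by simp
  have hab : a ∈ V.erase b := Finset.mem_erase.2 ⟨(Finset.ne_of_mem_erase hb).symm, ha⟩
  rw [bd_Nv, bd_Nv, hub, map_zero, zero_sub, map_neg, pr_sub_right, pr_neg_right, pr_Nv hb' hm]
  have h1 : pr (dd a b u) (∑ w ∈ V.erase b, dd b w (Nv a V u)) =
      pr (dd a b u) (∑ w ∈ V.erase b, dd b w u) - pr (dd a b u) (dd a b u) := by
    rw [← Finset.add_sum_erase _ _ hab, ← Finset.add_sum_erase _ (fun w => dd b w u) hab, pr_add_right, pr_add_right,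
      dd_zero' (Finset.notMem_erase a V) b (Nv_mem a huC), pr_zero_right, dd_symm b a, zero_add, add_sub_cancel_left,
      pr_sum_right, pr_sum_right]
    refine Finset.sum_congr rfl fun w hw => ?_
    rw [← pr_x_left, ← pr_x_left]
    simp only [Finset.mem_erase] at hw hb
    apply pr_Nv'
    intro v
    rw [dd_x_ne (by rw [Ne, Sym2.eq_iff]; grind), dd_zero ha' v hm, mul_zero, neg_zero]
  rw [h1]; ring


theorem lap {c : ℕ} {V : Finset ℕ} {u : LE} (hu : u ∈ Z (c + 1) V) :
    ((V.card : ℤ) - 2 * (c + 1)) * ((V.card : ℤ) - 1 - 2 * (c + 1)) * pr u u - 2 * (c + 1) * pr u u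
      ≤ pr u (bd (del V u)) := by
  obtain ⟨huC, hub⟩ := mem_Z.1 hu
  have e1 : pr u (bd (del V u)) = (∑ a ∈ V, ∑ b ∈ V.erase a, pr u (Nv b V (Nv a V u)))
      - ∑ a ∈ V, ∑ b ∈ V.erase a, pr (dd a b u) (bd (Nv b V (Nv a V u))) := by
    rw [del_apply]
    simp only [map_sum, bd_x_mul, pr_sum_right, pr_sub_right, pr_x_right, Finset.sum_sub_distrib]
  have e2 : ∑ a ∈ V, ∑ b ∈ V.erase a, pr u (Nv b V (Nv a V u)) =
      ((V.card : ℤ) - 2 * (c + 1)) * ((V.card : ℤ) - 1 - 2 * (c + 1)) * pr u u := by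
    have h1 : ∀ a ∈ V, ∑ b ∈ V.erase a, pr u (Nv b V (Nv a V u)) =
        ((V.card : ℤ) - 1 - 2 * (c + 1)) * pr u (Nv a V u) := by
      intro a ha
      have h2 := congrArg (pr u) (sum_Nv (Nv_mem a huC))
      rw [pr_sum_right, pr_smul_right] at h2
      rw [Finset.sum_congr rfl fun b hb => by rw [Nv_sub rfl (Nv_mem a huC)], h2, Finset.card_erase_of_mem ha,
        Nat.cast_sub (Finset.card_pos.2 ⟨a, ha⟩)]
      push_cast; ring
    rw [Finset.sum_congr rfl h1, ← Finset.mul_sum, ← pr_sum_right, sum_Nv huC, pr_smul_right]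
    push_cast; ring
  have e3 : ∑ a ∈ V, ∑ b ∈ V.erase a, pr (dd a b u) (dd a b u) = 2 * (c + 1) * pr u u := by
    have h := congrArg (pr u) (sum_erase huC)
    simp only [pr_sum_right, pr_smul_right, pr_x_right] at h
    rw [h]; push_cast; ring
  have e4 : ∑ a ∈ V, ∑ b ∈ V.erase a, pr (dd a b u) (∑ w ∈ V.erase a, dd a w u) =
      ∑ a ∈ V, pr (∑ w ∈ V.erase a, dd a w u) (∑ w ∈ V.erase a, dd a w u) := by
    simp only [pr_sum_left]
  have e5 : ∑ a ∈ V, ∑ b ∈ V.erase a, pr (dd a b u) (∑ w ∈ V.erase b, dd b w u) =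
      ∑ a ∈ V, pr (∑ w ∈ V.erase a, dd a w u) (∑ w ∈ V.erase a, dd a w u) := by
    rw [← e4]
    rw [Finset.sum_comm' (t' := V) (s' := fun a => V.erase a)]
    · refine Finset.sum_congr rfl fun a ha => Finset.sum_congr rfl fun b hb => ?_
      rw [dd_symm]
    · intro a b; simp only [Finset.mem_erase]; grind
  have e6 : 0 ≤ ∑ a ∈ V, pr (∑ w ∈ V.erase a, dd a w u) (∑ w ∈ V.erase a, dd a w u) := by
    refine Finset.sum_nonneg fun a ha => pr_self_nonneg (c := c) (V := V) ?_
    exact Submodule.sum_mem _ fun b hb => C_mono Finset.sdiff_subset (dd_mem a b huC)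
  rw [e1, e2, Finset.sum_congr rfl fun a ha => Finset.sum_congr rfl fun b hb => lap_term hu ha hb]
  simp only [Finset.sum_sub_distrib]
  rw [e3, e4, e5]
  linarith

theorem lap_inj {c : ℕ} {V : Finset ℕ}
    (hc : 2 * (c + 1) < ((V.card : ℤ) - 2 * (c + 1)) * ((V.card : ℤ) - 1 - 2 * (c + 1)))
    {u : LE} (hu : u ∈ Z (c + 1) V) (h : bd (del V u) = 0) : u = 0 := by
  have h1 := lap hu
  rw [h, pr_zero_right] at h1
  have h2 := pr_self_nonneg (mem_Z.1 hu).1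
  refine pr_self_zero (mem_Z.1 hu).1 ?_
  nlinarith

theorem quot_finite {c n : ℕ} {V : Finset ℕ} (hV : V = Finset.range n)
    (hc : 2 * ((c : ℤ) + 1) < ((n : ℤ) - 2 * (c + 1)) * ((n : ℤ) - 1 - 2 * (c + 1))) {M : Type} [AddCommGroup M]
    (π : Z (c + 1) V →+ M) (hs : Function.Surjective π)
    (hk : ∀ z, z.1 ∈ B (c + 1) V → π z = 0) : Finite M := by
  have hfin : Module.Finite ℤ (C (c + 1) V) := Module.Finite.iff_fg.2 (by rw [hV]; exact C_fg n (c + 1))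
  have hle : Z (c + 1) V ≤ C (c + 1) V := fun z hz => (mem_Z.1 hz).1
  have hfinZ : Module.Finite ℤ (Z (c + 1) V) :=
    Module.Finite.of_injective (Submodule.inclusion hle) (Submodule.inclusion_injective hle)
  have htf : Module.IsTorsionFree ℤ (Z (c + 1) V) := by
    refine Module.IsTorsionFree.mk fun r hr z w h => ?_
    have h1 : r • (z.1 - w.1) = 0 := by
      have := congrArg Subtype.val h
      simpa [smul_sub, sub_eq_zero] using this
    have h2 := tf (Submodule.sub_mem _ (hle z.2) (hle w.2)) (IsRegular.ne_zero hr) h1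
    exact Subtype.ext (sub_eq_zero.1 h2)
  let T : Z (c + 1) V →ₗ[ℤ] Z (c + 1) V :=
    ((bd.comp (del V)).comp (Z (c + 1) V).subtype).codRestrict (Z (c + 1) V)
      fun z => B_le_Z (bd_mem_B (del_mem (hle z.2)))
  have hT : Function.Injective T := by
    rw [injective_iff_map_eq_zero]
    intro z hz
    apply Subtype.ext
    exact lap_inj (V := V) (by rw [hV, Finset.card_range]; exact_mod_cast hc) z.2 (congrArg Subtype.val hz)
  have hr : Module.finrank ℤ (LinearMap.range T) = Module.finrank ℤ (Z (c + 1) V) :=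
    LinearMap.finrank_range_of_inj hT
  have := Submodule.finiteQuotientOfFreeOfRankEq _ hr
  let π' : (Z (c + 1) V ⧸ LinearMap.range T) →ₗ[ℤ] M := (LinearMap.range T).liftQ π.toIntLinearMap (by
    rintro _ ⟨z, rfl⟩
    exact hk _ (bd_mem_B (del_mem (hle z.2))))
  refine Finite.of_surjective π' ?_
  intro m
  obtain ⟨z, rfl⟩ := hs m
  exact ⟨Submodule.Quotient.mk z, rfl⟩

end MC

set_option synthInstance.maxHeartbeats 20000
set_option maxHeartbeats 400000
set_option linter.all false
namespace MC

theorem ex_one (c : ℕ) : ∃ z ∈ Z (c + 2) (Finset.range (3 * (c + 2) + 1)), z ∉ B (c + 2) (Finset.range (3 * (c + 2) + 1)) := by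
  refine ⟨Ebr (List.range (3 * (c + 2))), Br_le_Z (Ebr_Br _ _ _ (List.length_range) List.nodup_range ?_),
    nontriv c (by simp) (r := 3 * (c + 2)) (by simp) List.nodup_range List.length_range ?_⟩
  · intro a ha; simp at ha ⊢; omega
  · intro a ha; simp at ha ⊢; omega

theorem ex_zero (c : ℕ) : ∃ z ∈ Z (c + 2) (Finset.range (3 * (c + 2))), z ∉ B (c + 2) (Finset.range (3 * (c + 2))) := by
  refine ⟨Ebr (List.range (3 * (c + 2))), Br_le_Z (Ebr_Br _ _ _ (List.length_range) List.nodup_range ?_), fun h => ?_⟩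
  · intro a ha; simpa using ha
  · refine nontriv c (by simp) (r := 3 * (c + 2)) (V := Finset.range (3 * (c + 2) + 1)) (by simp) List.nodup_range List.length_range ?_ (B_mono ?_ h)
    · intro a ha; simp at ha ⊢; omega
    · intro a ha; simp at ha ⊢; omega

theorem ex_two (c : ℕ) : ∃ z ∈ Z (c + 4) (Finset.range (3 * (c + 2) + 5)),
    ∀ N : ℤ, N • z ∈ B (c + 4) (Finset.range (3 * (c + 2) + 5)) → 3 ∣ N := by
  obtain ⟨m, hm⟩ : ∃ m, m = 3 * (c + 2) := ⟨_, rfl⟩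
  have hE : Ebr (List.range m) ∈ Z (c + 2) (Finset.range m) :=
    Br_le_Z (Ebr_Br _ _ _ (by simp [hm]) List.nodup_range (by simp))
  have hnd : [m, m + 1, m + 2, m + 3, m + 4].Nodup := by simp
  rw [← hm]
  refine ⟨pent m (m + 1) (m + 2) (m + 3) (m + 4) * Ebr (List.range m), pent_mul_Z ?_ hnd hE ?_, fun N hN => ?_⟩
  · intro a; simp; omega
  · intro a; simp; omega
  have h1 := dd_B (c := c + 2) (m + 1) (m + 3) (dd_B (c := c + 3) m (m + 2) hN)
  rw [map_smul, map_smul, dd_pent_mul hnd (m + 2) (m + 3) (mem_Z.1 hE).1 (by simp) (by simp)] at h1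
  simp only [and_self, if_true] at h1
  have h2 : N • Ebr (List.range m) ∈ B (c + 2) (insert (m + 4) (Finset.range m)) := by
    refine B_mono ?_ h1
    intro a; simp; omega
  have h3 : (3 : ℤ) • Ebr (List.range m) ∈ B (c + 2) (insert (m + 4) (Finset.range m)) :=
    exp_one (by rw [Finset.card_insert_of_notMem (by simp), Finset.card_range]; omega) (Z_mono (Finset.subset_insert _ _) hE)
  by_contra h4
  have h5 : IsCoprime (3 : ℤ) N := (Int.prime_three.coprime_iff_not_dvd).2 h4
  obtain ⟨a, b, hab⟩ := h5
  refine nontriv c (V := insert (m + 4) (Finset.range m)) (r := m + 4) (l := List.range m)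
    (by rw [Finset.card_insert_of_notMem (by simp), Finset.card_range]; omega) (by simp) List.nodup_range (by simp [hm]) ?_ ?_
  · intro v hv; simp at hv ⊢; omega
  · have : Ebr (List.range m) = a • (3 : ℤ) • Ebr (List.range m) + b • N • Ebr (List.range m) := by
      rw [← mul_smul, ← mul_smul, ← add_smul, hab, one_smul]
    rw [this]
    exact Submodule.add_mem _ (Submodule.smul_mem _ _ h3) (Submodule.smul_mem _ _ h2)

theorem dd_Rv {q a c d : ℕ} {V : Finset ℕ} (h1 : a ≠ c) (h2 : a ≠ d) (h3 : q ≠ c) (h4 : q ≠ d) (z : LE) :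
    dd c d (Rv q a V z) = Rv q a V (dd c d z) := by
  have e : ∀ p, p ≠ c → p ≠ d → ∀ b, dd c d (x p b * dd a b z) = x p b * dd a b (dd c d z) := by
    intro p hc hd b
    rw [dd_x_ne (by rw [Ne, Sym2.eq_iff]; grind), dd_dd c d a b, mul_neg, neg_neg]
  rw [Rv_apply, Rv_apply, Nv_apply, Nv_apply, map_add, map_sub, map_sum, map_sum]
  congr 1
  · congr 1; exact Finset.sum_congr rfl fun b _ => e a h1 h2 b
  · exact Finset.sum_congr rfl fun b _ => e q h3 h4 b

theorem al_mem : Ebr (List.range 6) ∈ Z 2 (Finset.range 6) :=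
  Br_le_Z (Ebr_Br _ _ _ (by simp) List.nodup_range (by simp))

theorem al_not (r : ℕ) (hr : 6 ≤ r) : Ebr (List.range 6) ∉ B 2 (insert r (Finset.range 6)) := by
  refine nontriv 0 (r := r) ?_ (by simp) List.nodup_range (by simp) ?_
  · rw [Finset.card_insert_of_notMem (by simp; omega), Finset.card_range]
  · intro v hv; simp at hv ⊢; omega

noncomputable def w9 : LE := Sv 7 8 (Finset.range 7) (Ebr (List.range 6))

theorem sub67 : Finset.range 6 ⊆ Finset.range 7 := Finset.range_subset_range.2 (by norm_num)

theorem ins9 : (insert 7 (insert 8 (Finset.range 7)) : Finset ℕ) = Finset.range 9 := by decide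
theorem ins11 : (insert 9 (insert 10 (Finset.range 9)) : Finset ℕ) = Finset.range 11 := by decide

theorem w9_Z : w9 ∈ Z 3 (Finset.range 9) := by
  rw [← ins9]; exact Sv_Z (by simp) (by simp) (by simp) (Z_mono sub67 al_mem)

theorem w9_three : (3 : ℤ) • w9 ∈ B 3 (Finset.range 9) := by
  rw [← ins9, w9, ← map_smul]
  exact Sv_B (by simp) (by simp) (by simp) (exp_one (k := 0) (by simp) (Z_mono sub67 al_mem))

theorem w9_dd : dd 7 6 w9 = Ebr (List.range 6) := by
  rw [w9, dd_Sv (by simp) (by simp) (by simp) (by simp) (C_mono sub67 (mem_Z.1 al_mem).1)]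
  exact (Rv_spare (by simp) (mem_Z.1 al_mem).1).1

theorem w9_not : w9 ∉ B 3 (Finset.range 9) := by
  intro h
  have h1 := dd_B (c := 2) 7 6 h
  rw [w9_dd] at h1
  exact al_not 8 (by norm_num) (B_mono (by decide) h1)

theorem ex_nine : ∃ z ∈ Z 3 (Finset.range 9), z ∉ B 3 (Finset.range 9) ∧ (3 : ℤ) • z ∈ B 3 (Finset.range 9) :=
  ⟨w9, w9_Z, w9_not, w9_three⟩

theorem ex_eleven : ∃ z ∈ Z 4 (Finset.range 11), z ∉ B 4 (Finset.range 11) ∧ (3 : ℤ) • z ∈ B 4 (Finset.range 11) := by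
  refine ⟨Sv 9 10 (Finset.range 9) w9, ?_, fun h => ?_, ?_⟩
  · rw [← ins11]; exact Sv_Z (by simp) (by simp) (by simp) w9_Z
  · have h1 := dd_B (c := 2) 7 6 (dd_B (c := 3) 9 8 h)
    rw [dd_Sv (by simp) (by simp) (by simp) (by simp) (mem_Z.1 w9_Z).1, dd_Rv (by simp) (by simp) (by simp) (by simp), w9_dd,
      (Rv_spare (by simp) (mem_Z.1 al_mem).1).1] at h1
    exact al_not 10 (by norm_num) (B_mono (by decide) h1)
  · rw [← ins11, ← map_smul]
    exact Sv_B (by simp) (by simp) (by simp) w9_three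

end MC

set_option synthInstance.maxHeartbeats 20000
set_option maxHeartbeats 400000
set_option linter.all false
namespace MC

noncomputable def ad (w : LE) : LE →ₗ[ℤ] LE := MulOpposite.unop (kap w)

theorem ad_mul (w z y : LE) : ad (w * z) y = ad z (ad w y) := by
  simp [ad]

theorem ad_one (y : LE) : ad 1 y = y := by
  simp [ad]

theorem ad_add (w z y : LE) : ad (w + z) y = ad w y + ad z y := by
  simp [ad]

theorem ad_sub (w z y : LE) : ad (w - z) y = ad w y - ad z y := by
  simp [ad]

theorem ad_smul (m : ℤ) (z y : LE) : ad (m • z) y = m • ad z y := by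
  unfold ad
  rw [map_zsmul]
  rfl

theorem ad_x (a b : ℕ) : ad (x a b) = dd a b := by
  unfold ad x dd
  rw [kap_gen, MulOpposite.unop_op]
  congr 1
  funext e
  rw [Finsupp.single_apply]
  simp only [eq_comm]

theorem ad_sum {ι : Type} (s : Finset ι) (f : ι → LE) (y : LE) :
    ad (∑ i ∈ s, f i) y = ∑ i ∈ s, ad (f i) y := by
  classical
  induction s using Finset.induction_on with
  | empty => simp [ad]
  | insert a s ha ih => rw [Finset.sum_insert ha, Finset.sum_insert ha, ad_add, ih]

theorem pr_ad (w z y : LE) : pr (w * z) y = pr z (ad w y) := by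
  change sc (MulOpposite.unop (kap (w * z)) y) = sc (MulOpposite.unop (kap z) (ad w y))
  have := ad_mul w z y
  unfold ad at this ⊢
  rw [this]

theorem pr_ad_one (w y : LE) : pr w y = sc (ad w y) := rfl

theorem C_full (c : ℕ) : ∀ {V : Finset ℕ} {S : Submodule ℤ LE}
    (h : ∀ U ⊆ V, U.card = 2 * c → C c U ≤ S), C c V ≤ S := by
  induction c with
  | zero =>
    intro V S h
    exact C_zero_le (h ∅ (by simp) (by simp) (one_mem_C _))
  | succ c ih =>
    intro V S h
    apply C_succ_le
    intro a b z ha hb hab hz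
    have key : C c (V \ {a, b}) ≤ S.comap (LinearMap.mulLeft ℤ (x a b)) := by
      apply ih
      intro U hU hc w hw
      have haU : a ∉ U := fun h => by have := hU h; simp at this
      have hbU : b ∉ U := fun h => by have := hU h; simp at this
      change x a b * w ∈ S
      apply h (insert a (insert b U))
      · intro v hv
        simp only [Finset.mem_insert] at hv
        rcases hv with rfl | rfl | hv
        · exact ha
        · exact hb
        · exact (Finset.mem_sdiff.1 (hU hv)).1
      · rw [Finset.card_insert_of_notMem (by simp [hab, haU]), Finset.card_insert_of_notMem hbU]
        omega
      · exact x_mul_mem_C' (by simp) (by simp) hab hw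
          (fun v hv => by simp [hv]) haU hbU
    exact key hz

theorem C_succ_le' {c : ℕ} {V : Finset ℕ} {S : Submodule ℤ LE}
    (h : ∀ a b z, a ∈ V → b ∈ V → a ≠ b → z ∈ C c (V \ {a, b}) → z * x a b ∈ S) :
    C (c + 1) V ≤ S := by
  apply C_succ_le
  intro a b z ha hb hab hz
  rw [x_comm hz]
  exact S.smul_mem _ (h a b z ha hb hab hz)

/-- the map x_ab -> a + b -/
noncomputable def fm : LE →+* Lam ℕ :=
  mapL (fun e : Sym2 ℕ => Sym2.lift ⟨fun a b => Finsupp.single a (1 : ℤ) + Finsupp.single b 1,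
    fun a b => add_comm _ _⟩ e)

theorem fm_x (a b : ℕ) : fm (x a b) = gen a + gen b := by
  unfold fm x
  rw [mapL_gen, Sym2.lift_mk, lin_add, lin_single, lin_single]

noncomputable def gm (V : Finset ℕ) : Lam ℕ →+* LE :=
  mapL (fun v => ∑ b ∈ V.erase v, Finsupp.single s(v, b) (1 : ℤ))

theorem gm_gen (V : Finset ℕ) (v : ℕ) : gm V (gen v) = ∑ b ∈ V.erase v, x v b := by
  unfold gm x
  rw [mapL_gen, lin_sum]
  exact Finset.sum_congr rfl fun b _ => lin_single _

noncomputable def one (V : Finset ℕ) : Lam ℕ := ∑ v ∈ V, gen v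

theorem sum_sq {ι E : Type} (s : Finset ι) (f : ι → E) :
    (∑ i ∈ s, (gen (f i) : Lam E)) * (∑ i ∈ s, gen (f i)) = 0 := by
  classical
  induction s using Finset.induction_on with
  | empty => simp
  | insert a s ha ih =>
    rw [Finset.sum_insert ha, add_mul, mul_add, mul_add, gen_sq, ih, Finset.mul_sum, Finset.sum_mul,
      zero_add, add_zero, ← Finset.sum_add_distrib]
    exact Finset.sum_eq_zero fun i _ => by rw [gen_anti]; simp

theorem one_sq (V : Finset ℕ) (F : Lam ℕ) : one V * (one V * F) = 0 := by
  rw [← mul_assoc]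
  unfold one
  rw [sum_sq V (fun v => v), zero_mul]

theorem gen_sum_anti (V : Finset ℕ) (a : ℕ) : one V * gen a = - (gen a * one V) := by
  unfold one
  rw [Finset.mul_sum, Finset.sum_mul, ← Finset.sum_neg_distrib]
  exact Finset.sum_congr rfl fun b _ => gen_anti _ _

theorem one_fm (c : ℕ) : ∀ {U : Finset ℕ} (hU : U.card = 2 * c) {z : LE} (hz : z ∈ C c U),
    one U * fm z = 0 := by
  induction c with
  | zero =>
    intro U hU z hz
    have : U = ∅ := by rw [← Finset.card_eq_zero]; omega
    subst this
    simp [one]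
  | succ c ih =>
    intro U hU
    have key : C (c + 1) U ≤
        LinearMap.ker ((LinearMap.mulLeft ℤ (one U)).comp fm.toAddMonoidHom.toIntLinearMap) := by
      apply C_succ_le
      intro a b z ha hb hab hz
      change one U * fm (x a b * z) = 0
      have h1 : one U = gen a + gen b + one (U \ {a, b}) := by
        unfold one
        rw [← Finset.sum_sdiff (show ({a, b} : Finset ℕ) ⊆ U by
          intro v hv; simp at hv; rcases hv with rfl | rfl <;> assumption)]
        rw [Finset.sum_pair hab, add_comm]
      have h2 : (U \ {a, b}).card = 2 * c := by
        rw [Finset.card_sdiff_of_subset (by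
          intro v hv; simp at hv; rcases hv with rfl | rfl <;> assumption), Finset.card_pair hab]
        omega
      have h3 := ih h2 hz
      have h4 : (gen a + gen b : Lam ℕ) * (gen a + gen b) = 0 := by
        rw [add_mul, mul_add, mul_add, gen_sq, gen_sq, gen_anti b a]; simp
      have h5 : one (U \ {a, b}) * (gen a + gen b) = - ((gen a + gen b) * one (U \ {a, b})) := by
        rw [mul_add, gen_sum_anti, gen_sum_anti, add_mul]; abel
      rw [map_mul, fm_x, ← mul_assoc, h1, add_mul, h4, h5, zero_add, neg_mul, mul_assoc, h3]
      simp
    intro z hz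
    exact key hz

/-- S operator -/
noncomputable def S (V : Finset ℕ) (v : ℕ) : LE →ₗ[ℤ] LE := ∑ b ∈ V.erase v, dd v b

theorem S_apply (V : Finset ℕ) (v : ℕ) (y : LE) : S V v y = ∑ b ∈ V.erase v, dd v b y := by
  simp [S]

theorem ad_gm (V : Finset ℕ) (v : ℕ) (y : LE) : ad (gm V (gen v)) y = S V v y := by
  rw [gm_gen, ad_sum, S_apply]
  simp [ad_x]

theorem S_dd (V : Finset ℕ) (v a b : ℕ) (y : LE) : S V v (dd a b y) = - dd a b (S V v y) := by
  rw [S_apply, S_apply, map_sum, ← Finset.sum_neg_distrib]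
  exact Finset.sum_congr rfl fun c _ => dd_dd _ _ _ _ _

theorem S_S (V : Finset ℕ) (v w : ℕ) (y : LE) : S V v (S V w y) = - S V w (S V v y) := by
  rw [S_apply V w, map_sum, S_apply V w, ← Finset.sum_neg_distrib]
  exact Finset.sum_congr rfl fun c _ => S_dd _ _ _ _ _

theorem S_mem {c : ℕ} {V W : Finset ℕ} (v : ℕ) {y : LE} (hy : y ∈ C (c + 1) W) :
    S V v y ∈ C c W := by
  rw [S_apply]
  exact Submodule.sum_mem _ fun b _ => C_mono Finset.sdiff_subset (dd_mem v b hy)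

theorem S_zero {c : ℕ} {V W : Finset ℕ} {v : ℕ} (hv : v ∉ W) {y : LE} (hy : y ∈ C c W) :
    S V v y = 0 := by
  rw [S_apply]
  exact Finset.sum_eq_zero fun b _ => dd_zero hv b hy

theorem S_dd_zero {c : ℕ} {V W : Finset ℕ} {a b : ℕ} {y : LE} (hy : y ∈ C (c + 1) W) :
    S V a (dd a b y) = 0 := S_zero (W := W \ {a, b}) (by simp) (dd_mem a b hy)

theorem sum_S {c : ℕ} {V : Finset ℕ} {y : LE} (hy : y ∈ C c V) :
    ∑ v ∈ V, S V v y = (2 : ℤ) • bd y := by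
  rw [← sum_dd hy]
  apply Finset.sum_congr rfl
  intro a ha
  rw [S_apply, ← Finset.add_sum_erase _ _ ha, dd_self a hy, zero_add]

/-- only three edges see w -/
theorem tri_sum {c : ℕ} {V U : Finset ℕ} {p q r : ℕ} (hUV : V = insert p (insert q (insert r U)))
    (hp : p ∉ U) (hq : q ∉ U) (hr : r ∉ U) (hpq : p ≠ q) (hpr : p ≠ r) (hqr : q ≠ r)
    (hU : U.card = 2 * c) {w y : LE} (hw : w ∈ C c U) (hy : y ∈ C (c + 1) V) :
    pr w (bd y) = pr w (dd p q y) + pr w (dd q r y) + pr w (dd p r y) := by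
  have h1 := sum_dd hy
  have hz : ∀ a b, a ∈ U ∨ b ∈ U → pr w (dd a b y) = 0 := by
    rintro a b (h | h)
    · exact pr_full hU h (by simp) hw (dd_mem a b hy)
    · exact pr_full hU h (by simp) hw (dd_mem a b hy)
  have h2 : pr w ((2 : ℤ) • bd y) = ∑ a ∈ V, ∑ b ∈ V, pr w (dd a b y) := by
    rw [← h1, pr_sum_right]
    exact Finset.sum_congr rfl fun a _ => pr_sum_right _ _ _
  have hs : ∀ a, ∑ b ∈ V, pr w (dd a b y) = pr w (dd a p y) + pr w (dd a q y) + pr w (dd a r y) := by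
    intro a
    rw [hUV, Finset.sum_insert (by simp [hpq, hpr, hp]), Finset.sum_insert (by simp [hqr, hq]),
      Finset.sum_insert hr, Finset.sum_eq_zero (fun b hb => hz a b (Or.inr hb))]
    ring
  simp only [hs] at h2
  rw [hUV, Finset.sum_insert (by simp [hpq, hpr, hp]), Finset.sum_insert (by simp [hqr, hq]),
      Finset.sum_insert hr, Finset.sum_eq_zero (fun b hb => by
        rw [hz b _ (Or.inl hb), hz b _ (Or.inl hb), hz b _ (Or.inl hb)]; rfl)] at h2
  rw [dd_self p hy, dd_self q hy, dd_self r hy, dd_symm q p, dd_symm r p, dd_symm r q,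
    pr_smul_right, pr_zero_right] at h2
  linarith

theorem S_full {c : ℕ} {V U : Finset ℕ} {p q r : ℕ} (hUV : V = insert p (insert q (insert r U)))
    (hp : p ∉ U) (hq : q ∉ U) (hr : r ∉ U) (hpq : p ≠ q) (hpr : p ≠ r) (hqr : q ≠ r)
    (hU : U.card = 2 * c) {w y : LE} (hw : w ∈ C c U) (hy : y ∈ C (c + 1) V) :
    pr w (S V p y) = pr w (dd p q y) + pr w (dd p r y) := by
  have hz : ∀ a b, a ∈ U ∨ b ∈ U → pr w (dd a b y) = 0 := by
    rintro a b (h | h)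
    · exact pr_full hU h (by simp) hw (dd_mem a b hy)
    · exact pr_full hU h (by simp) hw (dd_mem a b hy)
  have he : V.erase p = insert q (insert r U) := by
    rw [hUV, Finset.erase_insert (by simp [hpq, hpr, hp])]
  rw [S_apply, pr_sum_right, he, Finset.sum_insert (by simp [hqr, hq]),
      Finset.sum_insert hr, Finset.sum_eq_zero (fun b hb => hz p b (Or.inr hb))]
  ring

end MC

set_option synthInstance.maxHeartbeats 20000
set_option maxHeartbeats 400000
set_option linter.all false
namespace MC

theorem compl_two {U V : Finset ℕ} (h : U ⊆ V) (hc : V.card = U.card + 2) :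
    ∃ p q, p ∉ U ∧ q ∉ U ∧ p ≠ q ∧ V = insert p (insert q U) := by
  have h1 : (V \ U).card = 2 := by rw [Finset.card_sdiff_of_subset h]; omega
  obtain ⟨p, q, hpq, e⟩ := Finset.card_eq_two.1 h1
  have h2 : ∀ v, (v ∈ V ∧ v ∉ U) ↔ (v = p ∨ v = q) := by
    intro v; rw [← Finset.mem_sdiff, e]; simp
  refine ⟨p, q, ((h2 p).2 (by simp)).2, ((h2 q).2 (by simp)).2, hpq, ?_⟩
  ext v
  simp only [Finset.mem_insert]
  have := h2 v
  have h3 := @h v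
  constructor
  · intro hv
    by_cases hU : v ∈ U
    · exact Or.inr (Or.inr hU)
    · rcases this.1 ⟨hv, hU⟩ with h | h <;> simp [h]
  · rintro (hv | hv | hv)
    · exact (this.2 (Or.inl hv)).1
    · exact (this.2 (Or.inr hv)).1
    · exact h3 hv

theorem compl_three {U V : Finset ℕ} (h : U ⊆ V) (hc : V.card = U.card + 3) :
    ∃ p q r, p ∉ U ∧ q ∉ U ∧ r ∉ U ∧ p ≠ q ∧ p ≠ r ∧ q ≠ r ∧
      V = insert p (insert q (insert r U)) := by
  have h1 : (V \ U).Nonempty := by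
    rw [← Finset.card_pos, Finset.card_sdiff_of_subset h]; omega
  obtain ⟨r, hr⟩ := h1
  rw [Finset.mem_sdiff] at hr
  obtain ⟨p, q, hp, hq, hpq, e⟩ := compl_two (U := insert r U) (V := V)
    (Finset.insert_subset hr.1 h) (by rw [Finset.card_insert_of_notMem hr.2]; omega)
  simp only [Finset.mem_insert, not_or] at hp hq
  exact ⟨p, q, r, hp.2, hq.2, hr.2, hpq, hp.1, hq.1, e⟩

/-- representing cycles -/
theorem cyc {c : ℕ} {V : Finset ℕ} (hV : V.card = 2 * c + 3) (T : Lam ℕ →+ ℤ)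
    (hT : ∀ F, T (one V * F) = 0) :
    ∃ y ∈ Z (c + 1) V, ∀ z ∈ C (c + 1) V, pr z y = T (fm z) := by
  obtain ⟨y, hy, h⟩ := repr (c + 1) V (T.comp fm.toAddMonoidHom)
  refine ⟨y, mem_Z.2 ⟨hy, ?_⟩, h⟩
  apply nondeg (bd_mem hy)
  have key : C c V ≤ LinearMap.ker ((pr.flip (bd y)).toIntLinearMap) := by
    apply C_full
    intro U hU hc w hw
    change pr w (bd y) = 0
    obtain ⟨p, q, r, hp, hq, hr, hpq, hpr, hqr, e⟩ := compl_three hU (by omega)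
    have hx : ∀ a b, a ∉ U → b ∉ U → a ≠ b → a ∈ V → b ∈ V → pr w (dd a b y) =
        T ((gen a + gen b) * fm w) := by
      intro a b ha hb hab haV hbV
      rw [← pr_x_left, h _ (x_mul_mem_C' haV hbV hab hw hU ha hb)]
      change T (fm (x a b * w)) = _
      rw [map_mul, fm_x]
    rw [tri_sum e hp hq hr hpq hpr hqr hc hw hy,
      hx p q hp hq hpq (by simp [e]) (by simp [e]),
      hx q r hq hr hqr (by simp [e]) (by simp [e]), hx p r hp hr hpr (by simp [e]) (by simp [e]),
      ← map_add, ← map_add]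
    have h1 : one V = gen p + (gen q + (gen r + one U)) := by
      unfold one
      rw [e, Finset.sum_insert (by simp [hpq, hpr, hp]), Finset.sum_insert (by simp [hqr, hq]),
        Finset.sum_insert hr]
    have h2 : (gen p + gen q) * fm w + (gen q + gen r) * fm w + (gen p + gen r) * fm w
        = one V * fm w + one V * fm w := by
      have := one_fm c hc hw
      rw [h1]
      simp only [add_mul, this, add_zero]
      abel
    rw [h2, map_add, hT]; rfl
  exact fun z hz => key hz

noncomputable abbrev d0 (v : ℕ) : Lam ℕ →ₗ[ℤ] Lam ℕ := D (fun e => if e = v then 1 else 0)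

theorem d0_one {V : Finset ℕ} {v : ℕ} (hv : v ∈ V) (F : Lam ℕ) :
    d0 v (one V * F) = F - one V * d0 v F := by
  unfold one d0
  rw [Finset.sum_mul, map_sum, Finset.sum_mul]
  simp only [D_gen_mul]
  rw [Finset.sum_sub_distrib]
  congr 1
  rw [Finset.sum_eq_single v (by intro b _ hb; simp [hb]) (by intro h; exact absurd hv h)]
  simp

noncomputable def Tt (V : Finset ℕ) (v : ℕ) (T : Lam ℕ →+ ℤ) : Lam ℕ →+ ℤ :=
  T.comp ((d0 v).toAddMonoidHom.comp (AddMonoidHom.mulLeft (one V)))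

theorem Tt_apply (V : Finset ℕ) (v : ℕ) (T : Lam ℕ →+ ℤ) (F : Lam ℕ) :
    Tt V v T F = T (d0 v (one V * F)) := rfl

theorem Tt_one (V : Finset ℕ) (v : ℕ) (T : Lam ℕ →+ ℤ) (F : Lam ℕ) :
    Tt V v T (one V * F) = 0 := by
  rw [Tt_apply, one_sq, map_zero, map_zero]

theorem LL {c : ℕ} {V : Finset ℕ} (hV : V.card = 2 * c + 3) {N M : ℤ} (hN : N ≠ 0) {y u : LE}
    (hy : y ∈ C (c + 1) V) (hu : u ∈ C c V) (hb : bd y = N • u) (T : Lam ℕ →+ ℤ)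
    (hT : ∀ F, N ∣ T (one V * F)) (h : ∀ z ∈ C (c + 1) V, N ∣ M * pr z y - T (fm z)) :
    M • u ∈ B c V := by
  have hne : V.Nonempty := by rw [← Finset.card_pos]; omega
  obtain ⟨v, hv⟩ := hne
  obtain ⟨y0, hy0, h0⟩ := cyc hV (Tt V v T) (Tt_one V v T)
  rw [mem_Z] at hy0
  obtain ⟨y', hy', e⟩ := div_crit N (y := M • y - y0)
    (Submodule.sub_mem _ (Submodule.smul_mem _ _ hy) hy0.1) (by
      intro z hz
      rw [pr_sub_right, pr_smul_right, h0 z hz, Tt_apply, d0_one hv, map_sub]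
      have := dvd_add (h z hz) (hT (d0 v (fm z)))
      rw [← sub_add]
      exact this)
  refine mem_B.2 ⟨y', hy', ?_⟩
  have h1 : N • bd y' = N • (M • u) := by
    have := congrArg bd e
    rw [map_sub, map_smul, map_smul, hb, hy0.2, sub_zero] at this
    rw [← this, smul_comm]
  have h2 : N • (bd y' - M • u) = 0 := by rw [smul_sub, h1, sub_self]
  exact sub_eq_zero.1 (tf (Submodule.sub_mem _ (bd_mem hy') (Submodule.smul_mem _ _ hu)) hN h2)

/-- Jacobi-type operator -/
noncomputable def J (V : Finset ℕ) (a b c : ℕ) : LE →ₗ[ℤ] LE :=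
  (S V c).comp (dd a b) + (S V a).comp (dd b c) + (S V b).comp (dd c a)

theorem J_apply (V : Finset ℕ) (a b c : ℕ) (y : LE) :
    J V a b c y = S V c (dd a b y) + S V a (dd b c y) + S V b (dd c a y) := rfl

theorem J_S (V : Finset ℕ) (a b c s : ℕ) (y : LE) : J V a b c (S V s y) = S V s (J V a b c y) := by
  rw [J_apply, J_apply, map_add, map_add]
  congr 1
  · congr 1
    · rw [S_S V s, S_dd V s, map_neg, neg_neg]
    · rw [S_S V s, S_dd V s, map_neg, neg_neg]
  · rw [S_S V s, S_dd V s, map_neg, neg_neg]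

theorem S_mem' {c : ℕ} {V W : Finset ℕ} (v : ℕ) {y : LE} (hy : y ∈ C (c + 1) W) :
    S V v y ∈ C c (W.erase v) := by
  rw [S_apply]
  exact Submodule.sum_mem _ fun b _ => C_mono (by
    intro w hw; simp at hw ⊢; exact ⟨hw.2.1, hw.1⟩) (dd_mem v b hy)

theorem S_sub {c : ℕ} {V W : Finset ℕ} (h : W ⊆ V) (v : ℕ) {y : LE} (hy : y ∈ C c W) :
    S V v y = S W v y := by
  rw [S_apply, S_apply]
  symm
  apply Finset.sum_subset (Finset.erase_subset_erase _ h)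
  intro b hb hb'
  apply dd_zero' _ v hy
  intro hbW
  exact hb' (Finset.mem_erase.2 ⟨(Finset.mem_erase.1 hb).1, hbW⟩)

theorem J_aux {c : ℕ} {V U : Finset ℕ} {N : ℤ} {y u : LE} {a b p d e : ℕ}
    (hUV : V \ {a, b} = insert p (insert d (insert e U)))
    (hp : p ∉ U) (hd : d ∉ U) (he : e ∉ U) (hpd : p ≠ d) (hpe : p ≠ e) (hde : d ≠ e)
    (hU : U.card = 2 * c) {w : LE} (hw : w ∈ C c U)
    (hy : y ∈ C (c + 2) V) (hb : bd y = N • u) :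
    N ∣ pr w (S V p (dd a b y)) - pr w (dd a b (dd d e y)) := by
  have h1 := tri_sum hUV hp hd he hpd hpe hde hU hw (dd_mem a b hy)
  have h2 := S_full hUV hp hd he hpd hpe hde hU hw (dd_mem a b hy)
  rw [← S_sub Finset.sdiff_subset p (dd_mem a b hy)] at h2
  rw [h2, dd_dd a b, pr_neg_right]
  rw [bd_dd, hb, map_smul, pr_neg_right, pr_smul_right] at h1
  refine ⟨- pr w (dd a b u), ?_⟩
  linarith

theorem Jdvd {c : ℕ} {V : Finset ℕ} (hV : V.card = 2 * c + 5) {N : ℤ} {y u : LE}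
    (hy : y ∈ C (c + 2) V) (hb : bd y = N • u) {a b p : ℕ} (haV : a ∈ V) (hbV : b ∈ V)
    (hpV : p ∈ V) (hab : a ≠ b) (hap : a ≠ p) (hbp : b ≠ p) :
    ∃ w, J V a b p y = N • w := by
  have hm : J V a b p y ∈ C c (V \ {a, b, p}) := by
    rw [J_apply]
    refine Submodule.add_mem _ (Submodule.add_mem _ ?_ ?_) ?_
    all_goals
      refine C_mono ?_ (S_mem' _ (dd_mem _ _ hy))
      intro v hv
      simp only [Finset.mem_erase, Finset.mem_sdiff, Finset.mem_insert, Finset.mem_singleton,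
        not_or] at hv ⊢
      tauto
  obtain ⟨w, -, hw⟩ := div_crit N hm (by
    have key : C c (V \ {a, b, p}) ≤ (AddSubgroup.comap (pr.flip (J V a b p y))
        (AddSubgroup.zmultiples N)).toIntSubmodule := by
      apply C_full
      intro U hU hc w hw
      change pr w (J V a b p y) ∈ AddSubgroup.zmultiples N
      rw [Int.mem_zmultiples_iff]
      have hd3 : (V \ {a, b, p}).card = 2 * c + 2 := by
        rw [Finset.card_sdiff_of_subset (by
          intro v hv; simp at hv; rcases hv with rfl | rfl | rfl <;> assumption)]
        rw [Finset.card_eq_three.2 ⟨a, b, p, hab, hap, hbp, rfl⟩]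
        omega
      obtain ⟨d, e, hd, he, hde, hE⟩ := compl_two hU (by omega)
      have hM : ∀ v, (v ∈ V ∧ v ≠ a ∧ v ≠ b ∧ v ≠ p) ↔ (v = d ∨ v = e ∨ v ∈ U) := by
        intro v
        have := Finset.ext_iff.1 hE v
        simpa using this
      have hdV := (hM d).2 (by simp)
      have heV := (hM e).2 (by simp)
      have haU : a ∉ U := fun h => ((hM a).2 (by simp [h])).2.1 rfl
      have hbU : b ∉ U := fun h => ((hM b).2 (by simp [h])).2.2.1 rfl
      have hpU : p ∉ U := fun h => ((hM p).2 (by simp [h])).2.2.2 rfl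
      have e1 : V \ {a, b} = insert p (insert d (insert e U)) := by
        ext v; have := hM v
        simp only [Finset.mem_sdiff, Finset.mem_insert, Finset.mem_singleton, not_or]
        grind
      have e2 : V \ {b, p} = insert a (insert d (insert e U)) := by
        ext v; have := hM v
        simp only [Finset.mem_sdiff, Finset.mem_insert, Finset.mem_singleton, not_or]
        grind
      have e3 : V \ {p, a} = insert b (insert d (insert e U)) := by
        ext v; have := hM v
        simp only [Finset.mem_sdiff, Finset.mem_insert, Finset.mem_singleton, not_or]
        grind
      have e4 : V \ {d, e} = insert a (insert b (insert p U)) := by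
        ext v; have := hM v
        simp only [Finset.mem_sdiff, Finset.mem_insert, Finset.mem_singleton, not_or]
        grind
      have j1 := J_aux e1 hpU hd he hdV.2.2.2.symm heV.2.2.2.symm hde hc hw hy hb
      have j2 := J_aux e2 haU hd he hdV.2.1.symm heV.2.1.symm hde hc hw hy hb
      have j3 := J_aux e3 hbU hd he hdV.2.2.1.symm heV.2.2.1.symm hde hc hw hy hb
      have j4 := tri_sum e4 haU hbU hpU hab hap hbp hc hw (dd_mem d e hy)
      rw [bd_dd, hb, map_smul, pr_neg_right, pr_smul_right] at j4
      rw [dd_symm p a] at j3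
      rw [J_apply, pr_add_right, pr_add_right, dd_symm p a]
      obtain ⟨t1, j1⟩ := j1
      obtain ⟨t2, j2⟩ := j2
      obtain ⟨t3, j3⟩ := j3
      exact ⟨t1 + t2 + t3 - pr w (dd d e u), by linarith⟩
    intro z hz
    have := key hz
    change pr z (J V a b p y) ∈ AddSubgroup.zmultiples N at this
    rwa [Int.mem_zmultiples_iff] at this)
  exact ⟨w, hw⟩

end MC

set_option synthInstance.maxHeartbeats 20000
set_option maxHeartbeats 400000
set_option linter.all false
namespace MC

/-- the claim for a fixed pair a b -/
def Cl (N : ℤ) (V : Finset ℕ) (a b : ℕ) (y : LE) (m : ℤ) (c : ℕ) : Prop :=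
  ∀ μ ∈ C c (V \ {a, b}), N ∣ pr μ (S V a y + S V b y) - m * pr μ (dd a b y)

theorem Cl_base {c : ℕ} {V : Finset ℕ} (hV : V.card = 2 * c + 3) {N : ℤ} {y u : LE}
    (hy : y ∈ C (c + 1) V) (hb : bd y = N • u) {a b : ℕ} (haV : a ∈ V) (hbV : b ∈ V)
    (hab : a ≠ b) : Cl N V a b y 1 c := by
  have key : C c (V \ {a, b}) ≤ (AddSubgroup.comap
      (pr.flip (S V a y + S V b y - dd a b y))
        (AddSubgroup.zmultiples N)).toIntSubmodule := by
    apply C_full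
    intro U hU hc w hw
    change pr w (S V a y + S V b y - dd a b y) ∈ AddSubgroup.zmultiples N
    rw [Int.mem_zmultiples_iff]
    have hd3 : (V \ {a, b}).card = 2 * c + 1 := by
      rw [Finset.card_sdiff_of_subset (by
        intro v hv; simp at hv; rcases hv with rfl | rfl <;> assumption)]
      rw [Finset.card_pair hab]
      omega
    have h1 : ((V \ {a, b}) \ U).card = 1 := by
      rw [Finset.card_sdiff_of_subset hU]; omega
    obtain ⟨p, hp⟩ := Finset.card_eq_one.1 h1
    have hM : ∀ v, (v ∈ V ∧ v ≠ a ∧ v ≠ b ∧ v ∉ U) ↔ v = p := by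
      intro v
      have := Finset.ext_iff.1 hp v
      simpa [and_assoc] using this
    have hpV := (hM p).2 rfl
    have haU : a ∉ U := fun h => by have := hU h; simp at this
    have hbU : b ∉ U := fun h => by have := hU h; simp at this
    have hUV : ∀ v ∈ U, v ∈ V := fun v hv => (Finset.mem_sdiff.1 (hU hv)).1
    have e1 : V = insert a (insert b (insert p U)) := by
      ext v; have := hM v; have := hUV v
      simp only [Finset.mem_insert]
      grind
    have e2 : V = insert b (insert a (insert p U)) := by
      rw [e1, Finset.insert_comm]
    have h2 := tri_sum e1 haU hbU hpV.2.2.2 hab hpV.2.1.symm hpV.2.2.1.symm hc hw hy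
    have h3 := S_full e1 haU hbU hpV.2.2.2 hab hpV.2.1.symm hpV.2.2.1.symm hc hw hy
    have h4 := S_full e2 hbU haU hpV.2.2.2 hab.symm hpV.2.2.1.symm hpV.2.1.symm hc hw hy
    rw [dd_symm b a] at h4
    rw [hb, pr_smul_right] at h2
    rw [pr_sub_right, pr_add_right, h3, h4]
    exact ⟨pr w u, by linarith⟩
  intro μ hμ
  have := key hμ
  change pr μ (S V a y + S V b y - dd a b y) ∈ AddSubgroup.zmultiples N at this
  rw [Int.mem_zmultiples_iff, pr_sub_right] at this
  rwa [one_mul]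

theorem pr_dd_Nv {c d : ℕ} {V : Finset ℕ} (U W : Finset ℕ) {s v : ℕ} {w : LE} (μ : LE)
    (hw : w ∈ C (d + 1) V) :
    pr μ (dd s v w) = pr (Nv v W (Nv s U μ)) (dd s v w) := by
  rw [pr_comm, pr_comm _ (dd s v w), pr_Nv (U := V \ {s, v}) (by simp) (dd_mem s v hw),
    pr_Nv (U := V \ {s, v}) (by simp) (dd_mem s v hw)]

theorem Cl_step {c : ℕ} {V : Finset ℕ} {N : ℤ} {y : LE} (hy : y ∈ C (c + 2) V) {a b s : ℕ}
    (haV : a ∈ V) (hbV : b ∈ V) (hsV : s ∈ V) (hab : a ≠ b) (hsa : s ≠ a) (hsb : s ≠ b)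
    (hJ : ∃ w, J V a b s y = N • w) {m : ℤ} (h : Cl N V a b y m (c + 1)) :
    Cl N V a b (S V s y) (m + 1) c := by
  intro μ hμ
  obtain ⟨w, hw⟩ := hJ
  set Y := S V a y + S V b y with hY
  have hYm : Y ∈ C (c + 1) V := Submodule.add_mem _ (S_mem _ hy) (S_mem _ hy)
  have e1 : S V a (S V s y) + S V b (S V s y) = - S V s Y := by
    rw [S_S V a, S_S V b, hY, map_add]; abel
  have hset : V.erase s = insert a (insert b (V \ {a, b, s})) := by
    ext v
    simp only [Finset.mem_erase, Finset.mem_insert, Finset.mem_sdiff, Finset.mem_singleton]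
    grind
  have hsplit : ∀ z, S V s z = dd s a z + (dd s b z + ∑ v ∈ V \ {a, b, s}, dd s v z) := by
    intro z
    rw [S_apply, hset, Finset.sum_insert (by simp [hab]), Finset.sum_insert (by simp)]
  have e2 : dd s a Y = - S V b (dd s a y) := by
    rw [hY, map_add]
    have h1 : dd s a (S V a y) = 0 := by
      have := S_dd V a a s y
      rw [S_dd_zero hy] at this
      rw [dd_symm]
      simpa using this.symm
    rw [h1, S_dd, neg_neg, zero_add]
  have e3 : dd s b Y = - S V a (dd s b y) := by
    rw [hY, map_add]
    have h1 : dd s b (S V b y) = 0 := by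
      have := S_dd V b b s y
      rw [S_dd_zero hy] at this
      rw [dd_symm]
      simpa using this.symm
    rw [h1, S_dd, neg_neg, add_zero]
  have e4 : S V b (dd s a y) + S V a (dd s b y) = N • w + dd a b (S V s y) := by
    rw [← hw, J_apply, S_dd V s, dd_symm b s]; abel
  have e5 : ∀ v ∈ V \ {a, b, s}, ∃ t, pr μ (dd s v Y) = m * pr μ (dd s v (dd a b y)) + N * t := by
    intro v hv
    simp only [Finset.mem_sdiff, Finset.mem_insert, Finset.mem_singleton, not_or] at hv
    rw [pr_dd_Nv (c := 0) (V \ {a, b}) (V \ {a, b}) μ hYm,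
      pr_dd_Nv (c := 0) (V \ {a, b}) (V \ {a, b}) μ (dd_mem a b hy), ← pr_x_left, ← pr_x_left]
    have hm := x_mul_mem_C (V := V \ {a, b}) (a := s) (b := v) (by simp [hsV, hsa, hsb]) (by
      simp [hv]) (Ne.symm hv.2.2.2) (NvNv_mem hμ)
    obtain ⟨t, ht⟩ := h _ hm
    exact ⟨t, by linarith⟩
  choose! t ht using e5
  have e6 : ∑ v ∈ V \ {a, b, s}, dd s v (dd a b y) = - dd a b (S V s y) := by
    have := hsplit (dd a b y)
    rw [dd_zero' (V := V \ {a, b}) (by simp) s (dd_mem a b hy),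
      dd_zero' (V := V \ {a, b}) (by simp) s (dd_mem a b hy), zero_add, zero_add] at this
    rw [← this, S_dd]
  have e7 : pr μ (∑ v ∈ V \ {a, b, s}, dd s v Y) =
      - m * pr μ (dd a b (S V s y)) + N * ∑ v ∈ V \ {a, b, s}, t v := by
    rw [pr_sum_right, Finset.sum_congr rfl ht, Finset.sum_add_distrib, ← Finset.mul_sum,
      ← Finset.mul_sum, ← pr_sum_right, e6, pr_neg_right]
    ring
  rw [e1, hsplit Y, e2, e3]
  have e8 : -(-S V b (dd s a y) + (-S V a (dd s b y) + ∑ v ∈ V \ {a, b, s}, dd s v Y)) =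
    (S V b (dd s a y) + S V a (dd s b y)) - ∑ v ∈ V \ {a, b, s}, dd s v Y := by abel
  rw [e8, e4, pr_sub_right, pr_add_right, pr_smul_right, e7]
  exact ⟨pr μ w - ∑ v ∈ V \ {a, b, s}, t v, by ring⟩

/-- a sequence of S operators -/
noncomputable def Sl (V : Finset ℕ) (l : List ℕ) (y : LE) : LE := l.foldl (fun z s => S V s z) y

theorem Sl_snoc (V : Finset ℕ) (l : List ℕ) (s : ℕ) (y : LE) :
    Sl V (l ++ [s]) y = S V s (Sl V l y) := by
  simp [Sl]

theorem Sl_nil (V : Finset ℕ) (y : LE) : Sl V [] y = y := rfl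

theorem Sl_cons (V : Finset ℕ) (l : List ℕ) (s : ℕ) (y : LE) :
    Sl V (s :: l) y = Sl V l (S V s y) := rfl

theorem ad_mon (V : Finset ℕ) (l : List ℕ) : ∀ y, ad (gm V (mon l)) y = Sl V l y := by
  induction l with
  | nil => intro y; rw [mon_nil, map_one, ad_one]; rfl
  | cons s l ih => intro y; rw [mon_cons, map_mul, ad_mul, ad_gm, ih]; rfl

theorem Sl_mem {V W : Finset ℕ} (l : List ℕ) : ∀ {c : ℕ} {y : LE} (hy : y ∈ C (c + l.length) W),
    Sl V l y ∈ C c W := by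
  induction l with
  | nil => intro c y hy; exact hy
  | cons s l ih => intro c y hy; exact ih (S_mem s hy)

theorem Sl_J {V : Finset ℕ} {N : ℤ} {a b p : ℕ} (l : List ℕ) : ∀ {y : LE}
    (h : ∃ w, J V a b p y = N • w), ∃ w, J V a b p (Sl V l y) = N • w := by
  induction l with
  | nil => intro y h; exact h
  | cons s l ih =>
    rintro y ⟨w, h⟩
    apply ih
    exact ⟨S V s w, by rw [J_S, h, map_smul]⟩

theorem Cl_list {c : ℕ} {V : Finset ℕ} (hV : V.card = 2 * c + 3) {N : ℤ} {y u : LE}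
    (hy : y ∈ C (c + 1) V) (hb : bd y = N • u) {a b : ℕ} (haV : a ∈ V) (hbV : b ∈ V)
    (hab : a ≠ b) (l : List ℕ) : ∀ {d : ℕ}, (∀ s ∈ l, s ∈ V \ {a, b}) → c = d + l.length →
    Cl N V a b (Sl V l y) (l.length + 1) d := by
  induction l using List.reverseRecOn with
  | nil =>
    intro d _ h
    simp only [List.length_nil, add_zero] at h
    subst h
    simpa [Sl_nil] using Cl_base hV hy hb haV hbV hab
  | append_singleton l s ih =>
    intro d hl h
    rw [List.length_append, List.length_singleton] at h
    have hs := hl s (by simp)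
    simp only [Finset.mem_sdiff, Finset.mem_insert, Finset.mem_singleton, not_or] at hs
    have h1 := ih (d := d + 1) (fun t ht => hl t (by simp [ht])) (by omega)
    rw [Sl_snoc, List.length_append, List.length_singleton]
    push_cast
    refine Cl_step ?_ haV hbV hs.1 hab hs.2.1 hs.2.2 ?_ h1
    · apply Sl_mem
      rw [show d + 2 + l.length = c + 1 by omega]
      exact hy
    · apply Sl_J
      obtain ⟨c, rfl⟩ : ∃ c', c = c' + 1 := ⟨d + l.length, by omega⟩
      exact Jdvd (by omega) hy hb haV hbV hs.1 hab (Ne.symm hs.2.1) (Ne.symm hs.2.2)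

noncomputable def A (j : ℕ) (W : Finset ℕ) : Submodule ℤ (Lam ℕ) :=
  Submodule.span ℤ {F | ∃ l : List ℕ, (∀ v ∈ l, v ∈ W) ∧ l.length = j ∧ F = mon l}

theorem fm_mem (c : ℕ) : ∀ {W : Finset ℕ} {z : LE}, z ∈ C c W → fm z ∈ A c W := by
  induction c with
  | zero =>
    intro W z hz
    have : C 0 W ≤ (A 0 W).comap fm.toAddMonoidHom.toIntLinearMap := by
      apply C_zero_le
      change fm 1 ∈ A 0 W
      rw [map_one]
      exact Submodule.subset_span ⟨[], by simp, rfl, mon_nil.symm⟩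
    exact this hz
  | succ c ih =>
    intro W z hz
    have : C (c + 1) W ≤ (A (c + 1) W).comap fm.toAddMonoidHom.toIntLinearMap := by
      apply C_succ_le
      intro a b z ha hb hab hz
      change fm (x a b * z) ∈ A (c + 1) W
      rw [map_mul, fm_x]
      have h1 := ih (C_mono Finset.sdiff_subset hz)
      have h2 : A c W ≤ (A (c + 1) W).comap (LinearMap.mulLeft ℤ (gen a + gen b)) := by
        apply Submodule.span_le.2
        rintro F ⟨l, hl, hc, rfl⟩
        change (gen a + gen b) * mon l ∈ A (c + 1) W
        rw [add_mul, ← mon_cons, ← mon_cons]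
        exact Submodule.add_mem _
          (Submodule.subset_span ⟨a :: l, by simpa using ⟨ha, hl⟩, by simp [hc], rfl⟩)
          (Submodule.subset_span ⟨b :: l, by simpa using ⟨hb, hl⟩, by simp [hc], rfl⟩)
      exact h2 h1
    exact this hz

theorem Cl_A {c : ℕ} {V : Finset ℕ} (hV : V.card = 2 * c + 3) {N : ℤ} {y u : LE}
    (hy : y ∈ C (c + 1) V) (hb : bd y = N • u) {a b : ℕ} (haV : a ∈ V) (hbV : b ∈ V)
    (hab : a ≠ b) {d j : ℕ} (hc : c = d + j) {F : Lam ℕ} (hF : F ∈ A j (V \ {a, b})) :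
    Cl N V a b (ad (gm V F) y) (j + 1) d := by
  unfold A at hF
  induction hF using Submodule.span_induction with
  | mem F h =>
    obtain ⟨l, hl, hj, rfl⟩ := h
    rw [ad_mon]
    subst hj
    exact Cl_list hV hy hb haV hbV hab l hl hc
  | zero =>
    intro μ _
    rw [map_zero]
    simp [ad]
  | add F G _ _ h1 h2 =>
    intro μ hμ
    obtain ⟨t, ht⟩ := h1 μ hμ
    obtain ⟨s, hs⟩ := h2 μ hμ
    rw [map_add (gm V), ad_add]
    simp only [map_add, pr_add_right] at ht hs ⊢
    exact ⟨t + s, by linarith⟩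
  | smul r F _ h1 =>
    intro μ hμ
    obtain ⟨t, ht⟩ := h1 μ hμ
    rw [map_zsmul (gm V), ad_smul]
    simp only [map_smul, pr_add_right, pr_smul_right] at ht ⊢
    exact ⟨r * t, by linear_combination r * ht⟩

theorem Rm {k : ℕ} {V : Finset ℕ} (hV : V.card = 2 * k + 1) {N : ℤ} {y u : LE}
    (hy : y ∈ C k V) (hb : bd y = N • u) (m : ℕ) : ∀ {d : ℕ} (_ : k = m + d) {W : Finset ℕ}
    (_ : W ⊆ V) {z : LE} (_ : z ∈ C m W) {μ : LE} (_ : μ ∈ C d (V \ W)),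
    N ∣ pr (gm V (fm z) * μ) y - (m.factorial : ℤ) * pr (z * μ) y := by
  induction m with
  | zero =>
    intro d hd W hW z hz μ hμ
    have : z ∈ (Submodule.span ℤ {(1 : LE)}) := hz
    obtain ⟨t, rfl⟩ := Submodule.mem_span_singleton.1 this
    rw [map_zsmul, map_zsmul, map_one, map_one]
    simp
  | succ m ih =>
    intro d hd W hW z hz μ hμ
    have key : C (m + 1) W ≤ (AddSubgroup.comap
        ((pr.flip y).comp (((AddMonoidHom.mulRight μ).comp
          ((gm V).toAddMonoidHom.comp fm.toAddMonoidHom)) -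
            ((m + 1).factorial : ℤ) • (AddMonoidHom.mulRight μ)))
        (AddSubgroup.zmultiples N)).toIntSubmodule := by
      apply C_succ_le'
      intro a b z ha hb' hab hz
      change pr (gm V (fm (z * x a b)) * μ - ((m + 1).factorial : ℤ) • (z * x a b * μ)) y ∈
        AddSubgroup.zmultiples N
      rw [Int.mem_zmultiples_iff, pr_sub_left, pr_smul_left]
      obtain ⟨t, ht⟩ := ih (d := d + 1) (by omega) (W := W \ {a, b})
        (Finset.sdiff_subset.trans hW) hz (μ := x a b * μ) (x_mul_mem_C' (W := V \ W)
          (by simp [hW ha]) (by simp [hW hb']) hab hμ (by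
            intro v hv; simp at hv ⊢; tauto) (by simp [ha]) (by simp [hb']))
      obtain ⟨c, rfl⟩ : ∃ c, k = c + 1 := ⟨m + d, by omega⟩
      obtain ⟨s, hs⟩ := Cl_A (by omega) hy hb (hW ha) (hW hb') hab (d := d) (j := m) (by omega)
        (fm_mem m (C_mono (Finset.sdiff_subset_sdiff hW (Finset.Subset.refl _)) hz)) μ
        (C_mono (by intro v hv; simp at hv ⊢; grind) hμ)
      have e1 : pr (gm V (fm (z * x a b)) * μ) y =
          pr μ (S V a (ad (gm V (fm z)) y) + S V b (ad (gm V (fm z)) y)) := by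
        rw [map_mul fm, fm_x, map_mul (gm V), map_add (gm V), mul_assoc, pr_ad, pr_ad, ad_add, ad_gm, ad_gm]
      have e2 : pr (gm V (fm z) * (x a b * μ)) y = pr μ (dd a b (ad (gm V (fm z)) y)) := by
        rw [pr_ad, pr_x_left]
      rw [e1, mul_assoc]
      rw [e2] at ht
      refine ⟨s + (m + 1) * t, ?_⟩
      rw [Nat.factorial_succ]
      push_cast
      linear_combination hs + (m + 1 : ℤ) * ht
    have := key hz
    change pr (gm V (fm z) * μ - ((m + 1).factorial : ℤ) • (z * μ)) y ∈
        AddSubgroup.zmultiples N at this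
    rwa [Int.mem_zmultiples_iff, pr_sub_left, pr_smul_left] at this

theorem eta_one {c : ℕ} {V : Finset ℕ} {N : ℤ} {y u : LE}
    (hy : y ∈ C c V) (hb : bd y = N • u) (F : Lam ℕ) : N ∣ pr (gm V (one V * F)) y := by
  have : ad (gm V (one V)) y = (2 : ℤ) • (N • u) := by
    rw [← hb, ← sum_S hy]
    unfold one
    rw [map_sum, ad_sum]
    exact Finset.sum_congr rfl fun v _ => ad_gm V v y
  rw [map_mul (gm V), pr_ad, this, pr_smul_right, pr_smul_right]
  exact ⟨2 * pr (gm V F) u, by ring⟩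

theorem kfac {c : ℕ} {V : Finset ℕ} (hV : V.card = 2 * c + 3) {N : ℤ} (hN : N ≠ 0) {u : LE}
    (hu : u ∈ C c V) (h : N • u ∈ B c V) : ((c + 1).factorial : ℤ) • u ∈ B c V := by
  obtain ⟨y, hy, hb⟩ := mem_B.1 h
  refine LL hV hN hy hu hb ((pr.flip y).comp (gm V).toAddMonoidHom) ?_ ?_
  · intro F
    exact eta_one hy hb F
  · intro z hz
    have := Rm (k := c + 1) (by omega) hy hb (c + 1) (d := 0) (by omega) (Finset.Subset.refl _) hz
      (one_mem_C _)
    rw [mul_one, mul_one, dvd_sub_comm] at this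
    exact this

end MC

set_option synthInstance.maxHeartbeats 20000
set_option maxHeartbeats 400000
set_option linter.all false
namespace MC

noncomputable def kl : List ℕ → (Lam ℕ →+ ℤ)
  | [] => sc.toAddMonoidHom
  | a :: l => (kl l).comp (d0 a).toAddMonoidHom

theorem kl_cons (a : ℕ) (l : List ℕ) (F : Lam ℕ) : kl (a :: l) F = kl l (d0 a F) := rfl

theorem kl_zero (l : List ℕ) : ∀ (a : ℕ) (_ : a ∈ l) (F : Lam ℕ) (_ : d0 a F = 0), kl l F = 0 := by
  induction l with
  | nil => intro a h; simp at h
  | cons s l ih =>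
    intro a h F hF
    rw [kl_cons]
    by_cases hs : s = a
    · subst hs; rw [hF, map_zero]
    · have : a ∈ l := by
        rcases List.mem_cons.1 h with h | h
        · exact absurd h.symm hs
        · exact h
      apply ih a this
      rw [D_comm, hF, map_zero, neg_zero]

theorem kl_self (l : List ℕ) (h : l.Nodup) : kl l (mon l) = 1 := by
  induction l with
  | nil => rw [mon_nil]; exact map_one sc
  | cons s l ih =>
    rw [List.nodup_cons] at h
    rw [kl_cons, mon_cons, D_gen_mul, D_mon_zero s l h.1]
    simp [ih h.2]

theorem mon_anti (l : List ℕ) (G : Lam ℕ) (hG : ∀ a, G * gen a = - (gen a * G)) :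
    mon l * G = (-1 : ℤ) ^ l.length • (G * mon l) := by
  induction l with
  | nil => simp [mon_nil]
  | cons s l ih =>
    rw [mon_cons, mul_assoc, ih, mul_smul_comm, ← mul_assoc, ← mul_assoc, hG, List.length_cons, pow_succ,
      mul_smul]
    simp

theorem mon_gen_zero (l : List ℕ) (s : ℕ) (hs : s ∈ l) : mon l * gen s = 0 := by
  induction l with
  | nil => simp at hs
  | cons a l ih =>
    rw [mon_cons, mul_assoc]
    by_cases h : s ∈ l
    · rw [ih h, mul_zero]
    · have : s = a := by simpa [h] using hs
      subst this
      rw [mon_anti l (gen s) (fun a => gen_anti _ _), mul_smul_comm, gen_sq_mul, smul_zero]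

theorem psi_zero {k : ℕ} {V : Finset ℕ} (hV : V.card = 2 * k + 1) (ψ : Lam ℕ →+ ℤ)
    (h1 : ∀ F, ψ (one V * F) = 0) (h2 : ∀ z ∈ C k V, ψ (fm z) = 0) (j : ℕ) :
    ∀ (m : ℕ) (_ : k = m + j) (l : List ℕ) (_ : l.length = j) (_ : l.Nodup) (U : Finset ℕ)
      (_ : U ⊆ V) (_ : U.card = 2 * m) (_ : ∀ a ∈ l, a ∈ V \ U) (z : LE) (_ : z ∈ C m U),
      ψ (mon l * fm z) = 0 := by
  induction j with
  | zero =>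
    intro m hm l hl _ U hU hc _ z hz
    obtain rfl := List.length_eq_zero_iff.1 hl
    rw [mon_nil, one_mul]
    apply h2
    have : m = k := by omega
    subst this
    exact C_mono hU hz
  | succ j ih =>
    intro m hm l hl hn U hU hc hlV z hz
    obtain ⟨l, v, rfl⟩ : ∃ l' v, l = l' ++ [v] := by
      rcases List.eq_nil_or_concat l with h | ⟨l', v, h⟩
      · subst h; simp at hl
      · exact ⟨l', v, by simpa using h⟩
    have hl' : l.length = j := by simpa using hl
    have hn' : l.Nodup := (List.nodup_append.1 hn).1
    have hvl : v ∉ l := by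
      intro h
      have := (List.nodup_append.1 hn).2.2 v h v (by simp)
      exact this rfl
    have hvV := hlV v (by simp)
    have hlV' : ∀ a ∈ l, a ∈ V \ U := fun a ha => hlV a (by simp [ha])
    set X := ψ (mon l * (gen v * fm z)) with hX
    have e0 : ψ (mon (l ++ [v]) * fm z) = X := by
      rw [mon_append, mon_cons, mon_nil, mul_one, mul_assoc]
    rw [e0]
    set Dd := (V \ U) \ (insert v l.toFinset) with hD
    have hb : ∀ b ∈ Dd, ψ (mon l * (gen b * fm z)) = - X := by
      intro b hb
      simp only [hD, Finset.mem_sdiff, Finset.mem_insert, List.mem_toFinset, not_or] at hb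
      rw [Finset.mem_sdiff] at hvV
      have := ih (m + 1) (by omega) l hl' hn' (insert v (insert b U))
        (by
          intro w hw
          simp only [Finset.mem_insert] at hw
          rcases hw with rfl | rfl | hw
          · exact hvV.1
          · exact hb.1.1
          · exact hU hw)
        (by
          rw [Finset.card_insert_of_notMem (by simp [Ne.symm hb.2.1, hvV.2]),
            Finset.card_insert_of_notMem hb.1.2]
          omega)
        (by
          intro a ha
          have := Finset.mem_sdiff.1 (hlV' a ha)
          simp only [Finset.mem_sdiff, Finset.mem_insert, not_or]
          exact ⟨this.1, fun h => hvl (h ▸ ha), fun h => hb.2.2 (h ▸ ha), this.2⟩)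
        (x v b * z)
        (x_mul_mem_C' (by simp) (by simp) (Ne.symm hb.2.1) hz (fun w hw => by simp [hw]) hvV.2 hb.1.2)
      rw [map_mul fm, fm_x, add_mul, mul_add, map_add] at this
      linarith
    have h3 : ψ (mon l * (one V * fm z)) = 0 := by
      rw [← mul_assoc, mon_anti l (one V) (gen_sum_anti V), smul_mul_assoc, map_zsmul, mul_assoc, h1,
        smul_zero]
    have h4 : one V = one U + (one (insert v l.toFinset) + one Dd) := by
      unfold one
      rw [hD, add_comm (∑ v ∈ insert v l.toFinset, gen v),
        Finset.sum_sdiff (by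
          intro w hw
          simp only [Finset.mem_insert, List.mem_toFinset] at hw
          rcases hw with rfl | hw
          · exact hvV
          · exact hlV' w hw), add_comm,
        Finset.sum_sdiff hU]
    have h5 : ψ (mon l * (one (insert v l.toFinset) * fm z)) = X := by
      unfold one
      rw [Finset.sum_insert (by simp [hvl]), add_mul, mul_add, map_add, Finset.sum_mul, Finset.mul_sum,
        Finset.sum_eq_zero (s := l.toFinset), map_zero, add_zero]
      intro a ha
      rw [← mul_assoc, mon_gen_zero l a (by simpa using ha), zero_mul]
    have h6 : ψ (mon l * (one Dd * fm z)) = (Dd.card : ℤ) * (- X) := by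
      unfold one
      rw [Finset.sum_mul, Finset.mul_sum, map_sum, Finset.sum_congr rfl hb, Finset.sum_const]
      simp
    have h7 : Dd.card = j + 2 := by
      rw [hD, Finset.card_sdiff_of_subset (by
          intro w hw
          simp only [Finset.mem_insert, List.mem_toFinset] at hw
          rcases hw with rfl | hw
          · exact hvV
          · exact hlV' w hw), Finset.card_sdiff_of_subset hU,
          Finset.card_insert_of_notMem (by simp [hvl]), List.toFinset_card_of_nodup hn']
      omega
    rw [h4, add_mul, one_fm m hc hz, zero_add, add_mul, mul_add, map_add, h5, h6, h7] at h3
    push_cast at h3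
    have h8 : ((j : ℤ) + 1) * X = 0 := by linarith
    rcases mul_eq_zero.1 h8 with h | h
    · omega
    · exact h

theorem Z_fin (c n : ℕ) : Module.Finite ℤ (Z c (Finset.range n)) := by
  have hfin : Module.Finite ℤ (C c (Finset.range n)) := Module.Finite.iff_fg.2 (C_fg n c)
  have hle : Z c (Finset.range n) ≤ C c (Finset.range n) := fun z hz => (mem_Z.1 hz).1
  exact Module.Finite.of_injective (Submodule.inclusion hle) (Submodule.inclusion_injective hle)

theorem Z_tf (c : ℕ) (V : Finset ℕ) : Module.IsTorsionFree ℤ (Z c V) := by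
  have hle : Z c V ≤ C c V := fun z hz => (mem_Z.1 hz).1
  refine Module.IsTorsionFree.mk fun r hr z w h => ?_
  have h1 : r • (z.1 - w.1) = 0 := by
    have := congrArg Subtype.val h
    simpa [smul_sub, sub_eq_zero] using this
  have h2 := tf (Submodule.sub_mem _ (hle z.2) (hle w.2)) (IsRegular.ne_zero hr) h1
  exact Subtype.ext (sub_eq_zero.1 h2)

theorem rank_ge (c : ℕ) :
    (2 * c + 2).choose (c + 1) ≤ Module.finrank ℤ (Z (c + 1) (Finset.range (2 * c + 3))) := by
  set V := Finset.range (2 * c + 3) with hVd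
  have hV : V.card = 2 * c + 3 := by simp [hVd]
  have hfin : Module.Finite ℤ (Z (c + 1) V) := Z_fin _ _
  have htf := Z_tf (c + 1) V
  have h0V : 0 ∈ V := by simp [hVd]
  have hex := fun I : Finset.powersetCard (c + 1) (V.erase 0) =>
    cyc hV (Tt V 0 (kl I.1.toList)) (Tt_one V 0 _)
  choose y hy hpr using hex
  have hli : LinearIndependent ℤ (fun I => (⟨y I, hy I⟩ : Z (c + 1) V)) := by
    rw [Fintype.linearIndependent_iff]
    intro a ha I
    have hs : ∑ I, a I • y I = 0 := by
      have := congrArg Subtype.val ha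
      simpa using this
    let ψ : Lam ℕ →+ ℤ := ∑ I : Finset.powersetCard (c + 1) (V.erase 0),
      a I • Tt V 0 (kl I.1.toList)
    have hψ : ∀ F, ψ F = ∑ I : Finset.powersetCard (c + 1) (V.erase 0),
        a I * Tt V 0 (kl I.1.toList) F := by
      intro F
      simp [ψ]
    have h1 : ∀ F, ψ (one V * F) = 0 := by
      intro F
      rw [hψ]
      exact Finset.sum_eq_zero fun I _ => by rw [Tt_one, mul_zero]
    have h2 : ∀ z ∈ C (c + 1) V, ψ (fm z) = 0 := by
      intro z hz
      rw [hψ]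
      have : pr z (∑ I, a I • y I) = 0 := by rw [hs, pr_zero_right]
      rw [pr_sum_right] at this
      rw [← this]
      refine Finset.sum_congr rfl fun I _ => ?_
      rw [pr_smul_right, hpr I z hz]
    have hI := Finset.mem_powersetCard.1 I.2
    have hIV : ∀ w ∈ I.1, w ∈ V ∧ w ≠ 0 := fun w hw => by
      have := Finset.mem_erase.1 (hI.1 hw)
      exact ⟨this.2, this.1⟩
    have h3 := psi_zero (k := c + 1) (by omega) ψ h1 h2 (c + 1) 0 (by omega) I.1.toList (by simp [hI.2])
      (Finset.nodup_toList _) ∅ (by simp) (by simp) (fun w hw => by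
        simpa using (hIV w (by simpa using hw)).1) 1 (one_mem_C _)
    rw [map_one, mul_one, hψ] at h3
    have h4 : ∀ T : Lam ℕ →+ ℤ, Tt V 0 T (mon I.1.toList) = T (mon I.1.toList) := by
      intro T
      rw [Tt_apply, d0_one h0V, D_mon_zero 0 _ (by
        intro h; exact (hIV 0 (by simpa using h)).2 rfl), mul_zero, sub_zero]
    rw [Finset.sum_eq_single I] at h3
    · rw [h4, kl_self _ (Finset.nodup_toList _), mul_one] at h3
      exact h3
    · intro I' _ hne
      rw [h4]
      have hI' := Finset.mem_powersetCard.1 I'.2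
      have : ∃ w ∈ I'.1, w ∉ I.1 := by
        by_contra! hcon
        exact hne (Subtype.ext (Finset.eq_of_subset_of_card_le hcon (by rw [hI.2, hI'.2])))
      obtain ⟨w, hw, hw'⟩ := this
      rw [kl_zero _ w (by simpa using hw) _ (D_mon_zero w _ (by simpa using hw')), mul_zero]
    · intro h; exact absurd (Finset.mem_univ _) h
  have := hli.fintype_card_le_finrank
  rwa [Fintype.card_coe, Finset.card_powersetCard, Finset.card_erase_of_mem h0V, hV] at this

theorem rank_lemma {c p : ℕ} [hp : Fact p.Prime] {V : Finset ℕ} (hVd : V = Finset.range (2 * c + 3))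
    {ι : Type} [Fintype ι] (hcard : Fintype.card ι ≤ (2 * c + 2).choose (c + 1))
    (L : ι → LE →+ ZMod p)
    (hdet : ∀ y ∈ C (c + 1) V, (∃ u, bd y = (p : ℤ) • u) → (∀ i, L i y = 0) → ∃ w, y = (p : ℤ) • w)
    {u : LE} (hu : u ∈ C c V) (h : (p : ℤ) • u ∈ B c V) : u ∈ B c V := by
  have hp0 : (p : ℤ) ≠ 0 := by exact_mod_cast hp.out.ne_zero
  have hfin : Module.Finite ℤ (Z (c + 1) V) := by rw [hVd]; exact Z_fin _ _
  have htf := Z_tf (c + 1) V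
  have hrk := rank_ge c
  rw [← hVd] at hrk
  let bs := Module.finBasis ℤ (Z (c + 1) V)
  set r := Module.finrank ℤ (Z (c + 1) V) with hr
  have hdet' : ∀ y ∈ C (c + 1) V, (∃ u, bd y = (p : ℤ) • u) → (∀ i, L i y = 0) →
      ∃ w ∈ C (c + 1) V, y = (p : ℤ) • w := by
    intro y hy hb hL
    obtain ⟨w, hw⟩ := hdet y hy hb hL
    apply div_crit _ hy
    intro z _
    rw [hw, pr_smul_right]
    exact dvd_mul_right _ _
  let Λ : LE →+ (ι → ZMod p) := AddMonoidHom.mk' (fun y i => L i y) (by intro a b; ext i; simp)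
  have hΛ : ∀ y i, Λ y i = L i y := fun _ _ => rfl
  have hsm : ∀ (t : ℤ) (y : LE), Λ (t • y) = (t : ZMod p) • Λ y := by
    intro t y
    rw [map_zsmul]
    ext i; simp
  have hli : LinearIndependent (ZMod p) (fun i : Fin r => Λ (bs i).1) := by
    rw [Fintype.linearIndependent_iff]
    intro a ha i
    let y : Z (c + 1) V := ∑ i, ((a i).val : ℤ) • bs i
    have hLy : Λ y.1 = 0 := by
      have : y.1 = ∑ i, ((a i).val : ℤ) • (bs i).1 := by simp [y]
      rw [this, map_sum, ← ha]
      refine Finset.sum_congr rfl fun i _ => ?_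
      rw [hsm]; simp
    have hy := mem_Z.1 y.2
    obtain ⟨w, hw, e⟩ := hdet' y.1 hy.1 ⟨0, by rw [hy.2, smul_zero]⟩ (fun i => by
      rw [← hΛ, hLy]; rfl)
    have hbw : bd w = 0 := by
      have h1 : (p : ℤ) • bd w = 0 := by rw [← map_smul, ← e, hy.2]
      exact tf (bd_mem hw) hp0 h1
    let w' : Z (c + 1) V := ⟨w, mem_Z.2 ⟨hw, hbw⟩⟩
    have e' : y = (p : ℤ) • w' := Subtype.ext e
    have h2 := congrArg (fun t => bs.repr t i) e'
    have h3 : bs.repr y i = ((a i).val : ℤ) := by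
      simp only [y]
      rw [bs.repr_sum_self]
    simp only [h3, map_smul, Finsupp.smul_apply, smul_eq_mul] at h2
    have h4 := congrArg (Int.cast : ℤ → ZMod p) h2
    simpa using h4
  have hc1 := hli.fintype_card_le_finrank
  rw [Module.finrank_fintype_fun_eq_card, Fintype.card_fin] at hc1
  have hspan := hli.span_eq_top_of_card_eq_finrank' (by
    rw [Module.finrank_fintype_fun_eq_card, Fintype.card_fin]; omega)
  obtain ⟨y, hy, hb⟩ := mem_B.1 h
  have hyin : Λ y ∈ Submodule.span (ZMod p) (Set.range (fun i : Fin r => Λ (bs i).1)) := by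
    rw [hspan]; trivial
  rw [Submodule.mem_span_range_iff_exists_fun] at hyin
  obtain ⟨a, ha⟩ := hyin
  let y0 : Z (c + 1) V := ∑ i, ((a i).val : ℤ) • bs i
  have hy0 := mem_Z.1 y0.2
  have hLy : Λ y0.1 = Λ y := by
    have : y0.1 = ∑ i, ((a i).val : ℤ) • (bs i).1 := by simp [y0]
    rw [this, map_sum, ← ha]
    refine Finset.sum_congr rfl fun i _ => ?_
    rw [hsm]; simp
  obtain ⟨w, hw, e⟩ := hdet' (y - y0.1) (Submodule.sub_mem _ hy hy0.1)
    ⟨u, by rw [map_sub, hb, hy0.2, sub_zero]⟩ (fun i => by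
      rw [← hΛ, map_sub, hLy, sub_self]; rfl)
  refine mem_B.2 ⟨w, hw, ?_⟩
  have h1 : (p : ℤ) • (bd w - u) = 0 := by
    rw [smul_sub, ← map_smul, ← e, map_sub, hb, hy0.2, sub_zero, sub_self]
  exact sub_eq_zero.1 (tf (Submodule.sub_mem _ (bd_mem hw) hu) hp0 h1)

end MC

set_option synthInstance.maxHeartbeats 20000
set_option maxHeartbeats 400000
set_option linter.all false
namespace MC

abbrev Mt : Type := Finset (Sym2 ℕ)

inductive PM : Finset ℕ → Mt → Prop
  | nil : PM ∅ ∅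
  | cons (a b : ℕ) (U : Finset ℕ) (τ : Mt) (ha : a ∉ U) (hb : b ∉ U) (hab : a ≠ b) (h : PM U τ) :
      PM (insert a (insert b U)) (insert s(a, b) τ)

theorem PM_empty {τ : Mt} (h : PM ∅ τ) : τ = ∅ := by
  generalize hU : (∅ : Finset ℕ) = U at h
  cases h with
  | nil => rfl
  | cons a b U τ ha hb hab h => exact absurd hU.symm (Finset.insert_ne_empty _ _)

theorem PM_cons {a b : ℕ} {U : Finset ℕ} {τ : Mt} (h : PM U τ) (ha : a ∉ U) (hb : b ∉ U)
    (hab : a ≠ b) : PM (insert a (insert b U)) (insert s(a, b) τ) := PM.cons a b U τ ha hb hab h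

theorem PM_mem {U : Finset ℕ} {τ : Mt} (h : PM U τ) : ∀ a b, s(a, b) ∈ τ → a ∈ U ∧ b ∈ U := by
  induction h with
  | nil => intro a b h; simp at h
  | cons a b U τ ha hb hab h ih =>
    intro p q hpq
    rw [Finset.mem_insert] at hpq
    rcases hpq with h1 | h1
    · rw [Sym2.eq_iff] at h1
      rcases h1 with ⟨rfl, rfl⟩ | ⟨rfl, rfl⟩ <;> simp
    · have := ih p q h1
      simp [this]

theorem PM_split {U : Finset ℕ} {σ : Mt} (h : PM U σ) : ∀ v ∈ U, ∃ w U' τ, v ∉ U' ∧ w ∉ U' ∧ v ≠ w ∧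
    U = insert v (insert w U') ∧ σ = insert s(v, w) τ ∧ PM U' τ := by
  induction h with
  | nil => intro v h; simp at h
  | cons a b U τ ha hb hab h ih =>
    intro v hv
    simp only [Finset.mem_insert] at hv
    by_cases hva : v = a
    · subst hva; exact ⟨b, U, τ, ha, hb, hab, rfl, rfl, h⟩
    by_cases hvb : v = b
    · subst hvb
      exact ⟨a, U, τ, hb, ha, hab.symm, Finset.insert_comm _ _ _, by rw [Sym2.eq_swap], h⟩
    have hvU : v ∈ U := by
      rcases hv with h | h | h
      · exact absurd h hva
      · exact absurd h hvb
      · exact h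
    obtain ⟨w, U', τ', h1, h2, h3, rfl, rfl, h6⟩ := ih v hvU
    simp only [Finset.mem_insert, not_or] at ha hb
    refine ⟨w, insert a (insert b U'), insert s(a, b) τ', ?_, ?_, h3, ?_, ?_, ?_⟩
    · simp [hva, hvb, h1]
    · simp [h2, Ne.symm ha.2.1, Ne.symm hb.2.1]
    · ext t; simp only [Finset.mem_insert]; grind
    · rw [Finset.insert_comm]
    · exact PM_cons h6 ha.2.2 hb.2.2 hab

noncomputable def supp (τ : Mt) : Finset ℕ := τ.biUnion fun e => e.toFinset

theorem PM_supp {U : Finset ℕ} {σ : Mt} (h : PM U σ) : supp σ = U := by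
  induction h with
  | nil => rfl
  | cons a b U τ ha hb hab h ih =>
    unfold supp at ih ⊢
    rw [Finset.biUnion_insert, ih]
    ext t
    simp only [Finset.mem_union, Sym2.mem_toFinset, Sym2.mem_iff, Finset.mem_insert]
    tauto

abbrev Fu : Type := Mt → ZMod 2

def Fn (c : Fu) (V : Finset ℕ) (m : ℕ) : Prop :=
  ∀ U τ a b d, U ⊆ V → U.card + 2 = 2 * m → PM U τ → a ∈ V → b ∈ V → d ∈ V → a ∉ U → b ∉ U → d ∉ U →
    a ≠ b → a ≠ d → b ≠ d → c (insert s(a, b) τ) + c (insert s(b, d) τ) + c (insert s(a, d) τ) = 0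

def Van (c : Fu) (V : Finset ℕ) (m : ℕ) : Prop :=
  ∀ U τ, U ⊆ V → U.card = 2 * m → PM U τ → c τ = 0

def Det (V : Finset ℕ) (m r : ℕ) : Prop :=
  ∃ (ι : Type) (_ : Fintype ι) (Φ : ι → (Fu →+ ZMod 2)), Fintype.card ι ≤ r ∧
    ∀ c : Fu, Fn c V m → (∀ i, Φ i c = 0) → Van c V m

/-- pull back along a choice of sums of insertions -/
noncomputable def hatx (v : ℕ) (xs : Mt → ℕ) : Fu →+ Fu :=
  AddMonoidHom.mk' (fun c τ => c (insert s(v, xs τ) τ)) (by intro a b; rfl)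

theorem hatx_apply (v : ℕ) (xs : Mt → ℕ) (c : Fu) (τ : Mt) :
    hatx v xs c τ = c (insert s(v, xs τ) τ) := rfl

theorem exists_spare (V : Finset ℕ) : ∃ xs : Mt → ℕ, ∀ U τ, PM U τ → U.card < V.card → xs τ ∈ V \ U := by
  classical
  refine ⟨fun τ => if h : (V \ supp τ).Nonempty then h.choose else 0, ?_⟩
  intro U τ h hc
  have hne : (V \ supp τ).Nonempty := by
    rw [PM_supp h, ← Finset.card_pos]
    have := Finset.le_card_sdiff U V
    omega
  rw [← PM_supp h]
  simp only [hne, dif_pos]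
  exact hne.choose_spec

theorem F2 (a b : ZMod 2) (h : a + b = 0) : a = b := by
  revert a b; decide

theorem Fn_mono {c : Fu} {V W : Finset ℕ} {m : ℕ} (h : Fn c V m) (hW : W ⊆ V) : Fn c W m :=
  fun U τ a b d hU hc hP ha hb hd => h U τ a b d (hU.trans hW) hc hP (hW ha) (hW hb) (hW hd)

theorem K_indep {V : Finset ℕ} {v m : ℕ} (hv : v ∈ V) {c : Fu} (hF : Fn c V (m + 1))
    (hvan : Van c (V.erase v) (m + 1)) {U : Finset ℕ} {τ : Mt} (hU : U ⊆ V.erase v)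
    (hc : U.card = 2 * m) (hP : PM U τ) {s t : ℕ} (hs : s ∈ V.erase v) (ht : t ∈ V.erase v)
    (hsU : s ∉ U) (htU : t ∉ U) : c (insert s(v, s) τ) = c (insert s(v, t) τ) := by
  by_cases hst : s = t
  · rw [hst]
  have hvU : v ∉ U := fun h => (Finset.mem_erase.1 (hU h)).1 rfl
  rw [Finset.mem_erase] at hs ht
  have h1 := hF U τ v s t (hU.trans (Finset.erase_subset _ _)) (by omega) hP hv hs.2 ht.2 hvU hsU htU
    (Ne.symm hs.1) (Ne.symm ht.1) hst
  have h2 : c (insert s(s, t) τ) = 0 := by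
    refine hvan (insert s (insert t U)) _ ?_ ?_ (PM_cons hP hsU htU hst)
    · intro w hw
      simp only [Finset.mem_insert] at hw
      rcases hw with rfl | rfl | hw
      · exact Finset.mem_erase.2 hs
      · exact Finset.mem_erase.2 ht
      · exact hU hw
    · rw [Finset.card_insert_of_notMem (by simp [hst, hsU]), Finset.card_insert_of_notMem htU]; omega
  rw [h2, add_zero] at h1
  exact F2 _ _ h1

theorem exists_avoid {V X : Finset ℕ} (h : X.card < V.card) : ∃ t ∈ V, t ∉ X := by
  by_contra! hc
  exact absurd (Finset.card_le_card (show V ⊆ X from hc)) (by omega)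

theorem K_lemma {V : Finset ℕ} {v m r s : ℕ} (hv : v ∈ V) (hV : 2 * m + 3 ≤ V.card)
    (h0 : ∃ (ι : Type) (_ : Fintype ι) (Φ : ι → (Fu →+ ZMod 2)), Fintype.card ι ≤ r ∧
      ∀ c : Fu, Fn c V (m + 1) → (∀ i, Φ i c = 0) → Van c (V.erase v) (m + 1))
    (h1 : Det (V.erase v) m s) : Det V (m + 1) (r + s) := by
  obtain ⟨ι, hι, Φ, hr, hΦ⟩ := h0
  obtain ⟨κ, hκ, Ψ, hs, hΨ⟩ := h1
  obtain ⟨xs, hxs⟩ := exists_spare (V.erase v)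
  have hcV : (V.erase v).card = V.card - 1 := Finset.card_erase_of_mem hv
  refine ⟨ι ⊕ κ, inferInstance, Sum.elim Φ (fun i => (Ψ i).comp (hatx v xs)), ?_, ?_⟩
  · rw [Fintype.card_sum]; omega
  intro c hF hi
  have hvan := hΦ c hF (fun i => hi (Sum.inl i))
  have hhat := hΨ (hatx v xs c) ?_ (fun i => hi (Sum.inr i))
  · intro U σ hU hc hP
    by_cases hvU : v ∈ U
    · obtain ⟨w, U', τ, h1, h2, h3, rfl, rfl, h6⟩ := PM_split hP v hvU
      rw [Finset.card_insert_of_notMem (by simp [h1, h3]), Finset.card_insert_of_notMem h2] at hc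
      have hU' : U' ⊆ V.erase v := by
        intro t ht
        rw [Finset.mem_erase]
        exact ⟨fun h => h1 (h ▸ ht), hU (by simp [ht])⟩
      have h7 := hhat U' τ hU' (by omega) h6
      rw [hatx_apply] at h7
      have h8 := hxs U' τ h6 (by omega)
      rw [Finset.mem_sdiff] at h8
      rw [← h7]
      exact K_indep hv hF hvan hU' (by omega) h6
        (Finset.mem_erase.2 ⟨h3.symm, hU (by simp)⟩) h8.1 h2 h8.2
    · exact hvan U σ (fun t ht => Finset.mem_erase.2 ⟨fun h => hvU (h ▸ ht), hU ht⟩) hc hP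
  · intro U τ a b d hU hc hP ha hb hd haU hbU hdU hab had hbd
    obtain ⟨t, htV, ht⟩ := exists_avoid (V := V.erase v) (X := insert a (insert b (insert d U))) (by
      have := Finset.card_insert_le a (insert b (insert d U))
      have := Finset.card_insert_le b (insert d U)
      have := Finset.card_insert_le d U
      omega)
    simp only [Finset.mem_insert, not_or] at ht
    have key : ∀ p q, p ∈ V.erase v → q ∈ V.erase v → p ∉ U → q ∉ U → p ≠ q → t ≠ p → t ≠ q →
        hatx v xs c (insert s(p, q) τ) = c (insert s(p, q) (insert s(v, t) τ)) := by
      intro p q hp hq hpU hqU hpq htp htq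
      rw [hatx_apply, Finset.insert_comm s(p, q)]
      have hP' := PM_cons hP hpU hqU hpq
      have hc' : (insert p (insert q U)).card = 2 * m := by
        rw [Finset.card_insert_of_notMem (by simp [hpq, hpU]), Finset.card_insert_of_notMem hqU]; omega
      have h8 := hxs _ _ hP' (by omega)
      rw [Finset.mem_sdiff] at h8
      refine K_indep hv hF hvan ?_ hc' hP' h8.1 htV h8.2 (by simp [htp, htq, ht.2.2.2])
      intro w hw
      simp only [Finset.mem_insert] at hw
      rcases hw with rfl | rfl | hw
      · exact hp
      · exact hq
      · exact hU hw
    rw [key a b ha hb haU hbU hab ht.1 ht.2.1, key b d hb hd hbU hdU hbd ht.2.1 ht.2.2.1,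
      key a d ha hd haU hdU had ht.1 ht.2.2.1]
    have hvU : v ∉ U := fun h => (Finset.mem_erase.1 (hU h)).1 rfl
    have htV' := Finset.mem_erase.1 htV
    have ha' := Finset.mem_erase.1 ha
    have hb' := Finset.mem_erase.1 hb
    have hd' := Finset.mem_erase.1 hd
    refine hF (insert v (insert t U)) _ a b d ?_ ?_ (PM_cons hP hvU ht.2.2.2 (Ne.symm htV'.1))
      ha'.2 hb'.2 hd'.2 ?_ ?_ ?_ hab had hbd
    · intro w hw
      simp only [Finset.mem_insert] at hw
      rcases hw with rfl | rfl | hw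
      · exact hv
      · exact htV'.2
      · exact (Finset.mem_erase.1 (hU hw)).2
    · rw [Finset.card_insert_of_notMem (by simp [Ne.symm htV'.1, hvU]), Finset.card_insert_of_notMem ht.2.2.2]
      omega
    · simp [ha'.1, haU, Ne.symm ht.1]
    · simp [hb'.1, hbU, Ne.symm ht.2.1]
    · simp [hd'.1, hdU, Ne.symm ht.2.2.1]

end MC

set_option synthInstance.maxHeartbeats 20000
set_option maxHeartbeats 400000
set_option linter.all false
namespace MC

def c2 (c : Fu) (τ : Mt) (a b d e : ℕ) : ZMod 2 := c (insert s(a, b) (insert s(d, e) τ))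

theorem c2_s (c : Fu) (τ : Mt) (a b d e : ℕ) : c2 c τ a b d e = c2 c τ b a d e := by
  unfold c2; rw [Sym2.eq_swap]

theorem c2_c (c : Fu) (τ : Mt) (a b d e : ℕ) : c2 c τ a b d e = c2 c τ d e a b := by
  unfold c2; rw [Finset.insert_comm]

def G4 (c : Fu) (τ : Mt) (a b d e : ℕ) : ZMod 2 :=
  c2 c τ a b d e + c2 c τ a d b e + c2 c τ a e b d

theorem G4_swap (c : Fu) (τ : Mt) (a b d e : ℕ) : G4 c τ a b d e = G4 c τ b a d e := by
  unfold G4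
  rw [c2_s c τ a b, c2_c c τ a d, c2_c c τ a e]
  ring

theorem G4_swap' (c : Fu) (τ : Mt) (a b d e : ℕ) : G4 c τ a b d e = G4 c τ a d b e := by
  unfold G4
  rw [c2_c c τ a e b d, c2_s c τ b d, c2_c c τ d b]
  ring

theorem G4_swap'' (c : Fu) (τ : Mt) (a b d e : ℕ) : G4 c τ a b d e = G4 c τ a b e d := by
  unfold G4
  rw [c2_c c τ a b d e, c2_s c τ d e, c2_c c τ e d]
  ring

theorem Fn2 {c : Fu} {V U : Finset ℕ} {m : ℕ} {τ : Mt} (hF : Fn c V m) (hU : U ⊆ V)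
    (hc : U.card + 4 = 2 * m) (hP : PM U τ) {a b d e f : ℕ} (ha : a ∈ V) (hb : b ∈ V) (hd : d ∈ V)
    (he : e ∈ V) (hf : f ∈ V) (haU : a ∉ U) (hbU : b ∉ U) (hdU : d ∉ U) (heU : e ∉ U) (hfU : f ∉ U)
    (hn : [a, b, d, e, f].Nodup) :
    c2 c τ a b e f + c2 c τ b d e f + c2 c τ a d e f = 0 := by
  simp only [List.nodup_cons, List.mem_cons, List.not_mem_nil, not_or, or_false, List.nodup_nil,
    not_false_eq_true, and_true] at hn
  obtain ⟨⟨h1, h2, h3, h4⟩, ⟨h5, h6, h7⟩, ⟨h8, h9⟩, h10⟩ := hn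
  refine hF (insert e (insert f U)) _ a b d ?_ ?_ (PM_cons hP heU hfU h10) ha hb hd ?_ ?_ ?_ h1 h2 h5
  · intro w hw
    simp only [Finset.mem_insert] at hw
    rcases hw with rfl | rfl | hw
    · exact he
    · exact hf
    · exact hU hw
  · rw [Finset.card_insert_of_notMem (by simp [h10, heU]), Finset.card_insert_of_notMem hfU]; omega
  · simp [h3, h4, haU]
  · simp [h6, h7, hbU]
  · simp [h8, h9, hdU]

theorem five {c : Fu} {V U : Finset ℕ} {m : ℕ} {τ : Mt} (hF : Fn c V m) (hU : U ⊆ V)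
    (hc : U.card + 4 = 2 * m) (hP : PM U τ) {p q r s t : ℕ} (hp : p ∈ V) (hq : q ∈ V) (hr : r ∈ V)
    (hs : s ∈ V) (ht : t ∈ V) (hpU : p ∉ U) (hqU : q ∉ U) (hrU : r ∉ U) (hsU : s ∉ U) (htU : t ∉ U)
    (hn : [p, q, r, s, t].Nodup) : G4 c τ p r s t = G4 c τ q r s t := by
  have hn' := hn
  simp only [List.nodup_cons, List.mem_cons, List.not_mem_nil, not_or, or_false, List.nodup_nil,
    not_false_eq_true, and_true] at hn'
  obtain ⟨⟨h1, h2, h3, h4⟩, ⟨h5, h6, h7⟩, ⟨h8, h9⟩, h10⟩ := hn'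
  have e1 := Fn2 hF hU hc hP hp hq hr hs ht hpU hqU hrU hsU htU hn
  have e2 := Fn2 hF hU hc hP hp hq hs hr ht hpU hqU hsU hrU htU (by simp; grind)
  have e3 := Fn2 hF hU hc hP hp hq ht hr hs hpU hqU htU hrU hsU (by simp; grind)
  have e4 := Fn2 hF hU hc hP hr hs ht hp hq hrU hsU htU hpU hqU (by simp; grind)
  rw [c2_c c τ r s, c2_c c τ s t, c2_c c τ r t] at e4
  apply F2
  unfold G4
  have two : (2 : ZMod 2) = 0 := by decide
  linear_combination e1 + e2 + e3 - e4

theorem exists_three (W : Finset ℕ) : ∃ p q r : Mt → ℕ, ∀ U τ, PM U τ → U ⊆ W → W.card = U.card + 3 →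
    p τ ∉ U ∧ q τ ∉ U ∧ r τ ∉ U ∧ p τ ≠ q τ ∧ p τ ≠ r τ ∧ q τ ≠ r τ ∧
      W = insert (p τ) (insert (q τ) (insert (r τ) U)) := by
  have : ∀ τ : Mt, ∃ p q r, ∀ U, PM U τ → U ⊆ W → W.card = U.card + 3 →
      p ∉ U ∧ q ∉ U ∧ r ∉ U ∧ p ≠ q ∧ p ≠ r ∧ q ≠ r ∧ W = insert p (insert q (insert r U)) := by
    intro τ
    by_cases h : ∃ U, PM U τ ∧ U ⊆ W ∧ W.card = U.card + 3
    · obtain ⟨U, h1, h2, h3⟩ := h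
      obtain ⟨p, q, r, hh⟩ := compl_three h2 h3
      refine ⟨p, q, r, fun U' h1' _ _ => ?_⟩
      have : U' = U := by rw [← PM_supp h1, ← PM_supp h1']
      subst this
      exact hh
    · exact ⟨0, 0, 0, fun U h1 h2 h3 => absurd ⟨U, h1, h2, h3⟩ h⟩
  choose p q r h using this
  exact ⟨p, q, r, fun U τ => h τ U⟩

noncomputable def hat3 (z : ℕ) (p q r : Mt → ℕ) : Fu →+ Fu :=
  AddMonoidHom.mk' (fun c τ => G4 c τ z (p τ) (q τ) (r τ)) (by
    intro a b; funext τ; simp [G4, c2]; ring)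

theorem hat3_apply (z : ℕ) (p q r : Mt → ℕ) (c : Fu) (τ : Mt) :
    hat3 z p q r c τ = G4 c τ z (p τ) (q τ) (r τ) := rfl

theorem G4_eq (c : Fu) (τ : Mt) {W U : Finset ℕ} {z p q r p' q' r' : ℕ}
    (h1 : p ∉ U) (h2 : q ∉ U) (h3 : r ∉ U) (h4 : p ≠ q) (h5 : p ≠ r) (h6 : q ≠ r)
    (hW : W = insert p (insert q (insert r U)))
    (h1' : p' ∉ U) (h2' : q' ∉ U) (h3' : r' ∉ U) (h4' : p' ≠ q') (h5' : p' ≠ r') (h6' : q' ≠ r')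
    (hp' : p' ∈ W) (hq' : q' ∈ W) (hr' : r' ∈ W) :
    G4 c τ z p q r = G4 c τ z p' q' r' := by
  subst hW
  simp only [Finset.mem_insert, h1', h2', h3', or_false] at hp' hq' hr'
  have s1 : ∀ i j k, G4 c τ z i j k = G4 c τ z j i k := G4_swap' c τ z
  have s2 : ∀ i j k, G4 c τ z i j k = G4 c τ z i k j := G4_swap'' c τ z
  rcases hp' with h | h | h <;> rcases hq' with h' | h' | h' <;> rcases hr' with h'' | h'' | h'' <;>
    subst h <;> subst h' <;> subst h'' <;>
    first
    | exact absurd rfl h4'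
    | exact absurd rfl h5'
    | exact absurd rfl h6'
    | rfl
    | exact s1 _ _ _
    | exact s2 _ _ _
    | exact (s1 _ _ _).trans (s2 _ _ _)
    | exact (s2 _ _ _).trans (s1 _ _ _)
    | exact ((s2 _ _ _).trans (s1 _ _ _)).trans (s2 _ _ _)

theorem top_lemma {V : Finset ℕ} {v z m r s : ℕ} (hv : v ∈ V) (hz : z ∈ V) (hzv : z ≠ v)
    (hV : V.card = 2 * m + 5) (h1 : Det ((V.erase v).erase z) m r)
    (h2 : Det ((V.erase v).erase z) (m + 1) s) :
    ∃ (ι : Type) (_ : Fintype ι) (Φ : ι → (Fu →+ ZMod 2)), Fintype.card ι ≤ r + s ∧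
      ∀ c : Fu, Fn c V (m + 2) → (∀ i, Φ i c = 0) → Van c (V.erase v) (m + 2) := by
  set W := (V.erase v).erase z with hWd
  have hWc : W.card = 2 * m + 3 := by
    rw [hWd, Finset.card_erase_of_mem (Finset.mem_erase.2 ⟨hzv, hz⟩), Finset.card_erase_of_mem hv]
    omega
  have hWm : ∀ w ∈ W, w ∈ V ∧ w ≠ v ∧ w ≠ z := by
    intro w hw
    simp only [hWd, Finset.mem_erase] at hw
    exact ⟨hw.2.2, hw.2.1, hw.1⟩
  obtain ⟨ι, hι, Φ, hr, hΦ⟩ := h1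
  obtain ⟨κ, hκ, Ψ, hs, hΨ⟩ := h2
  obtain ⟨xs, hxs⟩ := exists_spare W
  obtain ⟨fp, fq, fr, hf⟩ := exists_three W
  refine ⟨ι ⊕ κ, inferInstance, Sum.elim (fun i => (Φ i).comp (hat3 z fp fq fr))
    (fun i => (Ψ i).comp (hatx z xs)), ?_, ?_⟩
  · rw [Fintype.card_sum]; omega
  intro c hF hi
  have hg := hΦ (hat3 z fp fq fr c) ?_ (fun i => hi (Sum.inl i))
  · have hg' := hΨ (hatx z xs c) ?_ (fun i => hi (Sum.inr i))
    · intro U σ hU hc hP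
      have hUe : U = V.erase v := Finset.eq_of_subset_of_card_le hU (by
        rw [Finset.card_erase_of_mem hv]; omega)
      obtain ⟨w, U', τ, h1, h2, h3, h4, rfl, h6⟩ := PM_split hP z (by
        rw [hUe]; exact Finset.mem_erase.2 ⟨hzv, hz⟩)
      rw [h4, Finset.card_insert_of_notMem (by simp [h1, h3]), Finset.card_insert_of_notMem h2] at hc
      have hWe : W = insert w U' := by
        rw [hWd, ← hUe, h4, Finset.erase_insert (by simp [h1, h3])]
      have h7 := hg' U' τ (by rw [hWe]; exact Finset.subset_insert _ _) (by omega) h6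
      have h8 := hxs U' τ h6 (by omega)
      have h9 : xs τ = w := by
        rw [hWe, Finset.mem_sdiff, Finset.mem_insert] at h8
        rcases h8.1 with h | h
        · exact h
        · exact absurd h h8.2
      rw [hatx_apply, h9] at h7
      exact h7
    · intro U τ a b d hU hc hP ha hb hd haU hbU hdU hab had hbd
      have h3 := hf U τ hP hU (by omega)
      have h4 := hg U τ hU (by omega) hP
      rw [hat3_apply, G4_eq c τ h3.1 h3.2.1 h3.2.2.1 h3.2.2.2.1 h3.2.2.2.2.1 h3.2.2.2.2.2.1
        h3.2.2.2.2.2.2 haU hbU hdU hab had hbd ha hb hd] at h4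
      have hWe : W = insert a (insert b (insert d U)) := by
        symm
        apply Finset.eq_of_subset_of_card_le
        · intro w hw
          simp only [Finset.mem_insert] at hw
          rcases hw with rfl | rfl | rfl | hw
          · exact ha
          · exact hb
          · exact hd
          · exact hU hw
        · rw [Finset.card_insert_of_notMem (by simp [hab, had, haU]),
            Finset.card_insert_of_notMem (by simp [hbd, hbU]), Finset.card_insert_of_notMem hdU]
          omega
      have key : ∀ p q t, p ∉ U → q ∉ U → p ≠ q → t ≠ p → t ≠ q →
          (∀ w ∈ W, w = p ∨ w = q ∨ w = t ∨ w ∈ U) →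
          hatx z xs c (insert s(p, q) τ) = c2 c τ z t p q := by
        intro p q t hpU hqU hpq htp htq hcov
        have hP' := PM_cons hP hpU hqU hpq
        have h8 := hxs _ _ hP' (by
          rw [Finset.card_insert_of_notMem (by simp [hpq, hpU]), Finset.card_insert_of_notMem hqU]; omega)
        rw [Finset.mem_sdiff, Finset.mem_insert, Finset.mem_insert, not_or, not_or] at h8
        have h9 : xs (insert s(p, q) τ) = t := by
          rcases hcov _ h8.1 with h | h | h | h
          · exact absurd h h8.2.1
          · exact absurd h h8.2.2.1
          · exact h
          · exact absurd h h8.2.2.2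
        rw [hatx_apply, h9]
        rfl
      have hcov : ∀ w ∈ W, w = a ∨ w = b ∨ w = d ∨ w ∈ U := by
        intro w hw; rw [hWe] at hw; simpa using hw
      rw [key a b d haU hbU hab (Ne.symm had) (Ne.symm hbd) hcov,
        key b d a hbU hdU hbd hab had (fun w hw => by
          rcases hcov w hw with h | h | h | h <;> simp [h]),
        key a d b haU hdU had (Ne.symm hab) hbd (fun w hw => by
          rcases hcov w hw with h | h | h | h <;> simp [h])]
      unfold G4 at h4
      linear_combination h4
  · intro U τ a b d hU hc hP ha hb hd haU hbU hdU hab had hbd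
    have hTc : (insert a (insert b (insert d U))).card = U.card + 3 := by
      rw [Finset.card_insert_of_notMem (by simp [hab, had, haU]),
            Finset.card_insert_of_notMem (by simp [hbd, hbU]), Finset.card_insert_of_notMem hdU]
    obtain ⟨e, f, he, hf', hef, hWe⟩ := compl_two (U := insert a (insert b (insert d U))) (V := W) (by
        intro w hw
        simp only [Finset.mem_insert] at hw
        rcases hw with rfl | rfl | rfl | hw
        · exact ha
        · exact hb
        · exact hd
        · exact hU hw) (by omega)
    have heW : e ∈ W := by rw [hWe]; simp
    have hfW : f ∈ W := by rw [hWe]; simp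
    simp only [Finset.mem_insert, not_or] at he hf'
    have hvU : v ∉ U := fun h => (hWm v (hU h)).2.1 rfl
    have hzU : z ∉ U := fun h => (hWm z (hU h)).2.2 rfl
    have hUV : U ⊆ V := fun w hw => (hWm w (hU hw)).1
    have key : ∀ p q t, p ∈ W → q ∈ W → t ∈ W → p ∉ U → q ∉ U → t ∉ U → p ≠ q → t ≠ p → t ≠ q →
        e ≠ p → e ≠ q → e ≠ t → f ≠ p → f ≠ q → f ≠ t →
          hat3 z fp fq fr c (insert s(p, q) τ) = G4 c (insert s(p, q) τ) v z e f := by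
      intro p q t hp hq ht hpU hqU htU hpq htp htq hep heq het hfp hfq hft
      have hP' := PM_cons hP hpU hqU hpq
      have hcc : (insert p (insert q U)).card = U.card + 2 := by
        rw [Finset.card_insert_of_notMem (by simp [hpq, hpU]), Finset.card_insert_of_notMem hqU]
      have hsub : insert p (insert q U) ⊆ W := by
        intro w hw
        simp only [Finset.mem_insert] at hw
        rcases hw with rfl | rfl | hw
        · exact hp
        · exact hq
        · exact hU hw
      have h3 := hf _ _ hP' hsub (by omega)
      have hp' := hWm p hp
      have hq' := hWm q hq
      have ht' := hWm t ht
      have he' := hWm e heW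
      have hf'' := hWm f hfW
      rw [hat3_apply, G4_eq (p' := t) (q' := e) (r' := f) c _ h3.1 h3.2.1 h3.2.2.1 h3.2.2.2.1
        h3.2.2.2.2.1 h3.2.2.2.2.2.1 h3.2.2.2.2.2.2 (by simp [htp, htq, htU])
        (by simp [hep, heq, he.2.2.2]) (by simp [hfp, hfq, hf'.2.2.2])
        (Ne.symm het) (Ne.symm hft) hef ht heW hfW]
      rw [G4_swap]
      refine five hF (hsub.trans fun w hw => (hWm w hw).1) (by omega) hP' ht'.1 hv hz he'.1 hf''.1
        (by simp [htp, htq, htU]) ?_ ?_ (by simp [hep, heq, he.2.2.2])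
        (by simp [hfp, hfq, hf'.2.2.2]) ?_
      · simp [hvU, Ne.symm hp'.2.1, Ne.symm hq'.2.1]
      · simp [hzU, Ne.symm hp'.2.2, Ne.symm hq'.2.2]
      · simp only [List.nodup_cons, List.mem_cons, List.not_mem_nil, not_or, or_false, List.nodup_nil,
          not_false_eq_true, and_true]
        exact ⟨⟨ht'.2.1, ht'.2.2, Ne.symm het, Ne.symm hft⟩,
          ⟨Ne.symm hzv, Ne.symm he'.2.1, Ne.symm hf''.2.1⟩, ⟨Ne.symm he'.2.2, Ne.symm hf''.2.2⟩, hef⟩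
    rw [key a b d ha hb hd haU hbU hdU hab (Ne.symm had) (Ne.symm hbd) he.1 he.2.1 he.2.2.1 hf'.1
        hf'.2.1 hf'.2.2.1,
      key b d a hb hd ha hbU hdU haU hbd hab had he.2.1 he.2.2.1 he.1 hf'.2.1 hf'.2.2.1 hf'.1,
      key a d b ha hd hb haU hdU hbU had (Ne.symm hab) hbd he.1 he.2.2.1 he.2.1 hf'.1 hf'.2.2.1 hf'.2.1]
    have ha' := hWm a ha
    have hb' := hWm b hb
    have hd' := hWm d hd
    have he' := hWm e heW
    have hf'' := hWm f hfW
    have key2 : ∀ g h i j, g ∈ V → h ∈ V → i ∈ V → j ∈ V → g ∉ U → h ∉ U → i ∉ U → j ∉ U →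
        [a, b, d, g, h, i, j].Nodup →
        c2 c (insert s(a, b) τ) g h i j + c2 c (insert s(b, d) τ) g h i j +
          c2 c (insert s(a, d) τ) g h i j = 0 := by
      intro g h i j hg hh hii hj hgU hhU hiU hjU hn
      simp only [List.nodup_cons, List.mem_cons, List.not_mem_nil, not_or, or_false, List.nodup_nil,
          not_false_eq_true, and_true] at hn
      obtain ⟨⟨a1, a2, a3, a4, a5, a6⟩, ⟨b2, b3, b4, b5, b6⟩, ⟨d3, d4, d5, d6⟩, ⟨g1, g2, g3⟩,
        ⟨i1, i2⟩, j1⟩ := hn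
      have hP1 := PM_cons hP hiU hjU j1
      have := Fn2 (τ := insert s(i, j) τ) (e := g) (f := h) hF (U := insert i (insert j U)) (by
        intro w hw
        simp only [Finset.mem_insert] at hw
        rcases hw with rfl | rfl | hw
        · exact hii
        · exact hj
        · exact hUV hw) (by
          rw [Finset.card_insert_of_notMem (by simp [j1, hiU]), Finset.card_insert_of_notMem hjU]
          omega) hP1 ha'.1 hb'.1 hd'.1 hg hh (by simp [a5, a6, haU]) (by simp [b5, b6, hbU])
          (by simp [d5, d6, hdU]) (by simp [g2, g3, hgU]) (by simp [i1, i2, hhU]) (by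
            simp only [List.nodup_cons, List.mem_cons, List.not_mem_nil, not_or, or_false,
              List.nodup_nil, not_false_eq_true, and_true]
            exact ⟨⟨a1, a2, a3, a4⟩, ⟨b2, b3, b4⟩, ⟨d3, d4⟩, g1⟩)
      unfold c2 at this ⊢
      have hrw : ∀ e1 e2 e3 : Sym2 ℕ, insert e1 (insert e2 (insert e3 τ)) =
          insert e3 (insert e1 (insert e2 τ)) := by
        intro e1 e2 e3
        rw [Finset.insert_comm e2 e3, Finset.insert_comm e1 e3]
      rw [hrw s(g, h), hrw s(g, h), hrw s(g, h)]
      exact this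
    have n1 : [a, b, d, v, z, e, f].Nodup := by
      simp only [List.nodup_cons, List.mem_cons, List.not_mem_nil, not_or, or_false, List.nodup_nil,
          not_false_eq_true, and_true]
      grind
    have k1 := key2 v z e f hv hz he'.1 hf''.1 hvU hzU he.2.2.2 hf'.2.2.2 n1
    have k2 := key2 v e z f hv he'.1 hz hf''.1 hvU he.2.2.2 hzU hf'.2.2.2 (by
      simp only [List.nodup_cons, List.mem_cons, List.not_mem_nil, not_or, or_false, List.nodup_nil,
          not_false_eq_true, and_true] at n1 ⊢
      grind)
    have k3 := key2 v f z e hv hf''.1 hz he'.1 hvU hf'.2.2.2 hzU he.2.2.2 (by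
      simp only [List.nodup_cons, List.mem_cons, List.not_mem_nil, not_or, or_false, List.nodup_nil,
          not_false_eq_true, and_true] at n1 ⊢
      grind)
    unfold G4
    linear_combination k1 + k2 + k3

end MC

set_option synthInstance.maxHeartbeats 20000
set_option maxHeartbeats 400000
set_option linter.all false
namespace MC

theorem Det_zero (V : Finset ℕ) : Det V 0 1 := by
  refine ⟨Unit, inferInstance, fun _ => Pi.evalAddMonoidHom (fun _ : Mt => ZMod 2) (∅ : Mt), ?_, ?_⟩
  · simp
  · intro c _ hi U τ _ hc hP
    have : U = ∅ := Finset.card_eq_zero.1 (by omega)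
    subst this
    rw [PM_empty hP]
    exact hi ()

theorem Det_mono_r {V : Finset ℕ} {m r s : ℕ} (h : Det V m r) (hrs : r ≤ s) : Det V m s := by
  obtain ⟨ι, hι, Φ, h1, h2⟩ := h
  exact ⟨ι, hι, Φ, h1.trans hrs, h2⟩

theorem Det_all : ∀ n (V : Finset ℕ) m, V.card = n → 2 * m + 1 ≤ n → Det V m ((n - 1).choose m) := by
  intro n
  induction n using Nat.strong_induction_on with
  | _ n ih =>
  intro V m hV hm
  rcases m with _ | m
  · simpa using Det_zero V
  obtain ⟨k, rfl⟩ : ∃ k, n = k + 2 := ⟨n - 2, by omega⟩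
  obtain ⟨v, hv⟩ : V.Nonempty := Finset.card_pos.1 (by omega)
  have hVv : (V.erase v).card = k + 1 := by rw [Finset.card_erase_of_mem hv]; omega
  have h1 := ih (k + 1) (by omega) (V.erase v) m hVv (by omega)
  have e1 : k + 2 - 1 = k + 1 := by omega
  have e2 : k + 1 - 1 = k := by omega
  rw [e2] at h1
  rw [e1, Nat.choose_succ_succ, add_comm (k.choose m)]
  refine K_lemma hv (by omega) ?_ h1
  by_cases hbig : 2 * m + 4 ≤ k + 2
  · have h2 := ih (k + 1) (by omega) (V.erase v) (m + 1) hVv (by omega)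
    rw [e2] at h2
    obtain ⟨ι, hι, Φ, hr, hΦ⟩ := h2
    exact ⟨ι, hι, Φ, hr, fun c hF hi => hΦ c (Fn_mono hF (Finset.erase_subset _ _)) hi⟩
  obtain rfl : k = 2 * m + 1 := by omega
  obtain ⟨z, hz⟩ : (V.erase v).Nonempty := Finset.card_pos.1 (by omega)
  have hW : ((V.erase v).erase z).card = 2 * m + 1 := by
    rw [Finset.card_erase_of_mem hz]; omega
  rcases m with _ | m
  · obtain ⟨w, hw⟩ := Finset.card_eq_one.1 hW
    refine ⟨Unit, inferInstance, fun _ => Pi.evalAddMonoidHom (fun _ : Mt => ZMod 2) {s(z, w)}, ?_, ?_⟩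
    · simp
    · intro c _ hi U τ hU hc hP
      have hUe : U = V.erase v := Finset.eq_of_subset_of_card_le hU (by omega)
      obtain ⟨w', U', τ', h1, h2, h3, h4, rfl, h6⟩ := PM_split hP z (by rw [hUe]; exact hz)
      rw [← hUe, h4, Finset.erase_insert (by simp [h1, h3])] at hw
      have hw' : w' = w := by
        have : w' ∈ ({w} : Finset ℕ) := by rw [← hw]; simp
        simpa using this
      subst hw'
      have hU' : U' = ∅ := by
        rw [← Finset.erase_insert h2, hw]; simp
      subst hU'
      rw [PM_empty h6]
      exact hi ()
  · have hz' := Finset.mem_erase.1 hz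
    have h3 := ih (2 * m + 3) (by omega) _ m hW (by omega)
    have h4 := ih (2 * m + 3) (by omega) _ (m + 1) hW (by omega)
    obtain ⟨ι, hι, Φ, hr, hΦ⟩ := top_lemma hv hz'.2 hz'.1 (by omega) h3 h4
    refine ⟨ι, hι, Φ, hr.trans ?_, hΦ⟩
    have e3 : 2 * m + 3 - 1 = 2 * m + 2 := by omega
    rw [e3]
    have e4 : 2 * (m + 1) + 1 = 2 * m + 2 + 1 := by ring
    rw [e4, Nat.choose_succ_succ (2 * m + 2) (m + 1)]
    rw [Nat.succ_eq_add_one]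
    have : (2 * m + 2).choose (m + 1 + 1) = (2 * m + 2).choose m :=
      Nat.choose_symm_of_eq_add (by omega)
    omega

/-! Link with chains. -/

noncomputable def mm (σ : Mt) : LE := (σ.toList.map gen).prod

theorem mm_perm {l l' : List (Sym2 ℕ)} (h : l.Perm l') :
    (l.map (gen : Sym2 ℕ → LE)).prod = (l'.map gen).prod ∨
      (l.map (gen : Sym2 ℕ → LE)).prod = -(l'.map gen).prod := by
  induction h with
  | nil => left; rfl
  | cons a h ih =>
    simp only [List.map_cons, List.prod_cons]
    rcases ih with h | h <;> rw [h]
    · left; rfl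
    · right; rw [mul_neg]
  | swap a b l =>
    right
    simp only [List.map_cons, List.prod_cons]
    rw [gen_anti_mul]
  | trans _ _ h1 h2 =>
    rcases h1 with h1 | h1 <;> rcases h2 with h2 | h2 <;> rw [h1, h2] <;> simp

theorem mm_insert {σ : Mt} {e : Sym2 ℕ} (h : e ∉ σ) :
    mm (insert e σ) = gen e * mm σ ∨ mm (insert e σ) = -(gen e * mm σ) := by
  have := mm_perm (Finset.toList_insert h)
  simpa [mm] using this

theorem mm_empty : mm ∅ = 1 := by simp [mm]

theorem mm_mem {U : Finset ℕ} {σ : Mt} (h : PM U σ) : ∀ m, U.card = 2 * m → mm σ ∈ C m U := by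
  induction h with
  | nil => intro m hm; obtain rfl : m = 0 := by simpa using hm.symm
           rw [mm_empty]; exact one_mem_C _
  | cons a b U τ ha hb hab h ih =>
    intro m hm
    rw [Finset.card_insert_of_notMem (by simp [hab, ha]), Finset.card_insert_of_notMem hb] at hm
    obtain ⟨k, rfl⟩ : ∃ k, m = k + 1 := ⟨m - 1, by omega⟩
    have hx : x a b * mm τ ∈ C (k + 1) (insert a (insert b U)) :=
      x_mul_mem_C' (by simp) (by simp) hab (ih k (by omega))
        (fun w hw => by simp [hw]) ha hb
    rcases mm_insert (σ := τ) (e := s(a, b)) (fun hh => ha (PM_mem h a b hh).1) with h | h <;> rw [h]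
    · exact hx
    · exact neg_mem hx

noncomputable def cy : LE →+ Fu :=
  AddMonoidHom.mk' (fun y σ => ((pr (mm σ) y : ℤ) : ZMod 2)) (by
    intro a b; funext σ; simp)

theorem cy_apply (y : LE) (σ : Mt) : cy y σ = ((pr (mm σ) y : ℤ) : ZMod 2) := rfl

theorem neg2 (a : ZMod 2) : -a = a := by revert a; decide

theorem cy_insert {σ : Mt} {a b : ℕ} (h : s(a, b) ∉ σ) (y : LE) :
    cy y (insert s(a, b) σ) = ((pr (x a b * mm σ) y : ℤ) : ZMod 2) := by
  rw [cy_apply]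
  rcases mm_insert h with h | h <;> rw [h]
  · rfl
  · rw [pr_neg_left]
    push_cast
    rw [neg2]; rfl

theorem pr_x_C {c : ℕ} {U V : Finset ℕ} {w y : LE} (hw : w ∈ C c U) (a b : ℕ) :
    pr (x a b * w) y = pr w (dd a b y) := by
  rw [pr_ad, ad_x]

theorem cy_Fn {c : ℕ} {V : Finset ℕ} {y u : LE} (hV : V.card = 2 * c + 3) (hy : y ∈ C (c + 1) V)
    (hb : bd y = (2 : ℤ) • u) : Fn (cy y) V (c + 1) := by
  intro U τ a b d hU hc hP ha hb' hd haU hbU hdU hab had hbd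
  have hw := mm_mem hP c (by omega)
  have hVe : V = insert a (insert b (insert d U)) := by
    symm
    apply Finset.eq_of_subset_of_card_le
    · intro w hw
      simp only [Finset.mem_insert] at hw
      rcases hw with rfl | rfl | rfl | hw
      · exact ha
      · exact hb'
      · exact hd
      · exact hU hw
    · rw [Finset.card_insert_of_notMem (by simp [hab, had, haU]),
        Finset.card_insert_of_notMem (by simp [hbd, hbU]), Finset.card_insert_of_notMem hdU]
      omega
  have ht := tri_sum hVe haU hbU hdU hab had hbd (by omega) hw hy
  rw [hb, pr_smul_right] at ht
  rw [cy_insert (fun hh => haU (PM_mem hP _ _ hh).1), cy_insert (fun hh => hbU (PM_mem hP _ _ hh).1),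
    cy_insert (fun hh => haU (PM_mem hP _ _ hh).1)]
  rw [pr_ad, pr_ad, pr_ad, ad_x, ad_x, ad_x, ← Int.cast_add, ← Int.cast_add, ← ht]
  push_cast
  have two : (2 : ZMod 2) = 0 := by decide
  simp [two]

theorem C_PM (S : Submodule ℤ LE) : ∀ (c : ℕ) (V : Finset ℕ),
    (∀ U σ, U ⊆ V → U.card = 2 * c → PM U σ → mm σ ∈ S) → C c V ≤ S := by
  intro c
  induction c generalizing S with
  | zero =>
    intro V h
    apply C_zero_le
    rw [← mm_empty]
    exact h ∅ ∅ (by simp) (by simp) PM.nil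
  | succ c ih =>
    intro V h
    apply C_succ_le
    intro a b z ha hb hab hz
    have := ih (S.comap (LinearMap.mulLeft ℤ (x a b))) (V \ {a, b}) ?_ hz
    · simpa using this
    · intro U σ hU hc hP
      have haU : a ∉ U := fun hh => by have := hU hh; simp at this
      have hbU : b ∉ U := fun hh => by have := hU hh; simp at this
      have h1 := h (insert a (insert b U)) (insert s(a, b) σ) (by
        intro w hw
        simp only [Finset.mem_insert] at hw
        rcases hw with rfl | rfl | hw
        · exact ha
        · exact hb
        · exact (Finset.mem_sdiff.1 (hU hw)).1) (by
        rw [Finset.card_insert_of_notMem (by simp [hab, haU]), Finset.card_insert_of_notMem hbU]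
        omega) (PM_cons hP haU hbU hab)
      rcases mm_insert (fun hh => haU (PM_mem hP _ _ hh).1) with h2 | h2 <;> rw [h2] at h1
      · exact h1
      · have h3 := neg_mem_iff.1 h1
        exact h3

theorem no_two {c : ℕ} {u : LE} (hu : u ∈ C c (Finset.range (2 * c + 3)))
    (h : (2 : ℤ) • u ∈ B c (Finset.range (2 * c + 3))) : u ∈ B c (Finset.range (2 * c + 3)) := by
  obtain ⟨ι, hι, Φ, hr, hΦ⟩ := Det_all (2 * c + 3) (Finset.range (2 * c + 3)) (c + 1) (by simp) (by omega)
  haveI : Fact (Nat.Prime 2) := ⟨Nat.prime_two⟩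
  refine rank_lemma (p := 2) rfl (ι := ι) (by simpa using hr) (fun i => (Φ i).comp cy) ?_ hu
    (by exact_mod_cast h)
  intro y hy hb hi
  obtain ⟨u', hb⟩ := hb
  have hvan := hΦ (cy y) (cy_Fn (by simp) hy (by exact_mod_cast hb)) hi
  have hd : ∀ z ∈ C (c + 1) (Finset.range (2 * c + 3)), (2 : ℤ) ∣ pr z y := by
    have := C_PM (Submodule.comap (pr.flip y).toIntLinearMap (Ideal.span {(2 : ℤ)})) (c + 1)
      (Finset.range (2 * c + 3)) ?_
    · intro z hz
      have := this hz
      simpa [Ideal.mem_span_singleton] using this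
    · intro U σ hU hc hP
      have := hvan U σ hU hc hP
      rw [cy_apply, ZMod.intCast_zmod_eq_zero_iff_dvd] at this
      simpa [Ideal.mem_span_singleton] using this
  obtain ⟨y', _, h⟩ := div_crit 2 hy hd
  exact ⟨y', by exact_mod_cast h⟩

end MC

set_option synthInstance.maxHeartbeats 20000
set_option maxHeartbeats 400000
set_option linter.all false
namespace MC

/-! An abstract lemma on `q(ab,c)` symbols modulo five. -/

structure D4 (X : Finset ℕ) (a b c d : ℕ) : Prop where
  ha : a ∈ X
  hb : b ∈ X
  hc : c ∈ X
  hd : d ∈ X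
  ab : a ≠ b
  ac : a ≠ c
  ad : a ≠ d
  bc : b ≠ c
  bd : b ≠ d
  cd : c ≠ d

structure QQ (X : Finset ℕ) (q : ℕ → ℕ → ℕ → ZMod 5) : Prop where
  sy : ∀ a b c, q a b c = q b a c
  J : ∀ a b c d, D4 X a b c d → q a b c + q b c a + q c a b = 0
  R : ∀ a b c d, D4 X a b c d → q c d a + q c d b + q a b c + q a b d = 0

def tt (q : ℕ → ℕ → ℕ → ZMod 5) (a c b d : ℕ) : ZMod 5 := q a b c + q a d c - q b d c

theorem tt_symm {X : Finset ℕ} {q : ℕ → ℕ → ℕ → ZMod 5} (h : QQ X q) (a c b d : ℕ) :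
    tt q a c b d = tt q a c d b := by
  unfold tt; rw [h.sy b d]; ring

theorem D4.p1 {X : Finset ℕ} {a b c d : ℕ} (h : D4 X a b c d) : D4 X b a c d :=
  ⟨h.hb, h.ha, h.hc, h.hd, h.ab.symm, h.bc, h.bd, h.ac, h.ad, h.cd⟩
theorem D4.p2 {X : Finset ℕ} {a b c d : ℕ} (h : D4 X a b c d) : D4 X a c b d :=
  ⟨h.ha, h.hc, h.hb, h.hd, h.ac, h.ab, h.ad, h.bc.symm, h.cd, h.bd⟩
theorem D4.p3 {X : Finset ℕ} {a b c d : ℕ} (h : D4 X a b c d) : D4 X a b d c :=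
  ⟨h.ha, h.hb, h.hd, h.hc, h.ab, h.ad, h.ac, h.bd, h.bc, h.cd.symm⟩

theorem tt_anti {X : Finset ℕ} {q : ℕ → ℕ → ℕ → ZMod 5} (h : QQ X q) {a c b d : ℕ}
    (hd : D4 X a c b d) : tt q a c b d + tt q c a b d = 0 := by
  have j1 := h.J a b c d hd.p2
  have j2 := h.J a d c b hd.p3.p2
  have r := h.R a c b d hd
  unfold tt
  rw [h.sy b c] at j1
  rw [h.sy d c] at j2
  rw [h.sy c a b] at j1
  rw [h.sy c a d] at j2
  linear_combination j1 + j2 - r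

def g5 (q : ℕ → ℕ → ℕ → ZMod 5) (a b c d e : ℕ) : ZMod 5 :=
  q a d c - q b d c - q a e c + q b e c

theorem g5_tt {q : ℕ → ℕ → ℕ → ZMod 5} (a b c d e : ℕ) :
    g5 q a b c d e = tt q a c b d - tt q a c b e := by
  unfold g5 tt; ring

theorem g5_13 {X : Finset ℕ} {q : ℕ → ℕ → ℕ → ZMod 5} (h : QQ X q) {a b c d e : ℕ}
    (h1 : D4 X a c b d) (h2 : D4 X a c b e) : g5 q a b c d e = - g5 q c b a d e := by
  rw [g5_tt, g5_tt]
  linear_combination tt_anti h h1 - tt_anti h h2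

theorem g5_45 {q : ℕ → ℕ → ℕ → ZMod 5} (a b c d e : ℕ) :
    g5 q a b c d e = - g5 q a b c e d := by
  unfold g5; ring

theorem g5_flip {X : Finset ℕ} {q : ℕ → ℕ → ℕ → ZMod 5} (h : QQ X q) (a b c d e : ℕ) :
    g5 q a b c d e = g5 q d e c a b := by
  unfold g5; rw [h.sy d a, h.sy e a, h.sy d b, h.sy e b]; ring

theorem g5_34 {X : Finset ℕ} {q : ℕ → ℕ → ℕ → ZMod 5} (h : QQ X q) {a b c d e : ℕ}
    (h1 : D4 X d c e a) (h2 : D4 X d c e b) : g5 q a b c d e = - g5 q a b d c e := by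
  rw [g5_flip h, g5_13 h h1 h2, g5_flip h a b d]

theorem g5_rel (q : ℕ → ℕ → ℕ → ZMod 5) (a b c d e f : ℕ) :
    g5 q a b c d e + g5 q a b c e f - g5 q a b c d f = 0 := by
  unfold g5; ring

theorem g5_zero {X : Finset ℕ} {q : ℕ → ℕ → ℕ → ZMod 5} (h : QQ X q) {a b c d e f : ℕ}
    (ha : a ∈ X) (hb : b ∈ X) (hc : c ∈ X) (hd : d ∈ X) (he : e ∈ X) (hf : f ∈ X)
    (hn : [a, b, c, d, e, f].Nodup) : g5 q a b c d e = 0 := by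
  have sw : ∀ u v w, u ∈ [c, d, e, f] → v ∈ [c, d, e, f] → w ∈ [c, d, e, f] → u ≠ v → u ≠ w → v ≠ w →
      g5 q a b u v w = - g5 q a b v u w := by
    intro u v w hu hv hw huv huw hvw
    simp only [List.nodup_cons, List.mem_cons, List.not_mem_nil, not_or, or_false, List.nodup_nil,
          not_false_eq_true, and_true] at hn hu hv hw
    have hX : ∀ t, (t = c ∨ t = d ∨ t = e ∨ t = f) → t ∈ X ∧ t ≠ a ∧ t ≠ b := by
      rintro t (rfl | rfl | rfl | rfl)
      · exact ⟨hc, Ne.symm hn.1.2.1, Ne.symm hn.2.1.1⟩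
      · exact ⟨hd, Ne.symm hn.1.2.2.1, Ne.symm hn.2.1.2.1⟩
      · exact ⟨he, Ne.symm hn.1.2.2.2.1, Ne.symm hn.2.1.2.2.1⟩
      · exact ⟨hf, Ne.symm hn.1.2.2.2.2, Ne.symm hn.2.1.2.2.2⟩
    have hu' := hX u hu
    have hv' := hX v hv
    have hw' := hX w hw
    exact g5_34 h ⟨hv'.1, hu'.1, hw'.1, ha, Ne.symm huv, hvw, hv'.2.1, huw, hu'.2.1, hw'.2.1⟩
      ⟨hv'.1, hu'.1, hw'.1, hb, Ne.symm huv, hvw, hv'.2.2, huw, hu'.2.2, hw'.2.2⟩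
  simp only [List.nodup_cons, List.mem_cons, List.not_mem_nil, not_or, or_false, List.nodup_nil,
          not_false_eq_true, and_true] at hn
  obtain ⟨-, -, ⟨cd, ce, cf⟩, ⟨de, df⟩, ef⟩ := hn
  have r1 := g5_rel q a b c d e f
  have r2 := g5_rel q a b d c e f
  have r3 := g5_rel q a b e c d f
  have r4 := g5_rel q a b f c d e
  have s1 := sw d c e (by simp) (by simp) (by simp) (Ne.symm cd) de ce
  have s2 := sw d c f (by simp) (by simp) (by simp) (Ne.symm cd) df cf
  have s3 := sw e c d (by simp) (by simp) (by simp) (Ne.symm ce) (Ne.symm de) cd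
  have s4 := sw e d f (by simp) (by simp) (by simp) (Ne.symm de) ef df
  have s5 := sw e c f (by simp) (by simp) (by simp) (Ne.symm ce) ef cf
  have s6 := sw f c d (by simp) (by simp) (by simp) (Ne.symm cf) (Ne.symm df) cd
  have s7 := sw f d e (by simp) (by simp) (by simp) (Ne.symm df) (Ne.symm ef) de
  have s8 := sw f c e (by simp) (by simp) (by simp) (Ne.symm cf) (Ne.symm ef) ce
  have t1 := g5_45 (q := q) a b c e d
  have t2 := g5_45 (q := q) a b c f d
  have t3 := g5_45 (q := q) a b d f e
  have t4 := g5_45 (q := q) a b c f e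
  rw [s1, s2] at r2
  rw [s3, s4, s5, t1] at r3
  rw [s6, s7, s8, t2, t3, t4] at r4
  have five : (5 : ZMod 5) = 0 := by decide
  linear_combination 2 * (r1 - r2 + r3 + 2 * r4) - five * g5 q a b c d e

theorem D4.swap2 {X : Finset ℕ} {a b c d : ℕ} (h : D4 X a b c d) : D4 X a b d c := h.p3

theorem tt_step {X : Finset ℕ} {q : ℕ → ℕ → ℕ → ZMod 5} (h : QQ X q) (hX : 6 ≤ X.card) {a c b d e : ℕ}
    (h1 : D4 X a c b d) (h2 : D4 X a c b e) : tt q a c b d = tt q a c b e := by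
  by_cases hde : d = e
  · rw [hde]
  obtain ⟨f, hf, hf'⟩ := exists_avoid (V := X) (X := {a, b, c, d, e}) (by
    have : ({a, b, c, d, e} : Finset ℕ).card ≤ 5 := Finset.card_le_five
    omega)
  simp only [Finset.mem_insert, Finset.mem_singleton, not_or] at hf'
  have := g5_zero h h1.ha h1.hc h1.hb h1.hd h2.hd hf (by
    simp only [List.nodup_cons, List.mem_cons, List.not_mem_nil, not_or, or_false, List.nodup_nil,
          not_false_eq_true, and_true]
    exact ⟨⟨h1.ac, h1.ab, h1.ad, h2.ad, Ne.symm hf'.1⟩, ⟨h1.bc.symm, h1.cd, h2.cd, Ne.symm hf'.2.1⟩,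
      ⟨h1.bd, h2.bd, Ne.symm hf'.2.2.1⟩, ⟨hde, Ne.symm hf'.2.2.2.1⟩, Ne.symm hf'.2.2.2.2⟩)
  rw [g5_tt] at this
  exact sub_eq_zero.1 this

theorem tt_indep {X : Finset ℕ} {q : ℕ → ℕ → ℕ → ZMod 5} (h : QQ X q) (hX : 6 ≤ X.card)
    {a c b d b' d' : ℕ} (h1 : D4 X a c b d) (h2 : D4 X a c b' d') : tt q a c b d = tt q a c b' d' := by
  by_cases e1 : b' = b
  · subst e1; exact tt_step h hX h1 h2
  by_cases e2 : d = b'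
  · subst e2
    rw [tt_symm h]
    exact tt_step h hX h1.p3 h2
  · have h3 : D4 X a c b b' := ⟨h1.ha, h1.hb, h1.hc, h2.hc, h1.ab, h1.ac, h2.ac, h1.bc, h2.bc, Ne.symm e1⟩
    rw [tt_step h hX h1 h3, tt_symm h]
    exact tt_step h hX h3.p3 h2

theorem tt_two {X : Finset ℕ} {q : ℕ → ℕ → ℕ → ZMod 5} (h : QQ X q) (a c b d : ℕ) :
    2 * q a b c = tt q a c b d + tt q b c a d := by
  unfold tt; rw [h.sy b a]; ring

end MC

set_option synthInstance.maxHeartbeats 20000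
set_option maxHeartbeats 400000
set_option linter.all false
namespace MC

noncomputable def qi (V : Finset ℕ) (y : LE) (m n o a b c : ℕ) : ℤ :=
  sc (S V c (dd a b (S V m (S V n (S V o y)))))

noncomputable def qz (V : Finset ℕ) (y : LE) (m n o a b c : ℕ) : ZMod 5 := (qi V y m n o a b c : ℤ)

theorem qi_sy (V : Finset ℕ) (y : LE) (m n o a b c : ℕ) : qi V y m n o a b c = qi V y m n o b a c := by
  unfold qi; rw [dd_symm]

theorem qi_s1 (V : Finset ℕ) (y : LE) (m n o a b c : ℕ) : qi V y m n o a b c = - qi V y c n o a b m := by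
  unfold qi
  rw [S_dd, S_S, S_dd, map_neg, map_neg, map_neg, neg_neg]

theorem qi_s2 (V : Finset ℕ) (y : LE) (m n o a b c : ℕ) : qi V y m n o a b c = - qi V y n m o a b c := by
  unfold qi
  rw [S_S V m n, map_neg, map_neg, map_neg]

theorem qi_s3 (V : Finset ℕ) (y : LE) (m n o a b c : ℕ) : qi V y m n o a b c = - qi V y m o n a b c := by
  unfold qi
  rw [S_S V n o, map_neg, map_neg, map_neg, map_neg]

theorem qi_a {V : Finset ℕ} {y : LE} (hy : y ∈ C 5 V) (m n o a b : ℕ) : qi V y m n o a b a = 0 := by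
  unfold qi
  rw [S_dd_zero (c := 1) (S_mem m (S_mem n (S_mem o hy))), map_zero]

theorem qi_b {V : Finset ℕ} {y : LE} (hy : y ∈ C 5 V) (m n o a b : ℕ) : qi V y m n o a b b = 0 := by
  rw [qi_sy, qi_a hy]

theorem qi_bm {V : Finset ℕ} {y : LE} (hy : y ∈ C 5 V) (n o a b c : ℕ) : qi V y b n o a b c = 0 := by
  rw [qi_s1, qi_b hy, neg_zero]

theorem qi_bn {V : Finset ℕ} {y : LE} (hy : y ∈ C 5 V) (m o a b c : ℕ) : qi V y m b o a b c = 0 := by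
  rw [qi_s2, qi_bm hy, neg_zero]

theorem qi_bo {V : Finset ℕ} {y : LE} (hy : y ∈ C 5 V) (m n a b c : ℕ) : qi V y m n b a b c = 0 := by
  rw [qi_s3, qi_bn hy, neg_zero]

theorem Sl3 (V : Finset ℕ) (y : LE) (m n o : ℕ) : Sl V [o, n, m] y = S V m (S V n (S V o y)) := by
  simp [Sl_cons, Sl_nil]

theorem Sl4 (V : Finset ℕ) (y : LE) (c m n o : ℕ) :
    Sl V [o, n, m, c] y = S V c (S V m (S V n (S V o y))) := by
  simp [Sl_cons, Sl_nil]

theorem qq {V : Finset ℕ} (hV : V.card = 11) {y u : LE} (hy : y ∈ C 5 V) (hb : bd y = (5 : ℤ) • u)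
    {m n o : ℕ} (hm : m ∈ V) (hn : n ∈ V) (ho : o ∈ V) : QQ (V \ {m, n, o}) (qz V y m n o) := by
  have hX : ∀ a, a ∈ V \ {m, n, o} → a ∈ V ∧ m ≠ a ∧ n ≠ a ∧ o ≠ a := by
    intro a ha
    simp only [Finset.mem_sdiff, Finset.mem_insert, Finset.mem_singleton, not_or] at ha
    exact ⟨ha.1, Ne.symm ha.2.1, Ne.symm ha.2.2.1, Ne.symm ha.2.2.2⟩
  constructor
  · intro a b c; unfold qz; rw [qi_sy]
  · intro a b c d h
    obtain ⟨w, hw⟩ := Sl_J [o, n, m] (Jdvd (c := 3) (by omega) hy hb (hX a h.ha).1 (hX b h.hb).1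
      (hX c h.hc).1 h.ab h.ac h.bc)
    rw [Sl3, J_apply] at hw
    have h2 := congrArg sc hw
    rw [map_add, map_add, map_zsmul] at h2
    unfold qz qi
    rw [← Int.cast_add, ← Int.cast_add, h2, ZMod.intCast_zmod_eq_zero_iff_dvd]
    simp
  · have half : ∀ a b c d, D4 (V \ {m, n, o}) a b c d → (5 : ℤ) ∣ -(qi V y m n o c d a + qi V y m n o c d b) -
        4 * sc (dd c d (dd a b (S V m (S V n (S V o y))))) := by
      intro a b c d h
      have ha := hX a h.ha
      have hb' := hX b h.hb
      have hc := hX c h.hc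
      have hd := hX d h.hd
      have h1 := Cl_list (c := 4) (by omega) hy hb ha.1 hb'.1 h.ab [o, n, m] (d := 1) (by
        intro s hs
        simp only [List.mem_cons, List.not_mem_nil, or_false] at hs
        rcases hs with rfl | rfl | rfl <;> simp_all) (by simp)
      have h2 := h1 (x c d) (by
        have := x_mul_mem_C (V := V \ {a, b}) (a := c) (b := d) (c := 0) (z := 1)
          (by simp [hc.1, h.ac.symm, h.bc.symm]) (by simp [hd.1, h.ad.symm, h.bd.symm]) h.cd (one_mem_C _)
        simpa using this)
      rw [Sl3, pr_ad_one, pr_ad_one, ad_x, map_add, map_add] at h2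
      unfold qi
      rw [S_dd, S_dd, map_neg, map_neg]
      have e : ((([o, n, m] : List ℕ).length : ℤ) + 1) = 4 := by simp
      rw [e] at h2
      convert h2 using 1
      ring
    intro a b c d h
    have h1 := half a b c d h
    have h2 := half c d a b ⟨h.hc, h.hd, h.ha, h.hb, h.cd, h.ac.symm, h.bc.symm, h.ad.symm, h.bd.symm, h.ab⟩
    rw [dd_dd, map_neg] at h2
    unfold qz
    rw [← Int.cast_add, ← Int.cast_add, ← Int.cast_add, ZMod.intCast_zmod_eq_zero_iff_dvd]
    push_cast
    omega

theorem eta5 {V : Finset ℕ} (hV : V.card = 11) {y u : LE} (hy : y ∈ C 5 V) (hb : bd y = (5 : ℤ) • u)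
    {a c m n o : ℕ} (ha : a ∈ V) (hc : c ∈ V) (hm : m ∈ V) (hn : n ∈ V) (ho : o ∈ V)
    (h1 : a ≠ c) (h2 : a ≠ m) (h3 : a ≠ n) (h4 : a ≠ o) :
    (5 : ℤ) ∣ sc (S V a (S V c (S V m (S V n (S V o y))))) := by
  have key : ∀ a b, a ∈ V → b ∈ V → a ≠ b → a ∉ ({c, m, n, o} : Finset ℕ) → b ∉ ({c, m, n, o} : Finset ℕ) →
      (5 : ℤ) ∣ sc (S V a (S V c (S V m (S V n (S V o y))))) +
        sc (S V b (S V c (S V m (S V n (S V o y))))) := by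
    intro a b ha hb' hab h1 h2
    simp only [Finset.mem_insert, Finset.mem_singleton, not_or] at h1 h2
    have h3 := Cl_list (c := 4) (by omega) hy hb ha hb' hab [o, n, m, c] (d := 0) (by
        intro s hs
        simp only [List.mem_cons, List.not_mem_nil, or_false] at hs
        simp only [Finset.mem_sdiff, Finset.mem_insert, Finset.mem_singleton, not_or]
        rcases hs with rfl | rfl | rfl | rfl
        · exact ⟨ho, Ne.symm h1.2.2.2, Ne.symm h2.2.2.2⟩
        · exact ⟨hn, Ne.symm h1.2.2.1, Ne.symm h2.2.2.1⟩
        · exact ⟨hm, Ne.symm h1.2.1, Ne.symm h2.2.1⟩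
        · exact ⟨hc, Ne.symm h1.1, Ne.symm h2.1⟩) (by simp)
    have h4 := h3 1 (one_mem_C _)
    have e : ((([o, n, m, c] : List ℕ).length : ℤ) + 1) = 5 := by simp
    rw [Sl4, pr_ad_one, pr_ad_one, ad_one, ad_one, map_add, e] at h4
    omega
  have hle : ({a, c, m, n, o} : Finset ℕ).card ≤ 5 := Finset.card_le_five
  obtain ⟨b, hbV, hb'⟩ := exists_avoid (V := V) (X := {a, c, m, n, o}) (by omega)
  have hle2 : (insert b {a, c, m, n, o} : Finset ℕ).card ≤ 6 := (Finset.card_insert_le _ _).trans (by omega)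
  obtain ⟨e, heV, he'⟩ := exists_avoid (V := V) (X := insert b {a, c, m, n, o}) (by omega)
  rw [Finset.mem_insert, not_or] at he'
  rw [Finset.mem_insert, not_or] at hb'
  rw [Finset.mem_insert, not_or] at he'
  have haa : a ∉ ({c, m, n, o} : Finset ℕ) := by simp [h1, h2, h3, h4]
  have k1 := key a b ha hbV (Ne.symm hb'.1) haa hb'.2
  have k2 := key a e ha heV (Ne.symm he'.2.1) haa he'.2.2
  have k3 := key b e hbV heV (Ne.symm he'.1) hb'.2 he'.2.2
  omega

theorem qi_sum {V : Finset ℕ} {y : LE} (m n o a c : ℕ) :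
    ∑ b ∈ V.erase a, qi V y m n o a b c = - sc (S V a (S V c (S V m (S V n (S V o y))))) := by
  unfold qi
  rw [S_S V a c, map_neg, neg_neg, S_apply V a, map_sum, map_sum]

noncomputable def PT (V : Finset ℕ) (y : LE) (l : List ℕ) : Prop :=
  ∀ a c m n o, l = [a, c, m, n, o] → l.Nodup → (∀ t ∈ l, t ∈ V) → ∀ b d, b ∈ V → d ∈ V → b ∉ l → d ∉ l →
    b ≠ d → tt (qz V y m n o) a c b d = 0

theorem PT_of_one {V : Finset ℕ} (hV : V.card = 11) {y u : LE} (hy : y ∈ C 5 V) (hb : bd y = (5 : ℤ) • u)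
    {a c m n o b d : ℕ} (hbV : b ∈ V) (hdV : d ∈ V) (hbl : b ∉ [a, c, m, n, o]) (hdl : d ∉ [a, c, m, n, o])
    (hbd : b ≠ d) (h : tt (qz V y m n o) a c b d = 0) : PT V y [a, c, m, n, o] := by
  intro a' c' m' n' o' he hn hl b' d' hb' hd' hbl' hdl' hbd'
  simp only [List.cons.injEq, and_true] at he
  obtain ⟨rfl, rfl, rfl, rfl, rfl⟩ := he
  have hm := hl m (by simp)
  have hn' := hl n (by simp)
  have ho := hl o (by simp)
  have ha := hl a (by simp)
  have hc := hl c (by simp)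
  have hle : ({m, n, o} : Finset ℕ).card ≤ 3 := Finset.card_le_three
  have hX : 6 ≤ (V \ {m, n, o}).card := by
    have := Finset.le_card_sdiff {m, n, o} V
    omega
  simp only [List.nodup_cons, List.mem_cons, List.not_mem_nil, not_or, or_false, List.nodup_nil,
          not_false_eq_true, and_true] at hn hbl hdl hbl' hdl'
  obtain ⟨⟨n1, n2, n3, n4⟩, ⟨n5, n6, n7⟩, -⟩ := hn
  rw [← h]
  refine tt_indep (qq hV hy hb hm hn' ho) hX ?_ ?_
  · refine ⟨?_, ?_, ?_, ?_, n1, Ne.symm hbl'.1, Ne.symm hdl'.1, Ne.symm hbl'.2.1, Ne.symm hdl'.2.1, hbd'⟩ <;>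
      simp [*]
  · refine ⟨?_, ?_, ?_, ?_, n1, Ne.symm hbl.1, Ne.symm hdl.1, Ne.symm hbl.2.1, Ne.symm hdl.2.1, hbd⟩ <;>
      simp [*]

theorem PT_swap {V : Finset ℕ} (hV : V.card = 11) {y u : LE} (hy : y ∈ C 5 V) (hb : bd y = (5 : ℤ) • u)
    (pre : List ℕ) (p q : ℕ) (l : List ℕ) (h : PT V y (pre ++ p :: q :: l)) : PT V y (pre ++ q :: p :: l) := by
  have hperm : (pre ++ q :: p :: l).Perm (pre ++ p :: q :: l) :=
    List.Perm.append_left _ (List.Perm.swap _ _ _)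
  intro a c m n o he hn hl b d hbV hdV hbl hdl hbd
  have hn2 := hperm.nodup_iff.1 hn
  have hl2 : ∀ t ∈ pre ++ p :: q :: l, t ∈ V := fun t ht => hl t (hperm.mem_iff.2 ht)
  have hbl2 : b ∉ pre ++ p :: q :: l := fun ht => hbl (hperm.mem_iff.2 ht)
  have hdl2 : d ∉ pre ++ p :: q :: l := fun ht => hdl (hperm.mem_iff.2 ht)
  rcases pre with _ | ⟨p0, _ | ⟨p1, _ | ⟨p2, _ | ⟨p3, pre⟩⟩⟩⟩
  · simp only [List.nil_append, List.cons.injEq] at he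
    obtain ⟨rfl, rfl, rfl⟩ := he
    have h1 := h p q m n o rfl hn2 hl2 b d hbV hdV hbl2 hdl2 hbd
    simp only [List.nil_append] at hn2 hl2 hbl2 hdl2
    have hm := hl2 m (by simp)
    have hn' := hl2 n (by simp)
    have ho := hl2 o (by simp)
    have ha := hl2 p (by simp)
    have hc := hl2 q (by simp)
    simp only [List.nodup_cons, List.mem_cons, List.not_mem_nil, not_or, or_false, List.nodup_nil,
          not_false_eq_true, and_true] at hn2 hbl2 hdl2
    obtain ⟨⟨n1, n2, n3, n4⟩, ⟨n5, n6, n7⟩, -⟩ := hn2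
    have h2 := tt_anti (qq hV hy hb hm hn' ho) (a := p) (c := q) (b := b) (d := d) (by
      refine ⟨?_, ?_, ?_, ?_, n1, Ne.symm hbl2.1, Ne.symm hdl2.1, Ne.symm hbl2.2.1, Ne.symm hdl2.2.1, hbd⟩ <;>
      simp [*])
    rw [h1, zero_add] at h2
    exact h2
  · simp only [List.cons_append, List.nil_append, List.cons.injEq] at he
    obtain ⟨rfl, rfl, rfl, rfl⟩ := he
    have h1 := h p0 p q n o rfl hn2 hl2 b d hbV hdV hbl2 hdl2 hbd
    unfold tt qz at h1 ⊢
    rw [qi_s1 V y p, qi_s1 V y p, qi_s1 V y p]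
    push_cast
    linear_combination -h1
  · simp only [List.cons_append, List.nil_append, List.cons.injEq] at he
    obtain ⟨rfl, rfl, rfl, rfl, rfl⟩ := he
    have h1 := h p0 p1 p q o rfl hn2 hl2 b d hbV hdV hbl2 hdl2 hbd
    unfold tt qz at h1 ⊢
    rw [qi_s2 V y q, qi_s2 V y q, qi_s2 V y q]
    push_cast
    linear_combination -h1
  · simp only [List.cons_append, List.nil_append, List.cons.injEq] at he
    obtain ⟨rfl, rfl, rfl, rfl, rfl, rfl⟩ := he
    have h1 := h p0 p1 p2 p q rfl hn2 hl2 b d hbV hdV hbl2 hdl2 hbd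
    unfold tt qz at h1 ⊢
    rw [qi_s3 V y p2 q p, qi_s3 V y p2 q p, qi_s3 V y p2 q p]
    push_cast
    linear_combination -h1
  · have := congrArg List.length he
    simp at this
    omega

theorem perm_inv {P : List ℕ → Prop} (h : ∀ pre a b l, P (pre ++ a :: b :: l) → P (pre ++ b :: a :: l))
    {l l' : List ℕ} (hp : l.Perm l') : ∀ pre, P (pre ++ l) → P (pre ++ l') := by
  induction hp with
  | nil => intro pre h; exact h
  | cons a _ ih =>
    intro pre hh
    have := ih (pre ++ [a]) (by simpa using hh)
    simpa using this
  | swap a b l => intro pre hh; exact h _ _ _ _ hh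
  | trans _ _ h1 h2 => intro pre hh; exact h2 _ (h1 _ hh)

end MC

set_option synthInstance.maxHeartbeats 20000
set_option maxHeartbeats 400000
set_option linter.all false
namespace MC

theorem PT_perm {V : Finset ℕ} (hV : V.card = 11) {y u : LE} (hy : y ∈ C 5 V) (hb : bd y = (5 : ℤ) • u)
    {l l' : List ℕ} (hp : l.Perm l') (h : PT V y l) : PT V y l' := by
  have := perm_inv (P := PT V y) (fun pre a b l => PT_swap hV hy hb pre a b l) hp [] (by simpa using h)
  simpa using this

theorem PT_zero_first {V : Finset ℕ} (hV : V.card = 11) {y u : LE} (hy : y ∈ C 5 V)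
    (hb : bd y = (5 : ℤ) • u) {z : ℕ} (hz : z ∈ V)
    (hT : ∀ a c m n o, [a, c, m, n, o].Nodup → z ∉ [a, c, m, n, o] → (∀ t ∈ [a, c, m, n, o], t ∈ V) →
      PT V y [a, c, m, n, o]) (c m n o : ℕ) : PT V y [z, c, m, n, o] := by
  intro a' c' m' n' o' he hn hl b0 d0 hb0 hd0 hbl0 hdl0 hbd0
  simp only [List.cons.injEq, and_true] at he
  obtain ⟨rfl, rfl, rfl, rfl, rfl⟩ := he
  have hm := hl m (by simp)
  have hn' := hl n (by simp)
  have ho := hl o (by simp)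
  have hc := hl c (by simp)
  have hnn := hn
  simp only [List.nodup_cons, List.mem_cons, List.not_mem_nil, not_or, or_false, List.nodup_nil,
          not_false_eq_true, and_true] at hnn hbl0 hdl0
  obtain ⟨⟨n1, n2, n3, n4⟩, ⟨n5, n6, n7⟩, ⟨n8, n9⟩, n10⟩ := hnn
  have hle : ({m, n, o} : Finset ℕ).card ≤ 3 := Finset.card_le_three
  have hX : 6 ≤ (V \ {m, n, o}).card := by
    have := Finset.le_card_sdiff {m, n, o} V
    omega
  have hQ := qq hV hy hb hm hn' ho
  set X := V.erase z \ {c, m, n, o} with hXd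
  have hXc : X.card = 6 := by
    rw [hXd, Finset.card_sdiff_of_subset, Finset.card_erase_of_mem hz, hV]
    · rw [Finset.card_insert_of_notMem (by simp [n5, n6, n7]),
        Finset.card_insert_of_notMem (by simp [n8, n9]), Finset.card_insert_of_notMem (by simp [n10]),
        Finset.card_singleton]
    · intro t ht
      simp only [Finset.mem_insert, Finset.mem_singleton] at ht
      rcases ht with rfl | rfl | rfl | rfl
      · exact Finset.mem_erase.2 ⟨Ne.symm n1, hc⟩
      · exact Finset.mem_erase.2 ⟨Ne.symm n2, hm⟩
      · exact Finset.mem_erase.2 ⟨Ne.symm n3, hn'⟩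
      · exact Finset.mem_erase.2 ⟨Ne.symm n4, ho⟩
  have hXm : ∀ t ∈ X, t ∈ V ∧ t ≠ z ∧ t ≠ c ∧ t ≠ m ∧ t ≠ n ∧ t ≠ o := by
    intro t ht
    simp only [hXd, Finset.mem_sdiff, Finset.mem_erase, Finset.mem_insert, Finset.mem_singleton, not_or] at ht
    exact ⟨ht.1.2, ht.1.1, ht.2⟩
  have term : ∀ b ∈ X, 2 * qz V y m n o z b c = tt (qz V y m n o) z c b0 d0 := by
    intro b hbX
    obtain ⟨d, hdX, hdb⟩ := exists_avoid (V := X) (X := {b}) (by rw [hXc]; simp)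
    simp only [Finset.mem_singleton] at hdb
    obtain ⟨b1, b2, b3, b4, b5, b6⟩ := hXm b hbX
    obtain ⟨d1, d2, d3, d4, d5, d6⟩ := hXm d hdX
    rw [tt_two hQ z c b d]
    have e1 : tt (qz V y m n o) z c b d = tt (qz V y m n o) z c b0 d0 := by
      refine tt_indep hQ hX ?_ ?_
      · refine ⟨?_, ?_, ?_, ?_, n1, Ne.symm b2, Ne.symm d2, Ne.symm b3, Ne.symm d3, Ne.symm hdb⟩ <;>
          simp only [Finset.mem_sdiff, Finset.mem_insert, Finset.mem_singleton, not_or]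
        · exact ⟨hz, n2, n3, n4⟩
        · exact ⟨hc, n5, n6, n7⟩
        · exact ⟨b1, b4, b5, b6⟩
        · exact ⟨d1, d4, d5, d6⟩
      · refine ⟨?_, ?_, ?_, ?_, n1, Ne.symm hbl0.1, Ne.symm hdl0.1, Ne.symm hbl0.2.1,
          Ne.symm hdl0.2.1, hbd0⟩ <;>
          simp only [Finset.mem_sdiff, Finset.mem_insert, Finset.mem_singleton, not_or]
        · exact ⟨hz, n2, n3, n4⟩
        · exact ⟨hc, n5, n6, n7⟩
        · exact ⟨hb0, hbl0.2.2⟩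
        · exact ⟨hd0, hdl0.2.2⟩
    have nd : [b, c, m, n, o].Nodup := by
      simp only [List.nodup_cons, List.mem_cons, List.not_mem_nil, not_or, or_false, List.nodup_nil,
          not_false_eq_true, and_true]
      exact ⟨⟨b3, b4, b5, b6⟩, ⟨n5, n6, n7⟩, ⟨n8, n9⟩, n10⟩
    have zn : z ∉ [b, c, m, n, o] := by simp [n1, n2, n3, n4, Ne.symm b2]
    have lv : ∀ t ∈ [b, c, m, n, o], t ∈ V := by
      intro t ht
      rcases List.mem_cons.1 ht with rfl | ht
      · exact b1
      · exact hl t (List.mem_cons_of_mem _ ht)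
    have e2 := hT b c m n o nd zn lv b c m n o rfl nd lv z d hz d1 zn (by simp [hdb, d3, d4, d5, d6])
      (Ne.symm d2)
    rw [e1, e2, add_zero]
  have hsum : ∑ b ∈ X, qz V y m n o z b c = 0 := by
    have h1 : ∑ b ∈ V.erase z, qz V y m n o z b c = 0 := by
      unfold qz
      rw [← Int.cast_sum, qi_sum, ZMod.intCast_zmod_eq_zero_iff_dvd]
      exact (dvd_neg.2 (eta5 hV hy hb hz hc hm hn' ho n1 n2 n3 n4))
    rw [← h1]
    apply Finset.sum_subset Finset.sdiff_subset
    intro b hb1 hb2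
    have : b ∈ ({c, m, n, o} : Finset ℕ) := by
      by_contra h
      exact hb2 (Finset.mem_sdiff.2 ⟨hb1, h⟩)
    simp only [Finset.mem_insert, Finset.mem_singleton] at this
    unfold qz
    rcases this with rfl | rfl | rfl | rfl
    · rw [qi_b hy]; simp
    · rw [qi_bm hy]; simp
    · rw [qi_bn hy]; simp
    · rw [qi_bo hy]; simp
  have h2 := Finset.sum_congr rfl term
  rw [← Finset.mul_sum, hsum, Finset.sum_const, hXc, mul_zero] at h2
  have five : (5 : ZMod 5) = 0 := by decide
  rw [nsmul_eq_mul] at h2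
  push_cast at h2
  linear_combination -h2 - five * tt (qz V y m n o) z c b0 d0

theorem PT_all {V : Finset ℕ} (hV : V.card = 11) {y u : LE} (hy : y ∈ C 5 V)
    (hb : bd y = (5 : ℤ) • u) {z : ℕ} (hz : z ∈ V)
    (hT : ∀ W ⊆ V.erase z, W.card = 5 → PT V y W.toList) (a c m n o : ℕ) : PT V y [a, c, m, n, o] := by
  by_cases hgood : [a, c, m, n, o].Nodup ∧ ∀ t ∈ [a, c, m, n, o], t ∈ V
  · have h1 : ∀ a c m n o, [a, c, m, n, o].Nodup → z ∉ [a, c, m, n, o] →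
        (∀ t ∈ [a, c, m, n, o], t ∈ V) → PT V y [a, c, m, n, o] := by
      intro a c m n o hn hzl hl
      have hp : ([a, c, m, n, o].toFinset.toList).Perm [a, c, m, n, o] := List.toFinset_toList hn
      refine PT_perm hV hy hb hp (hT _ ?_ ?_)
      · intro t ht
        rw [List.mem_toFinset] at ht
        exact Finset.mem_erase.2 ⟨fun h => hzl (h ▸ ht), hl t ht⟩
      · rw [List.toFinset_card_of_nodup hn]; rfl
    obtain ⟨hn, hl⟩ := hgood
    by_cases hzl : z ∈ [a, c, m, n, o]
    · have hp := List.perm_cons_erase hzl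
      have hlen : ([a, c, m, n, o].erase z).length = 4 := by
        rw [List.length_erase_of_mem hzl]; rfl
      obtain ⟨c', m', n', o', he⟩ := List.length_eq_four.1 hlen
      rw [he] at hp
      exact PT_perm hV hy hb hp.symm (PT_zero_first hV hy hb hz h1 c' m' n' o')
    · exact h1 _ _ _ _ _ hn hzl hl
  · intro a' c' m' n' o' he hn hl
    exact absurd ⟨hn, hl⟩ hgood

theorem qz_zero {V : Finset ℕ} (hV : V.card = 11) {y u : LE} (hy : y ∈ C 5 V)
    (hb : bd y = (5 : ℤ) • u) (hT : ∀ a c m n o, PT V y [a, c, m, n, o]) {a b c m n o : ℕ}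
    (ha : a ∈ V) (hb' : b ∈ V) (hc : c ∈ V) (hm : m ∈ V) (hn : n ∈ V) (ho : o ∈ V) (hab : a ≠ b)
    (ha2 : a ∉ [c, m, n, o]) (hb2 : b ∉ [c, m, n, o]) : qz V y m n o a b c = 0 := by
  have dup : ∀ r : ℤ, r = -r → (r : ZMod 5) = 0 := by
    intro r hr
    have : r = 0 := by omega
    simp [this]
  have neg : ∀ r s : ℤ, r = -s → (s : ZMod 5) = 0 → (r : ZMod 5) = 0 := by
    intro r s h1 h2
    rw [h1]; push_cast; rw [h2, neg_zero]
  unfold qz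
  by_cases cm : c = m
  · subst cm; exact dup _ (qi_s1 _ _ _ _ _ _ _ _)
  by_cases mn : m = n
  · subst mn; exact dup _ (qi_s2 _ _ _ _ _ _ _ _)
  by_cases no : n = o
  · subst no; exact dup _ (qi_s3 _ _ _ _ _ _ _ _)
  by_cases cn : c = n
  · subst cn
    exact neg _ _ (qi_s2 _ _ _ _ _ _ _ _) (dup _ (qi_s1 _ _ _ _ _ _ _ _))
  by_cases mo : m = o
  · subst mo
    exact neg _ _ (qi_s2 _ _ _ _ _ _ _ _) (dup _ (qi_s3 _ _ _ _ _ _ _ _))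
  by_cases co : c = o
  · subst co
    exact neg _ _ (qi_s3 _ _ _ _ _ _ _ _) (neg _ _ (qi_s2 _ _ _ _ _ _ _ _) (dup _ (qi_s1 _ _ _ _ _ _ _ _)))
  have hle : ({m, n, o, c, a} : Finset ℕ).card ≤ 5 := Finset.card_le_five
  have hle2 : (insert b {m, n, o, c, a} : Finset ℕ).card ≤ 6 := (Finset.card_insert_le _ _).trans (by omega)
  obtain ⟨d, hd, hd'⟩ := exists_avoid (V := V) (X := insert b {m, n, o, c, a}) (by omega)
  simp only [Finset.mem_insert, Finset.mem_singleton, not_or] at hd'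
  obtain ⟨d1, d2, d3, d4, d5, d6⟩ := hd'
  have h2 := tt_two (qq hV hy hb hm hn ho) a c b d
  have key : ∀ a b, a ∈ V → b ∈ V → a ≠ b → a ∉ [c, m, n, o] → b ∉ [c, m, n, o] → d ≠ a → d ≠ b →
      tt (qz V y m n o) a c b d = 0 := by
    intro a b ha hb' hab ha2 hb2 hda hdb
    have nd : [a, c, m, n, o].Nodup := by
      refine List.nodup_cons.2 ⟨ha2, ?_⟩
      simp only [List.nodup_cons, List.mem_cons, List.not_mem_nil, not_or, or_false, List.nodup_nil,
          not_false_eq_true, and_true]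
      exact ⟨⟨cm, cn, co⟩, ⟨mn, mo⟩, no⟩
    refine hT a c m n o a c m n o rfl nd ?_ b d hb' hd ?_ ?_ (Ne.symm hdb)
    · intro t ht
      simp only [List.mem_cons, List.not_mem_nil, or_false] at ht
      rcases ht with rfl | rfl | rfl | rfl | rfl <;> assumption
    · intro h
      rcases List.mem_cons.1 h with h | h
      · exact hab h.symm
      · exact hb2 h
    · simp [hda, d2, d3, d4, d5]
  rw [key a b ha hb' hab ha2 hb2 d6 d1, key b a hb' ha (Ne.symm hab) hb2 ha2 d1 d6] at h2
  have five : (5 : ZMod 5) = 0 := by decide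
  change qz V y m n o a b c = 0
  linear_combination 3 * h2 - five * qz V y m n o a b c

theorem five_div {V : Finset ℕ} (hV : V.card = 11) {y u : LE} (hy : y ∈ C 5 V)
    (hb : bd y = (5 : ℤ) • u) (hT : ∀ a c m n o, PT V y [a, c, m, n, o]) : ∃ w, y = (5 : ℤ) • w := by
  have hd : ∀ z ∈ C 5 V, (5 : ℤ) ∣ pr z y := by
    have := C_succ_le' (c := 4) (V := V)
      (S := Submodule.comap (pr.flip y).toIntLinearMap (Ideal.span {(5 : ℤ)})) ?_
    · intro z hz
      have := this hz
      simpa [Ideal.mem_span_singleton] using this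
    · intro a b z ha hb' hab hz
      have hx : x a b ∈ C 1 (V \ (V \ {a, b})) := by
        have := x_mul_mem_C (V := V \ (V \ {a, b})) (a := a) (b := b) (c := 0) (z := 1)
          (by simp [ha]) (by simp [hb']) hab (one_mem_C _)
        simpa using this
      have h1 := Rm (k := 5) (by omega) hy hb 4 (d := 1) rfl (Finset.sdiff_subset (s := V) (t := {a, b})) hz hx
      have h2 : ∀ F ∈ A 4 (V \ {a, b}), (5 : ℤ) ∣ pr (gm V F * x a b) y := by
        intro F hF
        unfold A at hF
        induction hF using Submodule.span_induction with
        | mem F hF =>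
          obtain ⟨l, h3, h4, rfl⟩ := hF
          obtain ⟨o, n, m, c, rfl⟩ := List.length_eq_four.1 h4
          rw [pr_ad, ad_mon, pr_ad_one, ad_x, Sl4]
          have mem : ∀ t ∈ [o, n, m, c], t ∈ V ∧ t ≠ a ∧ t ≠ b := by
            intro t ht
            have := h3 t ht
            simp only [Finset.mem_sdiff, Finset.mem_insert, Finset.mem_singleton, not_or] at this
            exact this
          have ho := mem o (by simp)
          have hn := mem n (by simp)
          have hm := mem m (by simp)
          have hc := mem c (by simp)
          have h5 := qz_zero hV hy hb hT (a := a) (b := b) ha hb' hc.1 hm.1 hn.1 ho.1 hab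
            (by simp [Ne.symm ho.2.1, Ne.symm hn.2.1, Ne.symm hm.2.1, Ne.symm hc.2.1])
            (by simp [Ne.symm ho.2.2, Ne.symm hn.2.2, Ne.symm hm.2.2, Ne.symm hc.2.2])
          unfold qz qi at h5
          rw [ZMod.intCast_zmod_eq_zero_iff_dvd, S_dd, map_neg, dvd_neg] at h5
          exact_mod_cast h5
        | zero => rw [map_zero, zero_mul, pr_zero_left]; exact dvd_zero _
        | add F G _ _ h1 h2 => rw [map_add (gm V), add_mul, pr_add_left]; exact dvd_add h1 h2
        | smul r F _ h1 =>
          rw [map_zsmul, smul_mul_assoc, pr_smul_left]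
          exact Dvd.dvd.mul_left h1 _
      have h3 := h2 _ (fm_mem 4 hz)
      have h4 : (5 : ℤ) ∣ pr (z * x a b) y := by
        have e : ((Nat.factorial 4 : ℕ) : ℤ) = 24 := by decide
        rw [e] at h1
        omega
      simpa [Ideal.mem_span_singleton] using h4
  obtain ⟨y', _, h⟩ := div_crit 5 hy hd
  exact ⟨y', h⟩

theorem exists_bd : ∃ fb fd : Finset ℕ → ℕ, ∀ W : Finset ℕ, W.card = 5 → fb W ∈ Finset.range 11 ∧
    fd W ∈ Finset.range 11 ∧ fb W ∉ W ∧ fd W ∉ W ∧ fb W ≠ fd W := by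
  have : ∀ W : Finset ℕ, ∃ b d, W.card = 5 → b ∈ Finset.range 11 ∧ d ∈ Finset.range 11 ∧ b ∉ W ∧ d ∉ W ∧
      b ≠ d := by
    intro W
    by_cases hW : W.card = 5
    · obtain ⟨b, hb, hb'⟩ := exists_avoid (V := Finset.range 11) (X := W) (by simp; omega)
      obtain ⟨d, hd, hd'⟩ := exists_avoid (V := Finset.range 11) (X := insert b W) (by
        rw [Finset.card_insert_of_notMem hb', Finset.card_range]; omega)
      simp only [Finset.mem_insert, not_or] at hd'
      exact ⟨b, d, fun _ => ⟨hb, hd, hb', hd'.2, Ne.symm hd'.1⟩⟩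
    · exact ⟨0, 0, fun h => absurd h hW⟩
  choose fb fd h using this
  exact ⟨fb, fd, h⟩

noncomputable def TL (V : Finset ℕ) (a c m n o b d : ℕ) : LE →+ ZMod 5 :=
  AddMonoidHom.mk' (fun y => tt (qz V y m n o) a c b d) (by
    intro y z
    simp only [tt, qz, qi, map_add, Int.cast_add]
    ring)

theorem no_five {u : LE} (hu : u ∈ C 4 (Finset.range 11))
    (h : (5 : ℤ) • u ∈ B 4 (Finset.range 11)) : u ∈ B 4 (Finset.range 11) := by
  haveI : Fact (Nat.Prime 5) := ⟨by norm_num⟩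
  obtain ⟨fb, fd, hbd⟩ := exists_bd
  refine rank_lemma (c := 4) (p := 5) rfl
    (ι := {W : Finset ℕ // W ∈ Finset.powersetCard 5 ((Finset.range 11).erase 0)}) ?_
    (fun W => TL (Finset.range 11) (W.1.toList.getD 0 0) (W.1.toList.getD 1 0) (W.1.toList.getD 2 0)
      (W.1.toList.getD 3 0) (W.1.toList.getD 4 0) (fb W.1) (fd W.1)) ?_ hu (by exact_mod_cast h)
  · rw [Fintype.card_coe, Finset.card_powersetCard, Finset.card_erase_of_mem (by simp), Finset.card_range]
  · intro y hy hb hi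
    obtain ⟨u', hb⟩ := hb
    have hb' : bd y = (5 : ℤ) • u' := by exact_mod_cast hb
    have := five_div (by simp) hy hb' (PT_all (by simp) hy hb' (z := 0) (by simp) (by
      intro W hW hc
      have h1 := hi ⟨W, Finset.mem_powersetCard.2 ⟨hW, hc⟩⟩
      simp only at h1
      have hlen : W.toList.length = 5 := by simp [hc]
      have h2 := hbd W hc
      have hb2 : fb W ∉ W.toList := by simpa using h2.2.2.1
      have hd2 : fd W ∉ W.toList := by simpa using h2.2.2.2.1
      generalize W.toList = l at *
      rcases l with _ | ⟨a, _ | ⟨c, _ | ⟨m, _ | ⟨n, _ | ⟨o, _ | ⟨t, l⟩⟩⟩⟩⟩⟩ <;> simp at hlen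
      exact PT_of_one (by simp) hy hb' h2.1 h2.2.1 hb2 hd2 h2.2.2.2.2 h1))
    exact_mod_cast this

theorem nine {u : LE} (hu : u ∈ C 3 (Finset.range 9)) {N : ℤ} (hN : N ≠ 0)
    (h : N • u ∈ B 3 (Finset.range 9)) : (3 : ℤ) • u ∈ B 3 (Finset.range 9) := by
  have h1 := kfac (c := 3) (by simp) hN hu h
  have e : (((3 + 1).factorial : ℕ) : ℤ) • u = (2 : ℤ) • (2 : ℤ) • (2 : ℤ) • (3 : ℤ) • u := by
    simp only [smul_smul]; norm_num [Nat.factorial]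
  rw [e] at h1
  have m3 : (3 : ℤ) • u ∈ C 3 (Finset.range 9) := Submodule.smul_mem _ _ hu
  have m6 := Submodule.smul_mem _ (2 : ℤ) m3
  have m12 := Submodule.smul_mem _ (2 : ℤ) m6
  exact no_two (c := 3) m3 (no_two (c := 3) m6 (no_two (c := 3) m12 h1))

theorem eleven {u : LE} (hu : u ∈ C 4 (Finset.range 11)) {N : ℤ} (hN : N ≠ 0)
    (h : N • u ∈ B 4 (Finset.range 11)) : (3 : ℤ) • u ∈ B 4 (Finset.range 11) := by
  have h1 := kfac (c := 4) (by simp) hN hu h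
  have e : (((4 + 1).factorial : ℕ) : ℤ) • u = (5 : ℤ) • (2 : ℤ) • (2 : ℤ) • (2 : ℤ) • (3 : ℤ) • u := by
    simp only [smul_smul]; norm_num [Nat.factorial]
  rw [e] at h1
  have m3 : (3 : ℤ) • u ∈ C 4 (Finset.range 11) := Submodule.smul_mem _ _ hu
  have m6 := Submodule.smul_mem _ (2 : ℤ) m3
  have m12 := Submodule.smul_mem _ (2 : ℤ) m6
  have m24 := Submodule.smul_mem _ (2 : ℤ) m12
  exact no_two (c := 4) m3 (no_two (c := 4) m6 (no_two (c := 4) m12 (no_five m24 h1)))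

end MC

set_option synthInstance.maxHeartbeats 20000
set_option maxHeartbeats 400000
set_option linter.all false
namespace MC
open MatchPaper

theorem asm_exp {n dg c : ℕ} (hc : dg + 1 = c)
    (h : ∀ z ∈ Z c (Finset.range n), (3 : ℤ) • z ∈ B c (Finset.range n)) :
    ∀ t : MH ℤ n dg, 3 • t = 0 := by
  subst hc
  obtain ⟨π, hs, hk⟩ := bridge n dg
  intro t
  obtain ⟨z, rfl⟩ := hs t
  rw [← map_nsmul, hk]
  have := h z.1 z.2
  rw [← natCast_zsmul]
  exact this

theorem asm_nt {n dg c : ℕ} (hc : dg + 1 = c)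
    (h : ∃ z ∈ Z c (Finset.range n), z ∉ B c (Finset.range n)) : Nontrivial (MH ℤ n dg) := by
  subst hc
  obtain ⟨π, hs, hk⟩ := bridge n dg
  obtain ⟨z, hz, hB⟩ := h
  exact nontrivial_of_ne (π ⟨z, hz⟩) 0 (fun h0 => hB ((hk _).1 h0))

theorem asm_tors {n dg c : ℕ} (hc : dg + 1 = c) (m : ℕ)
    (h : ∀ u ∈ C c (Finset.range n), ∀ N : ℤ, N ≠ 0 → N • u ∈ B c (Finset.range n) →
      (m : ℤ) • u ∈ B c (Finset.range n)) :
    ∀ t : MH ℤ n dg, IsOfFinAddOrder t → m • t = 0 := by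
  subst hc
  obtain ⟨π, hs, hk⟩ := bridge n dg
  intro t ht
  obtain ⟨z, rfl⟩ := hs t
  obtain ⟨k, hk0, hk1⟩ := isOfFinAddOrder_iff_nsmul_eq_zero.1 ht
  rw [← map_nsmul, hk, ← natCast_zsmul] at hk1 ⊢
  exact h z.1 (mem_Z.1 z.2).1 k (by omega) hk1

theorem asm_ex {n dg c : ℕ} (hc : dg + 1 = c)
    (h : ∃ z ∈ Z c (Finset.range n), z ∉ B c (Finset.range n) ∧ (3 : ℤ) • z ∈ B c (Finset.range n)) :
    ∃ t : MH ℤ n dg, t ≠ 0 ∧ IsOfFinAddOrder t := by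
  subst hc
  obtain ⟨π, hs, hk⟩ := bridge n dg
  obtain ⟨z, hz, hB, h3⟩ := h
  refine ⟨π ⟨z, hz⟩, fun h0 => hB ((hk _).1 h0), isOfFinAddOrder_iff_nsmul_eq_zero.2 ⟨3, by norm_num, ?_⟩⟩
  rw [← map_nsmul, hk, ← natCast_zsmul]
  exact h3

theorem asm_big (n : ℕ) (hn : n = 7 ∨ n = 10 ∨ n = 12 ∨ n = 13 ∨ 15 ≤ n) :
    Nontrivial (MH ℤ n ((n - 2) / 3)) ∧ ∀ t : MH ℤ n ((n - 2) / 3), 3 • t = 0 := by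
  have h3 : n % 3 = 0 ∨ n % 3 = 1 ∨ n % 3 = 2 := by omega
  rcases h3 with h3 | h3 | h3
  · obtain ⟨k, rfl⟩ : ∃ k, n = 3 * (k + 4) := ⟨n / 3 - 4, by omega⟩
    have hc : (3 * (k + 4) - 2) / 3 + 1 = k + 4 := by omega
    exact ⟨asm_nt hc (ex_zero (k + 2)), asm_exp hc (fun z hz => exp_zero (by simp) hz)⟩
  · obtain ⟨k, rfl⟩ : ∃ k, n = 3 * (k + 2) + 1 := ⟨n / 3 - 2, by omega⟩
    have hc : (3 * (k + 2) + 1 - 2) / 3 + 1 = k + 2 := by omega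
    exact ⟨asm_nt hc (ex_one k), asm_exp hc (fun z hz => exp_one (by rw [Finset.card_range]; omega) hz)⟩
  · obtain ⟨k, rfl⟩ : ∃ k, n = 3 * (k + 4) + 5 := ⟨(n - 5) / 3 - 4, by omega⟩
    have hc : (3 * (k + 4) + 5 - 2) / 3 + 1 = k + 6 := by omega
    refine ⟨asm_nt hc ?_, asm_exp hc (fun z hz => exp_two (by simp) hz)⟩
    obtain ⟨z, hz, hN⟩ := ex_two (k + 2)
    refine ⟨z, hz, fun hB => ?_⟩
    have := hN 1 (by rw [one_smul]; exact hB)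
    omega

theorem asm_mid (n : ℕ) (hn : n = 9 ∨ n = 11) :
    (∃ t : MH ℤ n ((n - 2) / 3), t ≠ 0 ∧ IsOfFinAddOrder t) ∧
        ∀ t : MH ℤ n ((n - 2) / 3), IsOfFinAddOrder t → 3 • t = 0 := by
  rcases hn with rfl | rfl
  · exact ⟨asm_ex (c := 3) (by norm_num) ex_nine,
      asm_tors (c := 3) (by norm_num) 3 (fun u hu N hN h => nine hu hN h)⟩
  · exact ⟨asm_ex (c := 4) (by norm_num) ex_eleven,
      asm_tors (c := 4) (by norm_num) 3 (fun u hu N hN h => eleven hu hN h)⟩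

theorem asm_small (n : ℕ) (hn : n = 1 ∨ n = 2 ∨ n = 3 ∨ n = 4 ∨ n = 5 ∨ n = 6 ∨ n = 8)
    (t : MH ℤ n ((n - 2) / 3)) (ht : IsOfFinAddOrder t) : t = 0 := by
  have : 1 • t = 0 := by
    refine asm_tors rfl 1 ?_ t ht
    intro u hu N hN h
    rw [Nat.cast_one, one_smul]
    by_cases he : n = 2 * ((n - 2) / 3 + 1 + 1)
    · exact even_top (by rw [Finset.card_range]; exact he) hN hu h
    · exact tiny (by rw [Finset.card_range]; omega) hN hu h
  simpa using this

theorem asm_fourteen : Finite (MH ℤ 14 ((14 - 2) / 3)) ∧ ∃ t : MH ℤ 14 ((14 - 2) / 3), addOrderOf t = 3 := by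
  obtain ⟨π, hs, hk⟩ := bridge 14 ((14 - 2) / 3)
  have hfin : Finite (MH ℤ 14 ((14 - 2) / 3)) :=
    quot_finite (c := 4) rfl (by norm_num) π hs (fun z hz => (hk z).2 hz)
  refine ⟨hfin, ?_⟩
  obtain ⟨z, hz, hN⟩ := ex_two 1
  have ho : 3 ∣ addOrderOf (π ⟨z, hz⟩) := by
    have h1 := addOrderOf_nsmul_eq_zero (π ⟨z, hz⟩)
    rw [← map_nsmul, hk, ← natCast_zsmul] at h1
    have := hN _ h1
    exact_mod_cast this
  obtain ⟨k, hk'⟩ := ho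
  have hpos := addOrderOf_pos (π ⟨z, hz⟩)
  refine ⟨k • π ⟨z, hz⟩, ?_⟩
  rw [addOrderOf_nsmul_of_dvd (by omega) ⟨3, by omega⟩, hk']
  exact Nat.mul_div_cancel _ (by omega)

end MC

set_option synthInstance.maxHeartbeats 1000000
set_option maxHeartbeats 1000000

open MatchPaper in
/-- With `ν_n = ⌊(n-2)/3⌋`: `H̃_{ν_n}(M_n; ℤ)` is a nontrivial elementary
abelian `3`-group for `n ∈ {7,10,12,13}` and all `n ≥ 15`; its torsion subgroup is a
nontrivial elementary abelian `3`-group for `n ∈ {9,11}` and zero for `n ∈ {1,…,6,8}`; and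
`H̃_{ν_14}(M_14; ℤ) = H̃_4(M_14; ℤ)` is a finite group with nonvanishing `3`-torsion. -/
theorem bottom_nonvanishing_homology_of_matching_complexes :
    (∀ n : ℕ, n = 7 ∨ n = 10 ∨ n = 12 ∨ n = 13 ∨ 15 ≤ n →
      Nontrivial (MH ℤ n ((n - 2) / 3)) ∧ ∀ x : MH ℤ n ((n - 2) / 3), 3 • x = 0) ∧
    (∀ n : ℕ, n = 9 ∨ n = 11 →
      (∃ x : MH ℤ n ((n - 2) / 3), x ≠ 0 ∧ IsOfFinAddOrder x) ∧
        ∀ x : MH ℤ n ((n - 2) / 3), IsOfFinAddOrder x → 3 • x = 0) ∧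
    (∀ n : ℕ, n = 1 ∨ n = 2 ∨ n = 3 ∨ n = 4 ∨ n = 5 ∨ n = 6 ∨ n = 8 →
      ∀ x : MH ℤ n ((n - 2) / 3), IsOfFinAddOrder x → x = 0) ∧
    (Finite (MH ℤ 14 ((14 - 2) / 3)) ∧ ∃ x : MH ℤ 14 ((14 - 2) / 3), addOrderOf x = 3) := by
  exact ⟨MC.asm_big, MC.asm_mid, MC.asm_small, MC.asm_fourteen⟩
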